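/- For every natural number K ≥ 1 there are infinitely many natural numbers n such that φ(p_n − 1) > φ(p_{n+1} − 1) > ⋯ > φ(p_{n+K−1} − 1), i.e., Euler's totient function evaluated at the shifted primes p − 1 is strictly decreasing along some run of K consecutive primes, for infinitely many starting indices n. -/

import Mathlib

namespace TDR
open Finset ArithmeticFunction

/-- Abel summation in total variation form. -/
lemma abel_tv (f a : ℕ → ℂ) (B : ℝ) (hB : ∀ n, ‖∑ i ∈ range n, a i‖ ≤ B) (N : ℕ) :
    ‖∑ i ∈ range N, f i * a i‖ ≤
      B * (‖f (N - 1)‖ + ∑ i ∈ range (N - 1), ‖f (i + 1) - f i‖) := by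
  have h := Finset.sum_range_by_parts f a N
  simp only [smul_eq_mul] at h
  rw [h, mul_add, mul_sum _ _ B]
  refine (norm_sub_le _ _).trans (add_le_add ?_ ((norm_sum_le _ _).trans (sum_le_sum fun i _ => ?_)))
  · rw [norm_mul, mul_comm]; gcongr; exact hB _
  · rw [norm_mul, mul_comm]; gcongr; exact hB _

lemma abel_mono (f : ℕ → ℝ) (a : ℕ → ℂ) (B : ℝ) (hB : ∀ n, ‖∑ i ∈ range n, a i‖ ≤ B) (N : ℕ)
    (h0 : 0 ≤ f 0) (hf : Monotone f) :
    ‖∑ i ∈ range N, (f i : ℂ) * a i‖ ≤ B * (2 * f (N - 1)) := by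
  have hB0 : 0 ≤ B := (norm_nonneg _).trans (hB 0)
  refine (abel_tv (fun i => (f i : ℂ)) a B hB N).trans ?_
  gcongr
  have h1 : ∀ i, ‖((f (i + 1) : ℝ) : ℂ) - (f i : ℂ)‖ = f (i + 1) - f i := by
    intro i
    rw [← Complex.ofReal_sub, Complex.norm_real, Real.norm_of_nonneg]
    have := hf (Nat.le_succ i); simp at this; linarith
  have h2 : ‖((f (N - 1) : ℝ) : ℂ)‖ = f (N - 1) := by
    rw [Complex.norm_real, Real.norm_of_nonneg]
    exact h0.trans (hf (Nat.zero_le _))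
  simp only [h1, h2, Finset.sum_range_sub]
  linarith

/-- A family of character-like functions. -/
structure Fam {ι : Type} [Fintype ι] (ψ : ι → ℕ → ℂ) (Q : ℝ) : Prop where
  one_le : 1 ≤ Q
  zero : ∀ i, ψ i 0 = 0
  norm_le : ∀ i n, ‖ψ i n‖ ≤ 1
  mul : ∀ i m n, ψ i (m * n) = ψ i m * ψ i n
  sum_le : ∀ i N, ‖∑ n ∈ range N, ψ i n‖ ≤ Q
  cross : ∀ i j, i ≠ j → ∀ N, ‖∑ n ∈ range N, ψ i n * (starRingEnd ℂ) (ψ j n)‖ ≤ Q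
  card : (Fintype.card ι : ℝ) ≤ Q

lemma sum_range_eq_Ioc (f : ℕ → ℂ) (h : f 0 = 0) (N : ℕ) :
    ∑ n ∈ Ioc 0 N, f n = ∑ n ∈ range (N + 1), f n := by
  rw [Finset.sum_range_succ', h, add_zero, Finset.range_eq_Ico, Finset.sum_Ico_add' f 0 N 1]
  rfl

section
variable {ι : Type} [Fintype ι] {ψ : ι → ℕ → ℂ} {Q : ℝ}

lemma Fam.quad (hF : Fam ψ Q) (c : ι → ℂ) (y : ℕ) :
    ∑ n ∈ Ioc 0 y, ‖∑ i, c i * ψ i n‖ ^ 2 ≤ (y + Q ^ 2) * ∑ i, ‖c i‖ ^ 2 := by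
  classical
  have hQ := hF.one_le
  have e : ((∑ n ∈ Ioc 0 y, ‖∑ i, c i * ψ i n‖ ^ 2 : ℝ) : ℂ) =
      ∑ i, ∑ j, c i * (starRingEnd ℂ) (c j) *
        ∑ n ∈ Ioc 0 y, ψ i n * (starRingEnd ℂ) (ψ j n) := by
    push_cast
    simp_rw [← Complex.mul_conj', map_sum, map_mul, sum_mul_sum, mul_sum]
    rw [sum_comm]
    refine sum_congr rfl fun i _ => ?_
    rw [sum_comm]
    refine sum_congr rfl fun j _ => sum_congr rfl fun n _ => ?_
    ring
  have hb : ∀ i j, ‖c i * (starRingEnd ℂ) (c j) *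
        ∑ n ∈ Ioc 0 y, ψ i n * (starRingEnd ℂ) (ψ j n)‖ ≤
        (if i = j then y * ‖c i‖ ^ 2 else 0) + Q * (‖c i‖ * ‖c j‖) := by
    intro i j
    rw [norm_mul, norm_mul, RCLike.norm_conj]
    split_ifs with h
    · subst h
      have : ‖∑ n ∈ Ioc 0 y, ψ i n * (starRingEnd ℂ) (ψ i n)‖ ≤ y := by
        refine (norm_sum_le _ _).trans ?_
        calc _ ≤ ∑ n ∈ Ioc 0 y, (1 : ℝ) := by
              refine sum_le_sum fun n _ => ?_
              rw [norm_mul, RCLike.norm_conj]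
              have := hF.norm_le i n
              exact mul_le_one₀ this (norm_nonneg _) this
          _ = y := by simp
      have h3 : 0 ≤ Q * (‖c i‖ * ‖c i‖) := by positivity
      nlinarith [norm_nonneg (c i), mul_nonneg (norm_nonneg (c i)) (norm_nonneg (c i))]
    · rw [sum_range_eq_Ioc _ (by simp [hF.zero])]
      have := hF.cross i j h (y + 1)
      rw [zero_add, mul_comm]
      gcongr
  have h1 : ∑ n ∈ Ioc 0 y, ‖∑ i, c i * ψ i n‖ ^ 2 ≤
      ∑ i, ∑ j, ((if i = j then y * ‖c i‖ ^ 2 else 0) + Q * (‖c i‖ * ‖c j‖)) := by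
    have h2 : ‖((∑ n ∈ Ioc 0 y, ‖∑ i, c i * ψ i n‖ ^ 2 : ℝ) : ℂ)‖ =
      ∑ n ∈ Ioc 0 y, ‖∑ i, c i * ψ i n‖ ^ 2 := by
      rw [Complex.norm_real, Real.norm_of_nonneg]; positivity
    rw [← h2, e]
    exact (norm_sum_le _ _).trans (sum_le_sum fun i _ => (norm_sum_le _ _).trans
      (sum_le_sum fun j _ => hb i j))
  refine h1.trans ?_
  have h3 : (∑ i, ‖c i‖) ^ 2 ≤ Q * ∑ i, ‖c i‖ ^ 2 := by
    have := sq_sum_le_card_mul_sum_sq (s := (univ : Finset ι)) (f := fun i => ‖c i‖)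
    refine this.trans ?_
    gcongr
    simpa using hF.card
  simp only [sum_add_distrib, sum_ite_eq, mem_univ, if_true, ← mul_sum, ← sum_mul]
  nlinarith

lemma Fam.ls (hF : Fam ψ Q) (b : ℕ → ℂ) (y : ℕ) :
    ∑ i, ‖∑ n ∈ Ioc 0 y, b n * ψ i n‖ ^ 2 ≤ (y + Q ^ 2) * ∑ n ∈ Ioc 0 y, ‖b n‖ ^ 2 := by
  have hQ := hF.one_le
  set T : ι → ℂ := fun i => ∑ n ∈ Ioc 0 y, b n * ψ i n with hT
  set S := ∑ i, ‖T i‖ ^ 2 with hS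
  set B := ∑ n ∈ Ioc 0 y, ‖b n‖ ^ 2 with hBdef
  have e : (S : ℂ) = ∑ n ∈ Ioc 0 y, b n * ∑ i, (starRingEnd ℂ) (T i) * ψ i n := by
    rw [hS]; push_cast
    simp_rw [← Complex.mul_conj', mul_sum]
    rw [sum_comm]
    refine sum_congr rfl fun i _ => ?_
    simp only [hT, sum_mul]
    refine sum_congr rfl fun n _ => ?_
    ring
  have hS0 : 0 ≤ S := by positivity
  have hB0 : 0 ≤ B := by positivity
  have h1 : S ≤ ∑ n ∈ Ioc 0 y, ‖b n‖ * ‖∑ i, (starRingEnd ℂ) (T i) * ψ i n‖ := by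
    have : ‖(S : ℂ)‖ = S := by rw [Complex.norm_real, Real.norm_of_nonneg hS0]
    rw [← this, e]
    refine (norm_sum_le _ _).trans (sum_le_sum fun n _ => by rw [norm_mul])
  have h2 : S ^ 2 ≤ B * ((y + Q ^ 2) * S) := by
    calc S ^ 2 ≤ _ := pow_le_pow_left₀ hS0 h1 2
      _ ≤ _ := sum_mul_sq_le_sq_mul_sq _ _ _
      _ ≤ _ := by
        gcongr
        have := hF.quad (fun i => (starRingEnd ℂ) (T i)) y
        simpa [RCLike.norm_conj] using this
  rcases hS0.eq_or_lt with h | h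
  · rw [← h]; positivity
  · have : S * S ≤ ((y + Q ^ 2) * B) * S := by nlinarith
    exact le_of_mul_le_mul_right this h

end
end TDR

namespace TDR
open Finset ArithmeticFunction
open scoped ArithmeticFunction.zeta ArithmeticFunction.Moebius

lemma harm_le (y : ℕ) : ∑ d ∈ Ioc 0 y, (1 / (d : ℝ)) ≤ 1 + Real.log y := by
  have := harmonic_le_one_add_log y
  rw [harmonic_eq_sum_Icc] at this
  push_cast at this
  simp only [one_div]
  exact this

lemma harm_dvd_le (y g : ℕ) (hg : 0 < g) :
    ∑ d ∈ (Ioc 0 y).filter (g ∣ ·), (1 / (d : ℝ)) ≤ (1 / g) * (1 + Real.log y) := by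
  calc ∑ d ∈ (Ioc 0 y).filter (g ∣ ·), (1 / (d : ℝ))
      ≤ ∑ d ∈ (Ioc 0 y).image (g * ·), (1 / (d : ℝ)) := by
        refine sum_le_sum_of_subset_of_nonneg ?_ (fun _ _ _ => by positivity)
        intro d hd
        simp only [mem_filter, mem_Ioc] at hd
        obtain ⟨⟨h1, h2⟩, k, rfl⟩ := hd
        simp only [mem_image, mem_Ioc]
        refine ⟨k, ⟨Nat.pos_of_mul_pos_left h1, le_trans (Nat.le_mul_of_pos_left k hg) h2⟩, rfl⟩
    _ = ∑ d ∈ Ioc 0 y, (1 / (g : ℝ)) * (1 / (d : ℝ)) := by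
        rw [sum_image (fun a _ b _ h => Nat.eq_of_mul_eq_mul_left hg h)]
        refine sum_congr rfl fun d _ => ?_
        push_cast; rw [one_div_mul_one_div]
    _ ≤ _ := by
        rw [← mul_sum]
        gcongr
        exact harm_le y

lemma sum_tau_sq (y : ℕ) :
    ∑ n ∈ Ioc 0 y, ((n.divisors.card : ℝ)) ^ 2 ≤ y * (1 + Real.log y) ^ 3 := by
  have h0 : 0 ≤ 1 + Real.log y := by have := Real.log_natCast_nonneg y; linarith
  have e1 : ∀ n ∈ Ioc 0 y, ((n.divisors.card : ℝ)) ^ 2 =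
      ∑ d ∈ Ioc 0 y, ∑ e ∈ Ioc 0 y, if (Nat.lcm d e ∣ n) then (1 : ℝ) else 0 := by
    intro n hn
    simp only [mem_Ioc] at hn
    have : n.divisors = (Ioc 0 y).filter (· ∣ n) := by
      ext d
      simp only [Nat.mem_divisors, mem_filter, mem_Ioc]
      constructor
      · rintro ⟨h1, h2⟩
        exact ⟨⟨Nat.pos_of_dvd_of_pos h1 hn.1, (Nat.le_of_dvd hn.1 h1).trans hn.2⟩, h1⟩
      · rintro ⟨_, h1⟩
        exact ⟨h1, hn.1.ne'⟩
    rw [this, card_filter, sq]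
    push_cast
    rw [sum_mul_sum]
    refine sum_congr rfl fun d _ => sum_congr rfl fun e _ => ?_
    simp only [Nat.lcm_dvd_iff]
    split_ifs <;> simp_all
  rw [sum_congr rfl e1, sum_comm]
  calc _ = ∑ d ∈ Ioc 0 y, ∑ e ∈ Ioc 0 y, ∑ n ∈ Ioc 0 y,
            (if (Nat.lcm d e ∣ n) then (1 : ℝ) else 0) :=
        sum_congr rfl fun d _ => sum_comm
    _ ≤ ∑ d ∈ Ioc 0 y, ∑ e ∈ Ioc 0 y, ∑ g ∈ Ioc 0 y,
          ((y : ℝ) * (g * ((if g ∣ d then 1 / (d : ℝ) else 0) * (if g ∣ e then 1 / (e : ℝ) else 0)))) := by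
        refine sum_le_sum fun d hd => sum_le_sum fun e he => ?_
        simp only [mem_Ioc] at hd he
        have hg : 0 < Nat.gcd d e := Nat.gcd_pos_of_pos_left _ hd.1
        have hgm : Nat.gcd d e ∈ Ioc 0 y := by
          simp only [mem_Ioc]; exact ⟨hg, (Nat.gcd_le_left _ hd.1).trans hd.2⟩
        refine le_trans ?_ (single_le_sum (f := fun g : ℕ => ((y : ℝ) * (g * ((if g ∣ d then 1 / (d : ℝ) else 0) * (if g ∣ e then 1 / (e : ℝ) else 0))))) (fun g _ => by positivity) hgm)
        simp only [Nat.gcd_dvd_left, Nat.gcd_dvd_right, if_true]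
        rw [← Finset.sum_filter, Finset.sum_const, nsmul_eq_mul, mul_one, Nat.Ioc_filter_dvd_card_eq_div]
        refine Nat.cast_div_le.trans ?_
        have hde : ((Nat.gcd d e : ℝ)) * (Nat.lcm d e) = d * e := by exact_mod_cast Nat.gcd_mul_lcm d e
        have hd' : (0 : ℝ) < d := by exact_mod_cast hd.1
        have he' : (0 : ℝ) < e := by exact_mod_cast he.1
        have hg' : (0 : ℝ) < Nat.gcd d e := by exact_mod_cast hg
        have hl' : (0 : ℝ) < Nat.lcm d e := by exact_mod_cast Nat.lcm_pos hd.1 he.1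
        apply le_of_eq
        rw [one_div_mul_one_div, ← hde]
        field_simp
    _ = ∑ g ∈ Ioc 0 y, (y : ℝ) * (g * (∑ d ∈ (Ioc 0 y).filter (g ∣ ·), (1 / (d : ℝ))) ^ 2) := by
        rw [sum_congr rfl (fun d _ => sum_comm), sum_comm]
        refine sum_congr rfl fun g _ => ?_
        simp only [sq, sum_filter]
        rw [sum_mul_sum]
        simp only [mul_sum]
    _ ≤ ∑ g ∈ Ioc 0 y, (y : ℝ) * ((1 + Real.log y) ^ 2 * (1 / g)) := by
        refine sum_le_sum fun g hg => ?_
        simp only [mem_Ioc] at hg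
        have hg' : (0 : ℝ) < g := by exact_mod_cast hg.1
        have := harm_dvd_le y g hg.1
        refine mul_le_mul_of_nonneg_left ?_ (Nat.cast_nonneg y)
        calc _ ≤ (g : ℝ) * ((1 / g) * (1 + Real.log y)) ^ 2 := by gcongr
          _ = _ := by field_simp
    _ ≤ _ := by
        rw [← mul_sum, ← mul_sum]
        have := harm_le y
        have h2 : (1 + Real.log y) ^ 2 * ∑ d ∈ Ioc 0 y, (1 / (d : ℝ)) ≤ (1 + Real.log y) ^ 3 := by
          rw [pow_succ (1 + Real.log y) 2]; gcongr
        gcongr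

/-- truncations -/
noncomputable def cle (f : ArithmeticFunction ℝ) (U : ℕ) : ArithmeticFunction ℝ :=
  ⟨fun n => if n ≤ U then f n else 0, by simp⟩
noncomputable def cgt (f : ArithmeticFunction ℝ) (U : ℕ) : ArithmeticFunction ℝ :=
  ⟨fun n => if n ≤ U then 0 else f n, by simp⟩

lemma cle_apply (f : ArithmeticFunction ℝ) (U n : ℕ) : cle f U n = if n ≤ U then f n else 0 := rfl
lemma cgt_apply (f : ArithmeticFunction ℝ) (U n : ℕ) : cgt f U n = if n ≤ U then 0 else f n := rfl
lemma cle_add_cgt (f : ArithmeticFunction ℝ) (U : ℕ) : cle f U + cgt f U = f := by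
  ext n; simp only [ArithmeticFunction.add_apply, cle_apply, cgt_apply]; split_ifs <;> simp

lemma vaughan (U V : ℕ) : (Λ : ArithmeticFunction ℝ) =
    cle Λ U + log * cle (μ : ArithmeticFunction ℝ) V
      - cle Λ U * (cle (μ : ArithmeticFunction ℝ) V * (ζ : ArithmeticFunction ℝ))
      + cgt Λ U * ((ζ : ArithmeticFunction ℝ) * cgt (μ : ArithmeticFunction ℝ) V) := by
  have h1 := cle_add_cgt Λ U
  have h2 := cle_add_cgt (μ : ArithmeticFunction ℝ) V
  have h3 := vonMangoldt_mul_zeta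
  have h4 : (μ : ArithmeticFunction ℝ) * (ζ : ArithmeticFunction ℝ) = 1 := coe_moebius_mul_coe_zeta
  rw [← h2] at h4
  rw [← h3]
  linear_combination (-(cgt Λ U)) * h4 - (1 - (ζ : ArithmeticFunction ℝ) * cle (μ : ArithmeticFunction ℝ) V) * h1

/-- The type II coefficient. -/
noncomputable def bV (V : ℕ) : ArithmeticFunction ℝ :=
  (ζ : ArithmeticFunction ℝ) * cgt (μ : ArithmeticFunction ℝ) V

lemma bV_abs (V n : ℕ) : |bV V n| ≤ n.divisors.card := by
  rw [bV, coe_zeta_mul_apply]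
  refine (abs_sum_le_sum_abs _ _).trans ?_
  calc _ ≤ ∑ d ∈ n.divisors, (1 : ℝ) := by
        refine sum_le_sum fun d _ => ?_
        rw [cgt_apply]
        split_ifs
        · simp
        · rw [intCoe_apply]
          exact_mod_cast abs_moebius_le_one
    _ = _ := by simp

lemma bV_zero (V n : ℕ) (h : n ≤ V) : bV V n = 0 := by
  rw [bV, coe_zeta_mul_apply]
  refine sum_eq_zero fun d hd => ?_
  rw [cgt_apply, if_pos ((Nat.divisor_le hd).trans h)]

section
variable {ι : Type} [Fintype ι] {ψ : ι → ℕ → ℂ} {Q : ℝ}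

/-- twisted sum -/
noncomputable def tw (χ : ℕ → ℂ) (f : ℕ → ℝ) (N : ℕ) : ℂ := ∑ n ∈ Ioc 0 N, (f n : ℂ) * χ n

lemma tw_mul (χ : ℕ → ℂ) (hm : ∀ m n, χ (m * n) = χ m * χ n) (f g : ArithmeticFunction ℝ) (N : ℕ) :
    tw χ (⇑(f * g)) N = ∑ m ∈ Ioc 0 N, ((f m : ℂ) * χ m) * tw χ g (N / m) := by
  let T : ArithmeticFunction ℝ → ArithmeticFunction ℂ := fun f => ⟨fun n => (f n : ℂ) * χ n, by simp⟩
  have hT : ∀ f n, T f n = (f n : ℂ) * χ n := fun f n => rfl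
  have h : T (f * g) = T f * T g := by
    ext n
    rw [hT, mul_apply, mul_apply]
    push_cast
    rw [sum_mul]
    refine sum_congr rfl fun x hx => ?_
    have := (Nat.mem_divisorsAntidiagonal.1 hx).1
    rw [hT, hT, ← this, hm]; ring
  have := sum_Ioc_mul_eq_sum_sum (T f) (T g) N
  rw [← h] at this
  exact this

end
end TDR

namespace TDR
open Finset ArithmeticFunction
open scoped ArithmeticFunction.zeta ArithmeticFunction.Moebius

lemma sum_cut (f : ℕ → ℂ) (U N : ℕ) (B : ℝ) (hB : 0 ≤ B) (h0 : ∀ n ∈ Ioc 0 N, U < n → f n = 0)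
    (h1 : ∀ n ∈ Ioc 0 N, n ≤ U → ‖f n‖ ≤ B) : ‖∑ n ∈ Ioc 0 N, f n‖ ≤ U * B := by
  calc ‖∑ n ∈ Ioc 0 N, f n‖ ≤ ∑ n ∈ Ioc 0 N, ‖f n‖ := norm_sum_le _ _
    _ ≤ ∑ n ∈ Ioc 0 N, (if n ∈ Ioc 0 U then B else 0) := by
        refine sum_le_sum fun n hn => ?_
        by_cases h : n ≤ U
        · rw [if_pos (by simp only [mem_Ioc] at hn ⊢; omega)]; exact h1 n hn h
        · rw [h0 n hn (by omega), norm_zero]; split_ifs <;> simp [hB]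
    _ ≤ ∑ n ∈ Ioc 0 U, B := by
        rw [← sum_filter]
        refine sum_le_sum_of_subset_of_nonneg (fun n hn => (mem_filter.1 hn).2) (fun _ _ _ => hB)
    _ = U * B := by simp

section
variable {ι : Type} [Fintype ι] {ψ : ι → ℕ → ℂ} {Q : ℝ}

lemma Fam.tw_zeta (hF : Fam ψ Q) (i : ι) (y : ℕ) :
    ‖tw (ψ i) (⇑(ζ : ArithmeticFunction ℝ)) y‖ ≤ Q := by
  have : tw (ψ i) (⇑(ζ : ArithmeticFunction ℝ)) y = ∑ n ∈ Ioc 0 y, ψ i n := by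
    refine sum_congr rfl fun n hn => ?_
    rw [natCoe_apply, zeta_apply, if_neg (mem_Ioc.1 hn).1.ne']; simp
  rw [this, sum_range_eq_Ioc _ (hF.zero i)]
  exact hF.sum_le i _

lemma Fam.tw_log (hF : Fam ψ Q) (i : ι) (y : ℕ) :
    ‖tw (ψ i) (⇑log) y‖ ≤ Q * (2 * Real.log y) := by
  rw [tw, sum_range_eq_Ioc _ (by simp)]
  refine (abel_mono (fun n => Real.log n) (ψ i) Q (hF.sum_le i) (y + 1) (by simp) ?_)
  intro a b hab
  rcases Nat.eq_zero_or_pos a with h | h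
  · subst h; simpa using Real.log_natCast_nonneg b
  · exact Real.log_le_log (by exact_mod_cast h) (by exact_mod_cast hab)

lemma lam_le {n N : ℕ} {L : ℝ} (hL : Real.log N ≤ L) (hn : n ∈ Ioc 0 N) : Λ n ≤ L := by
  simp only [mem_Ioc] at hn
  exact vonMangoldt_le_log.trans
    ((Real.log_le_log (by exact_mod_cast hn.1) (by exact_mod_cast hn.2)).trans hL)

lemma log_div_le {m N : ℕ} {L : ℝ} (hL0 : 0 ≤ L) (hL : Real.log N ≤ L) : Real.log (N / m : ℕ) ≤ L := by
  rcases Nat.eq_zero_or_pos (N / m) with h | h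
  · rw [h]; simpa
  · exact (Real.log_le_log (by exact_mod_cast h) (by exact_mod_cast Nat.div_le_self _ _)).trans hL

lemma Fam.t0 (hF : Fam ψ Q) (i : ι) (U N : ℕ) (L : ℝ) (hL : Real.log N ≤ L) (hL0 : 0 ≤ L) :
    ‖tw (ψ i) (⇑(cle Λ U)) N‖ ≤ U * L := by
  refine sum_cut _ _ _ _ hL0 (fun n _ h => ?_) (fun n hn h => ?_)
  · rw [cle_apply, if_neg (by omega)]; simp
  · rw [cle_apply, if_pos h, norm_mul, Complex.norm_real, Real.norm_of_nonneg vonMangoldt_nonneg]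
    have := hF.norm_le i n
    have h2 := lam_le hL hn
    nlinarith [norm_nonneg (ψ i n)]

lemma cle_mu_norm (V n : ℕ) : ‖((cle (μ : ArithmeticFunction ℝ) V n : ℝ) : ℂ)‖ ≤ 1 := by
  rw [cle_apply, Complex.norm_real]
  split_ifs
  · rw [intCoe_apply, Real.norm_eq_abs]
    exact_mod_cast abs_moebius_le_one
  · simp

lemma Fam.mu_mul (hF : Fam ψ Q) (i : ι) (V N : ℕ) (B : ℝ) (f : ArithmeticFunction ℝ)
    (hB : ∀ m, ‖tw (ψ i) (⇑f) (N / m)‖ ≤ B) :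
    ‖tw (ψ i) (⇑(cle (μ : ArithmeticFunction ℝ) V * f)) N‖ ≤ V * B := by
  rw [tw_mul _ (hF.mul i)]
  have hB0 : 0 ≤ B := (norm_nonneg _).trans (hB 0)
  refine sum_cut _ _ _ _ hB0 (fun n _ h => ?_) (fun n hn h => ?_)
  · rw [cle_apply, if_neg (by omega)]; simp
  · rw [norm_mul, norm_mul]
    have h1 := cle_mu_norm V n
    have := hF.norm_le i n
    calc _ ≤ 1 * 1 * B := by gcongr; exact hB n
      _ = B := by ring

lemma Fam.t1 (hF : Fam ψ Q) (i : ι) (V N : ℕ) (L : ℝ) (hL : Real.log N ≤ L) (hL0 : 0 ≤ L) :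
    ‖tw (ψ i) (⇑(log * cle (μ : ArithmeticFunction ℝ) V)) N‖ ≤ V * (Q * (2 * L)) := by
  rw [mul_comm log]
  refine hF.mu_mul i V N _ _ fun m => (hF.tw_log i _).trans ?_
  have := hF.one_le
  gcongr
  exact log_div_le hL0 hL

lemma Fam.t2 (hF : Fam ψ Q) (i : ι) (U V N : ℕ) (L : ℝ) (hL : Real.log N ≤ L) (hL0 : 0 ≤ L) :
    ‖tw (ψ i) (⇑(cle Λ U * (cle (μ : ArithmeticFunction ℝ) V * (ζ : ArithmeticFunction ℝ)))) N‖
      ≤ U * (L * (V * Q)) := by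
  have hQ := hF.one_le
  rw [tw_mul _ (hF.mul i)]
  refine sum_cut _ _ _ _ (by positivity) (fun n _ h => ?_) (fun n hn h => ?_)
  · rw [cle_apply, if_neg (by omega)]; simp
  · have h3 := hF.mu_mul i V (N / n) Q (ζ : ArithmeticFunction ℝ) (fun m => hF.tw_zeta i _)
    rw [cle_apply, if_pos h, norm_mul, norm_mul, Complex.norm_real,
      Real.norm_of_nonneg vonMangoldt_nonneg]
    have := hF.norm_le i n
    have h2 := lam_le hL hn
    calc _ ≤ L * 1 * (V * Q) := by gcongr
      _ = _ := by ring

/-- diagonal bound -/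
lemma Fam.diag (hF : Fam ψ Q) (U V N : ℕ) (L : ℝ) (hL : 1 + Real.log N ≤ L) (hL0 : 0 ≤ L)
    (hV : Q ^ 2 ≤ V) :
    ∑ m ∈ (Ioc 0 N).filter (U < ·), (m : ℝ) * ∑ i, ‖tw (ψ i) (⇑(bV V)) (N / m)‖ ^ 2
      ≤ 2 * N ^ 2 * L ^ 4 := by
  have h1 : ∀ m ∈ Ioc 0 N, (m : ℝ) * ∑ i, ‖tw (ψ i) (⇑(bV V)) (N / m)‖ ^ 2 ≤
      (2 * N ^ 2 * L ^ 3) * (1 / m) := by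
    intro m hm
    simp only [mem_Ioc] at hm
    have hm' : (0 : ℝ) < m := by exact_mod_cast hm.1
    by_cases hy : N / m ≤ V
    · have : ∀ i, tw (ψ i) (⇑(bV V)) (N / m) = 0 := by
        intro i
        refine sum_eq_zero fun n hn => ?_
        rw [bV_zero V n ((mem_Ioc.1 hn).2.trans hy)]; simp
      simp only [this]
      simp
      positivity
    · push Not at hy
      have hls := hF.ls (fun n => (bV V n : ℂ)) (N / m)
      have h2 : ∑ n ∈ Ioc 0 (N / m), ‖(bV V n : ℂ)‖ ^ 2 ≤ ((N / m : ℕ) : ℝ) * L ^ 3 := by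
        calc _ ≤ ∑ n ∈ Ioc 0 (N / m), ((n.divisors.card : ℝ)) ^ 2 := by
              refine sum_le_sum fun n _ => ?_
              rw [Complex.norm_real]
              gcongr
              exact bV_abs V n
          _ ≤ _ := sum_tau_sq _
          _ ≤ _ := by
              have h3 : Real.log (N / m : ℕ) ≤ L - 1 := by
                refine log_div_le ?_ (by linarith)
                have := Real.log_natCast_nonneg N
                linarith
              have h4 := Real.log_natCast_nonneg (N / m)
              gcongr
              linarith
      have hVm : (V : ℝ) < ((N / m : ℕ) : ℝ) := by exact_mod_cast hy
      have h5 : ((N / m : ℕ) : ℝ) ≤ N / m := Nat.cast_div_le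
      calc _ ≤ (m : ℝ) * ((((N / m : ℕ) : ℝ) + Q ^ 2) * (((N / m : ℕ) : ℝ) * L ^ 3)) := by
            gcongr
            exact hls.trans (by gcongr)
        _ ≤ (m : ℝ) * (((N / m : ℝ) + (N / m : ℝ)) * ((N / m : ℝ) * L ^ 3)) := by
            gcongr
            linarith
        _ = _ := by field_simp; ring
  calc _ ≤ ∑ m ∈ Ioc 0 N, (m : ℝ) * ∑ i, ‖tw (ψ i) (⇑(bV V)) (N / m)‖ ^ 2 :=
        sum_le_sum_of_subset_of_nonneg (filter_subset _ _) (fun _ _ _ => by positivity)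
    _ ≤ ∑ m ∈ Ioc 0 N, (2 * N ^ 2 * L ^ 3) * (1 / (m : ℝ)) := sum_le_sum h1
    _ ≤ (2 * N ^ 2 * L ^ 3) * L := by
        rw [← mul_sum]
        gcongr
        exact (harm_le N).trans hL
    _ = _ := by ring

lemma Ioc_lin (a : ℕ → ℂ) (h0 : a 0 = 0) (hB : ∀ n, ‖∑ i ∈ range n, a i‖ ≤ Q) (U z N : ℕ)
    (hz : z ≤ N) : ‖∑ m ∈ Ioc U z, (m : ℂ) * a m‖ ≤ 4 * Q * N := by
  have hQ0 : 0 ≤ Q := (norm_nonneg _).trans (hB 0)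
  rcases le_or_gt z U with h | h
  · rw [Ioc_eq_empty (by omega)]; simp; positivity
  · have e : ∀ y ≤ N, ‖∑ m ∈ range (y + 1), (m : ℂ) * a m‖ ≤ 2 * Q * N := by
      intro y hy
      have := abel_mono (fun n => (n : ℝ)) a Q hB (y + 1) (by simp) (fun a b h => by simpa using h)
      simp only [Complex.ofReal_natCast, Nat.add_sub_cancel] at this
      refine this.trans ?_
      have : (y : ℝ) ≤ N := by exact_mod_cast hy
      nlinarith
    have e2 : ∑ m ∈ Ioc U z, (m : ℂ) * a m =
        ∑ m ∈ range (z + 1), (m : ℂ) * a m - ∑ m ∈ range (U + 1), (m : ℂ) * a m := by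
      rw [← sum_Ico_eq_sub _ (by omega)]
      exact sum_congr (by ext; simp only [mem_Ioc, mem_Ico]; omega) fun _ _ => rfl
    rw [e2]
    refine (norm_sub_le _ _).trans ?_
    linarith [e z hz, e U (by omega)]

lemma Fam.off (hF : Fam ψ Q) (i j : ι) (hij : i ≠ j) (U V N : ℕ) (hU : 0 < U) :
    ‖∑ m ∈ (Ioc 0 N).filter (U < ·), (m : ℂ) * (ψ i m * (starRingEnd ℂ) (ψ j m)) *
        (tw (ψ i) (⇑(bV V)) (N / m) * (starRingEnd ℂ) (tw (ψ j) (⇑(bV V)) (N / m)))‖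
      ≤ 4 * Q * N * ((N / U : ℕ) : ℝ) ^ 4 := by
  have hQ := hF.one_le
  set R := N / U
  set a : ℕ → ℂ := fun m => ψ i m * (starRingEnd ℂ) (ψ j m) with ha
  have e : ∑ m ∈ (Ioc 0 N).filter (U < ·), (m : ℂ) * a m *
        (tw (ψ i) (⇑(bV V)) (N / m) * (starRingEnd ℂ) (tw (ψ j) (⇑(bV V)) (N / m))) =
      ∑ n ∈ Ioc 0 R, ∑ n' ∈ Ioc 0 R, ((bV V n : ℂ) * ψ i n) *
        (starRingEnd ℂ) ((bV V n' : ℂ) * ψ j n') *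
        ∑ m ∈ Ioc U (min (N / n) (N / n')), (m : ℂ) * a m := by
    have tweq : ∀ (l : ι), ∀ m ∈ (Ioc 0 N).filter (U < ·), tw (ψ l) (⇑(bV V)) (N / m) =
        ∑ n ∈ Ioc 0 R, if n ≤ N / m then (bV V n : ℂ) * ψ l n else 0 := by
      intro l m hm
      simp only [mem_filter, mem_Ioc] at hm
      rw [← sum_filter, tw]
      refine sum_congr ?_ fun _ _ => rfl
      ext n
      have : N / m ≤ R := Nat.div_le_div_left (by omega) hU
      simp only [mem_filter, mem_Ioc]
      omega
    calc _ = ∑ m ∈ (Ioc 0 N).filter (U < ·), ∑ n ∈ Ioc 0 R, ∑ n' ∈ Ioc 0 R,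
          (if m ∈ Ioc U (min (N / n) (N / n')) then ((bV V n : ℂ) * ψ i n) *
        (starRingEnd ℂ) ((bV V n' : ℂ) * ψ j n') * ((m : ℂ) * a m) else 0) := by
          refine sum_congr rfl fun m hm => ?_
          rw [tweq i m hm, tweq j m hm, map_sum, sum_mul_sum, mul_sum]
          refine sum_congr rfl fun n hn => ?_
          rw [mul_sum]
          refine sum_congr rfl fun n' hn' => ?_
          simp only [mem_filter, mem_Ioc] at hm hn hn'
          have c1 : n ≤ N / m ↔ m ≤ N / n := by
            rw [Nat.le_div_iff_mul_le hm.1.1, Nat.le_div_iff_mul_le hn.1, mul_comm]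
          have c2 : n' ≤ N / m ↔ m ≤ N / n' := by
            rw [Nat.le_div_iff_mul_le hm.1.1, Nat.le_div_iff_mul_le hn'.1, mul_comm]
          have c3 : m ∈ Ioc U (min (N / n) (N / n')) ↔ (n ≤ N / m ∧ n' ≤ N / m) := by
            rw [c1, c2]; simp only [mem_Ioc, le_min_iff, hm.2, true_and]
          simp only [c3]
          by_cases k1 : n ≤ N / m <;> by_cases k2 : n' ≤ N / m <;> simp [k1, k2]
          ring
      _ = _ := by
          rw [sum_comm]
          refine sum_congr rfl fun n hn => ?_
          rw [sum_comm]
          refine sum_congr rfl fun n' hn' => ?_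
          rw [← sum_filter, mul_sum]
          refine sum_congr ?_ fun _ _ => rfl
          ext m
          simp only [mem_filter, mem_Ioc, le_min_iff]
          have : N / n ≤ N := Nat.div_le_self _ _
          omega
  rw [e]
  have hb : ∀ l : ι, ∀ n ∈ Ioc 0 R, ‖(bV V n : ℂ) * ψ l n‖ ≤ R := by
    intro l n hn
    simp only [mem_Ioc] at hn
    rw [norm_mul, Complex.norm_real, Real.norm_eq_abs]
    have h1 : |bV V n| ≤ n := (bV_abs V n).trans (by exact_mod_cast Nat.card_divisors_le_self n)
    have h2 : (n : ℝ) ≤ R := by exact_mod_cast hn.2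
    calc _ ≤ (R : ℝ) * 1 := by gcongr; exact h1.trans h2; exact hF.norm_le l n
      _ = _ := by ring
  calc _ ≤ ∑ n ∈ Ioc 0 R, ∑ n' ∈ Ioc 0 R, (R : ℝ) * R * (4 * Q * N) := by
        refine (norm_sum_le _ _).trans (sum_le_sum fun n hn => (norm_sum_le _ _).trans
          (sum_le_sum fun n' hn' => ?_))
        rw [norm_mul, norm_mul, RCLike.norm_conj]
        gcongr
        · exact hb i n hn
        · exact hb j n' hn'
        · exact Ioc_lin a (by simp [ha, hF.zero]) (hF.cross i j hij) _ _ _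
            ((min_le_left _ _).trans (Nat.div_le_self _ _))
    _ = _ := by simp; ring

end
end TDR

namespace TDR
open Finset ArithmeticFunction
open scoped ArithmeticFunction.zeta ArithmeticFunction.Moebius

section
variable {ι : Type} [Fintype ι] {ψ : ι → ℕ → ℂ} {Q : ℝ}

lemma exists_unit (z : ℂ) : ∃ c : ℂ, ‖c‖ ≤ 1 ∧ c * z = ‖z‖ := by
  by_cases h : z = 0
  · exact ⟨0, by simp, by simp [h]⟩
  · have h' : (‖z‖ : ℂ) ≠ 0 := by exact_mod_cast norm_ne_zero_iff.2 h
    refine ⟨(starRingEnd ℂ) z / ‖z‖, ?_, ?_⟩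
    · rw [norm_div, RCLike.norm_conj]; simp [div_self (norm_ne_zero_iff.2 h)]
    · rw [div_mul_eq_mul_div, Complex.conj_mul', sq, mul_div_assoc, div_self h', mul_one]

lemma Fam.t3 (hF : Fam ψ Q) (U V N : ℕ) (L : ℝ) (hL : 1 + Real.log N ≤ L) 
    (hV : Q ^ 2 ≤ V) (hU : 0 < U) :
    (∑ i, ‖tw (ψ i) (⇑(cgt Λ U * bV V)) N‖) ^ 2 ≤
      L ^ 3 * (2 * N ^ 2 * L ^ 4 + Q ^ 2 * (4 * Q * N * ((N / U : ℕ) : ℝ) ^ 4)) := by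
  classical
  have hQ := hF.one_le
  have hL1 : 1 ≤ L := by have := Real.log_natCast_nonneg N; linarith
  choose c hc1 hc2 using fun i => exists_unit (tw (ψ i) (⇑(cgt Λ U * bV V)) N)
  set M := (Ioc 0 N).filter (U < ·) with hM
  set B : ι → ℕ → ℂ := fun i m => tw (ψ i) (⇑(bV V)) (N / m) with hBdef
  set G : ℕ → ℂ := fun m => ∑ i, c i * (ψ i m * B i m) with hG
  set S := ∑ i, ‖tw (ψ i) (⇑(cgt Λ U * bV V)) N‖ with hS
  have hS0 : 0 ≤ S := by positivity
  have e1 : (S : ℂ) = ∑ m ∈ M, (Λ m : ℂ) * G m := by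
    rw [hS]; push_cast
    simp_rw [← hc2, tw_mul _ (hF.mul _), mul_sum]
    rw [sum_comm, hM, sum_filter]
    refine sum_congr rfl fun m hm => ?_
    rw [cgt_apply]
    by_cases h : m ≤ U
    · rw [if_pos h, if_neg (by omega)]; simp
    · rw [if_neg h, if_pos (by omega), hG, mul_sum]
      refine sum_congr rfl fun i _ => ?_
      simp only [hBdef]; ring
  have hMpos : ∀ m ∈ M, (0 : ℝ) < m := by
    intro m hm
    simp only [hM, mem_filter, mem_Ioc] at hm
    exact_mod_cast hm.1.1
  have h1 : S ≤ ∑ m ∈ M, (Λ m / Real.sqrt m) * (Real.sqrt m * ‖G m‖) := by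
    have : ‖(S : ℂ)‖ = S := by rw [Complex.norm_real, Real.norm_of_nonneg hS0]
    rw [← this, e1]
    refine (norm_sum_le _ _).trans (sum_le_sum fun m hm => ?_)
    have hs : Real.sqrt m ≠ 0 := (Real.sqrt_pos.2 (hMpos m hm)).ne'
    rw [norm_mul, Complex.norm_real, Real.norm_of_nonneg vonMangoldt_nonneg]
    apply le_of_eq
    field_simp
  have h2 : S ^ 2 ≤ (∑ m ∈ M, (Λ m / Real.sqrt m) ^ 2) * ∑ m ∈ M, (Real.sqrt m * ‖G m‖) ^ 2 :=
    (pow_le_pow_left₀ hS0 h1 2).trans (sum_mul_sq_le_sq_mul_sq _ _ _)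
  have h3 : ∑ m ∈ M, (Λ m / Real.sqrt m) ^ 2 ≤ L ^ 3 := by
    calc _ ≤ ∑ m ∈ M, L ^ 2 * (1 / (m : ℝ)) := by
          refine sum_le_sum fun m hm => ?_
          have hm' : m ∈ Ioc 0 N := (mem_filter.1 hm).1
          rw [div_pow, Real.sq_sqrt (hMpos m hm).le, mul_one_div]
          have := lam_le (L := L) (by linarith) hm'
          have h0 := vonMangoldt_nonneg (n := m)
          have := hMpos m hm
          gcongr
      _ ≤ ∑ m ∈ Ioc 0 N, L ^ 2 * (1 / (m : ℝ)) :=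
          sum_le_sum_of_subset_of_nonneg (filter_subset _ _) (fun _ _ _ => by positivity)
      _ ≤ _ := by
          rw [← mul_sum, pow_succ L 2]
          gcongr
          exact (harm_le N).trans hL
  have e2 : ((∑ m ∈ M, (Real.sqrt m * ‖G m‖) ^ 2 : ℝ) : ℂ) =
      ∑ i, ∑ j, c i * (starRingEnd ℂ) (c j) * ∑ m ∈ M, (m : ℂ) * (ψ i m * (starRingEnd ℂ) (ψ j m)) *
        (B i m * (starRingEnd ℂ) (B j m)) := by
    have : ∀ m ∈ M, (Real.sqrt m * ‖G m‖) ^ 2 = m * ‖G m‖ ^ 2 := by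
      intro m hm; rw [mul_pow, Real.sq_sqrt (hMpos m hm).le]
    rw [sum_congr rfl this]
    push_cast
    simp_rw [← Complex.mul_conj', hG, map_sum, sum_mul_sum, mul_sum]
    rw [sum_comm]
    refine sum_congr rfl fun i _ => ?_
    rw [sum_comm]
    refine sum_congr rfl fun j _ => sum_congr rfl fun n _ => ?_
    simp only [map_mul]
    ring
  set Off := 4 * Q * N * ((N / U : ℕ) : ℝ) ^ 4 with hOff
  have hOff0 : 0 ≤ Off := by positivity
  have hb : ∀ i j, ‖c i * (starRingEnd ℂ) (c j) * ∑ m ∈ M, (m : ℂ) * (ψ i m * (starRingEnd ℂ) (ψ j m)) *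
        (B i m * (starRingEnd ℂ) (B j m))‖ ≤
        (if i = j then ∑ m ∈ M, (m : ℝ) * ‖B i m‖ ^ 2 else 0) + Off := by
    intro i j
    rw [norm_mul, norm_mul, RCLike.norm_conj]
    have hcc : ‖c i‖ * ‖c j‖ ≤ 1 := mul_le_one₀ (hc1 i) (norm_nonneg _) (hc1 j)
    refine (mul_le_of_le_one_left (norm_nonneg _) hcc).trans ?_
    split_ifs with h
    · subst h
      refine le_add_of_le_of_nonneg ((norm_sum_le _ _).trans (sum_le_sum fun m hm => ?_)) hOff0
      simp only [norm_mul, RCLike.norm_conj, Complex.norm_natCast]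
      have := hF.norm_le i m
      have h7 : ‖ψ i m‖ * ‖ψ i m‖ ≤ 1 := mul_le_one₀ this (norm_nonneg _) this
      rw [← sq ‖B i m‖]
      gcongr
      nlinarith [hMpos m hm]
    · rw [zero_add]
      exact hF.off i j h U V N hU
  have h4 : ∑ m ∈ M, (Real.sqrt m * ‖G m‖) ^ 2 ≤ 2 * N ^ 2 * L ^ 4 + Q ^ 2 * Off := by
    have h5 : ‖((∑ m ∈ M, (Real.sqrt m * ‖G m‖) ^ 2 : ℝ) : ℂ)‖ =
      ∑ m ∈ M, (Real.sqrt m * ‖G m‖) ^ 2 := by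
      rw [Complex.norm_real, Real.norm_of_nonneg]; positivity
    rw [← h5, e2]
    refine ((norm_sum_le _ _).trans (sum_le_sum fun i _ => (norm_sum_le _ _).trans
      (sum_le_sum fun j _ => hb i j))).trans ?_
    simp only [sum_add_distrib, sum_ite_eq, mem_univ, if_true]
    refine add_le_add ?_ ?_
    · rw [sum_comm]
      simp_rw [← mul_sum]
      exact hF.diag U V N L hL (by linarith) hV
    · simp only [sum_const, nsmul_eq_mul, card_univ]
      have := hF.card
      rw [← mul_assoc, ← sq]
      gcongr
  refine h2.trans ?_
  have : 0 ≤ ∑ m ∈ M, (Real.sqrt m * ‖G m‖) ^ 2 := by positivity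
  gcongr

theorem Fam.main (hF : Fam ψ Q) (Y N : ℕ) (hY : 1 ≤ Y) (hN : N ≤ 1024 * Y ^ 10) (hQ : Q ^ 4 ≤ Y) :
    ∑ i, ‖tw (ψ i) (⇑Λ) N‖ ≤ 2 ^ 28 * (Y : ℝ) ^ 10 * (1 + Real.log (1024 * Y ^ 10)) ^ 4 := by
  have hQ1 := hF.one_le
  set L := 1 + Real.log (1024 * Y ^ 10) with hLdef
  have hY1 : (1 : ℝ) ≤ Y := by exact_mod_cast hY
  have hN' : (N : ℝ) ≤ 1024 * Y ^ 10 := by exact_mod_cast hN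
  have hL : 1 + Real.log N ≤ L := by
    rcases Nat.eq_zero_or_pos N with h | h
    · rw [h]; simp [hLdef]
      refine Real.log_nonneg ?_
      nlinarith [one_le_pow₀ hY1 (n := 10)]
    · have := Real.log_le_log (by exact_mod_cast h) hN'
      linarith
  have hL1 : 1 ≤ L := by have := Real.log_natCast_nonneg N; linarith
  have hQ2 : Q ^ 2 ≤ Y := le_trans (pow_le_pow_right₀ hQ1 (by norm_num)) hQ
  have hQ3 : Q ^ 3 ≤ Y := le_trans (pow_le_pow_right₀ hQ1 (by norm_num)) hQ
  have hQ11 : Q ≤ Y := le_trans (le_self_pow₀ hQ1 (by norm_num)) hQ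
  have hdec : ∀ i, ‖tw (ψ i) (⇑Λ) N‖ ≤ (Y ^ 8 : ℕ) * L + Y * (Q * (2 * L)) +
      (Y ^ 8 : ℕ) * (L * (Y * Q)) + ‖tw (ψ i) (⇑(cgt Λ (Y ^ 8) * bV Y)) N‖ := by
    intro i
    have e : tw (ψ i) (⇑Λ) N = tw (ψ i) (⇑(cle Λ (Y ^ 8))) N +
        tw (ψ i) (⇑(log * cle (μ : ArithmeticFunction ℝ) Y)) N -
        tw (ψ i) (⇑(cle Λ (Y ^ 8) * (cle (μ : ArithmeticFunction ℝ) Y * (ζ : ArithmeticFunction ℝ)))) N +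
        tw (ψ i) (⇑(cgt Λ (Y ^ 8) * bV Y)) N := by
      simp only [tw, ← sum_add_distrib, ← sum_sub_distrib]
      refine sum_congr rfl fun n _ => ?_
      have hv : Λ + cle Λ (Y ^ 8) * (cle (μ : ArithmeticFunction ℝ) Y * (ζ : ArithmeticFunction ℝ)) =
          cle Λ (Y ^ 8) + log * cle (μ : ArithmeticFunction ℝ) Y + cgt Λ (Y ^ 8) * bV Y := by
        rw [bV]
        linear_combination vaughan (Y ^ 8) Y
      have := congrArg (fun f : ArithmeticFunction ℝ => ((f n : ℝ) : ℂ)) hv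
      simp only [ArithmeticFunction.add_apply, Complex.ofReal_add] at this
      linear_combination (ψ i n) * this
    rw [e]
    refine (norm_add_le _ _).trans (add_le_add ((norm_sub_le _ _).trans (add_le_add
      ((norm_add_le _ _).trans (add_le_add ?_ ?_)) ?_)) le_rfl)
    · exact hF.t0 i _ _ _ (by linarith) (by linarith)
    · exact hF.t1 i _ _ _ (by linarith) (by linarith)
    · exact hF.t2 i _ _ _ _ (by linarith) (by linarith)
  have h3 := hF.t3 (Y ^ 8) Y N L hL hQ2 (by positivity)
  have hR : ((N / Y ^ 8 : ℕ) : ℝ) ≤ 1024 * Y ^ 2 := by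
    refine Nat.cast_div_le.trans ?_
    push_cast
    rw [div_le_iff₀ (by positivity)]
    nlinarith
  have h4 : (∑ i, ‖tw (ψ i) (⇑(cgt Λ (Y ^ 8) * bV Y)) N‖) ≤ 2 ^ 27 * (Y : ℝ) ^ 10 * L ^ 4 := by
    refine le_of_sq_le_sq ?_ (by positivity)
    refine h3.trans ?_
    calc _ ≤ L ^ 3 * (2 * (1024 * Y ^ 10) ^ 2 * L ^ 4 + 
            4 * Q ^ 3 * (1024 * Y ^ 10) * (1024 * Y ^ 2) ^ 4) := by
          rw [show Q ^ 2 * (4 * Q * ↑N * ((N / Y ^ 8 : ℕ) : ℝ) ^ 4) = 4 * Q ^ 3 * N * ((N / Y ^ 8 : ℕ) : ℝ) ^ 4 by ring]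
          gcongr
      _ ≤ L ^ 3 * (2 * (1024 * Y ^ 10) ^ 2 * L ^ 4 + 
            4 * (Y ^ 2 * L ^ 4) * (1024 * Y ^ 10) * (1024 * Y ^ 2) ^ 4) := by
          gcongr
          have : (1 : ℝ) ≤ L ^ 4 := one_le_pow₀ hL1
          have : (1 : ℝ) ≤ Y * L ^ 4 := by nlinarith
          nlinarith
      _ = (2 ^ 21 + 2 ^ 52) * Y ^ 20 * L ^ 7 := by ring
      _ ≤ 2 ^ 54 * Y ^ 20 * L ^ 8 := by
          gcongr
          · norm_num
          · norm_num
      _ = _ := by ring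
  refine (sum_le_sum fun i _ => hdec i).trans ?_
  rw [sum_add_distrib, sum_const, nsmul_eq_mul, card_univ]
  have hL4 : L ≤ L ^ 4 := le_self_pow₀ hL1 (by norm_num)
  have h5 : (Fintype.card ι : ℝ) * (((Y ^ 8 : ℕ) : ℝ) * L + Y * (Q * (2 * L)) + (Y ^ 8 : ℕ) * (L * (Y * Q)))
      ≤ 4 * Y ^ 10 * L ^ 4 := by
    push_cast
    calc _ ≤ Q * ((Y : ℝ) ^ 8 * L + Y * (Q * (2 * L)) + Y ^ 8 * (L * (Y * Q))) := by
          gcongr; exact hF.card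
      _ = Q * Y ^ 8 * L + 2 * Q ^ 2 * Y * L + Q ^ 2 * Y ^ 9 * L := by ring
      _ ≤ Y * Y ^ 8 * L + 2 * Y * Y * L + Y * Y ^ 9 * L := by gcongr
      _ = (Y ^ 9 + 2 * Y ^ 2 + Y ^ 10) * L := by ring
      _ ≤ (Y ^ 10 + 2 * Y ^ 10 + Y ^ 10) * L := by gcongr <;> first | exact hY1 | norm_num
      _ = 4 * Y ^ 10 * L := by ring
      _ ≤ _ := by gcongr
  have : (0 : ℝ) ≤ Y ^ 10 * L ^ 4 := by positivity
  linarith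

end
end TDR

namespace TDR
open Finset

/-- Abel summation with varying bounds. -/
lemma abel_var (f a : ℕ → ℂ) (β : ℕ → ℝ) (hB : ∀ n, ‖∑ i ∈ range n, a i‖ ≤ β n) (N : ℕ) :
    ‖∑ i ∈ range N, f i * a i‖ ≤
      ‖f (N - 1)‖ * β N + ∑ i ∈ range (N - 1), ‖f (i + 1) - f i‖ * β (i + 1) := by
  have h := Finset.sum_range_by_parts f a N
  simp only [smul_eq_mul] at h
  rw [h]
  refine (norm_sub_le _ _).trans (add_le_add ?_ ((norm_sum_le _ _).trans (sum_le_sum fun i _ => ?_)))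
  · rw [norm_mul]; gcongr; exact hB _
  · rw [norm_mul]; gcongr; exact hB _

lemma log_pow_le (i : ℕ) (δ : ℝ) (hδ : 0 < δ) :
    ∃ K : ℝ, 1 ≤ K ∧ ∀ n : ℕ, 1 ≤ n → (1 + Real.log (n + 1)) ^ i ≤ K * (n : ℝ) ^ δ := by
  set ε := δ / (i + 1) with hε
  have hε0 : 0 < ε := by positivity
  refine ⟨(2 + 1 / ε) ^ i, one_le_pow₀ (by have : 0 < 1 / ε := by positivity
                                           linarith), fun n hn => ?_⟩
  have hn' : (1 : ℝ) ≤ n := by exact_mod_cast hn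
  have h1 : Real.log (n + 1) ≤ 1 + Real.log n := by
    have : (n : ℝ) + 1 ≤ Real.exp 1 * n := by nlinarith [Real.add_one_le_exp (1 : ℝ)]
    calc Real.log (n + 1) ≤ Real.log (Real.exp 1 * n) := Real.log_le_log (by positivity) this
      _ = _ := by rw [Real.log_mul (by positivity) (by positivity), Real.log_exp]
  have h2 : Real.log n ≤ (n : ℝ) ^ ε / ε := Real.log_le_rpow_div (by positivity) hε0
  have h3 : (1 : ℝ) ≤ (n : ℝ) ^ ε := Real.one_le_rpow hn' hε0.le
  have h4 : 1 + Real.log (n + 1) ≤ (2 + 1 / ε) * (n : ℝ) ^ ε := by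
    have : (2 + 1 / ε) * (n : ℝ) ^ ε = 2 * (n : ℝ) ^ ε + (n : ℝ) ^ ε / ε := by ring
    rw [this]; linarith
  have h0 : 0 ≤ Real.log ((n : ℝ) + 1) := Real.log_nonneg (by linarith)
  calc _ ≤ ((2 + 1 / ε) * (n : ℝ) ^ ε) ^ i := by gcongr
    _ = (2 + 1 / ε) ^ i * (n : ℝ) ^ (ε * i) := by
        rw [mul_pow, ← Real.rpow_natCast ((n : ℝ) ^ ε), ← Real.rpow_mul (by positivity)]
    _ ≤ _ := by
        gcongr
        rw [hε, div_mul_eq_mul_div, div_le_iff₀ (by positivity)]; nlinarith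

/-- the weight function -/
noncomputable def hfun (i : ℕ) (s : ℂ) (x : ℝ) : ℂ := ((Real.log x : ℝ) : ℂ) ^ i * (x : ℂ) ^ (-s)

lemma hasDerivAt_cpow_neg (s : ℂ) (x : ℝ) (hx : 0 < x) :
    HasDerivAt (fun y : ℝ => (y : ℂ) ^ (-s)) (-s * (x : ℂ) ^ (-s - 1)) x := by
  have := (hasDerivAt_id (x : ℂ)).cpow_const (c := -s) (Or.inl (by simpa using hx))
  simpa using this.comp_ofReal

lemma hasDerivAt_hfun (i : ℕ) (s : ℂ) (x : ℝ) (hx : 0 < x) :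
    HasDerivAt (hfun i s) ((i * ((Real.log x : ℝ) : ℂ) ^ (i - 1) * ((x⁻¹ : ℝ) : ℂ)) * (x : ℂ) ^ (-s)
      + ((Real.log x : ℝ) : ℂ) ^ i * (-s * (x : ℂ) ^ (-s - 1))) x := by
  have h1 := ((Real.hasDerivAt_log hx.ne').ofReal_comp).pow i
  exact h1.mul (hasDerivAt_cpow_neg s x hx)

lemma norm_cpow_le (s : ℂ) (hs : 1 ≤ s.re) (x : ℝ) (hx : 1 ≤ x) : ‖(x : ℂ) ^ (-s)‖ ≤ x⁻¹ := by
  rw [Complex.norm_cpow_eq_rpow_re_of_pos (by linarith), ← Real.rpow_neg_one]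
  exact Real.rpow_le_rpow_of_exponent_le hx (by simpa using hs)

lemma norm_cpow_le' (s : ℂ) (hs : 1 ≤ s.re) (x : ℝ) (hx : 1 ≤ x) : ‖(x : ℂ) ^ (-s - 1)‖ ≤ x⁻¹ * x⁻¹ := by
  have hx0 : 0 < x := by linarith
  rw [Complex.cpow_sub _ _ (by exact_mod_cast hx0.ne'), Complex.cpow_one, norm_div, Complex.norm_real,
    Real.norm_of_nonneg hx0.le, div_eq_mul_inv]
  gcongr
  exact norm_cpow_le s hs x hx

lemma hfun_diff (i : ℕ) (s : ℂ) (hs : 1 ≤ s.re) (n : ℕ) (hn : 1 ≤ n) :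
    ‖hfun i s (n + 1 : ℕ) - hfun i s n‖ ≤ (i + ‖s‖) * (1 + Real.log (n + 1)) ^ i * ((n : ℝ)⁻¹ * (n : ℝ)⁻¹) := by
  have hn' : (1 : ℝ) ≤ n := by exact_mod_cast hn
  have key := (convex_Icc (n : ℝ) (n + 1)).norm_image_sub_le_of_norm_hasDerivWithin_le
    (f := hfun i s) (C := (i + ‖s‖) * (1 + Real.log (n + 1)) ^ i * ((n : ℝ)⁻¹ * (n : ℝ)⁻¹))
    (x := n) (y := n + 1)
    (fun x hx => (hasDerivAt_hfun i s x (by linarith [hx.1])).hasDerivWithinAt) ?_ (by simp) (by simp)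
  · simpa using key
  · intro x hx
    have hx1 : 1 ≤ x := by linarith [hx.1]
    have hx0 : 0 < x := by linarith
    have hl0 : 0 ≤ Real.log x := Real.log_nonneg hx1
    have hl : Real.log x ≤ 1 + Real.log (n + 1) := by
      linarith [Real.log_le_log hx0 hx.2]
    have hl1 : 1 ≤ 1 + Real.log (n + 1) := by linarith [Real.log_nonneg (show (1:ℝ) ≤ n + 1 by linarith)]
    have hxn : x⁻¹ ≤ (n : ℝ)⁻¹ := inv_anti₀ (by linarith) hx.1
    have hxi : 0 ≤ x⁻¹ := by positivity
    have hc := norm_cpow_le s hs x hx1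
    have hc' := norm_cpow_le' s hs x hx1
    have hp : Real.log x ^ (i - 1) ≤ (1 + Real.log (n + 1)) ^ i :=
      (pow_le_pow_left₀ hl0 hl _).trans (pow_le_pow_right₀ hl1 (by omega))
    have hp' : Real.log x ^ i ≤ (1 + Real.log (n + 1)) ^ i := pow_le_pow_left₀ hl0 hl _
    refine (norm_add_le _ _).trans ?_
    simp only [norm_mul, norm_pow, Complex.norm_real, Complex.norm_natCast, norm_neg,
      Real.norm_of_nonneg hl0, Real.norm_of_nonneg hxi]
    calc _ ≤ (i * (1 + Real.log (n + 1)) ^ i * (n : ℝ)⁻¹) * (n : ℝ)⁻¹ +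
          (1 + Real.log (n + 1)) ^ i * (‖s‖ * ((n : ℝ)⁻¹ * (n : ℝ)⁻¹)) := by
            gcongr
            · exact hc.trans hxn
            · exact hc'.trans (by gcongr)
      _ = _ := by ring

theorem L_ub (i : ℕ) (δ : ℝ) (hδ : 0 < δ) (hδ1 : δ ≤ 1) : ∃ C : ℝ, 1 ≤ C ∧ ∀ (a : ℕ → ℂ) (r : ℝ), 1 ≤ r →
    (∀ n, ‖a n‖ ≤ 1) → (∀ N, ‖∑ n ∈ range N, a n‖ ≤ r) → ∀ s : ℂ, 1 ≤ s.re → s.re ≤ 2 →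
    LSeriesSummable (fun n => (Real.log n : ℂ) ^ i * a n) s →
    ‖LSeries (fun n => (Real.log n : ℂ) ^ i * a n) s‖ ≤ C * (1 + |s.im|) * r ^ δ := by
  obtain ⟨K, hK1, hK⟩ := log_pow_le i (δ / 2) (by linarith)
  have hsum : Summable (fun n : ℕ => ((n : ℝ) ^ (1 + δ / 2))⁻¹) :=
    Real.summable_nat_rpow_inv.2 (by linarith)
  set T := ∑' n : ℕ, ((n : ℝ) ^ (1 + δ / 2))⁻¹ with hT
  have hT0 : 0 ≤ T := tsum_nonneg fun n => by positivity
  refine ⟨1 + 2 * K + 2 * K * (i + 2) * T, by nlinarith [mul_nonneg (by positivity : (0:ℝ) ≤ 2 * K * (i + 2)) hT0], ?_⟩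
  intro a r hr ha haS s hs1 hs2 hsumm
  have ht : 0 ≤ |s.im| := abs_nonneg _
  have hsn : ‖s‖ ≤ 2 + |s.im| := by
    refine (Complex.norm_le_abs_re_add_abs_im s).trans ?_
    rw [abs_of_nonneg (by linarith)]; linarith
  set f : ℕ → ℂ := fun n => if n = 0 then 0 else hfun i s n with hf
  have hr0 : 0 < r := by linarith
  have hβ : ∀ n : ℕ, ‖∑ k ∈ range n, a k‖ ≤ (n : ℝ) ^ (1 - δ) * r ^ δ := by
    intro n
    have h1 : ‖∑ k ∈ range n, a k‖ ≤ n := (norm_sum_le _ _).trans (by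
      calc _ ≤ ∑ k ∈ range n, (1 : ℝ) := sum_le_sum fun k _ => ha k
        _ = n := by simp)
    have h2 := haS n
    set S := ‖∑ k ∈ range n, a k‖ with hS
    rcases (norm_nonneg (∑ k ∈ range n, a k)).eq_or_lt with h | h
    · rw [hS, ← h]; positivity
    · calc S = S ^ (1 - δ) * S ^ δ := by rw [← Real.rpow_add (show 0 < S from h)]; simp
        _ ≤ _ := by
          gcongr
  have hterm : ∀ n, LSeries.term (fun n => (Real.log n : ℂ) ^ i * a n) s n = f n * a n := by
    intro n
    simp only [hf, hfun]
    rcases Nat.eq_zero_or_pos n with h | h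
    · subst h; simp
    · rw [LSeries.term_of_ne_zero h.ne', if_neg h.ne', Complex.cpow_neg]
      simp only [Complex.ofReal_natCast]
      ring
  have hbound : ∀ N : ℕ, ‖∑ n ∈ range N, f n * a n‖ ≤
      (1 + 2 * K + 2 * K * (i + 2) * T) * (1 + |s.im|) * r ^ δ := by
    intro N
    rcases Nat.lt_or_ge N 2 with hN | hN
    · have : ∑ n ∈ range N, f n * a n = 0 := by
        refine sum_eq_zero fun n hn => ?_
        have : n = 0 := by have := mem_range.1 hn; omega
        simp [hf, this]
      rw [this, norm_zero]; positivity
    obtain ⟨M, rfl⟩ : ∃ M, N = M + 2 := ⟨N - 2, by omega⟩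
    refine (abel_var f a _ hβ (M + 2)).trans ?_
    rw [show M + 2 - 1 = M + 1 by omega]
    have hdbl : ∀ n : ℕ, 1 ≤ n → (((n + 1 : ℕ) : ℝ)) ^ (1 - δ) ≤ 2 * (n : ℝ) ^ (1 - δ) := by
      intro n hn
      have hn' : (1 : ℝ) ≤ n := by exact_mod_cast hn
      calc (((n + 1 : ℕ) : ℝ)) ^ (1 - δ) ≤ (2 * n : ℝ) ^ (1 - δ) := by
            apply Real.rpow_le_rpow (by positivity) _ (by linarith)
            push_cast; linarith
        _ = 2 ^ (1 - δ) * (n : ℝ) ^ (1 - δ) := Real.mul_rpow (by norm_num) (by positivity)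
        _ ≤ 2 ^ (1 : ℝ) * (n : ℝ) ^ (1 - δ) := by
            gcongr
            · norm_num
            · linarith
        _ = _ := by simp
    -- last term
    have l1 : ‖f (M + 1)‖ * (((M + 2 : ℕ) : ℝ) ^ (1 - δ) * r ^ δ) ≤ 2 * K * r ^ δ := by
      have hM : (1 : ℝ) ≤ ((M + 1 : ℕ) : ℝ) := by push_cast; linarith [Nat.cast_nonneg (α := ℝ) M]
      set m : ℕ := M + 1 with hm
      have hM0 : (0 : ℝ) < (m : ℝ) := by linarith
      have b1 : ‖f m‖ ≤ (K * (m : ℝ) ^ (δ / 2)) * (m : ℝ)⁻¹ := by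
        simp only [hf]
        rw [if_neg (by omega), hfun, norm_mul, norm_pow, Complex.norm_real]
        have hl0 := Real.log_nonneg hM
        rw [Real.norm_of_nonneg hl0]
        gcongr
        · refine le_trans ?_ (hK m (by omega))
          gcongr
          have : Real.log (m : ℝ) ≤ Real.log ((m : ℝ) + 1) := Real.log_le_log hM0 (by linarith)
          linarith
        · exact norm_cpow_le s hs1 _ hM
      have b2 := hdbl m (by omega)
      rw [show ((m + 1 : ℕ)) = M + 2 by omega] at b2
      calc _ ≤ ((K * (m : ℝ) ^ (δ / 2)) * (m : ℝ)⁻¹) * ((2 * (m : ℝ) ^ (1 - δ)) * r ^ δ) := by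
            gcongr
        _ = 2 * K * r ^ δ * ((m : ℝ) ^ (δ / 2) * (m : ℝ)⁻¹ * (m : ℝ) ^ (1 - δ)) := by ring
        _ ≤ 2 * K * r ^ δ * 1 := by
            gcongr
            rw [← Real.rpow_neg_one, ← Real.rpow_add hM0, ← Real.rpow_add hM0]
            exact Real.rpow_le_one_of_one_le_of_nonpos hM (by linarith)
        _ = _ := by ring
    have l2 : ∑ j ∈ range (M + 1), ‖f (j + 1) - f j‖ * (((j + 1 : ℕ) : ℝ) ^ (1 - δ) * r ^ δ) ≤
        (2 * K * (i + 2) * T) * (1 + |s.im|) * r ^ δ + 1 * r ^ δ := by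
      rw [sum_range_succ']
      refine add_le_add ?_ ?_
      · calc _ ≤ ∑ j ∈ range M, (2 * K * (i + 2)) * (1 + |s.im|) * r ^ δ * (((j + 1 : ℕ) : ℝ) ^ (1 + δ / 2))⁻¹ := by
              refine sum_le_sum fun j _ => ?_
              set m : ℕ := j + 1 with hm
              have hM : (1 : ℝ) ≤ (m : ℝ) := by exact_mod_cast (by omega : 1 ≤ m)
              have hM0 : (0 : ℝ) < (m : ℝ) := by linarith
              have b1 : ‖f (m + 1) - f m‖ ≤ ((i + 2) * (1 + |s.im|)) * (K * (m : ℝ) ^ (δ / 2)) * ((m : ℝ)⁻¹ * (m : ℝ)⁻¹) := by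
                simp only [hf]
                rw [if_neg (by omega), if_neg (by omega)]
                refine (hfun_diff i s hs1 m (by omega)).trans ?_
                have hl : 0 ≤ Real.log ((m:ℝ)+1) := Real.log_nonneg (by linarith)
                have hl' : 0 ≤ (1 + Real.log ((m:ℝ)+1)) ^ i := by positivity
                gcongr
                · nlinarith [mul_nonneg (Nat.cast_nonneg (α := ℝ) i) ht]
                · exact hK m (by omega)
              calc _ ≤ (((i + 2) * (1 + |s.im|)) * (K * (m : ℝ) ^ (δ / 2)) * ((m : ℝ)⁻¹ * (m : ℝ)⁻¹)) *
                    ((2 * (m : ℝ) ^ (1 - δ)) * r ^ δ) := by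
                      gcongr
                      exact hdbl m (by omega)
                _ = (2 * K * (i + 2)) * (1 + |s.im|) * r ^ δ * ((m : ℝ) ^ (δ / 2) * ((m : ℝ)⁻¹ * (m : ℝ)⁻¹) * (m : ℝ) ^ (1 - δ)) := by ring
                _ = _ := by
                  rw [← Real.rpow_neg_one, ← Real.rpow_add hM0, ← Real.rpow_add hM0, ← Real.rpow_add hM0, ← Real.rpow_neg hM0.le]
                  congr 2
                  ring
          _ = ((2 * K * (i + 2)) * (1 + |s.im|) * r ^ δ) * ∑ j ∈ range M, (((j + 1 : ℕ) : ℝ) ^ (1 + δ / 2))⁻¹ := by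
              rw [mul_sum]
          _ ≤ ((2 * K * (i + 2)) * (1 + |s.im|) * r ^ δ) * T := by
              gcongr
              have h3 : ∑ j ∈ range M, (((j + 1 : ℕ) : ℝ) ^ (1 + δ / 2))⁻¹ ≤
                  ∑ j ∈ range (M + 1), ((j : ℝ) ^ (1 + δ / 2))⁻¹ := by
                rw [sum_range_succ' (fun j : ℕ => ((j : ℝ) ^ (1 + δ / 2))⁻¹) M]
                exact le_add_of_nonneg_right (by positivity)
              exact h3.trans (hsum.sum_le_tsum _ (fun _ _ => by positivity))
          _ = _ := by ring
      · have : ‖f (0 + 1) - f 0‖ ≤ 1 := by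
          simp only [hf, hfun]
          simp
          rcases Nat.eq_zero_or_pos i with h | h
          · simp [h]
          · simp [h.ne']
        simp only [Nat.cast_one, zero_add, Real.one_rpow, one_mul]
        simp only [zero_add] at this
        have : 0 ≤ r ^ δ := by positivity
        nlinarith
    have hrd : 0 ≤ r ^ δ := by positivity
    have : 2 * K * r ^ δ + 1 * r ^ δ ≤ (1 + 2 * K) * (1 + |s.im|) * r ^ δ := by
      have : 0 ≤ (1 + 2 * K) * |s.im| * r ^ δ := by positivity
      nlinarith
    calc _ ≤ _ := add_le_add l1 l2
      _ ≤ _ := by linarith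
  have hlim := hsumm.hasSum.tendsto_sum_nat
  refine le_of_tendsto hlim.norm (Filter.Eventually.of_forall fun N => ?_)
  simp only [hterm]
  exact hbound N

end TDR

namespace TDR
open Finset

lemma per_sum_le (a : ℕ → ℂ) (r : ℕ) (hr : 0 < r) (hp : ∀ n, a (n + r) = a n) (h0 : ∑ n ∈ range r, a n = 0)
    (ha : ∀ n, ‖a n‖ ≤ 1) (N : ℕ) : ‖∑ n ∈ range N, a n‖ ≤ r := by
  induction N using Nat.strong_induction_on with
  | _ N ih =>
    rcases Nat.lt_or_ge N r with h | h
    · refine (norm_sum_le _ _).trans ?_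
      calc _ ≤ ∑ k ∈ range N, (1 : ℝ) := sum_le_sum fun k _ => ha k
        _ = N := by simp
        _ ≤ r := by exact_mod_cast h.le
    · obtain ⟨M, rfl⟩ := Nat.exists_eq_add_of_le h
      rw [sum_range_add, h0, zero_add]
      simp only [add_comm r, hp]
      exact ih M (by omega)

lemma sum_range_zmod (r : ℕ) [NeZero r] (F : ZMod r → ℂ) : ∑ n ∈ range r, F (n : ZMod r) = ∑ a : ZMod r, F a := by
  obtain ⟨r', rfl⟩ : ∃ r', r = r' + 1 := ⟨r - 1, by have := NeZero.pos r; omega⟩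
  rw [← Fin.sum_univ_eq_sum_range (fun n => F (n : ZMod (r' + 1)))]
  refine Finset.sum_congr rfl fun x _ => ?_
  congr 1
  exact ZMod.natCast_zmod_val (n := r' + 1) x

lemma char_norm_le {r : ℕ} (χ : DirichletCharacter ℂ r) (n : ℕ) : ‖χ (n : ZMod r)‖ ≤ 1 := χ.norm_le_one _

lemma char_sum_le {r : ℕ} [NeZero r] (χ : DirichletCharacter ℂ r) (hχ : χ ≠ 1) (N : ℕ) :
    ‖∑ n ∈ range N, χ (n : ZMod r)‖ ≤ r := by
  refine per_sum_le _ r (NeZero.pos r) (fun n => by simp) ?_ (char_norm_le χ) N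
  rw [sum_range_zmod r (fun a => χ a)]
  exact MulChar.sum_eq_zero_of_ne_one hχ

lemma sum_triv (r : ℕ) [NeZero r] : ∑ a : ZMod r, (1 : DirichletCharacter ℂ r) a = (r.totient : ℂ) := by
  classical
  have : ∀ a : ZMod r, (1 : DirichletCharacter ℂ r) a = if IsUnit a then 1 else 0 := fun a => by
    split_ifs with h
    · exact MulChar.one_apply h
    · exact MulChar.map_nonunit _ h
  simp only [this]
  rw [Finset.sum_boole, ← ZMod.card_units_eq_totient]
  congr 1
  rw [← Fintype.card_subtype]
  exact (Fintype.card_congr (Equiv.ofBijective (fun u : (ZMod r)ˣ => (⟨u, u.isUnit⟩ : {a : ZMod r // IsUnit a}))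
    ⟨fun u v h => Units.ext (congrArg Subtype.val h), fun ⟨a, ha⟩ => ⟨ha.unit, rfl⟩⟩)).symm

lemma triv_sum_le (r : ℕ) [NeZero r] (N : ℕ) :
    ‖∑ n ∈ range N, ((1 : DirichletCharacter ℂ r) (n : ZMod r) - (r.totient : ℂ) / r)‖ ≤ r := by
  have hr : (0 : ℝ) < r := by exact_mod_cast NeZero.pos r
  refine per_sum_le _ r (NeZero.pos r) (fun n => by simp) ?_ ?_ N
  · rw [sum_sub_distrib, sum_range_zmod r (fun a => (1 : DirichletCharacter ℂ r) a), sum_triv]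
    simp only [sum_const, card_range, nsmul_eq_mul]
    rw [mul_div_cancel₀ _ (by exact_mod_cast (NeZero.ne r))]; simp
  · exact triv_norm_le r
where
  triv_norm_le (r : ℕ) [NeZero r] (n : ℕ) : ‖(1 : DirichletCharacter ℂ r) (n : ZMod r) - (r.totient : ℂ) / r‖ ≤ 1 := by
    have hr : (0 : ℝ) < r := by exact_mod_cast NeZero.pos r
    have h1 : (r.totient : ℝ) / r ≤ 1 := by
      rw [div_le_one hr]; exact_mod_cast Nat.totient_le r
    have h0 : 0 ≤ (r.totient : ℝ) / r := by positivity
    have : ((r.totient : ℂ) / r) = (((r.totient : ℝ) / r : ℝ) : ℂ) := by push_cast; rfl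
    rw [this]
    by_cases hu : IsUnit (n : ZMod r)
    · rw [MulChar.one_apply hu, ← Complex.ofReal_one, ← Complex.ofReal_sub, Complex.norm_real, Real.norm_of_nonneg (by linarith)]; linarith
    · rw [MulChar.map_nonunit _ hu, zero_sub, norm_neg, Complex.norm_real, Real.norm_of_nonneg h0]; exact h1

lemma prod_ne_one {r₁ r₂ : ℕ} [NeZero r₁] [NeZero r₂] (χ₁ : DirichletCharacter ℂ r₁) (χ₂ : DirichletCharacter ℂ r₂)
    (h₁ : χ₁.IsPrimitive) (h₂ : χ₂.IsPrimitive)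
    (hne : (⟨r₁, χ₁⟩ : Σ r, DirichletCharacter ℂ r) ≠ ⟨r₂, χ₂⟩) :
    χ₁.changeLevel (Nat.dvd_mul_right r₁ r₂) * (χ₂.changeLevel (Nat.dvd_mul_left r₂ r₁))⁻¹ ≠ 1 := by
  intro h
  rw [mul_inv_eq_one] at h
  have hc := congrArg DirichletCharacter.conductor h
  rw [DirichletCharacter.conductor_changeLevel, DirichletCharacter.conductor_changeLevel] at hc
  rw [DirichletCharacter.isPrimitive_def] at h₁ h₂
  rw [h₁, h₂] at hc
  subst hc
  exact hne (by rw [DirichletCharacter.changeLevel_injective _ h])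

lemma changeLevel_apply {r m : ℕ} (hm : r ∣ m) (χ : DirichletCharacter ℂ r) (n : ℕ) (h : n.Coprime m) :
    χ.changeLevel hm (n : ZMod m) = χ (n : ZMod r) := by
  have := DirichletCharacter.changeLevel_eq_cast_of_dvd' χ hm (a := n) (by exact_mod_cast (Nat.isCoprime_iff_coprime.2 h))
  simpa using this

lemma char_zero_of_not_coprime {r : ℕ} (χ : DirichletCharacter ℂ r) (n : ℕ) (h : ¬ n.Coprime r) : χ (n : ZMod r) = 0 :=
  MulChar.map_nonunit _ (by rwa [ZMod.isUnit_iff_coprime])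

lemma prod_apply {r₁ r₂ : ℕ} (χ₁ : DirichletCharacter ℂ r₁) (χ₂ : DirichletCharacter ℂ r₂) (n : ℕ) :
    (χ₁.changeLevel (Nat.dvd_mul_right r₁ r₂) * (χ₂.changeLevel (Nat.dvd_mul_left r₂ r₁))⁻¹) (n : ZMod (r₁ * r₂))
      = χ₁ n * (starRingEnd ℂ) (χ₂ n) := by
  by_cases h : n.Coprime (r₁ * r₂)
  · rw [MulChar.mul_apply, changeLevel_apply _ _ _ h, MulChar.inv_apply_eq_inv',
      changeLevel_apply _ _ _ h]
    congr 1
    have h2 : n.Coprime r₂ := Nat.Coprime.coprime_mul_left_right h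
    have : ‖χ₂ n‖ = 1 := χ₂.unit_norm_eq_one ((ZMod.unitOfCoprime n h2))
    exact Complex.inv_eq_conj this
  · rw [char_zero_of_not_coprime _ _ h]
    rw [Nat.coprime_mul_iff_right, not_and_or] at h
    rcases h with h | h
    · rw [char_zero_of_not_coprime _ _ h, zero_mul]
    · rw [char_zero_of_not_coprime χ₂ _ h]; simp

end TDR

namespace TDR
open Finset MeasureTheory

lemma zeta_ub (s : ℂ) (hs : 1 < s.re) : ‖riemannZeta s‖ ≤ ‖s‖ / ‖s - 1‖ + ‖s‖ := by
  have hs1 : s - 1 ≠ 0 := fun h => by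
    have := congrArg Complex.re h; simp at this; linarith
  have h1 := LSeries_eq_mul_integral (1 : ℕ → ℂ) (r := 1) zero_le_one hs
    (LSeriesSummable_one_iff.2 hs) (by
      refine Asymptotics.IsBigO.of_bound 1 (Filter.Eventually.of_forall fun n => ?_)
      simp)
  rw [LSeries_one_eq_riemannZeta hs] at h1
  set F : ℝ → ℂ := fun t => (t : ℂ) ^ (-s) with hF
  set G : ℝ → ℂ := fun t => ((t - ⌊t⌋₊ : ℝ) : ℂ) * (t : ℂ) ^ (-(s + 1)) with hG
  have iF : IntegrableOn F (Set.Ioi 1) := integrableOn_Ioi_cpow_of_lt (by simpa using hs) one_pos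
  have iH : IntegrableOn (fun t : ℝ => (t : ℂ) ^ (-(s + 1))) (Set.Ioi 1) :=
    integrableOn_Ioi_cpow_of_lt (by simp; linarith) one_pos
  have bG : ∀ t ∈ Set.Ioi (1 : ℝ), ‖G t‖ ≤ t ^ (-2 : ℝ) := by
    intro t ht
    have ht1 : (1 : ℝ) < t := ht
    simp only [hG, norm_mul, Complex.norm_real]
    have h2 : ‖t - (⌊t⌋₊ : ℝ)‖ ≤ 1 := by
      have := Nat.floor_le (show 0 ≤ t by linarith)
      have := Nat.lt_floor_add_one t
      rw [Real.norm_of_nonneg (by linarith)]; linarith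
    rw [Complex.norm_cpow_eq_rpow_re_of_pos (by linarith)]
    calc _ ≤ 1 * t ^ (-(s + 1)).re := by gcongr
      _ ≤ _ := by
        rw [one_mul]
        apply Real.rpow_le_rpow_of_exponent_le ht1.le
        simp; linarith
  have i2 : IntegrableOn (fun t : ℝ => t ^ (-2 : ℝ)) (Set.Ioi 1) := integrableOn_Ioi_rpow_of_lt (by norm_num) one_pos
  have iG : IntegrableOn G (Set.Ioi 1) := by
    refine Integrable.mono' i2 ?_ ((ae_restrict_iff' measurableSet_Ioi).2 (Filter.Eventually.of_forall bG))
    refine AEStronglyMeasurable.mul ?_ iH.aestronglyMeasurable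
    refine Measurable.aestronglyMeasurable ?_
    refine Complex.measurable_ofReal.comp (measurable_id.sub ?_)
    exact measurable_from_nat.comp Nat.measurable_floor
  have h3 : ∫ t in Set.Ioi (1 : ℝ), (∑ k ∈ Icc 1 ⌊t⌋₊, (1 : ℕ → ℂ) k) * (t : ℂ) ^ (-(s + 1)) =
      (∫ t in Set.Ioi (1 : ℝ), F t) - ∫ t in Set.Ioi (1 : ℝ), G t := by
    rw [← integral_sub iF iG]
    refine setIntegral_congr_fun measurableSet_Ioi fun t ht => ?_
    have ht0 : (t : ℂ) ≠ 0 := by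
      have : (1 : ℝ) < t := ht
      exact_mod_cast (by linarith : t ≠ 0)
    simp only [hF, hG, Pi.one_apply, sum_const, Nat.card_Icc, nsmul_eq_mul, mul_one]
    have : (t : ℂ) ^ (-s) = t * (t : ℂ) ^ (-(s + 1)) := by
      rw [show -s = 1 + -(s + 1) by ring, Complex.cpow_add _ _ ht0, Complex.cpow_one]
    rw [this]
    push_cast
    simp
    ring
  have h4 : ∫ t in Set.Ioi (1 : ℝ), F t = 1 / (s - 1) := by
    rw [hF, integral_Ioi_cpow_of_lt (by simpa using hs) one_pos]
    simp only [Complex.ofReal_one, Complex.one_cpow]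
    rw [show -s + 1 = -(s - 1) by ring, neg_div_neg_eq]
  have h5 : ‖∫ t in Set.Ioi (1 : ℝ), G t‖ ≤ 1 := by
    refine (norm_integral_le_of_norm_le i2 ((ae_restrict_iff' measurableSet_Ioi).2 (Filter.Eventually.of_forall bG))).trans ?_
    rw [integral_Ioi_rpow_of_lt (by norm_num) one_pos]
    norm_num
  rw [h1, h3, h4, norm_mul]
  calc _ ≤ ‖s‖ * (‖1 / (s - 1)‖ + 1) := by
        gcongr
        exact (norm_sub_le _ _).trans (by linarith)
    _ = _ := by rw [norm_div, norm_one]; ring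

lemma zeta_real_ub (σ : ℝ) (h0 : 0 < σ) (h1 : σ ≤ 1) : ∑' n : ℕ, 1 / (n : ℝ) ^ (1 + σ) ≤ 4 / σ := by
  have hz := zeta_ub ((1 + σ : ℝ) : ℂ) (by simpa using h0)
  rw [zeta_eq_tsum_one_div_nat_cpow (by simpa using h0)] at hz
  have : ∀ n : ℕ, 1 / (n : ℂ) ^ (((1 + σ : ℝ)) : ℂ) = ((1 / (n : ℝ) ^ (1 + σ) : ℝ) : ℂ) := by
    intro n
    rw [Complex.ofReal_div, Complex.ofReal_cpow (by positivity)]; simp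
  simp only [this] at hz
  rw [← Complex.ofReal_tsum, Complex.norm_real, Real.norm_of_nonneg (tsum_nonneg fun n => by positivity), Complex.norm_real,
    ← Complex.ofReal_one, ← Complex.ofReal_sub, Complex.norm_real, Real.norm_of_nonneg (by linarith), Real.norm_of_nonneg (by linarith)] at hz
  refine hz.trans ?_
  rw [show 1 + σ - 1 = σ by ring, div_add' _ _ _ h0.ne']
  gcongr
  nlinarith

lemma LSeries_norm_le (f : ℕ → ℂ) (hf : ∀ n, ‖f n‖ ≤ 1) (s : ℂ) (h1 : 1 < s.re) (h2 : s.re ≤ 2) :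
    ‖LSeries f s‖ ≤ 4 / (s.re - 1) := by
  have hs : Summable (fun n : ℕ => 1 / (n : ℝ) ^ (1 + (s.re - 1))) :=
    Real.summable_one_div_nat_rpow.2 (by linarith)
  refine (tsum_of_norm_bounded hs.hasSum fun n => ?_).trans (zeta_real_ub (s.re - 1) (by linarith) (by linarith))
  rcases Nat.eq_zero_or_pos n with h | h
  · subst h; simp [LSeries.term_zero]; positivity
  · rw [LSeries.term_of_ne_zero h.ne', norm_div, Complex.norm_natCast_cpow_of_pos h]
    rw [show 1 + (s.re - 1) = s.re by ring]
    gcongr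
    exact hf n

lemma LF_ge {r : ℕ} [NeZero r] (χ : DirichletCharacter ℂ r) (s : ℂ) (h1 : 1 < s.re) (h2 : s.re ≤ 2) :
    (s.re - 1) / 4 ≤ ‖χ.LFunction s‖ := by
  have h := DirichletCharacter.LSeries.mul_mu_eq_one χ h1
  rw [DirichletCharacter.LFunction_eq_LSeries χ h1]
  have h3 := congrArg norm h
  rw [norm_mul, norm_one] at h3
  have h4 := LSeries_norm_le ((fun n : ℕ => χ (n : ZMod r)) * fun n : ℕ => ((ArithmeticFunction.moebius n : ℤ) : ℂ)) (fun n => by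
    simp only [Pi.mul_apply, norm_mul]
    refine mul_le_one₀ (char_norm_le χ n) (norm_nonneg _) ?_
    rw [Complex.norm_intCast]
    exact_mod_cast ArithmeticFunction.abs_moebius_le_one) s h1 h2
  have h5 : 0 < s.re - 1 := by linarith
  have h6 := norm_nonneg (LSeries (fun n => χ (n : ZMod r)) s)
  have h7 : 1 ≤ ‖LSeries (fun n => χ (n : ZMod r)) s‖ * (4 / (s.re - 1)) := by
    calc (1:ℝ) = _ := h3.symm
      _ ≤ _ := by gcongr
  rw [mul_div_assoc', le_div_iff₀ h5] at h7
  linarith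

lemma LF_le {r : ℕ} [NeZero r] (χ : DirichletCharacter ℂ r) (s : ℂ) (h1 : 1 < s.re) (h2 : s.re ≤ 2) :
    ‖χ.LFunction s‖ ≤ 4 / (s.re - 1) := by
  rw [DirichletCharacter.LFunction_eq_LSeries χ h1]
  exact LSeries_norm_le _ (char_norm_le χ) s h1 h2

lemma logMul_iter (f : ℕ → ℂ) (m n : ℕ) : LSeries.logMul^[m] f n = ((Real.log n : ℝ) : ℂ) ^ m * f n := by
  induction m generalizing f with
  | zero => simp
  | succ m ih =>
    rw [Function.iterate_succ_apply, ih, LSeries.logMul, Complex.ofReal_log (by positivity)]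
    simp only [Complex.ofReal_natCast]
    ring

lemma iterDeriv_LF {r : ℕ} [NeZero r] (χ : DirichletCharacter ℂ r) (m : ℕ) (s : ℂ) (h1 : 1 < s.re) :
    iteratedDeriv m χ.LFunction s =
      (-1) ^ m * LSeries (fun n => ((Real.log n : ℝ) : ℂ) ^ m * χ (n : ZMod r)) s := by
  have he : χ.LFunction =ᶠ[nhds s] LSeries (fun n => χ (n : ZMod r)) := by
    filter_upwards [(isOpen_lt continuous_const Complex.continuous_re).mem_nhds h1] with z hz
    exact DirichletCharacter.LFunction_eq_LSeries χ hz
  rw [he.iteratedDeriv_eq, LSeries_iteratedDeriv]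
  · congr 2
    ext n; rw [logMul_iter]
  · rw [DirichletCharacter.absicssaOfAbsConv_eq_one (NeZero.ne r)]; exact_mod_cast h1

lemma summ_log {r : ℕ} [NeZero r] (χ : DirichletCharacter ℂ r) (m : ℕ) (s : ℂ) (h1 : 1 < s.re) :
    LSeriesSummable (fun n => ((Real.log n : ℝ) : ℂ) ^ m * χ (n : ZMod r)) s := by
  have : (fun n : ℕ => ((Real.log n : ℝ) : ℂ) ^ m * χ (n : ZMod r)) = LSeries.logMul^[m] (fun n => χ (n : ZMod r)) := by
    ext n; rw [logMul_iter]
  rw [this]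
  apply LSeriesSummable_of_abscissaOfAbsConv_lt_re
  rw [LSeries.absicssaOfAbsConv_logPowMul, DirichletCharacter.absicssaOfAbsConv_eq_one (NeZero.ne r)]
  exact_mod_cast h1

theorem LF_ub (i : ℕ) (δ : ℝ) (hδ : 0 < δ) (hδ1 : δ ≤ 1) : ∃ C : ℝ, 1 ≤ C ∧ ∀ (r : ℕ) [NeZero r]
    (χ : DirichletCharacter ℂ r), χ ≠ 1 → ∀ s : ℂ, 1 ≤ s.re → s.re ≤ 2 →
    ‖iteratedDeriv i χ.LFunction s‖ ≤ C * (1 + |s.im|) * (r : ℝ) ^ δ := by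
  obtain ⟨C, hC, h⟩ := L_ub i δ hδ hδ1
  refine ⟨C, hC, fun r _ χ hχ => ?_⟩
  have hr : (1 : ℝ) ≤ r := by exact_mod_cast NeZero.one_le
  have main : ∀ s : ℂ, 1 < s.re → s.re ≤ 2 → ‖iteratedDeriv i χ.LFunction s‖ ≤ C * (1 + |s.im|) * (r : ℝ) ^ δ := by
    intro s h1 h2
    rw [iterDeriv_LF χ i s h1, norm_mul, norm_pow, norm_neg, norm_one, one_pow, one_mul]
    exact h (fun n => χ (n : ZMod r)) r hr (char_norm_le χ) (char_sum_le χ hχ) s h1.le h2 (summ_log χ i s h1)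
  intro s h1 h2
  rcases h1.lt_or_eq with h1 | h1
  · exact main s h1 h2
  have hcont : Continuous (iteratedDeriv i χ.LFunction) := by
    have : ContDiff ℂ (i : ℕ∞) χ.LFunction := (DirichletCharacter.differentiable_LFunction hχ).contDiff
    exact this.continuous_iteratedDeriv i le_rfl
  have hl : Filter.Tendsto (fun x : ℝ => ‖iteratedDeriv i χ.LFunction (s + x)‖) (nhdsWithin 0 (Set.Ioi 0))
      (nhds ‖iteratedDeriv i χ.LFunction (s + (0 : ℝ))‖) := by
    have : Continuous (fun x : ℝ => ‖iteratedDeriv i χ.LFunction (s + x)‖) := by fun_prop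
    exact this.continuousAt.tendsto.mono_left nhdsWithin_le_nhds
  simp only [Complex.ofReal_zero, add_zero] at hl
  refine le_of_tendsto hl ?_
  filter_upwards [Ioo_mem_nhdsGT (show (0 : ℝ) < 1 by norm_num)] with x hx
  have := main (s + x) (by simp; linarith [hx.1]) (by simp; linarith [hx.2])
  simpa using this

/-- upper bound for trivial characters -/
theorem LF_ub1 (δ : ℝ) (hδ : 0 < δ) (hδ1 : δ ≤ 1) : ∃ C : ℝ, 1 ≤ C ∧ ∀ (r : ℕ) [NeZero r]
    (s : ℂ), 1 < s.re → s.re ≤ 2 →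
    ‖(1 : DirichletCharacter ℂ r).LFunction s‖ ≤ C * (1 + |s.im|) * (r : ℝ) ^ δ * (1 + 1 / ‖s - 1‖) := by
  obtain ⟨C, hC, h⟩ := L_ub 0 δ hδ hδ1
  refine ⟨C + 2, by linarith, fun r _ s h1 h2 => ?_⟩
  have hr : (1 : ℝ) ≤ r := by exact_mod_cast NeZero.one_le
  have ht := abs_nonneg s.im
  have hs1 : 0 < ‖s - 1‖ := norm_pos_iff.2 fun h => by
    have := congrArg Complex.re h; simp at this; linarith
  set a : ℕ → ℂ := fun n => (1 : DirichletCharacter ℂ r) (n : ZMod r) - (r.totient : ℂ) / r with ha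
  have sχ := DirichletCharacter.LSeriesSummable_of_one_lt_re (1 : DirichletCharacter ℂ r) h1
  have s1 : LSeriesSummable (((r.totient : ℂ) / r) • (1 : ℕ → ℂ)) s := (LSeriesSummable_one_iff.2 h1).smul _
  have hdec : (1 : DirichletCharacter ℂ r).LFunction s = LSeries a s + ((r.totient : ℂ) / r) * riemannZeta s := by
    rw [DirichletCharacter.LFunction_eq_LSeries _ h1, ← LSeries_one_eq_riemannZeta h1, ← LSeries_smul]
    have : a = (fun n : ℕ => (1 : DirichletCharacter ℂ r) (n : ZMod r)) - ((r.totient : ℂ) / r) • (1 : ℕ → ℂ) := by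
      ext n; simp [ha]
    rw [this, LSeries_sub sχ s1]
    ring
  have sa : LSeriesSummable (fun n => ((Real.log n : ℝ) : ℂ) ^ 0 * a n) s := by
    have : (fun n : ℕ => ((Real.log n : ℝ) : ℂ) ^ 0 * a n) =
        (fun n : ℕ => (1 : DirichletCharacter ℂ r) (n : ZMod r)) - ((r.totient : ℂ) / r) • (1 : ℕ → ℂ) := by
      ext n; simp [ha]
    rw [this]; exact sχ.sub s1
  have hb := h a r hr (triv_sum_le.triv_norm_le r) (triv_sum_le r) s h1.le h2 sa
  simp only [pow_zero, one_mul] at hb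
  have hφ : ‖(r.totient : ℂ) / r‖ ≤ 1 := by
    rw [norm_div, Complex.norm_natCast, Complex.norm_natCast, div_le_one (by linarith)]
    exact_mod_cast Nat.totient_le r
  have hz := zeta_ub s h1
  have hsn : ‖s‖ ≤ 2 * (1 + |s.im|) := by
    refine (Complex.norm_le_abs_re_add_abs_im s).trans ?_
    rw [abs_of_nonneg (by linarith)]; linarith
  have hrd : 1 ≤ (r : ℝ) ^ δ := Real.one_le_rpow hr hδ.le
  have hi : 0 < 1 / ‖s - 1‖ := by positivity
  have e1 : ‖riemannZeta s‖ ≤ 2 * (1 + |s.im|) * (r : ℝ) ^ δ * (1 + 1 / ‖s - 1‖) := by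
    calc _ ≤ ‖s‖ * (1 + 1 / ‖s - 1‖) := by refine hz.trans (le_of_eq ?_); ring
      _ ≤ (2 * (1 + |s.im|)) * (1 + 1 / ‖s - 1‖) := by gcongr
      _ = (2 * (1 + |s.im|)) * 1 * (1 + 1 / ‖s - 1‖) := by ring
      _ ≤ _ := by gcongr
  have e2 : C * (1 + |s.im|) * (r : ℝ) ^ δ ≤ C * (1 + |s.im|) * (r : ℝ) ^ δ * (1 + 1 / ‖s - 1‖) :=
    le_mul_of_one_le_right (by positivity) (by linarith)
  rw [hdec]
  refine (norm_add_le _ _).trans ?_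
  rw [norm_mul]
  have e3 : ‖(r.totient : ℂ) / r‖ * ‖riemannZeta s‖ ≤ 1 * ‖riemannZeta s‖ := by gcongr
  linarith

end TDR

namespace TDR
open Finset

/-- no real primitive character of conductor at most `Z` has tiny value at `1` -/
def Good (δ Z : ℝ) : Prop := ∀ (r : ℕ) [NeZero r] (χ : DirichletCharacter ℂ r), χ.IsPrimitive → 1 < r → (r : ℝ) ≤ Z →
  χ ^ 2 = 1 → Z ^ (-δ) ≤ ‖χ.LFunction 1‖

lemma prim_ne_one {r : ℕ} [NeZero r] (χ : DirichletCharacter ℂ r) (h : χ.IsPrimitive) (hr : 1 < r) : χ ≠ 1 := by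
  rintro rfl
  rw [DirichletCharacter.isPrimitive_def, DirichletCharacter.conductor_one] at h
  omega

/-- mean value inequality for `L` in the strip -/
lemma LF_mv {r : ℕ} [NeZero r] (χ : DirichletCharacter ℂ r) (hχ : χ ≠ 1) (T M : ℝ)
    (hM : ∀ s : ℂ, 1 ≤ s.re → s.re ≤ 2 → |s.im| ≤ T → ‖iteratedDeriv 1 χ.LFunction s‖ ≤ M)
    (s s' : ℂ) (h1 : 1 ≤ s.re) (h2 : s.re ≤ 2) (h3 : |s.im| ≤ T) (h1' : 1 ≤ s'.re) (h2' : s'.re ≤ 2) (h3' : |s'.im| ≤ T) :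
    ‖χ.LFunction s' - χ.LFunction s‖ ≤ M * ‖s' - s‖ := by
  have hconv : Convex ℝ {s : ℂ | 1 ≤ s.re ∧ s.re ≤ 2 ∧ |s.im| ≤ T} := by
    have e : {s : ℂ | 1 ≤ s.re ∧ s.re ≤ 2 ∧ |s.im| ≤ T} =
      (Complex.reLm ⁻¹' (Set.Icc 1 2)) ∩ (Complex.imLm ⁻¹' (Set.Icc (-T) T)) := by
      ext s; simp [abs_le, and_assoc]
    rw [e]
    exact ((convex_Icc _ _).linear_preimage _).inter ((convex_Icc _ _).linear_preimage _)
  refine hconv.norm_image_sub_le_of_norm_deriv_le (𝕜 := ℂ) (f := χ.LFunction)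
    (fun x _ => (DirichletCharacter.differentiable_LFunction hχ).differentiableAt) (fun x hx => ?_)
    ⟨h1, h2, h3⟩ ⟨h1', h2', h3'⟩
  have := hM x hx.1 hx.2.1 hx.2.2
  rwa [iteratedDeriv_one] at this

/-- the 3-4-1 argument -/
lemma LF_341 {r : ℕ} [NeZero r] (χ : DirichletCharacter ℂ r) (hχ : χ ≠ 1) (t M M' : ℝ) (hM1 : 1 ≤ M) (hM1' : 1 ≤ M')
    (hM : ∀ s : ℂ, 1 ≤ s.re → s.re ≤ 2 → |s.im| ≤ |t| → ‖iteratedDeriv 1 χ.LFunction s‖ ≤ M)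
    (hM' : ∀ s : ℂ, 1 < s.re → s.re ≤ 2 → s.im = 2 * t → ‖(χ ^ 2).LFunction s‖ ≤ M')
    (s : ℂ) (h1 : 1 < s.re) (h2 : s.re ≤ 2) (hst : s.im = t) :
    1 / (2 ^ 12 * M' * M ^ 4) ≤ ‖χ.LFunction s‖ := by
  have hM0 : 0 < M := by linarith
  have hM0' : 0 < M' := by linarith
  set η := 1 / (2 ^ 10 * M' * M ^ 4) with hη
  have hη0 : 0 < η := by positivity
  have hη1 : η ≤ 1 := by
    rw [hη, div_le_one (by positivity)]
    calc (1:ℝ) = 1 * 1 * 1 ^ 4 := by norm_num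
      _ ≤ _ := by gcongr; norm_num
  have e0 : 1 / (2 ^ 12 * M' * M ^ 4) = η / 4 := by rw [hη]; field_simp; norm_num
  rw [e0]
  rcases le_or_gt η (s.re - 1) with h | h
  · exact le_trans (by gcongr) (LF_ge χ s h1 h2)
  have key := DirichletCharacter.norm_LFunction_product_ge_one χ hη0 t
  set s0 : ℂ := 1 + η + Complex.I * t with hs0
  rw [norm_mul, norm_mul, norm_pow, norm_pow] at key
  have a1 : ‖DirichletCharacter.LFunctionTrivChar r (1 + η)‖ ≤ 4 / η := by
    have := LF_le (1 : DirichletCharacter ℂ r) (1 + η) (by simpa using hη0) (by simp; linarith)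
    simpa using this
  have a2 : ‖(χ ^ 2).LFunction (1 + η + 2 * Complex.I * t)‖ ≤ M' :=
    hM' _ (by simpa using hη0) (by simp; linarith) (by simp)
  have a3 : 1 ≤ (4 / η) ^ 3 * ‖χ.LFunction s0‖ ^ 4 * M' := key.le.trans (by gcongr)
  have a4 : 2 * (η * M) ≤ ‖χ.LFunction s0‖ := by
    by_contra hcon
    push Not at hcon
    have : (4 / η) ^ 3 * ‖χ.LFunction s0‖ ^ 4 * M' < (4 / η) ^ 3 * (2 * (η * M)) ^ 4 * M' := by gcongr
    have e : (4 / η) ^ 3 * (2 * (η * M)) ^ 4 * M' = 2 ^ 10 * M' * M ^ 4 * η := by field_simp; norm_num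
    have e' : 2 ^ 10 * M' * M ^ 4 * η = 1 := by rw [hη, mul_one_div_cancel (by positivity)]
    linarith
  have a5 := LF_mv χ hχ |t| M hM s s0 h1.le h2 (by rw [hst]) (by simp [hs0]; linarith) (by simp [hs0]; linarith) (by simp [hs0])
  have a6 : ‖s0 - s‖ ≤ η := by
    have : s0 - s = ((η - (s.re - 1) : ℝ) : ℂ) := by
      apply Complex.ext <;> simp [hs0, hst]; ring
    rw [this, Complex.norm_real, Real.norm_of_nonneg (by linarith)]; linarith
  have a7 : ‖χ.LFunction s0‖ - ‖χ.LFunction s‖ ≤ M * η := (norm_sub_norm_le _ _).trans (a5.trans (by gcongr))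
  nlinarith

theorem L_lb (δ : ℝ) (hδ : 0 < δ) (hδ1 : δ ≤ 1) : ∃ c : ℝ, 0 < c ∧ ∀ Z : ℝ, 1 ≤ Z → Good δ Z → ∀ (r : ℕ) [NeZero r]
    (χ : DirichletCharacter ℂ r), χ.IsPrimitive → 1 < r → (r : ℝ) ≤ Z → ∀ s : ℂ, 1 < s.re → s.re ≤ 2 →
    c * Z ^ (-(7 * δ)) / (1 + |s.im|) ^ 5 ≤ ‖χ.LFunction s‖ := by
  obtain ⟨C0, hC0, h0⟩ := LF_ub 0 δ hδ hδ1
  obtain ⟨C1, hC1, h1⟩ := LF_ub 1 δ hδ hδ1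
  obtain ⟨C2, hC2, h2⟩ := LF_ub1 δ hδ hδ1
  set C := max C0 (max C1 C2) with hC
  have c0 : C0 ≤ C := le_max_left _ _
  have c1 : C1 ≤ C := (le_max_left _ _).trans (le_max_right _ _)
  have c2 : C2 ≤ C := (le_max_right _ _).trans (le_max_right _ _)
  have hCC : 1 ≤ C := hC0.trans c0
  have hCp : 0 < C := by linarith
  refine ⟨1 / (2 ^ 17 * C ^ 6), by positivity, fun Z hZ hgood r _ χ hprim hr hrZ s hs1 hs2 => ?_⟩
  have hχ := prim_ne_one χ hprim hr
  set t := s.im with ht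
  have ht0 := abs_nonneg t
  have hr1 : (1 : ℝ) ≤ r := by exact_mod_cast hr.le
  have hZ0 : 0 < Z := by linarith
  set z := Z ^ δ with hz
  have hz1 : 1 ≤ z := Real.one_le_rpow hZ hδ.le
  have hz0 : 0 < z := by linarith
  have hrz : (r : ℝ) ^ δ ≤ z := Real.rpow_le_rpow (by linarith) hrZ hδ.le
  have hz7 : Z ^ (-(7 * δ)) = 1 / z ^ 7 := by
    rw [Real.rpow_neg hZ0.le, mul_comm, Real.rpow_mul hZ0.le, one_div, ← hz]
    norm_cast
  have hzm : Z ^ (-δ) = 1 / z := by rw [Real.rpow_neg hZ0.le, one_div]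
  set τ := 1 / (8 * C * z ^ 2) with hτ
  have hτ0 : 0 < τ := by positivity
  have hτ1 : τ ≤ 1 := by
    rw [hτ, div_le_one (by positivity)]
    calc (1:ℝ) = 1 * 1 * 1 ^ 2 := by norm_num
      _ ≤ _ := by gcongr; norm_num
  set M := C * (1 + |t|) * z with hM
  set M' := 2 * C * (1 + |t|) * z * (2 / τ) with hM'
  have hMd : ∀ s : ℂ, 1 ≤ s.re → s.re ≤ 2 → |s.im| ≤ |t| → ‖iteratedDeriv 1 χ.LFunction s‖ ≤ M := by
    intro s a b c
    exact (h1 r χ hχ s a b).trans (by rw [hM]; gcongr)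
  have h2τ : 1 ≤ 2 / τ := by rw [le_div_iff₀ hτ0]; linarith
  have hM1 : 1 ≤ M := by
    calc (1:ℝ) = 1 * 1 * 1 := by norm_num
      _ ≤ _ := by rw [hM]; gcongr; linarith
  have hM1' : 1 ≤ M' := by
    calc (1:ℝ) = 1 * 1 * 1 * 1 * 1 := by norm_num
      _ ≤ _ := by rw [hM']; gcongr; norm_num; linarith
  have hfin : 1 / (2 ^ 12 * M' * M ^ 4) ≥ 1 / (2 ^ 17 * C ^ 6) * Z ^ (-(7 * δ)) / (1 + |t|) ^ 5 := by
    rw [hz7, hM, hM', hτ]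
    rw [div_mul_div_comm, div_div, one_mul]
    apply one_div_le_one_div_of_le (by positivity)
    apply le_of_eq
    field_simp
    ring
  by_cases hc : χ ^ 2 ≠ 1
  · refine hfin.le.trans (LF_341 χ hχ t M M' hM1 hM1' hMd ?_ s hs1 hs2 rfl)
    intro s a b c
    have := h0 r (χ ^ 2) hc s a.le b
    rw [iteratedDeriv_zero, c, abs_mul, abs_two] at this
    refine this.trans ?_
    calc _ ≤ C * (2 * (1 + |t|)) * z := by gcongr; linarith
      _ = 2 * C * (1 + |t|) * z * 1 := by ring
      _ ≤ _ := by rw [hM']; gcongr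
  push Not at hc
  rcases le_or_gt τ |t| with htt | htt
  · refine hfin.le.trans (LF_341 χ hχ t M M' hM1 hM1' hMd ?_ s hs1 hs2 rfl)
    intro s a b c
    rw [hc]
    have := h2 r s a b
    have hsn : τ ≤ ‖s - 1‖ := by
      have := Complex.abs_im_le_norm (s - 1)
      simp only [Complex.sub_im, Complex.one_im, sub_zero, c, abs_mul, abs_two] at this
      linarith
    rw [c, abs_mul, abs_two] at this
    refine this.trans ?_
    have h3 : 1 + 1 / ‖s - 1‖ ≤ 2 / τ := by
      have : 1 / ‖s - 1‖ ≤ 1 / τ := by gcongr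
      have : 1 ≤ 1 / τ := by rw [le_div_iff₀ hτ0]; linarith
      have : 2 / τ = 1 / τ + 1 / τ := by ring
      linarith
    calc _ ≤ C * (2 * (1 + |t|)) * z * (2 / τ) := by gcongr; linarith
      _ = _ := by rw [hM']; ring
  · have hlow : 1 / (2 ^ 17 * C ^ 6) * Z ^ (-(7 * δ)) / (1 + |t|) ^ 5 ≤ τ / 4 := by
      rw [hz7, hτ, div_mul_div_comm, div_div, one_mul, div_div]
      apply one_div_le_one_div_of_le (by positivity)
      calc 8 * C * z ^ 2 * 4 = 32 * C ^ 1 * z ^ 2 * 1 := by ring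
        _ ≤ (2 ^ 17) * C ^ 6 * z ^ 7 * (1 + |t|) ^ 5 := by
          gcongr
          · norm_num
          · norm_num
          · norm_num
          · exact one_le_pow₀ (by linarith)
        _ = _ := by ring
    refine hlow.trans ?_
    rcases le_or_gt τ (s.re - 1) with h | h
    · exact le_trans (by gcongr) (LF_ge χ s hs1 hs2)
    · have hg := hgood r χ hprim hr hrZ hc
      have hmv := LF_mv χ hχ |t| M hMd s 1 hs1.le hs2 le_rfl (by simp) (by simp) (by simp)
      have hn : ‖1 - s‖ ≤ 2 * τ := by
        refine (Complex.norm_le_abs_re_add_abs_im _).trans ?_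
        simp only [Complex.sub_re, Complex.one_re, Complex.sub_im, Complex.one_im, zero_sub, abs_neg]
        rw [abs_of_neg (by linarith)]; linarith
      have hn2 : ‖χ.LFunction 1‖ - ‖χ.LFunction s‖ ≤ M * (2 * τ) := (norm_sub_norm_le _ _).trans (hmv.trans (by gcongr))
      have hMz : M * (2 * τ) ≤ 1 / (2 * z) := by
        calc M * (2 * τ) ≤ (C * 2 * z) * (2 * τ) := by rw [hM]; gcongr; linarith
          _ = 1 / (2 * z) := by rw [hτ]; field_simp; norm_num
      have : τ / 4 ≤ 1 / (2 * z) := by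
        rw [hτ, div_div]
        apply one_div_le_one_div_of_le (by positivity)
        nlinarith [mul_le_mul hCC hz1 (by norm_num) (by linarith)]
      rw [hzm] at hg
      have : 1 / z = 1 / (2 * z) + 1 / (2 * z) := by field_simp; norm_num
      linarith

end TDR

namespace TDR
open Finset

lemma real_values {r : ℕ} (χ : DirichletCharacter ℂ r) (h : χ ^ 2 = 1) (n : ℕ) :
    χ n = 0 ∨ χ n = 1 ∨ χ n = -1 := by
  by_cases hu : IsUnit (n : ZMod r)
  · right
    have h1 : (χ ^ 2) (n : ZMod r) = 1 := by rw [h]; exact MulChar.one_apply hu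
    rw [MulChar.pow_apply' _ (by norm_num)] at h1
    have h2 : (χ n - 1) * (χ n + 1) = 0 := by linear_combination h1
    rcases mul_eq_zero.1 h2 with h | h
    · left; linear_combination h
    · right; linear_combination h
  · left; exact MulChar.map_nonunit _ hu

lemma euler_factor (u : ℝ) (h0 : 0 < u) (h1 : u < 1) (a b : ℂ) (ha : a = 0 ∨ a = 1 ∨ a = -1) (hb : b = 0 ∨ b = 1 ∨ b = -1) :
    1 ≤ ‖(1 - (u : ℂ))⁻¹ * (1 - a * u)⁻¹ * (1 - b * u)⁻¹ * (1 - (a * (starRingEnd ℂ) b) * u)⁻¹‖ := by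
  obtain ⟨a', rfl, ha'⟩ : ∃ a' : ℝ, a = (a' : ℂ) ∧ (a' = 0 ∨ a' = 1 ∨ a' = -1) := by
    rcases ha with h | h | h
    · exact ⟨0, by simp [h], by simp⟩
    · exact ⟨1, by simp [h], by simp⟩
    · exact ⟨-1, by simp [h], by simp⟩
  obtain ⟨b', rfl, hb'⟩ : ∃ a' : ℝ, b = (a' : ℂ) ∧ (a' = 0 ∨ a' = 1 ∨ a' = -1) := by
    rcases hb with h | h | h
    · exact ⟨0, by simp [h], by simp⟩
    · exact ⟨1, by simp [h], by simp⟩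
    · exact ⟨-1, by simp [h], by simp⟩
  rw [Complex.conj_ofReal]
  have e : (1 - (u : ℂ))⁻¹ * (1 - (a' : ℂ) * (u : ℂ))⁻¹ * (1 - (b' : ℂ) * (u : ℂ))⁻¹ * (1 - ((a' : ℂ) * (b' : ℂ)) * (u : ℂ))⁻¹ =
    ((((1 - u) * (1 - a' * u) * (1 - b' * u) * (1 - (a' * b') * u))⁻¹ : ℝ) : ℂ) := by
    push_cast; simp only [mul_inv]
  rw [e, Complex.norm_real]
  have p1 : 0 < 1 - u := by linarith
  have p2 : 0 < 1 + u := by linarith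
  have q : (1 - u) * (1 + u) ≤ 1 := by nlinarith
  have q0 : 0 < (1 - u) * (1 + u) := by positivity
  have key : 0 < (1 - u) * (1 - a' * u) * (1 - b' * u) * (1 - (a' * b') * u) ∧
      (1 - u) * (1 - a' * u) * (1 - b' * u) * (1 - (a' * b') * u) ≤ 1 := by
    rcases ha' with rfl | rfl | rfl <;> rcases hb' with rfl | rfl | rfl
    · constructor <;> nlinarith
    · constructor <;> nlinarith
    · constructor <;> nlinarith
    · constructor <;> nlinarith
    · have e : (1 - u) * (1 - 1 * u) * (1 - 1 * u) * (1 - (1 * 1) * u) = (1 - u) ^ 4 := by ring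
      rw [e]; exact ⟨by positivity, pow_le_one₀ p1.le (by linarith)⟩
    · have e : (1 - u) * (1 - 1 * u) * (1 - -1 * u) * (1 - (1 * -1) * u) = ((1 - u) * (1 + u)) ^ 2 := by ring
      rw [e]; exact ⟨by positivity, pow_le_one₀ q0.le q⟩
    · constructor <;> nlinarith
    · have e : (1 - u) * (1 - -1 * u) * (1 - 1 * u) * (1 - (-1 * 1) * u) = ((1 - u) * (1 + u)) ^ 2 := by ring
      rw [e]; exact ⟨by positivity, pow_le_one₀ q0.le q⟩
    · have e : (1 - u) * (1 - -1 * u) * (1 - -1 * u) * (1 - (-1 * -1) * u) = ((1 - u) * (1 + u)) ^ 2 := by ring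
      rw [e]; exact ⟨by positivity, pow_le_one₀ q0.le q⟩
  rw [Real.norm_of_nonneg (inv_nonneg.2 key.1.le)]
  exact (one_le_inv₀ key.1).2 key.2

lemma four_prod {r₁ r₂ : ℕ} [NeZero r₁] [NeZero r₂] (χ₁ : DirichletCharacter ℂ r₁) (χ₂ : DirichletCharacter ℂ r₂)
    (h₁ : χ₁ ^ 2 = 1) (h₂ : χ₂ ^ 2 = 1) (σ : ℝ) (hσ : 0 < σ) :
    1 ≤ ‖(1 : DirichletCharacter ℂ 1).LFunction (1 + σ)‖ * ‖χ₁.LFunction (1 + σ)‖ * ‖χ₂.LFunction (1 + σ)‖ *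
      ‖(χ₁.changeLevel (Nat.dvd_mul_right r₁ r₂) * (χ₂.changeLevel (Nat.dvd_mul_left r₂ r₁))⁻¹).LFunction (1 + σ)‖ := by
  set χ₃ := χ₁.changeLevel (Nat.dvd_mul_right r₁ r₂) * (χ₂.changeLevel (Nat.dvd_mul_left r₂ r₁))⁻¹ with h3
  set s : ℂ := 1 + σ with hs
  have hs1 : 1 < s.re := by simpa [hs] using hσ
  have e0 := DirichletCharacter.LSeries_eulerProduct_hasProd (1 : DirichletCharacter ℂ 1) hs1
  have e1 := DirichletCharacter.LSeries_eulerProduct_hasProd χ₁ hs1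
  have e2 := DirichletCharacter.LSeries_eulerProduct_hasProd χ₂ hs1
  have e3 := DirichletCharacter.LSeries_eulerProduct_hasProd χ₃ hs1
  rw [DirichletCharacter.LFunction_eq_LSeries _ hs1, DirichletCharacter.LFunction_eq_LSeries _ hs1,
    DirichletCharacter.LFunction_eq_LSeries _ hs1, DirichletCharacter.LFunction_eq_LSeries _ hs1, ← norm_mul, ← norm_mul, ← norm_mul]
  have e := (((e0.mul e1).mul e2).mul e3)
  refine ge_of_tendsto (Filter.Tendsto.norm e) (Filter.Eventually.of_forall fun S => ?_)
  rw [norm_prod]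
  have one_le_pr : ∀ (f : Nat.Primes → ℝ), (∀ p, 1 ≤ f p) → 1 ≤ ∏ p ∈ S, f p := fun f hf => by
    calc (1 : ℝ) = ∏ p ∈ S, 1 := by simp
      _ ≤ _ := Finset.prod_le_prod (fun _ _ => zero_le_one) fun p _ => hf p
  refine one_le_pr _ fun p => ?_
  have hp : (1 : ℝ) < (p : ℕ) := by exact_mod_cast p.2.one_lt
  set u : ℝ := ((p : ℕ) : ℝ) ^ (-(1 + σ)) with hu
  have hup : ((p : ℕ) : ℂ) ^ (-s) = (u : ℂ) := by
    rw [hu, Complex.ofReal_cpow (by positivity), hs]; push_cast; rfl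
  rw [hup, h3, prod_apply]
  have := euler_factor u (by positivity) (Real.rpow_lt_one_of_one_lt_of_neg hp (by linarith)) _ _ (real_values χ₁ h₁ p) (real_values χ₂ h₂ p)
  rw [MulChar.one_apply (show IsUnit (((p : ℕ) : ZMod 1)) from by
    rw [Subsingleton.elim ((p : ℕ) : ZMod 1) 1]; exact isUnit_one), one_mul]
  exact this

theorem good_exists (δ : ℝ) (hδ : 0 < δ) (hδ1 : δ ≤ 1) (Z0 : ℝ) : ∃ Z, Z0 ≤ Z ∧ 1 ≤ Z ∧ Good δ Z := by
  by_contra hcon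
  push Not at hcon
  obtain ⟨C0, hC0, h0⟩ := LF_ub 0 (δ / 8) (by linarith) (by linarith)
  obtain ⟨C1, hC1, h1⟩ := LF_ub 1 (δ / 8) (by linarith) (by linarith)
  set C := max C0 C1 with hC
  have c0 : C0 ≤ C := le_max_left _ _
  have c1 : C1 ≤ C := le_max_right _ _
  have hC1 : 1 ≤ C := hC0.trans c0
  have hCp : 0 < C := by linarith
  set Z1 := max Z0 (max 1 ((16 * C ^ 3 + 1) ^ (2 / δ))) with hZ1
  have z0 : Z0 ≤ Z1 := le_max_left _ _
  have z1 : 1 ≤ Z1 := (le_max_left _ _).trans (le_max_right _ _)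
  have z2 : (16 * C ^ 3 + 1) ^ (2 / δ) ≤ Z1 := (le_max_right _ _).trans (le_max_right _ _)
  have z3 : 16 * C ^ 3 + 1 ≤ Z1 ^ (δ / 2) := by
    calc 16 * C ^ 3 + 1 = ((16 * C ^ 3 + 1) ^ (2 / δ)) ^ (δ / 2) := by
          rw [← Real.rpow_mul (by positivity), show 2 / δ * (δ / 2) = 1 by field_simp, Real.rpow_one]
      _ ≤ _ := Real.rpow_le_rpow (by positivity) z2 (by positivity)
  have b1 := hcon Z1 z0 z1
  simp only [Good, not_forall, not_le] at b1
  obtain ⟨r₁, i₁, χ₁, p₁, hr₁, hrZ₁, hq₁, hl₁⟩ := b1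
  have hχ₁ := prim_ne_one χ₁ p₁ hr₁
  set l₁ := ‖χ₁.LFunction 1‖ with hl1
  have l1pos : 0 < l₁ := norm_pos_iff.2 (DirichletCharacter.LFunction_apply_one_ne_zero hχ₁)
  set Z' := l₁ ^ (-(1 / δ)) with hZ'
  have hZ'0 : 0 < Z' := by positivity
  have hl1Z : l₁ = Z' ^ (-δ) := by
    rw [hZ', ← Real.rpow_mul l1pos.le, show -(1 / δ) * -δ = 1 by field_simp, Real.rpow_one]
  have hZZ : Z1 ≤ Z' := by
    have : Z' ^ (-δ) < Z1 ^ (-δ) := by rw [← hl1Z]; exact hl₁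
    by_contra hlt
    push Not at hlt
    have := Real.rpow_le_rpow_of_nonpos hZ'0 hlt.le (show -δ ≤ 0 by linarith)
    linarith
  have hZ'1 : 1 ≤ Z' := z1.trans hZZ
  have b2 := hcon Z' (z0.trans hZZ) hZ'1
  simp only [Good, not_forall, not_le] at b2
  obtain ⟨r₂, i₂, χ₂, p₂, hr₂, hrZ₂, hq₂, hl₂⟩ := b2
  have hχ₂ := prim_ne_one χ₂ p₂ hr₂
  have hne : (⟨r₁, χ₁⟩ : Σ r, DirichletCharacter ℂ r) ≠ ⟨r₂, χ₂⟩ := by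
    intro h
    obtain ⟨h, h'⟩ := Sigma.mk.inj_iff.1 h
    subst h
    have h' := eq_of_heq h'
    subst h'
    rw [← hl1Z] at hl₂
    exact lt_irrefl _ hl₂
  have hl1le : l₁ ≤ 1 := by
    rw [hl1Z]; exact Real.rpow_le_one_of_one_le_of_nonpos hZ'1 (by linarith)
  have h12 := prod_ne_one χ₁ χ₂ p₁ p₂ hne
  have F := four_prod χ₁ χ₂ hq₁ hq₂ l₁ l1pos
  have hre : ((1 : ℂ) + (l₁ : ℂ)).re = 1 + l₁ := by simp
  have him : ((1 : ℂ) + (l₁ : ℂ)).im = 0 := by simp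
  set y := Z' ^ (δ / 8) with hy
  have hy1 : 1 ≤ y := Real.one_le_rpow hZ'1 (by linarith)
  have f0 := LF_le (1 : DirichletCharacter ℂ 1) (1 + l₁) (by rw [hre]; linarith) (by rw [hre]; linarith)
  rw [hre, show 1 + l₁ - 1 = l₁ by ring] at f0
  have f3 := h0 _ _ h12 (1 + l₁) (by rw [hre]; linarith) (by rw [hre]; linarith)
  rw [iteratedDeriv_zero, him, abs_zero, add_zero, mul_one] at f3
  have rr : ((r₁ * r₂ : ℕ) : ℝ) ^ (δ / 8) ≤ y * y := by
    rw [Nat.cast_mul, Real.mul_rpow (by positivity) (by positivity)]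
    gcongr
    · exact Real.rpow_le_rpow (by positivity) (hrZ₁.trans hZZ) (by linarith)
    · exact Real.rpow_le_rpow (by positivity) (hrZ₂) (by linarith)
  have gen : ∀ (r : ℕ) [NeZero r] (χ : DirichletCharacter ℂ r), χ ≠ 1 → (r : ℝ) ≤ Z' → ‖χ.LFunction 1‖ ≤ l₁ →
      ‖χ.LFunction (1 + l₁)‖ ≤ l₁ * (2 * C * y) := by
    intro r _ χ hχ hr hl
    have := LF_mv χ hχ 0 (C * y) (fun s a b c => by
      have := h1 r χ hχ s a b
      have c' : |s.im| = 0 := le_antisymm c (abs_nonneg _)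
      rw [c', add_zero, mul_one] at this
      refine this.trans ?_
      gcongr
      exact Real.rpow_le_rpow (by positivity) hr (by linarith)) 1 (1 + l₁) (by simp) (by simp) (by simp) (by rw [hre]; linarith)
        (by rw [hre]; linarith) (by rw [him]; simp)
    rw [add_sub_cancel_left, Complex.norm_real, Real.norm_of_nonneg l1pos.le] at this
    have h5 := (norm_sub_norm_le _ _).trans this
    have : 1 ≤ C * y := one_le_mul_of_one_le_of_one_le hC1 hy1
    nlinarith
  have f1 := gen r₁ χ₁ hχ₁ (hrZ₁.trans hZZ) le_rfl
  have f2 := gen r₂ χ₂ hχ₂ hrZ₂ (by rw [hl1Z]; exact hl₂.le)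
  have f3' : _ ≤ C * (y * y) := f3.trans (by gcongr)
  have G : (1 : ℝ) ≤ (4 / l₁) * (l₁ * (2 * C * y)) * (l₁ * (2 * C * y)) * (C * (y * y)) := by
    refine F.trans ?_
    gcongr
  have e : (4 / l₁) * (l₁ * (2 * C * y)) * (l₁ * (2 * C * y)) * (C * (y * y)) = 16 * C ^ 3 * (l₁ * y ^ 4) := by
    field_simp; norm_num
  have e2 : l₁ * y ^ 4 * Z' ^ (δ / 2) = 1 := by
    rw [hl1Z, hy, ← Real.rpow_natCast, ← Real.rpow_mul hZ'0.le, ← Real.rpow_add hZ'0, ← Real.rpow_add hZ'0]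
    rw [show -δ + δ / 8 * ((4 : ℕ) : ℝ) + δ / 2 = 0 by push_cast; ring, Real.rpow_zero]
  have e3 : 16 * C ^ 3 + 1 ≤ Z' ^ (δ / 2) := z3.trans (Real.rpow_le_rpow (by linarith) hZZ (by linarith))
  rw [e] at G
  have p : 0 < l₁ * y ^ 4 := by positivity
  have : l₁ * y ^ 4 * (16 * C ^ 3 + 1) ≤ 1 := 
    le_of_le_of_eq (by gcongr) e2
  nlinarith

end TDR

namespace TDR
open Finset

lemma logderiv_bound (j : ℕ) : ∃ K : ℝ, 1 ≤ K ∧ ∀ (f g : ℂ → ℂ) (s : ℂ) (M m : ℝ), 0 < m → m ≤ M →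
    AnalyticAt ℂ f s → AnalyticAt ℂ g s → (f * g =ᶠ[nhds s] deriv f) → m ≤ ‖f s‖ →
    (∀ i ≤ j + 1, ‖iteratedDeriv i f s‖ ≤ M) → ∀ i ≤ j, ‖iteratedDeriv i g s‖ ≤ K * (M / m) ^ (i + 1) := by
  have step : ∀ j : ℕ, ∀ (f g : ℂ → ℂ) (s : ℂ) (M m : ℝ), 0 < m → m ≤ M →
    AnalyticAt ℂ f s → AnalyticAt ℂ g s → (f * g =ᶠ[nhds s] deriv f) → m ≤ ‖f s‖ →
    (∀ i ≤ j + 1, ‖iteratedDeriv i f s‖ ≤ M) → ∀ K : ℝ, 1 ≤ K → (∀ i < j, ‖iteratedDeriv i g s‖ ≤ K * (M / m) ^ (i + 1)) →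
    ‖iteratedDeriv j g s‖ ≤ (1 + 2 ^ j * K) * (M / m) ^ (j + 1) := by
    intro j f g s M m hm hmM hf hg hfg hms hM K hK hi
    have hMm : 1 ≤ M / m := by rw [le_div_iff₀ hm]; linarith
    have hM0 : 0 < M := by linarith
    have h1 : iteratedDeriv j (f * g) s = iteratedDeriv (j + 1) f s := by
      rw [hfg.iteratedDeriv_eq, iteratedDeriv_succ']
    have h2 := iteratedDeriv_mul (n := j) (x := s) (f := f) (g := g) hf.contDiffAt hg.contDiffAt
    rw [h1, sum_range_succ'] at h2
    simp only [Nat.choose_zero_right, Nat.cast_one, one_mul, iteratedDeriv_zero, Nat.sub_zero] at h2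
    have h3 : f s * iteratedDeriv j g s = iteratedDeriv (j + 1) f s -
      ∑ i ∈ range j, (j.choose (i + 1) : ℂ) * iteratedDeriv (i + 1) f s * iteratedDeriv (j - (i + 1)) g s := by
      rw [h2]; ring
    have h4 : ‖f s‖ * ‖iteratedDeriv j g s‖ ≤ M + ∑ i ∈ range j, (j.choose (i + 1) : ℝ) * M * (K * (M / m) ^ j) := by
      rw [← norm_mul, h3]
      refine (norm_sub_le _ _).trans (add_le_add (hM _ le_rfl) ((norm_sum_le _ _).trans (sum_le_sum fun i hij => ?_)))
      have hij := mem_range.1 hij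
      rw [norm_mul, norm_mul, Complex.norm_natCast]
      gcongr
      · exact hM _ (by omega)
      · refine (hi _ (by omega)).trans ?_
        gcongr
        omega
    have h5 : ∑ i ∈ range j, (j.choose (i + 1) : ℝ) ≤ 2 ^ j := by
      have := Nat.sum_range_choose j
      rw [sum_range_succ'] at this
      have h6 : ∑ i ∈ range j, j.choose (i + 1) ≤ 2 ^ j := by omega
      exact_mod_cast h6
    rw [← sum_mul, ← sum_mul] at h4
    have h7 : m * ‖iteratedDeriv j g s‖ ≤ M * (1 + 2 ^ j * K) * (M / m) ^ j := by
      calc m * ‖iteratedDeriv j g s‖ ≤ ‖f s‖ * ‖iteratedDeriv j g s‖ := by gcongr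
        _ ≤ _ := h4
        _ ≤ M * (M / m) ^ j + 2 ^ j * M * (K * (M / m) ^ j) := by
          gcongr
          exact le_mul_of_one_le_right hM0.le (one_le_pow₀ hMm)
        _ = _ := by ring
    have h8 : ‖iteratedDeriv j g s‖ ≤ M * (1 + 2 ^ j * K) * (M / m) ^ j / m := by
      rw [le_div_iff₀ hm]; linarith
    refine h8.trans (le_of_eq ?_)
    rw [pow_succ]; ring
  induction j with
  | zero =>
    refine ⟨2, by norm_num, fun f g s M m hm hmM hf hg hfg hms hM i hi => ?_⟩
    have := step 0 f g s M m hm hmM hf hg hfg hms hM 1 le_rfl (by simp)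
    obtain rfl : i = 0 := by omega
    norm_num at this ⊢
    exact this
  | succ j ih =>
    obtain ⟨K, hK, h⟩ := ih
    have h2 : (1:ℝ) ≤ 2 ^ (j + 1) := one_le_pow₀ (by norm_num)
    refine ⟨1 + 2 ^ (j + 1) * K, by nlinarith, fun f g s M m hm hmM hf hg hfg hms hM i hi => ?_⟩
    have hMm : 1 ≤ M / m := by rw [le_div_iff₀ hm]; linarith
    have hprev := h f g s M m hm hmM hf hg hfg hms (fun i hi => hM i (by omega))
    rcases Nat.lt_or_ge i (j + 1) with hij | hij
    · refine (hprev i (by omega)).trans ?_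
      gcongr
      nlinarith
    · obtain rfl : i = j + 1 := by omega
      exact step (j + 1) f g s M m hm hmM hf hg hfg hms hM K hK (fun i hi => hprev i (by omega))

/-- the twisted von Mangoldt function -/
noncomputable def vch {r : ℕ} (χ : DirichletCharacter ℂ r) (n : ℕ) : ℂ := χ (n : ZMod r) * ((ArithmeticFunction.vonMangoldt n : ℝ) : ℂ)

lemma vch_absc {r : ℕ} (χ : DirichletCharacter ℂ r) : LSeries.abscissaOfAbsConv (vch χ) ≤ (1 : ℝ) :=
  LSeries.abscissaOfAbsConv_le_of_forall_lt_LSeriesSummable fun y hy =>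
    DirichletCharacter.LSeriesSummable_twist_vonMangoldt χ (s := y) (by simpa using hy)

lemma vch_summ {r : ℕ} (χ : DirichletCharacter ℂ r) (j : ℕ) (s : ℂ) (hs : 1 < s.re) :
    LSeriesSummable (fun n => ((Real.log n : ℝ) : ℂ) ^ j * vch χ n) s := by
  have : (fun n : ℕ => ((Real.log n : ℝ) : ℂ) ^ j * vch χ n) = LSeries.logMul^[j] (vch χ) := by
    ext n; rw [logMul_iter]
  rw [this]
  apply LSeriesSummable_of_abscissaOfAbsConv_lt_re
  rw [LSeries.absicssaOfAbsConv_logPowMul]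
  exact (vch_absc χ).trans_lt (by exact_mod_cast hs)

theorem Q_ub (j : ℕ) (δ : ℝ) (hδ : 0 < δ) (hδ1 : δ ≤ 1) : ∃ C : ℝ, 1 ≤ C ∧ ∀ Z : ℝ, 1 ≤ Z → Good δ Z → ∀ (r : ℕ) [NeZero r]
    (χ : DirichletCharacter ℂ r), χ.IsPrimitive → 1 < r → (r : ℝ) ≤ Z → ∀ s : ℂ, 1 < s.re → s.re ≤ 2 →
    ‖LSeries (fun n => ((Real.log n : ℝ) : ℂ) ^ j * vch χ n) s‖ ≤ C * (Z ^ (8 * δ) * (1 + |s.im|) ^ 6) ^ (j + 1) := by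
  obtain ⟨K, hK, hKb⟩ := logderiv_bound j
  obtain ⟨c, hc, hlb⟩ := L_lb δ hδ hδ1
  have hCi : ∃ C : ℝ, 1 ≤ C ∧ ∀ i ≤ j + 1, ∀ (r : ℕ) [NeZero r]
    (χ : DirichletCharacter ℂ r), χ ≠ 1 → ∀ s : ℂ, 1 ≤ s.re → s.re ≤ 2 →
    ‖iteratedDeriv i χ.LFunction s‖ ≤ C * (1 + |s.im|) * (r : ℝ) ^ δ := by
    choose C hC hC' using fun i => LF_ub i δ hδ hδ1
    refine ⟨∑ i ∈ range (j + 2), C i, ?_, fun i hi r _ χ hχ s h1 h2 => ?_⟩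
    · refine (hC 0).trans (single_le_sum (f := C) (fun i _ => by linarith [hC i]) (by simp))
    · refine (hC' i r χ hχ s h1 h2).trans ?_
      gcongr
      exact single_le_sum (f := C) (fun i _ => by linarith [hC i]) (by simp; omega)
  obtain ⟨C, hC, hub⟩ := hCi
  set c' := min c 1 with hc'
  have hc'0 : 0 < c' := lt_min hc one_pos
  have hc'1 : c' ≤ 1 := min_le_right _ _
  refine ⟨K * (C / c') ^ (j + 1), ?_, fun Z hZ hgood r _ χ hprim hr hrZ s h1 h2 => ?_⟩
  · have : 1 ≤ C / c' := by rw [le_div_iff₀ hc'0]; linarith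
    exact one_le_mul_of_one_le_of_one_le hK (one_le_pow₀ this)
  have hχ := prim_ne_one χ hprim hr
  have hZ0 : 0 < Z := by linarith
  have ht := abs_nonneg s.im
  set U : Set ℂ := {z | 1 < z.re} with hU
  have hUo : IsOpen U := isOpen_lt continuous_const Complex.continuous_re
  have hsU : U ∈ nhds s := hUo.mem_nhds h1
  have hne : ∀ z ∈ U, χ.LFunction z ≠ 0 := fun z hz =>
    DirichletCharacter.LFunction_ne_zero_of_one_le_re χ (Or.inl hχ) (le_of_lt hz)
  have hd := DirichletCharacter.differentiable_LFunction hχ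
  have hf : AnalyticAt ℂ χ.LFunction s := hd.analyticAt s
  set g : ℂ → ℂ := fun z => deriv χ.LFunction z / χ.LFunction z with hg
  have hga : AnalyticAt ℂ g s := hf.deriv.div hf (hne s h1)
  have hfg : χ.LFunction * g =ᶠ[nhds s] deriv χ.LFunction := by
    filter_upwards [hsU] with z hz
    simp only [Pi.mul_apply, hg]
    rw [mul_div_cancel₀ _ (hne z hz)]
  have hgL : g =ᶠ[nhds s] fun z => - LSeries (vch χ) z := by
    filter_upwards [hsU] with z hz
    have e := DirichletCharacter.LSeries_twist_vonMangoldt_eq χ hz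
    have e2 : LSeries (vch χ) z = LSeries ((fun n : ℕ => χ (n : ZMod r)) * fun n : ℕ => ((ArithmeticFunction.vonMangoldt n : ℝ) : ℂ)) z := rfl
    have he : χ.LFunction =ᶠ[nhds z] LSeries (fun n => χ (n : ZMod r)) := by
      filter_upwards [hUo.mem_nhds hz] with w hw
      exact DirichletCharacter.LFunction_eq_LSeries χ hw
    rw [e2, e, hg]
    simp only
    rw [he.deriv_eq, he.eq_of_nhds, neg_div, neg_neg]
  have hiter : ‖LSeries (fun n => ((Real.log n : ℝ) : ℂ) ^ j * vch χ n) s‖ = ‖iteratedDeriv j g s‖ := by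
    have e3 : iteratedDeriv j (fun z => - LSeries (vch χ) z) s = - iteratedDeriv j (LSeries (vch χ)) s := by
      exact iteratedDeriv_neg j _ s
    rw [hgL.iteratedDeriv_eq, e3, norm_neg, LSeries_iteratedDeriv _ ((vch_absc χ).trans_lt (by exact_mod_cast h1)),
      norm_mul, norm_pow, norm_neg, norm_one, one_pow, one_mul]
    congr 2
    ext n; rw [logMul_iter]
  rw [hiter]
  set M := C * (1 + |s.im|) * Z ^ δ with hM
  set m := c' * Z ^ (-(7 * δ)) / (1 + |s.im|) ^ 5 with hm
  have hm0 : 0 < m := by positivity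
  have hmf : m ≤ ‖χ.LFunction s‖ := by
    refine le_trans ?_ (hlb Z hZ hgood r χ hprim hr hrZ s h1 h2)
    rw [hm]; gcongr; exact min_le_left _ _
  have hMb : ∀ i ≤ j + 1, ‖iteratedDeriv i χ.LFunction s‖ ≤ M := fun i hi => by
    refine (hub i hi r χ hχ s h1.le h2).trans ?_
    rw [hM]; gcongr
  have hmM : m ≤ M := by
    have := hMb 0 (by omega); rw [iteratedDeriv_zero] at this
    exact hmf.trans this
  refine (hKb χ.LFunction g s M m hm0 hmM hf hga hfg hmf hMb j le_rfl).trans (le_of_eq ?_)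
  rw [mul_assoc, ← mul_pow]
  congr 2
  rw [hM, hm]
  have e : Z ^ (8 * δ) = Z ^ δ * (Z ^ (-(7 * δ)))⁻¹ := by
    rw [Real.rpow_neg hZ0.le, inv_inv, ← Real.rpow_add hZ0]; congr 1; ring
  rw [e]
  field_simp

end TDR

namespace TDR
open Finset MeasureTheory SchwartzMap FourierTransform

/-- Fourier inversion in explicit form. -/
lemma schwartz_inv (g : 𝓢(ℝ, ℂ)) (u : ℝ) :
    g u = ∫ v : ℝ, Complex.exp ((2 * Real.pi * v * u : ℝ) * Complex.I) * (𝓕 g : 𝓢(ℝ, ℂ)) v := by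
  have h1 : (𝓕⁻ (𝓕 g) : 𝓢(ℝ, ℂ)) = g := fourierInv_fourier_eq g
  have h2 : g u = (𝓕⁻ ((𝓕 g : 𝓢(ℝ, ℂ)) : ℝ → ℂ)) u := by
    conv_lhs => rw [← h1]
    rw [SchwartzMap.fourierInv_coe]
  rw [h2, Real.fourierInv_eq']
  congr 1; ext v
  rw [smul_eq_mul]
  congr 3
  simp; ring

lemma fourier_LS (g : 𝓢(ℝ, ℂ)) (m : ℕ) : ∃ C : ℝ, 0 ≤ C ∧ ∀ (a : ℕ → ℂ) (σ M L : ℝ), 0 ≤ M →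
    LSeriesSummable a ((1 + σ : ℝ) : ℂ) → 
    (∀ s : ℂ, s.re = 1 + σ → ‖LSeries a s‖ ≤ M * (1 + |s.im|) ^ m) →
    ‖∑' n, LSeries.term a ((1 + σ : ℝ) : ℂ) n * g (Real.log n - L)‖ ≤ C * M := by
  set F : 𝓢(ℝ, ℂ) := 𝓕 g with hF
  have hintg : Integrable (fun v : ℝ => (1 + 2 * Real.pi * |v|) ^ m * ‖F v‖) := by
    have e : (fun v : ℝ => (1 + 2 * Real.pi * |v|) ^ m * ‖F v‖) =
        fun v : ℝ => ∑ i ∈ range (m + 1), ((2 * Real.pi) ^ i * (m.choose i)) * (‖v‖ ^ i * ‖F v‖) := by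
      ext v
      rw [add_comm, add_pow, sum_mul]
      refine sum_congr rfl fun i _ => ?_
      rw [mul_pow, one_pow, Real.norm_eq_abs]; ring
    rw [e]
    exact integrable_finsetSum _ fun i _ => (F.integrable_pow_mul volume i).const_mul _
  refine ⟨∫ v : ℝ, (1 + 2 * Real.pi * |v|) ^ m * ‖F v‖, integral_nonneg fun v => by positivity, ?_⟩
  intro a σ M L hM hs hb
  set t : ℕ → ℂ := LSeries.term a ((1 + σ : ℝ) : ℂ) with ht
  have hts : Summable fun n => ‖t n‖ := hs.norm
  set H : ℕ → ℝ → ℂ := fun n v => t n * (Complex.exp ((2 * Real.pi * v * (Real.log n - L) : ℝ) * Complex.I) * F v) with hH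
  have hnorm : ∀ n v, ‖H n v‖ = ‖t n‖ * ‖F v‖ := fun n v => by
    rw [hH]; simp only [norm_mul, Complex.norm_exp_ofReal_mul_I, one_mul]
  have hFi : Integrable (fun v => ‖F v‖) := F.integrable.norm
  have hHi : ∀ n, Integrable (H n) := fun n => by
    refine (Integrable.const_mul ?_ _)
    refine F.integrable.bdd_mul (c := 1) ?_ ?_
    · exact (Continuous.aestronglyMeasurable (by fun_prop))
    · exact Filter.Eventually.of_forall fun v => by rw [Complex.norm_exp_ofReal_mul_I]
  have hsum : Summable fun n => ∫ v, ‖H n v‖ := by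
    simp only [hnorm, integral_const_mul]
    exact hts.mul_right _
  have h1 := integral_tsum_of_summable_integral_norm hHi hsum
  have h2 : ∀ n, ∫ v, H n v = t n * g (Real.log n - L) := fun n => by
    rw [hH]; simp only
    rw [integral_const_mul, schwartz_inv g]
  have h3 : ∑' n, t n * g (Real.log n - L) = ∫ v, ∑' n, H n v := by
    rw [← h1]; simp only [h2]
  rw [h3, ← integral_mul_const]
  refine norm_integral_le_of_norm_le (hintg.mul_const M) (Filter.Eventually.of_forall fun v => ?_)
  have h4 : ∑' n, H n v = LSeries a (((1 + σ : ℝ) : ℂ) + (-(2 * Real.pi * v) : ℝ) * Complex.I) *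
      (Complex.exp (-(2 * Real.pi * v * L : ℝ) * Complex.I) * F v) := by
    rw [LSeries, ← tsum_mul_right]
    congr 1; ext n
    rw [hH]; simp only [ht]
    rcases eq_or_ne n 0 with rfl | hn
    · simp
    · have hn0 : (n : ℂ) ≠ 0 := by exact_mod_cast hn
      have e1 : Complex.exp ((2 * Real.pi * v * (Real.log n - L) : ℝ) * Complex.I) =
        ((n : ℂ) ^ (((-(2 * Real.pi * v) : ℝ) : ℂ) * Complex.I))⁻¹ * Complex.exp (-(2 * Real.pi * v * L : ℝ) * Complex.I) := by
        rw [Complex.cpow_def_of_ne_zero hn0, ← Complex.exp_neg, ← Complex.exp_add, ← Complex.natCast_log]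
        congr 1; push_cast; ring
      rw [LSeries.term_of_ne_zero hn, LSeries.term_of_ne_zero hn, Complex.cpow_add _ _ hn0, e1]
      field_simp
  rw [h4, norm_mul, norm_mul]
  have h5 := hb (((1 + σ : ℝ) : ℂ) + (-(2 * Real.pi * v) : ℝ) * Complex.I) (by simp)
  have h6 : (((1 + σ : ℝ) : ℂ) + (-(2 * Real.pi * v) : ℝ) * Complex.I).im = -(2 * Real.pi * v) := by simp
  rw [h6, abs_neg, abs_mul, abs_of_pos (by positivity : (0:ℝ) < 2 * Real.pi)] at h5
  have h7 : ‖Complex.exp (-(2 * Real.pi * v * L : ℝ) * Complex.I)‖ = 1 := by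
    rw [← Complex.ofReal_neg, Complex.norm_exp_ofReal_mul_I]
  rw [h7, one_mul]
  calc _ ≤ (M * (1 + 2 * Real.pi * |v|) ^ m) * ‖F v‖ := by gcongr
    _ = _ := by ring

end TDR

namespace TDR
open Finset MeasureTheory SchwartzMap

noncomputable def theBump : ContDiffBump (3 : ℝ) := ⟨2, 3, by norm_num, by norm_num⟩

noncomputable def bump (u : ℝ) : ℝ := theBump u

lemma bump_nonneg (u : ℝ) : 0 ≤ bump u := theBump.nonneg
lemma bump_le_one (u : ℝ) : bump u ≤ 1 := theBump.le_one
lemma bump_one {u : ℝ} (h1 : 1 ≤ u) (h2 : u ≤ 5) : bump u = 1 := by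
  apply theBump.one_of_mem_closedBall
  rw [Metric.mem_closedBall, Real.dist_eq, abs_le]
  constructor <;> simp [theBump] <;> linarith
lemma bump_zero {u : ℝ} (h : u ≤ 0 ∨ 6 ≤ u) : bump u = 0 := by
  apply theBump.zero_of_le_dist
  rw [Real.dist_eq, le_abs]
  rcases h with h | h
  · right; simp [theBump]; linarith
  · left; simp [theBump]; linarith
lemma bump_contDiff : ContDiff ℝ (⊤ : ℕ∞) bump := theBump.contDiff
lemma bump_diff : Differentiable ℝ bump := bump_contDiff.differentiable (by simp)
lemma bump_cs : HasCompactSupport bump := theBump.hasCompactSupport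
lemma bump_deriv_zero {u : ℝ} (h : u ≤ 0 ∨ 6 ≤ u) : deriv bump u = 0 := by
  apply IsLocalMin.deriv_eq_zero
  apply Filter.Eventually.of_forall
  intro v; rw [bump_zero h]; exact bump_nonneg v
lemma bump_deriv_bdd : ∃ C : ℝ, 0 ≤ C ∧ ∀ u, |deriv bump u| ≤ C := by
  have hc : Continuous (deriv bump) := bump_contDiff.continuous_deriv (by simp)
  obtain ⟨C, hC⟩ := hc.bounded_above_of_compact_support bump_cs.deriv
  exact ⟨C, (norm_nonneg _).trans (hC 0), fun u => hC u⟩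

lemma bump_schwartz : ∃ g : 𝓢(ℝ, ℂ), ∀ u, g u = (bump u : ℂ) := by
  have h1 : HasCompactSupport (fun u => (bump u : ℂ)) := by
    exact bump_cs.comp_left (g := fun x : ℝ => (x : ℂ)) (by simp)
  have h2 : ContDiff ℝ (⊤ : ℕ∞) (fun u => (bump u : ℂ)) := Complex.ofRealCLM.contDiff.comp bump_contDiff
  exact ⟨h1.toSchwartzMap h2, fun u => rfl⟩

/-- the weight -/
noncomputable def wt (j : ℕ) (L u : ℝ) : ℝ := u ^ j * Real.exp (-(1 + 1 / L) * u) * bump (u - L)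

lemma wt_zero (j : ℕ) {L u : ℝ} (h : u ≤ L ∨ L + 6 ≤ u) : wt j L u = 0 := by
  rw [wt, bump_zero, mul_zero]
  rcases h with h | h
  · left; linarith
  · right; linarith

lemma wt_nonneg (j : ℕ) {L : ℝ} (hL : 1 ≤ L) (u : ℝ) : 0 ≤ wt j L u := by
  rcases le_total u L with h | h
  · rw [wt_zero j (Or.inl h)]
  · have := bump_nonneg (u - L)
    have : 0 ≤ u := by linarith
    rw [wt]; positivity

lemma wt_le (j : ℕ) {L : ℝ} (hL : 1 ≤ L) (u : ℝ) : wt j L u ≤ (7 * L) ^ j * Real.exp (-L) := by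
  have h0 : 0 ≤ (7 * L) ^ j * Real.exp (-L) := by positivity
  rcases le_total u L with h | h
  · rw [wt_zero j (Or.inl h)]; exact h0
  rcases le_total (L + 6) u with h' | h'
  · rw [wt_zero j (Or.inr h')]; exact h0
  have hu : 0 ≤ u := by linarith
  have h1 : u ^ j ≤ (7 * L) ^ j := by gcongr; linarith
  have h2 : Real.exp (-(1 + 1 / L) * u) ≤ Real.exp (-L) := by
    apply Real.exp_le_exp.mpr
    have : 0 ≤ 1 / L * u := by positivity
    nlinarith
  calc wt j L u ≤ (7 * L) ^ j * Real.exp (-L) * 1 := by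
        rw [wt]
        exact mul_le_mul (mul_le_mul h1 h2 (Real.exp_pos _).le (by positivity)) (bump_le_one _) (bump_nonneg _) h0
    _ = _ := mul_one _

lemma wt_ge (j : ℕ) {L u : ℝ} (hL : 1 ≤ L) (h1 : L + 1 ≤ u) (h2 : u ≤ L + 5) :
    L ^ j * Real.exp (-L) * Real.exp (-11) ≤ wt j L u := by
  rw [wt, bump_one (by linarith) (by linarith), mul_one, mul_assoc, ← Real.exp_add]
  have h3 : Real.exp (-L + -11) ≤ Real.exp (-(1 + 1 / L) * u) := by
    apply Real.exp_le_exp.mpr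
    have : 1 / L * u ≤ 6 := by
      rw [div_mul_eq_mul_div, one_mul, div_le_iff₀ (by linarith)]; linarith
    nlinarith
  have h4 : 0 ≤ u := by linarith
  have h5 : L ≤ u := by linarith
  gcongr

lemma wt_lip (j : ℕ) : ∃ C : ℝ, 0 ≤ C ∧ ∀ L : ℝ, 1 ≤ L → ∀ u v, |wt j L u - wt j L v| ≤ C * L ^ j * Real.exp (-L) * |u - v| := by
  obtain ⟨C, hC0, hC⟩ := bump_deriv_bdd
  refine ⟨7 ^ j * (j + 2 + C), by positivity, fun L hL u v => ?_⟩
  have hd : ∀ w : ℝ, HasDerivAt (wt j L) ((j * w ^ (j - 1) * Real.exp (-(1 + 1 / L) * w) + w ^ j * (Real.exp (-(1 + 1 / L) * w) * (-(1 + 1 / L)))) * bump (w - L)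
     + w ^ j * Real.exp (-(1 + 1 / L) * w) * deriv bump (w - L)) w := by
    intro w
    have e1 : HasDerivAt (fun w : ℝ => w ^ j) (j * w ^ (j - 1)) w := hasDerivAt_pow j w
    have e2 : HasDerivAt (fun w : ℝ => Real.exp (-(1 + 1 / L) * w)) (Real.exp (-(1 + 1 / L) * w) * (-(1 + 1 / L))) w := by
      have := ((hasDerivAt_id w).const_mul (-(1 + 1 / L))).exp
      simpa using this
    have e3 : HasDerivAt (fun w : ℝ => bump (w - L)) (deriv bump (w - L)) w := by
      have := (bump_diff (w - L)).hasDerivAt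
      exact this.comp_sub_const w L
    exact (e1.mul e2).mul e3
  have hb : ∀ w : ℝ, ‖deriv (wt j L) w‖ ≤ 7 ^ j * (j + 2 + C) * L ^ j * Real.exp (-L) := by
    intro w
    rw [(hd w).deriv]
    have h0 : 0 ≤ 7 ^ j * (j + 2 + C) * L ^ j * Real.exp (-L) := by positivity
    rcases le_total w L with h | h
    · have : w - L ≤ 0 ∨ 6 ≤ w - L := Or.inl (by linarith)
      rw [bump_zero this, bump_deriv_zero this]; simpa using h0
    rcases le_total (L + 6) w with h' | h'
    · have : w - L ≤ 0 ∨ 6 ≤ w - L := Or.inr (by linarith)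
      rw [bump_zero this, bump_deriv_zero this]; simpa using h0
    have hw : 1 ≤ w := by linarith
    have h1 : w ^ j ≤ (7 * L) ^ j := by gcongr; linarith
    have h1' : w ^ (j - 1) ≤ (7 * L) ^ j := (pow_le_pow_right₀ hw (Nat.sub_le _ _)).trans h1
    have h2 : Real.exp (-(1 + 1 / L) * w) ≤ Real.exp (-L) := by
      apply Real.exp_le_exp.mpr
      have : 0 ≤ 1 / L * w := by positivity
      nlinarith
    have h3 : 1 / L ≤ 1 := by rw [div_le_one (by linarith)]; exact hL
    have h3' : 0 ≤ 1 / L := by positivity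
    have hb0 := bump_nonneg (w - L)
    have hb1 := bump_le_one (w - L)
    have hC' := hC (w - L)
    set E := Real.exp (-(1 + 1 / L) * w) with hE
    have hE0 : 0 < E := Real.exp_pos _
    set X := (7 * L) ^ j * Real.exp (-L) with hX
    have hX0 : 0 ≤ X := by positivity
    have hwE : w ^ j * E ≤ X := by rw [hX]; gcongr
    have hwE' : w ^ (j - 1) * E ≤ X := by rw [hX]; gcongr
    have hwE0 : 0 ≤ w ^ j * E := by positivity
    have hwE0' : 0 ≤ w ^ (j - 1) * E := by positivity
    rw [Real.norm_eq_abs]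
    calc _ = |j * (w ^ (j - 1) * E) * bump (w - L) + (w ^ j * E) * (-(1 + 1 / L)) * bump (w - L) + (w ^ j * E) * deriv bump (w - L)| := by
          congr 1; ring
      _ ≤ |j * (w ^ (j - 1) * E) * bump (w - L)| + |(w ^ j * E) * (-(1 + 1 / L)) * bump (w - L)| + |(w ^ j * E) * deriv bump (w - L)| := abs_add_three _ _ _
      _ ≤ j * X * 1 + X * 2 * 1 + X * C := by
          rw [abs_mul, abs_mul, abs_mul (w ^ j * E * _), abs_mul (w ^ j * E), abs_mul (w ^ j * E), abs_of_nonneg hb0, abs_of_nonneg hwE0, abs_of_nonneg hwE0', abs_neg,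
            abs_of_nonneg (by positivity : 0 ≤ 1 + 1 / L), Nat.abs_cast]
          gcongr
          linarith
      _ = _ := by rw [hX, mul_pow]; ring
  have := Convex.norm_image_sub_le_of_norm_deriv_le (𝕜 := ℝ) (f := wt j L) (s := Set.univ) (x := v) (y := u)
    (fun w _ => (hd w).differentiableAt) (fun w _ => hb w) convex_univ (Set.mem_univ _) (Set.mem_univ _)
  simpa [Real.norm_eq_abs] using this

end TDR

namespace TDR
open Finset

open Classical in
/-- primitive characters modulo r -/
noncomputable def primSet (r : ℕ) : Finset (DirichletCharacter ℂ r) :=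
  if h : r = 0 then ∅ else
    have : NeZero r := ⟨h⟩
    univ.filter fun χ => χ.IsPrimitive

lemma mem_primSet {r : ℕ} [NeZero r] (χ : DirichletCharacter ℂ r) : χ ∈ primSet r ↔ χ.IsPrimitive := by
  have h : r ≠ 0 := NeZero.ne r
  simp [primSet, h]

lemma card_primSet (r : ℕ) : (primSet r).card ≤ r := by
  rcases eq_or_ne r 0 with rfl | h
  · simp [primSet]
  have : NeZero r := ⟨h⟩
  have h1 : (primSet r).card ≤ Fintype.card (DirichletCharacter ℂ r) := card_le_univ _
  have h2 : Fintype.card (DirichletCharacter ℂ r) = r.totient := by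
    rw [← Nat.card_eq_fintype_card]
    exact DirichletCharacter.card_eq_totient_of_hasEnoughRootsOfUnity ℂ r
  rw [h2] at h1
  exact h1.trans (Nat.totient_le r)

noncomputable def primAll (P : ℕ) : Finset (Σ r, DirichletCharacter ℂ r) := (Ioc 1 P).sigma primSet

noncomputable def primPsi (P : ℕ) (i : primAll P) (n : ℕ) : ℂ := i.1.2 (n : ZMod i.1.1)

lemma primFam (P : ℕ) (hP : 1 ≤ P) : Fam (primPsi P) ((P : ℝ) ^ 2) := by
  have hP' : (1 : ℝ) ≤ P := by exact_mod_cast hP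
  have hPP : (P : ℝ) ≤ (P : ℝ) ^ 2 := by nlinarith
  refine ⟨by nlinarith, ?_, ?_, ?_, ?_, ?_, ?_⟩
  · rintro ⟨⟨r, χ⟩, hi⟩
    simp only [primAll, mem_sigma, mem_Ioc] at hi
    simp only [primPsi, Nat.cast_zero]
    have : Fact (1 < r) := ⟨hi.1.1⟩
    have : Nontrivial (ZMod r) := ZMod.nontrivial r
    exact χ.map_zero
  · intro i n; exact char_norm_le _ _
  · intro i m n; simp [primPsi]
  · rintro ⟨⟨r, χ⟩, hi⟩ N
    simp only [primAll, mem_sigma, mem_Ioc] at hi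
    have : NeZero r := ⟨by omega⟩
    have hp := (mem_primSet χ).1 hi.2
    simp only [primPsi]
    refine (char_sum_le χ (prim_ne_one χ hp hi.1.1) N).trans (le_trans ?_ hPP)
    exact_mod_cast hi.1.2
  · rintro ⟨⟨r₁, χ₁⟩, h1⟩ ⟨⟨r₂, χ₂⟩, h2⟩ hne N
    simp only [primAll, mem_sigma, mem_Ioc] at h1 h2
    have : NeZero r₁ := ⟨by omega⟩
    have : NeZero r₂ := ⟨by omega⟩
    have hp1 := (mem_primSet χ₁).1 h1.2
    have hp2 := (mem_primSet χ₂).1 h2.2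
    simp only [primPsi]
    have hne' : (⟨r₁, χ₁⟩ : Σ r, DirichletCharacter ℂ r) ≠ ⟨r₂, χ₂⟩ := fun h => hne (Subtype.ext h)
    have hn1 := prod_ne_one χ₁ χ₂ hp1 hp2 hne'
    have : NeZero (r₁ * r₂) := ⟨mul_ne_zero (by omega) (by omega)⟩
    have := char_sum_le _ hn1 N
    simp only [prod_apply] at this
    refine this.trans ?_
    rw [sq]; push_cast
    have ha : (r₁ : ℝ) ≤ P := by exact_mod_cast h1.1.2
    have hb : (r₂ : ℝ) ≤ P := by exact_mod_cast h2.1.2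
    gcongr
  · rw [Fintype.card_coe, primAll, card_sigma]
    have : ∑ r ∈ Ioc 1 P, (primSet r).card ≤ ∑ r ∈ Ioc 1 P, P :=
      sum_le_sum fun r hr => (card_primSet r).trans (mem_Ioc.1 hr).2
    rw [sum_const, Nat.card_Ioc, smul_eq_mul] at this
    have h2 : (P - 1) * P ≤ P ^ 2 := by rw [sq]; exact Nat.mul_le_mul_right _ (Nat.sub_le _ _)
    exact_mod_cast this.trans h2

lemma sum_primAll (P : ℕ) (F : ∀ r, DirichletCharacter ℂ r → ℝ) :
    ∑ i : primAll P, F i.1.1 i.1.2 = ∑ r ∈ Ioc 1 P, ∑ χ ∈ primSet r, F r χ := by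
  rw [Finset.sum_coe_sort (primAll P) (fun i => F i.1 i.2), primAll, sum_sigma]

lemma abel_id (f : ℕ → ℝ) (g : ℕ → ℝ) (ψ : ℕ → ℂ) (N : ℕ) :
    tw ψ (fun n => f n * g n) N = ∑ M ∈ Ioc 0 N, ((f M - f (M + 1) : ℝ) : ℂ) * tw ψ g M + (f (N + 1) : ℂ) * tw ψ g N := by
  have hs : ∀ (h : ℕ → ℂ) (n : ℕ), ∑ M ∈ Ioc 0 (n+1), h M = ∑ M ∈ Ioc 0 n, h M + h (n + 1) := fun h n =>
    Finset.sum_Ioc_succ_top (Nat.zero_le n) h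
  induction N with
  | zero => simp [tw]
  | succ n ih =>
    have e1 : tw ψ g (n + 1) = tw ψ g n + (g (n + 1) : ℂ) * ψ (n + 1) := by rw [tw, hs]; rfl
    have e2 : tw ψ (fun n => f n * g n) (n + 1) = tw ψ (fun n => f n * g n) n + (f (n + 1) * g (n + 1) : ℝ) * ψ (n + 1) := by rw [tw, hs]; rfl
    rw [e2, ih, hs, e1]; push_cast; ring

lemma abel_fam {ι : Type} [Fintype ι] (ψ : ι → ℕ → ℂ) (f g : ℕ → ℝ) (N : ℕ) (B : ℝ)
    (hB : ∀ M ≤ N, ∑ i, ‖tw (ψ i) g M‖ ≤ B) (hf : f (N + 1) = 0) :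
    ∑ i, ‖tw (ψ i) (fun n => f n * g n) N‖ ≤ B * ∑ M ∈ Ioc 0 N, |f M - f (M + 1)| := by
  calc _ ≤ ∑ i, ∑ M ∈ Ioc 0 N, |f M - f (M + 1)| * ‖tw (ψ i) g M‖ := by
        refine sum_le_sum fun i _ => ?_
        rw [abel_id, hf, Complex.ofReal_zero, zero_mul, add_zero]
        refine (norm_sum_le _ _).trans (le_of_eq (sum_congr rfl fun M _ => ?_))
        rw [norm_mul, Complex.norm_real, Real.norm_eq_abs]
    _ = ∑ M ∈ Ioc 0 N, |f M - f (M + 1)| * ∑ i, ‖tw (ψ i) g M‖ := by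
        rw [sum_comm]; simp only [mul_sum]
    _ ≤ ∑ M ∈ Ioc 0 N, |f M - f (M + 1)| * B :=
        sum_le_sum fun M hM => mul_le_mul_of_nonneg_left (hB M (mem_Ioc.1 hM).2) (abs_nonneg _)
    _ = _ := by rw [← sum_mul, mul_comm]

lemma exp6 : Real.exp 6 ≤ 500 := by
  have h := Real.exp_one_lt_d9
  have : Real.exp 6 = Real.exp 1 ^ 6 := by rw [← Real.exp_nat_mul]; norm_num
  rw [this]
  calc Real.exp 1 ^ 6 ≤ 2.7182818286 ^ 6 := by gcongr
    _ ≤ 500 := by norm_num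

noncomputable def NN (L : ℝ) : ℕ := ⌊500 * Real.exp L⌋₊

lemma log_NN {L : ℝ} {n : ℕ} (h : NN L < n) : L + 6 ≤ Real.log n := by
  have h1 : 500 * Real.exp L < n := (Nat.floor_lt (by positivity)).1 h
  rw [← Real.log_exp (L + 6)]
  apply Real.log_le_log (Real.exp_pos _)
  rw [Real.exp_add]
  have := exp6
  have := Real.exp_pos L
  nlinarith

lemma wt_tv (j : ℕ) : ∃ C : ℝ, 0 ≤ C ∧ ∀ L : ℝ, 1 ≤ L →
    ∑ M ∈ Ioc 0 (NN L), |wt j L (Real.log M) - wt j L (Real.log ((M + 1 : ℕ) : ℝ))| ≤ C * L ^ j * Real.exp (-L) := by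
  obtain ⟨C, hC0, hC⟩ := wt_lip j
  refine ⟨1000 * C, by positivity, fun L hL => ?_⟩
  have hx : 2 ≤ Real.exp L := by
    have := Real.add_one_le_exp L; linarith
  calc _ ≤ ∑ M ∈ Ioc 0 (NN L), C * L ^ j * Real.exp (-L) * (2 * Real.exp (-L)) := by
        refine sum_le_sum fun M hM => ?_
        have hM0 : 0 < M := (mem_Ioc.1 hM).1
        have hM1 : (0 : ℝ) < M := by exact_mod_cast hM0
        rcases le_total ((M + 1 : ℕ) : ℝ) (Real.exp L) with h | h
        · have e1 : Real.log ((M + 1 : ℕ) : ℝ) ≤ L := by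
            rw [Real.log_le_iff_le_exp (by positivity)]; exact h
          have e2 : Real.log (M : ℝ) ≤ L := by
            rw [Real.log_le_iff_le_exp (by positivity)]; push_cast at h; linarith
          rw [wt_zero j (Or.inl e1), wt_zero j (Or.inl e2), sub_zero, abs_zero]
          positivity
        · refine (hC L hL _ _).trans ?_
          gcongr
          have h2 : Real.exp L / 2 ≤ M := by push_cast at h; linarith
          have h3 : Real.log ((M + 1 : ℕ) : ℝ) - Real.log M ≤ 1 / M := by
            rw [← Real.log_div (by positivity) (by positivity)]
            refine (Real.log_le_sub_one_of_pos (by positivity)).trans (le_of_eq ?_)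
            push_cast; field_simp; ring
          have h4 : Real.log M ≤ Real.log ((M + 1 : ℕ) : ℝ) := Real.log_le_log hM1 (by push_cast; linarith)
          rw [abs_sub_comm, abs_of_nonneg (by linarith)]
          refine h3.trans ?_
          rw [Real.exp_neg, div_le_iff₀ hM1]
          have := Real.exp_pos L
          rw [mul_assoc, mul_comm, mul_assoc, inv_mul_eq_div, le_div_iff₀ this]; linarith
    _ ≤ 500 * Real.exp L * (C * L ^ j * Real.exp (-L) * (2 * Real.exp (-L))) := by
        rw [sum_const, Nat.card_Ioc, nsmul_eq_mul, Nat.sub_zero]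
        gcongr
        exact Nat.floor_le (by positivity)
    _ = _ := by
        have : Real.exp L * Real.exp (-L) = 1 := by rw [← Real.exp_add]; simp
        linear_combination (1000 * C * L ^ j * Real.exp (-L)) * this

/-- D part for the weight -/
lemma D_part (j : ℕ) : ∃ C : ℝ, 0 ≤ C ∧ ∀ L : ℝ, 1 ≤ L → ∀ P : ℕ, 1 ≤ P → (P : ℝ) ≤ Real.exp (L / 80) →
    ∑ r ∈ Ioc 1 P, ∑ χ ∈ primSet r, ‖tw (fun n => χ (n : ZMod r)) (fun n => wt j L (Real.log n) * ArithmeticFunction.vonMangoldt n) (NN L)‖ ≤ C * L ^ (j + 4) := by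
  obtain ⟨C, hC0, hC⟩ := wt_tv j
  refine ⟨2 ^ 38 * 16 ^ 4 * C, by positivity, fun L hL P hP hPL => ?_⟩
  have hP0 : (0 : ℝ) ≤ P := by positivity
  set Y := ⌈Real.exp (L / 10)⌉₊ with hY
  have he1 : 1 ≤ Real.exp (L / 10) := Real.one_le_exp (by positivity)
  have hYl : Real.exp (L / 10) ≤ Y := Nat.le_ceil _
  have hY1' : (1 : ℝ) ≤ Y := he1.trans hYl
  have hY1 : 1 ≤ Y := by exact_mod_cast hY1'
  have hYu : (Y : ℝ) ≤ 2 * Real.exp (L / 10) := by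
    have := (Nat.ceil_lt_add_one (by positivity : 0 ≤ Real.exp (L / 10))).le
    linarith
  have e10 : Real.exp (L / 10) ^ 10 = Real.exp L := by rw [← Real.exp_nat_mul]; congr 1; push_cast; ring
  have hYl' : Real.exp L ≤ (Y : ℝ) ^ 10 := by rw [← e10]; gcongr
  have hYu' : (Y : ℝ) ^ 10 ≤ 1024 * Real.exp L := by
    calc (Y : ℝ) ^ 10 ≤ (2 * Real.exp (L / 10)) ^ 10 := by gcongr
      _ = _ := by rw [mul_pow, e10]; norm_num
  have hQ : ((P : ℝ) ^ 2) ^ 4 ≤ Y := by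
    rw [← pow_mul]
    calc (P : ℝ) ^ (2 * 4) ≤ Real.exp (L / 80) ^ (2 * 4) := by gcongr
      _ = Real.exp (L / 10) := by rw [← Real.exp_nat_mul]; congr 1; push_cast; ring
      _ ≤ Y := hYl
  have hNr : ((NN L : ℕ) : ℝ) ≤ 500 * Real.exp L := Nat.floor_le (by positivity)
  have hN : NN L ≤ 1024 * Y ^ 10 := by
    have : ((NN L : ℕ) : ℝ) ≤ 1024 * (Y : ℝ) ^ 10 := by
      have := Real.exp_pos L; linarith
    exact_mod_cast this
  have hlog : 1 + Real.log (1024 * (Y : ℝ) ^ 10) ≤ 16 * L := by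
    have h1 : Real.log (1024 * (Y : ℝ) ^ 10) ≤ Real.log (2 ^ 20 * Real.exp L) := by
      apply Real.log_le_log (by positivity); linarith
    rw [Real.log_mul (by positivity) (Real.exp_pos _).ne', Real.log_exp, Real.log_pow] at h1
    have := Real.log_two_lt_d9
    push_cast at h1; linarith
  have hlog0 : 0 ≤ 1 + Real.log (1024 * (Y : ℝ) ^ 10) := by
    have : 0 ≤ Real.log (1024 * (Y : ℝ) ^ 10) := Real.log_nonneg (by
      have := one_le_pow₀ hY1' (n := 10); linarith)
    linarith
  have hmain := abel_fam (primPsi P) (fun n => wt j L (Real.log n)) (⇑ArithmeticFunction.vonMangoldt) (NN L) _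
    (fun M hM => (primFam P hP).main Y M hY1 (hM.trans hN) hQ) (wt_zero j (Or.inr (log_NN (Nat.lt_succ_self _))))
  have hs := sum_primAll P (fun r χ => ‖tw (fun n => χ (n : ZMod r)) (fun n => wt j L (Real.log n) * ArithmeticFunction.vonMangoldt n) (NN L)‖)
  rw [← hs]
  refine hmain.trans ?_
  calc _ ≤ 2 ^ 28 * (1024 * Real.exp L) * (16 * L) ^ 4 * (C * L ^ j * Real.exp (-L)) := by
        gcongr
        exact hC L hL
    _ = _ := by
        have : Real.exp L * Real.exp (-L) = 1 := by rw [← Real.exp_add]; simp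
        rw [pow_add]
        linear_combination (2 ^ 38 * 16 ^ 4 * C * L ^ j * L ^ 4) * this

end TDR

namespace TDR
open Finset

lemma E_part (j : ℕ) (δ : ℝ) (hδ : 0 < δ) (hδ1 : δ ≤ 1) : ∃ C : ℝ, 0 ≤ C ∧ ∀ Z : ℝ, 1 ≤ Z → Good δ Z → ∀ (r : ℕ) (χ : DirichletCharacter ℂ r),
    χ ∈ primSet r → 1 < r → (r : ℝ) ≤ Z → ∀ L : ℝ, 1 ≤ L →
    ‖tw (fun n => χ (n : ZMod r)) (fun n => wt j L (Real.log n) * ArithmeticFunction.vonMangoldt n) (NN L)‖ ≤ C * (Z ^ (8 * δ)) ^ (j + 1) := by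
  obtain ⟨g, hg⟩ := bump_schwartz
  obtain ⟨C1, hC1, hF⟩ := fourier_LS g (6 * (j + 1))
  obtain ⟨C2, hC2, hQ⟩ := Q_ub j δ hδ hδ1
  refine ⟨C1 * C2, by positivity, fun Z hZ hgood r χ hχ hr hrZ L hL => ?_⟩
  have : NeZero r := ⟨by omega⟩
  have hp := (mem_primSet χ).1 hχ
  have hL0 : 0 < L := by linarith
  have hL1 : 1 / L ≤ 1 := by rw [div_le_one hL0]; exact hL
  have hL2 : 0 < 1 / L := by positivity
  have h1 := hF (fun n => ((Real.log n : ℝ) : ℂ) ^ j * vch χ n) (1 / L) (C2 * (Z ^ (8 * δ)) ^ (j + 1)) L (by positivity)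
    (vch_summ χ j _ (by simp only [Complex.ofReal_re]; linarith))
    (fun s hs => by
      refine (hQ Z hZ hgood r χ hp hr hrZ s (by linarith) (by linarith)).trans (le_of_eq ?_)
      rw [mul_pow, ← pow_mul]; ring)
  rw [← mul_assoc] at h1
  refine le_trans (le_of_eq ?_) h1
  congr 1
  rw [tsum_eq_sum (s := Ioc 0 (NN L))]
  · rw [tw]
    refine sum_congr rfl fun n hn => ?_
    have hn0 : n ≠ 0 := by have := (mem_Ioc.1 hn).1; omega
    have hn1 : (n : ℂ) ≠ 0 := by exact_mod_cast hn0
    rw [LSeries.term_of_ne_zero hn0, hg, wt, vch, Complex.cpow_def_of_ne_zero hn1, ← Complex.natCast_log, div_eq_mul_inv (_ * _) (Complex.exp _), ← Complex.exp_neg]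
    push_cast
    have : -((1 : ℂ) + 1 / L) * Complex.log n = -(Complex.log n * (1 + 1 / L)) := by ring
    rw [this]; ring
  · intro n hn
    rcases Nat.eq_zero_or_pos n with rfl | h0
    · simp
    · have : NN L < n := by
        by_contra h; exact hn (mem_Ioc.2 ⟨h0, by omega⟩)
      rw [hg, bump_zero (Or.inr (by have := log_NN this; linarith))]; simp

lemma wt_le' (j : ℕ) {L : ℝ} (hL : 1 ≤ L) (hj : 6 * j ≤ L) (u : ℝ) : wt j L u ≤ 3 * L ^ j * Real.exp (-L) := by
  have h0 : 0 ≤ 3 * L ^ j * Real.exp (-L) := by positivity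
  rcases le_total u L with h | h
  · rw [wt_zero j (Or.inl h)]; exact h0
  rcases le_total (L + 6) u with h' | h'
  · rw [wt_zero j (Or.inr h')]; exact h0
  have hu : 0 ≤ u := by linarith
  have hL0 : 0 < L := by linarith
  have h1 : u ^ j ≤ 3 * L ^ j := by
    calc u ^ j ≤ (L * Real.exp (6 / L)) ^ j := by
          gcongr
          have := Real.add_one_le_exp (6 / L)
          have e : L + 6 = L * (6 / L + 1) := by field_simp; ring
          rw [e] at h'
          exact h'.trans (by gcongr)
      _ = L ^ j * Real.exp (j * (6 / L)) := by rw [mul_pow, ← Real.exp_nat_mul]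
      _ ≤ L ^ j * 3 := by
          gcongr
          have : (j : ℝ) * (6 / L) ≤ 1 := by
            rw [mul_div_assoc', div_le_one hL0]; linarith
          refine (Real.exp_le_exp.mpr this).trans ?_
          have := Real.exp_one_lt_d9; linarith
      _ = _ := mul_comm _ _
  have h2 : Real.exp (-(1 + 1 / L) * u) ≤ Real.exp (-L) := by
    apply Real.exp_le_exp.mpr
    have : 0 ≤ 1 / L * u := by positivity
    nlinarith
  calc wt j L u ≤ 3 * L ^ j * Real.exp (-L) * 1 := by
        rw [wt]
        exact mul_le_mul (mul_le_mul h1 h2 (Real.exp_pos _).le (by positivity)) (bump_le_one _) (bump_nonneg _) h0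
    _ = _ := mul_one _

lemma theta_lb {u : ℝ} (hu : 80 ≤ u) : Real.exp u / 10 ≤ Chebyshev.theta (Real.exp u) := by
  have h1 := Chebyshev.theta_ge' (x := Real.exp u) (Real.one_le_exp (by linarith))
  have h2 : 10 * u ≤ Real.exp (u / 2) := by
    have := Real.quadratic_le_exp_of_nonneg (x := u / 2) (by linarith)
    nlinarith
  have h3 : Real.sqrt (Real.exp u) = Real.exp (u / 2) := by
    rw [Real.sqrt_eq_iff_mul_self_eq (Real.exp_pos _).le (Real.exp_pos _).le, ← Real.exp_add]; congr 1; ring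
  have h4 : Real.exp u = Real.exp (u / 2) * Real.exp (u / 2) := by rw [← Real.exp_add]; congr 1; ring
  rw [h3, Real.log_exp] at h1
  have h5 : Real.log (Real.exp u + 2) ≤ u + 2 := by
    rw [Real.log_le_iff_le_exp (by positivity), Real.exp_add]
    have := Real.one_le_exp (x := u) (by linarith)
    have h6 : 3 ≤ Real.exp 2 := by have := Real.add_one_le_exp 2; linarith
    nlinarith
  have := Real.log_two_gt_d9
  have := Real.log_two_lt_d9
  set E := Real.exp (u / 2)
  have h7 : 2 * E * u ≤ E * E / 5 := by nlinarith
  have h8 : u + 3 ≤ E * E / 100 := by nlinarith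
  rw [h4] at h1 ⊢
  rw [h4] at h5
  have h9 : (E * E - 1) * 0.69 ≤ (E * E - 1) * Real.log 2 := by
    apply mul_le_mul_of_nonneg_left (by linarith); nlinarith
  linarith

lemma theta_window {L : ℝ} (hL : 80 ≤ L) : Real.exp L ≤ Chebyshev.theta (Real.exp (L + 5)) - Chebyshev.theta (Real.exp (L + 1)) := by
  have h1 := theta_lb (u := L + 5) (by linarith)
  have h2 := Chebyshev.theta_le_log4_mul_x (x := Real.exp (L + 1)) (Real.exp_pos _).le
  have h3 : Real.log 4 ≤ 1.4 := by
    have : (4 : ℝ) = 2 ^ 2 := by norm_num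
    rw [this, Real.log_pow]; have := Real.log_two_lt_d9; push_cast; linarith
  rw [Real.exp_add] at h1 h2
  rw [Real.exp_add, Real.exp_add]
  have h4 := Real.exp_one_lt_d9
  have h4' := Real.exp_one_gt_d9
  have h5 : 140 ≤ Real.exp 5 := by
    have : Real.exp 5 = Real.exp 1 ^ 5 := by rw [← Real.exp_nat_mul]; norm_num
    rw [this]
    calc (140:ℝ) ≤ 2.7182818283 ^ 5 := by norm_num
      _ ≤ _ := by gcongr
  have h0 := Real.exp_pos L
  have h6 : Real.log 4 * (Real.exp L * Real.exp 1) ≤ 1.4 * (Real.exp L * 2.8) := by gcongr; linarith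
  have h7 : Real.exp L * 140 ≤ Real.exp L * Real.exp 5 := by gcongr
  linarith

end TDR

namespace TDR
open Finset

noncomputable def om (j : ℕ) (L : ℝ) (n : ℕ) : ℝ := if n.Prime then Real.log n * wt j L (Real.log n) / L ^ j else 0

lemma sqrt500 : Real.sqrt 500 ≤ 23 := by
  rw [Real.sqrt_le_left (by norm_num)]; norm_num

lemma om_pp (j : ℕ) {L : ℝ} (hL : 1 ≤ L) (hj : 6 * j ≤ L) (χ : ℕ → ℂ) (hχ : ∀ n, ‖χ n‖ ≤ 1) :
    ‖tw χ (om j L) (NN L) - ((L ^ j)⁻¹ : ℝ) * tw χ (fun n => wt j L (Real.log n) * ArithmeticFunction.vonMangoldt n) (NN L)‖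
      ≤ 1104 * L * Real.exp (-(L / 2)) := by
  have hL0 : 0 < L := by linarith
  have hx1 : 1 ≤ 500 * Real.exp L := by
    have := Real.one_le_exp (x := L) (by linarith); linarith
  have h1 : ‖tw χ (om j L) (NN L) - ((L ^ j)⁻¹ : ℝ) * tw χ (fun n => wt j L (Real.log n) * ArithmeticFunction.vonMangoldt n) (NN L)‖
      ≤ ∑ n ∈ Ioc 0 (NN L), if ¬ n.Prime then 3 * Real.exp (-L) * ArithmeticFunction.vonMangoldt n else 0 := by
    rw [tw, tw, mul_sum, ← sum_sub_distrib]
    refine (norm_sum_le _ _).trans (sum_le_sum fun n _ => ?_)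
    rw [om]
    by_cases hp : n.Prime
    · simp only [hp, if_true, not_true, if_false, ArithmeticFunction.vonMangoldt_apply_prime hp]
      refine le_of_eq ?_
      rw [norm_eq_zero]
      push_cast; field_simp; ring
    · simp only [hp, if_false, not_false_eq_true, if_true, Complex.ofReal_zero, zero_mul, zero_sub, norm_neg]
      rw [norm_mul, norm_mul, Complex.norm_real, Complex.norm_real, Real.norm_eq_abs, Real.norm_eq_abs]
      have hw0 := wt_nonneg j hL (Real.log n)
      have hw := wt_le' j hL hj (Real.log n)
      have hv : 0 ≤ ArithmeticFunction.vonMangoldt n := ArithmeticFunction.vonMangoldt_nonneg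
      rw [abs_of_nonneg (by positivity), abs_of_nonneg (by positivity)]
      calc (L ^ j)⁻¹ * (wt j L (Real.log n) * ArithmeticFunction.vonMangoldt n * ‖χ n‖)
          ≤ (L ^ j)⁻¹ * ((3 * L ^ j * Real.exp (-L)) * ArithmeticFunction.vonMangoldt n * 1) := by
            gcongr; exact hχ n
        _ = _ := by field_simp
  refine h1.trans ?_
  rw [← sum_filter, ← mul_sum, NN, ← Chebyshev.psi_sub_theta_eq_sum_not_prime]
  have h2 := (le_abs_self _).trans (Chebyshev.abs_psi_sub_theta_le_sqrt_mul_log hx1)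
  have h3 : Real.sqrt (500 * Real.exp L) ≤ 23 * Real.exp (L / 2) := by
    rw [Real.sqrt_mul (by norm_num)]
    have : Real.sqrt (Real.exp L) = Real.exp (L / 2) := by
      rw [Real.sqrt_eq_iff_mul_self_eq (Real.exp_pos _).le (Real.exp_pos _).le, ← Real.exp_add]; congr 1; ring
    rw [this]
    gcongr; exact sqrt500
  have h4 : Real.log (500 * Real.exp L) ≤ 8 * L := by
    rw [Real.log_mul (by norm_num) (Real.exp_pos _).ne', Real.log_exp]
    have : Real.log 500 ≤ 7 := by
      rw [Real.log_le_iff_le_exp (by norm_num)]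
      have e : Real.exp 7 = Real.exp 1 ^ 7 := by rw [← Real.exp_nat_mul]; norm_num
      rw [e]
      have := Real.exp_one_gt_d9
      calc (500:ℝ) ≤ 2.7 ^ 7 := by norm_num
        _ ≤ _ := by gcongr; linarith
    linarith
  have h5 : 0 ≤ Real.log (500 * Real.exp L) := Real.log_nonneg hx1
  calc _ ≤ 3 * Real.exp (-L) * (2 * (23 * Real.exp (L / 2)) * (8 * L)) := by
        gcongr
        exact h2.trans (by gcongr)
    _ = 1104 * L * (Real.exp (-L) * Real.exp (L / 2)) := by ring
    _ = _ := by rw [← Real.exp_add]; congr 2; ring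

lemma om_mass (j : ℕ) {L : ℝ} (hL : 80 ≤ L) : Real.exp (-11) ≤ ∑ n ∈ Ioc 0 (NN L), om j L n := by
  have hL0 : 0 < L := by linarith
  set a := ⌊Real.exp (L + 1)⌋₊ with ha
  set b := ⌊Real.exp (L + 5)⌋₊ with hb
  have hab : a ≤ b := Nat.floor_mono (Real.exp_le_exp.mpr (by linarith))
  have hbN : b ≤ NN L := by
    apply Nat.floor_mono
    rw [Real.exp_add]
    have := exp6
    have h5 : Real.exp 5 ≤ Real.exp 6 := Real.exp_le_exp.mpr (by norm_num)
    have := Real.exp_pos L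
    nlinarith
  have h0 : ∀ n, 0 ≤ om j L n := fun n => by
    rw [om]; split_ifs
    · have := wt_nonneg j (by linarith : 1 ≤ L) (Real.log n)
      have := Real.log_natCast_nonneg n
      positivity
    · exact le_rfl
  have h1 := theta_window hL
  have h2 : ∑ n ∈ Ioc a b with n.Prime, Real.log n = Chebyshev.theta (Real.exp (L + 5)) - Chebyshev.theta (Real.exp (L + 1)) := by
    rw [Chebyshev.theta, Chebyshev.theta, ← ha, ← hb, sum_filter, sum_filter, sum_filter, eq_sub_iff_add_eq, add_comm]
    exact Finset.sum_Ioc_consecutive _ (Nat.zero_le a) hab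
  calc Real.exp (-11) = Real.exp (-L) * Real.exp (-11) * Real.exp L := by
        rw [← Real.exp_add, ← Real.exp_add]; congr 1; ring
    _ ≤ Real.exp (-L) * Real.exp (-11) * ∑ n ∈ Ioc a b with n.Prime, Real.log n := by
        rw [h2]; gcongr
    _ = ∑ n ∈ Ioc a b with n.Prime, Real.exp (-L) * Real.exp (-11) * Real.log n := mul_sum _ _ _
    _ ≤ ∑ n ∈ Ioc a b with n.Prime, om j L n := by
        refine sum_le_sum fun n hn => ?_
        obtain ⟨hn, hp⟩ := mem_filter.1 hn
        obtain ⟨hn1, hn2⟩ := mem_Ioc.1 hn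
        have hn0 : (0 : ℝ) < n := by exact_mod_cast hp.pos
        have l1 : L + 1 ≤ Real.log n := by
          rw [Real.le_log_iff_exp_le hn0]; exact ((Nat.floor_lt (Real.exp_pos _).le).1 hn1).le
        have l2 : Real.log n ≤ L + 5 := by
          rw [Real.log_le_iff_le_exp hn0]; exact (Nat.le_floor_iff (Real.exp_pos _).le).1 hn2
        have := wt_ge j (by linarith : 1 ≤ L) l1 l2
        rw [om, if_pos hp, le_div_iff₀ (by positivity)]
        have hl : 0 ≤ Real.log n := by linarith
        calc _ = Real.log n * (L ^ j * Real.exp (-L) * Real.exp (-11)) := by ring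
          _ ≤ _ := by gcongr
    _ ≤ ∑ n ∈ Ioc 0 (NN L), om j L n := by
        refine sum_le_sum_of_subset_of_nonneg ?_ fun n _ _ => h0 n
        intro n hn
        obtain ⟨hn1, hn2⟩ := mem_Ioc.1 (mem_filter.1 hn).1
        exact mem_Ioc.2 ⟨by omega, by omega⟩

theorem thmP : ∃ c1 C1 : ℝ, 0 < c1 ∧ 0 < C1 ∧ ∀ (A : ℕ) (L0 : ℝ), ∃ L, L0 ≤ L ∧ 1 ≤ L ∧ ∃ ω : ℕ → ℝ,
    (∀ n, 0 ≤ ω n) ∧ (∀ n, ω n ≠ 0 → n.Prime ∧ Real.exp L ≤ n ∧ n ≤ NN L) ∧ (∀ n, ω n ≤ C1 * L * Real.exp (-L)) ∧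
    c1 ≤ ∑ n ∈ Ioc 0 (NN L), ω n ∧
    ∀ P : ℕ, (P : ℝ) ≤ Real.exp (L / 80) →
      ∑ r ∈ Ioc 1 P, (r : ℝ) ^ (-(3 / 4) : ℝ) * ∑ χ ∈ primSet r, ‖tw (fun n => χ (n : ZMod r)) ω (NN L)‖ ≤ (L ^ A)⁻¹ := by
  refine ⟨Real.exp (-11), 21, Real.exp_pos _, by norm_num, fun A L0 => ?_⟩
  set B := 2 * (A + 6) with hB
  set j := 3 * B + A + 1 with hj
  set δ : ℝ := 1 / (8 * (j + 1)) with hδ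
  have hδ0 : 0 < δ := by positivity
  have hδ1 : δ ≤ 1 := by
    rw [hδ, div_le_one (by positivity)]
    have : (0 : ℝ) ≤ j := by positivity
    linarith
  obtain ⟨CD, hCD0, hCD⟩ := D_part j
  obtain ⟨CE, hCE0, hCE⟩ := E_part j δ hδ0 hδ1
  obtain ⟨T, hT⟩ : ∃ T : ℝ, ∀ L ≥ T, 3312 * L ^ (A + 1) ≤ Real.exp (L / 4) := by
    have := (isLittleO_pow_exp_pos_mul_atTop (A + 1) (b := 1 / 4) (by norm_num)).def (c := 1 / 3312) (by norm_num)
    rw [Filter.eventually_atTop] at this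
    obtain ⟨T, hT⟩ := this
    refine ⟨T, fun L hL => ?_⟩
    have h := hT L hL
    rw [Real.norm_eq_abs, Real.norm_eq_abs, Real.abs_exp] at h
    have h' := (le_abs_self _).trans h
    have e : 1 / 4 * L = L / 4 := by ring
    rw [e] at h'; linarith
  set Lm := max (max (max L0 80) (max (6 * j) T)) (max (3 * CE) (3 * CD)) with hLm
  obtain ⟨Z, hZ0, hZ1, hgood⟩ := good_exists δ hδ0 hδ1 (Lm ^ B)
  have hLm80 : 80 ≤ Lm := (le_max_right L0 80).trans ((le_max_left _ _).trans (le_max_left _ _))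
  set L := Z ^ (1 / (B : ℝ)) with hLdef
  have hBpos : 0 < B := by omega
  have hZL : L ^ B = Z := by
    rw [hLdef, ← Real.rpow_natCast, ← Real.rpow_mul (by linarith), one_div_mul_cancel (by positivity), Real.rpow_one]
  have hL0' : 0 ≤ L := by positivity
  have hLLm : Lm ≤ L := by
    rw [← hZL] at hZ0
    exact le_of_pow_le_pow_left₀ hBpos.ne' hL0' hZ0
  have c1 : L0 ≤ L := ((le_max_left L0 80).trans ((le_max_left _ _).trans (le_max_left _ _))).trans hLLm
  have c2 : 80 ≤ L := hLm80.trans hLLm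
  have c3 : 6 * (j : ℝ) ≤ L := ((le_max_left _ T).trans ((le_max_right _ _).trans (le_max_left _ _))).trans hLLm
  have c4 : T ≤ L := ((le_max_right _ T).trans ((le_max_right _ _).trans (le_max_left _ _))).trans hLLm
  have c5 : 3 * CE ≤ L := ((le_max_left _ _).trans (le_max_right _ _)).trans hLLm
  have c6 : 3 * CD ≤ L := ((le_max_right _ _).trans (le_max_right _ _)).trans hLLm
  have hL1 : 1 ≤ L := by linarith
  have hL : 0 < L := by linarith
  refine ⟨L, c1, hL1, om j L, ?_, ?_, ?_, om_mass j c2, ?_⟩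
  · intro n
    rw [om]; split_ifs
    · have := wt_nonneg j hL1 (Real.log n)
      have := Real.log_natCast_nonneg n
      positivity
    · exact le_rfl
  · intro n hn
    rw [om] at hn
    have hp : n.Prime := by by_contra h; simp [h] at hn
    rw [if_pos hp] at hn
    have hw : wt j L (Real.log n) ≠ 0 := by intro h; simp [h] at hn
    have hn0 : (0 : ℝ) < n := by exact_mod_cast hp.pos
    refine ⟨hp, ?_, ?_⟩
    · by_contra h
      push Not at h
      exact hw (wt_zero j (Or.inl ((Real.log_le_iff_le_exp hn0).2 h.le)))
    · by_contra h
      push Not at h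
      exact hw (wt_zero j (Or.inr (log_NN h)))
  · intro n
    have h0 : 0 ≤ 21 * L * Real.exp (-L) := by positivity
    rw [om]; split_ifs with hp
    · rcases le_total (L + 6) (Real.log n) with h | h
      · rw [wt_zero j (Or.inr h)]; simpa using h0
      · have := wt_le' j hL1 c3 (Real.log n)
        have h1 := wt_nonneg j hL1 (Real.log n)
        rw [div_le_iff₀ (by positivity)]
        calc _ ≤ (7 * L) * (3 * L ^ j * Real.exp (-L)) := by gcongr; linarith
          _ = _ := by ring
    · exact h0
  · intro P hP
    rcases Nat.eq_zero_or_pos P with rfl | hP1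
    · simp; positivity
    set G : ∀ r : ℕ, DirichletCharacter ℂ r → ℝ := fun r χ =>
      ‖tw (fun n => χ (n : ZMod r)) (fun n => wt j L (Real.log n) * ArithmeticFunction.vonMangoldt n) (NN L)‖ with hG
    set ε := 1104 * L * Real.exp (-(L / 2)) with hε
    have hε0 : 0 ≤ ε := by positivity
    have hG0 : ∀ r χ, 0 ≤ G r χ := fun r χ => norm_nonneg _
    have hom : ∀ r (χ : DirichletCharacter ℂ r), ‖tw (fun n => χ (n : ZMod r)) (om j L) (NN L)‖ ≤ (L ^ j)⁻¹ * G r χ + ε := by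
      intro r χ
      have h := om_pp j hL1 c3 (fun n => χ (n : ZMod r)) (fun n => char_norm_le χ n)
      have h' := norm_le_norm_add_norm_sub' (tw (fun n => χ (n : ZMod r)) (om j L) (NN L)) (((L ^ j)⁻¹ : ℝ) * tw (fun n => χ (n : ZMod r)) (fun n => wt j L (Real.log n) * ArithmeticFunction.vonMangoldt n) (NN L))
      rw [norm_mul, Complex.norm_real, Real.norm_eq_abs, abs_of_nonneg (by positivity : 0 ≤ (L ^ j)⁻¹)] at h'
      exact h'.trans (by gcongr)
    have hsmall : ∀ r ∈ Ioc 1 P, (r : ℝ) ^ (-(3 / 4) : ℝ) * ∑ χ ∈ primSet r, ‖tw (fun n => χ (n : ZMod r)) (om j L) (NN L)‖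
        ≤ (L ^ j)⁻¹ * ((if (r : ℝ) ≤ Z then CE * Z ^ 2 else 0) + (L ^ (A + 6))⁻¹ * ∑ χ ∈ primSet r, G r χ) + ε * P := by
      intro r hr
      obtain ⟨hr1, hrP⟩ := mem_Ioc.1 hr
      have hr1' : (1 : ℝ) ≤ r := by exact_mod_cast hr1.le
      have hr0 : (0 : ℝ) < r := by linarith
      have hle1 : (r : ℝ) ^ (-(3 / 4) : ℝ) ≤ 1 := Real.rpow_le_one_of_one_le_of_nonpos hr1' (by norm_num)
      have hcard : ((primSet r).card : ℝ) ≤ r := by exact_mod_cast card_primSet r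
      have hrP' : (r : ℝ) ≤ P := by exact_mod_cast hrP
      have hS0 : 0 ≤ ∑ χ ∈ primSet r, G r χ := sum_nonneg fun χ _ => hG0 r χ
      have h1 : ∑ χ ∈ primSet r, ‖tw (fun n => χ (n : ZMod r)) (om j L) (NN L)‖ ≤ (L ^ j)⁻¹ * ∑ χ ∈ primSet r, G r χ + ε * P := by
        refine (sum_le_sum fun χ _ => hom r χ).trans ?_
        rw [sum_add_distrib, ← mul_sum, sum_const, nsmul_eq_mul]
        have : (primSet r).card * ε ≤ ε * P := by rw [mul_comm]; exact mul_le_mul_of_nonneg_left (hcard.trans hrP') hε0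
        linarith
      have h2 : (r : ℝ) ^ (-(3 / 4) : ℝ) * ∑ χ ∈ primSet r, G r χ ≤ (if (r : ℝ) ≤ Z then CE * Z ^ 2 else 0) + (L ^ (A + 6))⁻¹ * ∑ χ ∈ primSet r, G r χ := by
        split_ifs with hrZ
        · have : ∑ χ ∈ primSet r, G r χ ≤ CE * Z ^ 2 := by
            calc ∑ χ ∈ primSet r, G r χ ≤ ∑ χ ∈ primSet r, CE * Z := by
                  refine sum_le_sum fun χ hχ => ?_
                  refine (hCE Z hZ1 hgood r χ hχ hr1 hrZ L hL1).trans (le_of_eq ?_)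
                  rw [← Real.rpow_natCast, ← Real.rpow_mul (by linarith)]
                  have : 8 * δ * ((j + 1 : ℕ) : ℝ) = 1 := by
                    rw [hδ]; push_cast; field_simp
                  rw [this, Real.rpow_one]
              _ = (primSet r).card * (CE * Z) := by rw [sum_const, nsmul_eq_mul]
              _ ≤ Z * (CE * Z) := by gcongr; linarith
              _ = _ := by ring
          have h3 : (r : ℝ) ^ (-(3 / 4) : ℝ) * ∑ χ ∈ primSet r, G r χ ≤ 1 * ∑ χ ∈ primSet r, G r χ := by gcongr
          have h4 : 0 ≤ (L ^ (A + 6))⁻¹ * ∑ χ ∈ primSet r, G r χ := by positivity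
          linarith
        · push Not at hrZ
          rw [zero_add]
          gcongr
          have e1 : (L ^ (A + 6))⁻¹ = Z ^ (-(1 / 2) : ℝ) := by
            have e2 : Z = (L ^ (A + 6)) ^ 2 := by rw [← hZL, ← pow_mul, hB, mul_comm]
            rw [Real.rpow_neg (by linarith), ← Real.sqrt_eq_rpow, e2, Real.sqrt_sq (by positivity)]
          rw [e1]
          calc (r : ℝ) ^ (-(3 / 4) : ℝ) ≤ (r : ℝ) ^ (-(1 / 2) : ℝ) := Real.rpow_le_rpow_of_exponent_le hr1' (by norm_num)
            _ ≤ Z ^ (-(1 / 2) : ℝ) := Real.rpow_le_rpow_of_nonpos (by linarith) hrZ.le (by norm_num)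
      have hε' : 0 ≤ ε * P := by positivity
      calc _ ≤ (r : ℝ) ^ (-(3 / 4) : ℝ) * ((L ^ j)⁻¹ * ∑ χ ∈ primSet r, G r χ + ε * P) := by gcongr
        _ = (L ^ j)⁻¹ * ((r : ℝ) ^ (-(3 / 4) : ℝ) * ∑ χ ∈ primSet r, G r χ) + (r : ℝ) ^ (-(3 / 4) : ℝ) * (ε * P) := by ring
        _ ≤ (L ^ j)⁻¹ * ((if (r : ℝ) ≤ Z then CE * Z ^ 2 else 0) + (L ^ (A + 6))⁻¹ * ∑ χ ∈ primSet r, G r χ) + 1 * (ε * P) :=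
          add_le_add (mul_le_mul_of_nonneg_left h2 (by positivity)) (mul_le_mul_of_nonneg_right hle1 hε')
        _ = _ := by rw [one_mul]
    refine (sum_le_sum hsmall).trans ?_
    rw [sum_add_distrib, ← mul_sum, sum_add_distrib, ← mul_sum, sum_const, Nat.card_Ioc, nsmul_eq_mul]
    have b1 : ∑ r ∈ Ioc 1 P, (if (r : ℝ) ≤ Z then CE * Z ^ 2 else 0) ≤ CE * Z ^ 3 := by
      rw [← sum_filter, sum_const, nsmul_eq_mul]
      have : #{r ∈ Ioc 1 P | ((r : ℕ) : ℝ) ≤ Z} ≤ #(Ioc 0 ⌊Z⌋₊) := by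
        apply card_le_card
        intro r hr
        obtain ⟨h1, h2⟩ := mem_filter.1 hr
        exact mem_Ioc.2 ⟨by have := (mem_Ioc.1 h1).1; omega, Nat.le_floor h2⟩
      rw [Nat.card_Ioc, Nat.sub_zero] at this
      have h2 : ((#{r ∈ Ioc 1 P | ((r : ℕ) : ℝ) ≤ Z} : ℕ) : ℝ) ≤ Z := le_trans (by exact_mod_cast this) (Nat.floor_le (by linarith))
      calc _ ≤ Z * (CE * Z ^ 2) := by gcongr
        _ = _ := by ring
    have b2 := hCD L hL1 P hP1 hP
    have b3 : ((P - 1 : ℕ) : ℝ) * (ε * P) ≤ 1104 * L * Real.exp (-(L / 4)) := by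
      have h1 : ((P - 1 : ℕ) : ℝ) ≤ P := by exact_mod_cast Nat.sub_le _ _
      calc _ ≤ Real.exp (L / 80) * (ε * Real.exp (L / 80)) := by gcongr; exact h1.trans hP
        _ = 1104 * L * (Real.exp (L / 80) * Real.exp (-(L / 2)) * Real.exp (L / 80)) := by rw [hε]; ring
        _ ≤ _ := by
          rw [← Real.exp_add, ← Real.exp_add]
          gcongr; linarith
    have b4 : 1104 * L * Real.exp (-(L / 4)) ≤ (L ^ A)⁻¹ / 3 := by
      have := hT L c4
      rw [Real.exp_neg, inv_eq_one_div (L ^ A), div_div, le_div_iff₀ (by positivity)]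
      have hE := Real.exp_pos (L / 4)
      rw [mul_assoc, inv_mul_eq_div, mul_div_assoc', div_le_one hE]
      rw [pow_succ] at this; linarith
    have b5 : (L ^ j)⁻¹ * (CE * Z ^ 3) ≤ (L ^ A)⁻¹ / 3 := by
      rw [← hZL, ← pow_mul, inv_mul_eq_div, inv_eq_one_div (L ^ A), div_div, div_le_div_iff₀ (by positivity) (by positivity)]
      have e : L ^ j = L ^ (B * 3) * L ^ A * L := by rw [hj]; ring
      rw [e]
      have : 0 < L ^ (B * 3) * L ^ A := by positivity
      nlinarith
    have b6 : (L ^ j)⁻¹ * ((L ^ (A + 6))⁻¹ * (CD * L ^ (j + 4))) ≤ (L ^ A)⁻¹ / 3 := by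
      rw [← mul_assoc, ← mul_inv, inv_mul_eq_div, inv_eq_one_div (L ^ A), div_div, div_le_div_iff₀ (by positivity) (by positivity)]
      have e : L ^ j * L ^ (A + 6) = L ^ (j + 4) * L ^ A * L * L := by ring
      rw [e]
      have h1 : 0 < L ^ (j + 4) * L ^ A := by positivity
      have h2 : CD * 3 ≤ L * L := by nlinarith
      nlinarith
    have b7 : (L ^ j)⁻¹ * (∑ r ∈ Ioc 1 P, (if (r : ℝ) ≤ Z then CE * Z ^ 2 else 0) + (L ^ (A + 6))⁻¹ * ∑ r ∈ Ioc 1 P, ∑ χ ∈ primSet r, G r χ)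
        ≤ (L ^ j)⁻¹ * (CE * Z ^ 3) + (L ^ j)⁻¹ * ((L ^ (A + 6))⁻¹ * (CD * L ^ (j + 4))) := by
      rw [← mul_add]; gcongr
    linarith

end TDR

namespace TDR
open Finset

section quad
variable {k : ℕ}

noncomputable def kap (q : ℝ) : Option (Fin k) → Option (Fin k) → ℝ
  | none, none => 1
  | some _, none => 1 / q
  | none, some _ => 1 / q
  | some i, some j => if i = j then 1 / q else 0

noncomputable def tau (q : ℝ) : Option (Fin k) → Option (Fin k) → ℝ
  | none, none => 1
  | some _, none => 0
  | none, some _ => 1 / q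
  | some i, some j => if i = j then 1 else 0

noncomputable def mU (q : ℝ) : Option (Fin k) → ℝ
  | none => 1
  | some _ => 1 / q

noncomputable def mL (q : ℝ) : Option (Fin k) → ℝ
  | none => 1
  | some _ => 1 / q - k / q ^ 2

noncomputable def BB {s : ℕ} (q : Fin s → ℝ) (l m : (Fin s → Option (Fin k)) → ℝ) : ℝ :=
  ∑ c, ∑ c', l c * m c' * ∏ t, kap (q t) (c t) (c' t)

noncomputable def TT {s : ℕ} (q : Fin s → ℝ) (l : (Fin s → Option (Fin k)) → ℝ) (r : Fin s → Option (Fin k)) : ℝ :=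
  ∑ d, l d * ∏ t, tau (q t) (r t) (d t)

lemma sum_cons {α : Type} [Fintype α] {s : ℕ} (F : (Fin (s + 1) → α) → ℝ) :
    ∑ c, F c = ∑ a, ∑ c', F (Fin.cons a c') := by
  rw [← Fintype.sum_prod_type']
  exact (Fintype.sum_equiv (Fin.consEquiv (fun _ : Fin (s + 1) => α)) _ _ (fun x => rfl)).symm

lemma BB_add_left {s : ℕ} (q : Fin s → ℝ) (l l' m : (Fin s → Option (Fin k)) → ℝ) :
    BB q (fun c => l c + l' c) m = BB q l m + BB q l' m := by
  simp only [BB, add_mul, sum_add_distrib]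

lemma BB_smul_left {s : ℕ} (q : Fin s → ℝ) (a : ℝ) (l m : (Fin s → Option (Fin k)) → ℝ) :
    BB q (fun c => a * l c) m = a * BB q l m := by
  simp only [BB, mul_sum, mul_assoc]

lemma kap_symm (q : ℝ) (o o' : Option (Fin k)) : kap q o o' = kap q o' o := by
  rcases o with _ | i <;> rcases o' with _ | j <;> simp [kap, eq_comm]

lemma BB_symm {s : ℕ} (q : Fin s → ℝ) (l m : (Fin s → Option (Fin k)) → ℝ) : BB q l m = BB q m l := by
  rw [BB, BB, sum_comm]
  refine sum_congr rfl fun c _ => sum_congr rfl fun c' _ => ?_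
  rw [mul_comm (l c')]
  congr 1
  exact prod_congr rfl fun t _ => kap_symm _ _ _

lemma BB_sum_left {s : ℕ} {ι : Type} (S : Finset ι) (q : Fin s → ℝ) (l : ι → (Fin s → Option (Fin k)) → ℝ) (m : (Fin s → Option (Fin k)) → ℝ) :
    BB q (fun c => ∑ i ∈ S, l i c) m = ∑ i ∈ S, BB q (l i) m := by
  classical
  induction S using Finset.induction_on with
  | empty => simp [BB]
  | insert a S ha ih =>
    simp only [sum_insert ha]
    rw [BB_add_left, ih]

lemma BB_sum_right {s : ℕ} {ι : Type} (S : Finset ι) (q : Fin s → ℝ) (l : ι → (Fin s → Option (Fin k)) → ℝ) (m : (Fin s → Option (Fin k)) → ℝ) :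
    BB q m (fun c => ∑ i ∈ S, l i c) = ∑ i ∈ S, BB q m (l i) := by
  rw [BB_symm, BB_sum_left]
  exact sum_congr rfl fun i _ => BB_symm _ _ _

lemma BB_quad {s : ℕ} (q : Fin s → ℝ) (a : ℝ) (l m : (Fin s → Option (Fin k)) → ℝ) :
    BB q (fun c => l c + a * m c) (fun c => l c + a * m c) = BB q l l + 2 * a * BB q m l + a ^ 2 * BB q m m := by
  have key : ∀ u, BB q (fun c => l c + a * m c) u = BB q l u + a * BB q m u := fun u => by
    rw [BB_add_left, BB_smul_left]
  rw [key, BB_symm q l, BB_symm q m, key, key, BB_symm q l m]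
  ring

lemma BB_succ {s : ℕ} (q : Fin (s + 1) → ℝ) (l m : (Fin (s + 1) → Option (Fin k)) → ℝ) :
    BB q l m = ∑ o, ∑ o', kap (q 0) o o' *
      BB (fun t => q t.succ) (fun c => l (Fin.cons o c)) (fun c => m (Fin.cons o' c)) := by
  rw [BB, sum_cons]
  refine sum_congr rfl fun o _ => ?_
  simp only [sum_cons (s := s)]
  rw [sum_comm]
  refine sum_congr rfl fun o' _ => ?_
  rw [BB, mul_sum]
  refine sum_congr rfl fun c _ => ?_
  rw [mul_sum]
  refine sum_congr rfl fun c' _ => ?_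
  rw [Fin.prod_univ_succ]
  simp only [Fin.cons_zero, Fin.cons_succ]
  ring

lemma TT_none {s : ℕ} (q : Fin (s + 1) → ℝ) (l : (Fin (s + 1) → Option (Fin k)) → ℝ) (r : Fin s → Option (Fin k)) :
    TT q l (Fin.cons none r) = TT (fun t => q t.succ)
      (fun c => l (Fin.cons none c) + 1 / q 0 * ∑ i, l (Fin.cons (some i) c)) r := by
  rw [TT, sum_cons, Fintype.sum_option, TT]
  simp only [Fin.prod_univ_succ, Fin.cons_zero, Fin.cons_succ, tau, add_mul, sum_add_distrib, one_mul]
  congr 1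
  rw [sum_comm]
  refine sum_congr rfl fun c _ => ?_
  rw [mul_sum, sum_mul]
  refine sum_congr rfl fun i _ => ?_
  ring

lemma TT_some {s : ℕ} (q : Fin (s + 1) → ℝ) (l : (Fin (s + 1) → Option (Fin k)) → ℝ) (r : Fin s → Option (Fin k)) (i : Fin k) :
    TT q l (Fin.cons (some i) r) = TT (fun t => q t.succ) (fun c => l (Fin.cons (some i) c)) r := by
  rw [TT, sum_cons, Fintype.sum_option, TT]
  simp only [Fin.prod_univ_succ, Fin.cons_zero, Fin.cons_succ, tau, zero_mul, mul_zero, sum_const_zero, zero_add]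
  rw [sum_eq_single i]
  · simp
  · intro j _ hj
    simp [hj.symm]
  · simp

lemma mL_nonneg {q : ℝ} (h0 : 0 < q) (h : (k : ℝ) ≤ q) (o : Option (Fin k)) : 0 ≤ mL q o := by
  rcases o with _ | i
  · simp [mL]
  · simp only [mL]
    rw [sub_nonneg, div_le_div_iff₀ (by positivity) h0]
    nlinarith

theorem quad {s : ℕ} (q : Fin s → ℝ) (h0 : ∀ t, 0 < q t) (h : ∀ t, (k : ℝ) ≤ q t) (l : (Fin s → Option (Fin k)) → ℝ) :
    ∑ r, (∏ t, mL (q t) (r t)) * (TT q l r) ^ 2 ≤ BB q l l ∧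
    BB q l l ≤ ∑ r, (∏ t, mU (q t) (r t)) * (TT q l r) ^ 2 := by
  induction s with
  | zero =>
    simp [BB, TT, sq]
  | succ s ih =>
    set q' : Fin s → ℝ := fun t => q t.succ with hq'
    have IH := fun l => ih q' (fun t => h0 _) (fun t => h _) l
    have psd : ∀ l, 0 ≤ BB q' l l := fun l => le_trans (sum_nonneg fun r _ =>
      mul_nonneg (prod_nonneg fun t _ => mL_nonneg (h0 _) (h _) _) (sq_nonneg _)) (IH l).1
    set l0 : (Fin s → Option (Fin k)) → ℝ := fun c => l (Fin.cons none c) with hl0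
    set li : Fin k → (Fin s → Option (Fin k)) → ℝ := fun i c => l (Fin.cons (some i) c) with hli
    set S : (Fin s → Option (Fin k)) → ℝ := fun c => ∑ i, li i c with hS
    set z : (Fin s → Option (Fin k)) → ℝ := fun c => l0 c + 1 / q 0 * S c with hz
    have hq0 := h0 0
    have hSS : BB q' S S = ∑ i, ∑ j, BB q' (li i) (li j) := by
      rw [hS, BB_sum_left]
      exact sum_congr rfl fun i _ => BB_sum_right _ _ _ _
    have e1 : BB q l l = BB q' l0 l0 + 2 * (1 / q 0) * BB q' S l0 + 1 / q 0 * ∑ i, BB q' (li i) (li i) := by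
      rw [BB_succ]
      simp only [Fintype.sum_option, kap, sum_add_distrib]
      have a1 : ∑ i, 1 / q 0 * BB q' (li i) l0 = 1 / q 0 * BB q' S l0 := by
        rw [hS, BB_sum_left, mul_sum]
      have a2 : ∑ i, 1 / q 0 * BB q' l0 (li i) = 1 / q 0 * BB q' S l0 := by
        rw [← a1]; exact sum_congr rfl fun i _ => by rw [BB_symm]
      have a3 : ∑ i, ∑ j, (if i = j then 1 / q 0 else 0) * BB q' (li i) (li j) = 1 / q 0 * ∑ i, BB q' (li i) (li i) := by
        rw [mul_sum]
        refine sum_congr rfl fun i _ => ?_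
        simp
      linarith [a1, a2, a3]
    have e2 : BB q' z z = BB q' l0 l0 + 2 * (1 / q 0) * BB q' S l0 + (1 / q 0) ^ 2 * BB q' S S := by
      exact BB_quad _ _ _ _
    have e3 : BB q' S S ≤ k * ∑ i, BB q' (li i) (li i) := by
      have a1 : 0 ≤ ∑ i, ∑ j, BB q' (fun c => li i c + (-1) * li j c) (fun c => li i c + (-1) * li j c) :=
        sum_nonneg fun i _ => sum_nonneg fun j _ => psd _
      have a2 : ∀ i j, BB q' (fun c => li i c + (-1) * li j c) (fun c => li i c + (-1) * li j c)
          = BB q' (li i) (li i) + BB q' (li j) (li j) - 2 * BB q' (li i) (li j) := by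
        intro i j
        rw [BB_quad, BB_symm _ (li j) (li i)]
        ring
      simp only [a2, sum_add_distrib, sum_sub_distrib, ← mul_sum, ← hSS, sum_const, card_univ, Fintype.card_fin, nsmul_eq_mul] at a1
      linarith
    have p0 := psd S
    have g0 : ∀ m : Fin (s + 1) → Option (Fin k) → ℝ, ∑ r, (∏ t, m t (r t)) * (TT q l r) ^ 2 =
        m 0 none * ∑ r, (∏ t, m (Fin.succ t) (r t)) * (TT q' z r) ^ 2 + ∑ i, m 0 (some i) * ∑ r, (∏ t, m (Fin.succ t) (r t)) * (TT q' (li i) r) ^ 2 := by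
      intro m
      have tn : ∀ r, TT q l (Fin.cons none r) = TT q' z r := fun r => TT_none q l r
      have ts : ∀ i r, TT q l (Fin.cons (some i) r) = TT q' (li i) r := fun i r => TT_some q l r i
      rw [sum_cons, Fintype.sum_option]
      simp only [Fin.prod_univ_succ, Fin.cons_zero, Fin.cons_succ, tn, ts, mul_sum, mul_assoc]
    rw [g0 (fun t => mL (q t)), g0 (fun t => mU (q t))]
    have s0 : 0 ≤ ∑ i, BB q' (li i) (li i) := sum_nonneg fun i _ => psd _
    have lz := IH z
    constructor
    · have : ∑ i, mL (q 0) (some i) * ∑ r, (∏ t, mL (q (Fin.succ t)) (r t)) * (TT q' (li i) r) ^ 2 ≤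
        ∑ i, (1 / q 0 - k / q 0 ^ 2) * BB q' (li i) (li i) :=
        sum_le_sum fun i _ => mul_le_mul_of_nonneg_left (IH (li i)).1 (mL_nonneg (h0 _) (h _) _)
      rw [← mul_sum] at this
      have h3 : (1 / q 0) ^ 2 * BB q' S S ≤ (1 / q 0) ^ 2 * (k * ∑ i, BB q' (li i) (li i)) := by gcongr
      have h4 : (1 / q 0 - k / q 0 ^ 2) * ∑ i, BB q' (li i) (li i) = 1 / q 0 * ∑ i, BB q' (li i) (li i) - (1 / q 0) ^ 2 * (k * ∑ i, BB q' (li i) (li i)) := by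
        field_simp
      have : mL (q 0) (none : Option (Fin k)) = 1 := rfl
      rw [this, one_mul]
      linarith [lz.1]
    · have : ∑ i, 1 / q 0 * BB q' (li i) (li i) ≤ ∑ i, mU (q 0) (some i) * ∑ r, (∏ t, mU (q (Fin.succ t)) (r t)) * (TT q' (li i) r) ^ 2 :=
        sum_le_sum fun i _ => mul_le_mul_of_nonneg_left (IH (li i)).2 (by positivity)
      rw [← mul_sum] at this
      have h3 : 0 ≤ (1 / q 0) ^ 2 * BB q' S S := by positivity
      have : mU (q 0) (none : Option (Fin k)) = 1 := rfl
      rw [this, one_mul]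
      linarith [lz.2]

end quad
end TDR

namespace TDR
open Finset

section pert
variable {k : ℕ}

def MonoL {s : ℕ} (y : (Fin s → Option (Fin k)) → ℝ) : Prop :=
  (∀ c, 0 ≤ y c) ∧ ∀ c t, y c ≤ y (Function.update c t none)

lemma MonoL.cons {s : ℕ} {y : (Fin (s + 1) → Option (Fin k)) → ℝ} (h : MonoL y) (o : Option (Fin k)) :
    MonoL (fun c => y (Fin.cons o c)) := by
  refine ⟨fun c => h.1 _, fun c t => ?_⟩
  have := h.2 (Fin.cons o c) t.succ
  rwa [← Fin.cons_update] at this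

lemma MonoL.le {s : ℕ} {y : (Fin (s + 1) → Option (Fin k)) → ℝ} (h : MonoL y) (o : Option (Fin k)) (c) :
    y (Fin.cons o c) ≤ y (Fin.cons none c) := by
  have := h.2 (Fin.cons o c) 0
  rwa [Fin.update_cons_zero] at this

lemma sum_prod_cons {s : ℕ} (a : Fin (s + 1) → Option (Fin k) → ℝ) (y : (Fin (s + 1) → Option (Fin k)) → ℝ) :
    ∑ c, y c * ∏ t, a t (c t) = ∑ o, a 0 o * ∑ c, y (Fin.cons o c) * ∏ t, a (Fin.succ t) (c t) := by
  rw [sum_cons]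
  refine sum_congr rfl fun o _ => ?_
  rw [mul_sum]
  refine sum_congr rfl fun c _ => ?_
  rw [Fin.prod_univ_succ]
  simp only [Fin.cons_zero, Fin.cons_succ]
  ring

lemma one_le_prod_real {ι : Type} [Fintype ι] {f : ι → ℝ} (h : ∀ t, 1 ≤ f t) : 1 ≤ ∏ t, f t := by
  calc (1 : ℝ) = ∏ t : ι, (1 : ℝ) := by simp
    _ ≤ ∏ t, f t := prod_le_prod (fun _ _ => zero_le_one) fun t _ => h t

theorem perturb {s : ℕ} (a e : Fin s → Option (Fin k) → ℝ) (η : Fin s → ℝ) (ha : ∀ t o, 0 ≤ a t o)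
    (hη : ∀ t, 0 ≤ η t) (he : ∀ t, ∑ o, |e t o| ≤ η t * a t none)
    (y : (Fin s → Option (Fin k)) → ℝ) (hy : MonoL y) :
    |∑ c, y c * ∏ t, (a t (c t) + e t (c t)) - ∑ c, y c * ∏ t, a t (c t)| ≤
      (∏ t, (1 + η t) - 1) * ∑ c, y c * ∏ t, a t (c t) := by
  induction s with
  | zero => simp
  | succ s ih =>
    have IH := fun o => ih (fun t => a t.succ) (fun t => e t.succ) (fun t => η t.succ) (fun t => ha _)
      (fun t => hη _) (fun t => he _) _ (hy.cons o)
    rw [sum_prod_cons (fun t o => a t o + e t o), sum_prod_cons a, Fin.prod_univ_succ]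
    set X : Option (Fin k) → ℝ := fun o => ∑ c, y (Fin.cons o c) * ∏ t, (a (Fin.succ t) (c t) + e (Fin.succ t) (c t)) with hX
    set M : Option (Fin k) → ℝ := fun o => ∑ c, y (Fin.cons o c) * ∏ t, a (Fin.succ t) (c t) with hM
    set E := ∏ t : Fin s, (1 + η t.succ) with hE
    have IH' : ∀ o, |X o - M o| ≤ (E - 1) * M o := IH
    have hE1 : 1 ≤ E := by
      rw [hE]
      exact one_le_prod_real fun t => by linarith [hη t.succ]
    have hM0 : ∀ o, 0 ≤ M o := fun o => sum_nonneg fun c _ => mul_nonneg (hy.1 _) (prod_nonneg fun t _ => ha _ _)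
    have hMn : ∀ o, M o ≤ M none := fun o => sum_le_sum fun c _ =>
      mul_le_mul_of_nonneg_right (hy.le o c) (prod_nonneg fun t _ => ha _ _)
    have hXn : ∀ o, |X o| ≤ E * M none := by
      intro o
      have h1 : |X o| ≤ |X o - M o| + |M o| := by
        have := abs_add_le (X o - M o) (M o); simpa using this
      rw [abs_of_nonneg (hM0 o)] at h1
      have := IH' o
      have h2 : E * M o ≤ E * M none := mul_le_mul_of_nonneg_left (hMn o) (by linarith)
      nlinarith
    have e1 : ∑ o, (a 0 o + e 0 o) * X o - ∑ o, a 0 o * M o = ∑ o, a 0 o * (X o - M o) + ∑ o, e 0 o * X o := by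
      rw [← sum_sub_distrib, ← sum_add_distrib]
      exact sum_congr rfl fun o _ => by ring
    show |∑ o, (a 0 o + e 0 o) * X o - ∑ o, a 0 o * M o| ≤ ((1 + η 0) * E - 1) * ∑ o, a 0 o * M o
    rw [e1]
    have b1 : |∑ o, a 0 o * (X o - M o)| ≤ (E - 1) * ∑ o, a 0 o * M o := by
      refine (abs_sum_le_sum_abs _ _).trans ?_
      rw [mul_sum]
      refine sum_le_sum fun o _ => ?_
      rw [abs_mul, abs_of_nonneg (ha 0 o)]
      have := mul_le_mul_of_nonneg_left (IH' o) (ha 0 o)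
      linarith
    have b2 : |∑ o, e 0 o * X o| ≤ η 0 * a 0 none * (E * M none) := by
      refine (abs_sum_le_sum_abs _ _).trans ?_
      have : ∑ o, |e 0 o * X o| ≤ ∑ o, |e 0 o| * (E * M none) := sum_le_sum fun o _ => by
        rw [abs_mul]
        exact mul_le_mul_of_nonneg_left (hXn o) (abs_nonneg _)
      refine this.trans ?_
      rw [← sum_mul]
      exact mul_le_mul_of_nonneg_right (he 0) (mul_nonneg (by linarith) (hM0 _))
    have b3 : a 0 none * M none ≤ ∑ o, a 0 o * M o :=
      single_le_sum (f := fun o => a 0 o * M o) (fun o _ => mul_nonneg (ha 0 o) (hM0 o)) (mem_univ _)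
    have b4 : η 0 * E * (a 0 none * M none) ≤ η 0 * E * ∑ o, a 0 o * M o :=
      mul_le_mul_of_nonneg_left b3 (mul_nonneg (hη 0) (by linarith))
    refine (abs_add_le _ _).trans ?_
    nlinarith

noncomputable def sg : Option (Fin k) → ℝ
  | none => 1
  | some _ => -1

noncomputable def lam {s : ℕ} (p : Fin s → ℝ) (y : (Fin s → Option (Fin k)) → ℝ) : (Fin s → Option (Fin k)) → ℝ :=
  TT (fun t => - p t) (fun c => y c * ∏ t, sg (c t))

noncomputable def rl {s : ℕ} (al : Fin s → Option (Fin k) → ℝ) (l : (Fin s → Option (Fin k)) → ℝ) :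
    (Fin s → Option (Fin k)) → ℝ := fun c => (∏ t, al t (c t)) * l c

noncomputable def rho (al : Option (Fin k) → ℝ) (q p : ℝ) (r d : Option (Fin k)) : ℝ :=
  ∑ o, al o * tau q r o * tau (-p) o d

lemma TT_rl {s : ℕ} (al : Fin s → Option (Fin k) → ℝ) (q p : Fin s → ℝ) (y : (Fin s → Option (Fin k)) → ℝ) (r) :
    TT q (rl al (lam p y)) r = ∑ c, y c * ∏ t, (rho (al t) (q t) (p t) (r t) (c t) * sg (c t)) := by
  simp only [TT, rl, lam]
  simp only [mul_sum, sum_mul]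
  rw [sum_comm]
  refine sum_congr rfl fun d _ => ?_
  rw [prod_mul_distrib]
  simp only [rho]
  rw [Finset.prod_univ_sum, Fintype.piFinset_univ, sum_mul, mul_sum]
  refine sum_congr rfl fun c _ => ?_
  simp only [prod_mul_distrib]
  ring

end pert
end TDR

namespace TDR
open Finset

section bounds
variable {k : ℕ}

lemma sum_delta {s : ℕ} (y : (Fin s → Option (Fin k)) → ℝ) (r : Fin s → Option (Fin k)) :
    ∑ c, y c * ∏ t, (if c t = r t then (1 : ℝ) else 0) = y r := by
  rw [sum_eq_single r]
  · simp
  · intro c _ hc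
    obtain ⟨t, ht⟩ := Function.ne_iff.mp hc
    rw [prod_eq_zero (mem_univ t) (by simp [ht]), mul_zero]
  · simp

noncomputable def alB {s : ℕ} (B : Finset (Fin s)) (t : Fin s) (o : Option (Fin k)) : ℝ :=
  if t ∈ B ∧ o ≠ none then 0 else 1

lemma abs_sg (o : Option (Fin k)) : |sg o| = 1 := by
  rcases o with _ | i <;> simp [sg]

lemma sg_sq (o : Option (Fin k)) : sg o * sg o = 1 := by
  rcases o with _ | i <;> simp [sg]

theorem BB_upper {s : ℕ} (B : Finset (Fin s)) (p : Fin s → ℝ) (hp0 : ∀ t, 0 < p t) (hp : ∀ t, (k : ℝ) ≤ p t)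
    (y : (Fin s → Option (Fin k)) → ℝ) (hy : MonoL y) :
    BB p (rl (alB B) (lam p y)) (rl (alB B) (lam p y)) ≤
      (∏ t, (1 + if t ∈ B then k / p t else 0)) ^ 2 * ∑ r, y r ^ 2 * ∏ t, mU (p t) (r t) := by
  refine (quad p hp0 hp _).2.trans ?_
  rw [mul_sum]
  refine sum_le_sum fun r _ => ?_
  rw [TT_rl]
  have hm : 0 ≤ ∏ t, mU (p t) (r t) := prod_nonneg fun t _ => by
    rcases r t with _ | i <;> simp [mU, (hp0 t).le]
  have hη : ∀ t, 0 ≤ (if t ∈ B then k / p t else 0) := fun t => by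
    have := hp0 t
    split_ifs <;> positivity
  set X := ∑ c, y c * ∏ t, (rho (alB B t) (p t) (p t) (r t) (c t) * sg (c t)) with hX
  have key : |X| ≤ (∏ t, (1 + if t ∈ B then k / p t else 0)) * y r := by
    set a : Fin s → Option (Fin k) → ℝ := fun t o => if o = r t then 1 else 0 with ha
    set e : Fin s → Option (Fin k) → ℝ := fun t o => if t ∈ B ∧ r t = none ∧ o ≠ none then 1 / p t else 0 with he
    have h1 : |X| ≤ ∑ c, y c * ∏ t, (a t (c t) + e t (c t)) := by
      refine (abs_sum_le_sum_abs _ _).trans (sum_le_sum fun c _ => ?_)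
      rw [abs_mul, abs_of_nonneg (hy.1 c), abs_prod]
      refine mul_le_mul_of_nonneg_left (prod_le_prod (fun _ _ => abs_nonneg _) fun t _ => ?_) (hy.1 c)
      rw [abs_mul, abs_sg, mul_one]
      have hpt := hp0 t
      simp only [ha, he]
      by_cases hB : t ∈ B
      · have : rho (alB B t) (p t) (p t) (r t) (c t) = tau (p t) (r t) none * tau (-p t) none (c t) := by
          rw [rho, Fintype.sum_option]
          simp [alB, hB]
        rw [this]
        rcases r t with _ | i <;> rcases c t with _ | j <;> simp [tau, hB, abs_of_pos hpt]
        split_ifs <;> norm_num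
      · have : rho (alB B t) (p t) (p t) (r t) (c t) = if c t = r t then 1 else 0 := by
          rw [rho, Fintype.sum_option]
          rcases r t with _ | i <;> rcases c t with _ | j <;> simp [tau, hB, alB]
          exact if_congr eq_comm rfl rfl
        rw [this]
        simp [hB]
        split_ifs <;> norm_num
    have h2 := perturb a e (fun t => if t ∈ B then k / p t else 0) (fun t o => by simp only [ha]; split_ifs <;> norm_num)
      hη (fun t => by
        simp only [ha, he]
        have hpt := hp0 t
        rw [Fintype.sum_option]
        by_cases hB : t ∈ B
        · rcases r t with _ | i <;> simp [hB, abs_of_pos hpt, div_eq_mul_inv]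
        · simp [hB]) y hy
    rw [sum_delta] at h2
    have := (abs_le.mp h2).2
    linarith
  have : X ^ 2 ≤ ((∏ t, (1 + if t ∈ B then k / p t else 0)) * y r) ^ 2 := by
    rw [← sq_abs]; exact pow_le_pow_left₀ (abs_nonneg _) key 2
  calc _ ≤ (∏ t, mU (p t) (r t)) * ((∏ t, (1 + if t ∈ B then k / p t else 0)) * y r) ^ 2 := by gcongr
    _ = _ := by ring

noncomputable def alm {s : ℕ} (m : Fin k) (_t : Fin s) (o : Option (Fin k)) : ℝ :=
  if o = some m then 0 else 1

def er (m : Fin k) (o : Option (Fin k)) : Option (Fin k) := if o = some m then none else o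

theorem BB_lower {s : ℕ} (m : Fin k) (p : Fin s → ℝ) (hp1 : ∀ t, 1 < p t) (hp : ∀ t, (k : ℝ) + 1 ≤ p t)
    (hprod : ∏ t, (1 + (k : ℝ) ^ 2 / (p t - 1) ^ 2) ≤ 3 / 2)
    (y Y : (Fin s → Option (Fin k)) → ℝ) (hy : MonoL y) (hY : MonoL Y) :
    (1 / 4 * ∑ c, y c * Y (fun t => er m (c t)) * ∏ t, mU (p t) (c t)) ^ 2 ≤
      BB (fun t => p t - 1) (rl (alm m) (lam p y)) (rl (alm m) (lam p y)) *
       ∑ r, Y r ^ 2 * ∏ t, (if r t = some m then 0 else mU (p t) (r t)) := by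
  have hk1 : (1 : ℝ) ≤ k := by
    have := m.2
    exact_mod_cast (by omega : 1 ≤ k)
  have hq0 : ∀ t, 0 < p t - 1 := fun t => by linarith [hp1 t]
  have hp0 : ∀ t, 0 < p t := fun t => by linarith [hp1 t]
  have hmU : ∀ t (o : Option (Fin k)), 0 ≤ mU (p t) o := fun t o => by
    rcases o with _ | i <;> simp [mU, (hp0 t).le]
  have hmL : ∀ t (o : Option (Fin k)), 0 ≤ mL (p t - 1) o := fun t o => mL_nonneg (hq0 t) (by linarith [hp t]) o
  have hη0 : ∀ t, 0 ≤ (k : ℝ) ^ 2 / (p t - 1) ^ 2 := fun t => by positivity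
  have hLU : ∀ t (o : Option (Fin k)), mL (p t - 1) o ≤ mU (p t) o := fun t o => by
    rcases o with _ | i
    · simp [mL, mU]
    · simp only [mL, mU]
      have h1 := hq0 t
      have h2 := hp0 t
      have h3 : 1 / (p t - 1) - 1 / p t = 1 / (p t * (p t - 1)) := by field_simp; ring
      have h4 : 1 / (p t * (p t - 1)) ≤ k / (p t - 1) ^ 2 := by
        rw [div_le_div_iff₀ (by positivity) (by positivity)]
        have : (p t - 1) * 1 ≤ p t * k := mul_le_mul (by linarith) hk1 zero_le_one h2.le
        nlinarith
      linarith
  refine le_trans ?_ (mul_le_mul_of_nonneg_right (quad (fun t => p t - 1) hq0 (fun t => by linarith [hp t]) _).1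
    (sum_nonneg fun r _ => mul_nonneg (sq_nonneg _) (prod_nonneg fun t _ => by split_ifs; exacts [le_rfl, hmU _ _])))
  set Ψ : (Fin s → Option (Fin k)) → ℝ := fun r => TT (fun t => p t - 1) (rl (alm m) (lam p y)) r with hΨ
  set w : (Fin s → Option (Fin k)) → ℝ := fun r => ∏ t, mL (p t - 1) (r t) with hw
  have hw0 : ∀ r, 0 ≤ w r := fun r => prod_nonneg fun t _ => hmL _ _
  set I : (Fin s → Option (Fin k)) → ℝ := fun r => ∏ t, alm m t (r t) with hI
  have hI0 : ∀ r, 0 ≤ I r := fun r => prod_nonneg fun t _ => by unfold alm; split_ifs <;> norm_num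
  have hII : ∀ r, I r * I r = I r := fun r => by
    rw [hI]; simp only; rw [← prod_mul_distrib]
    exact prod_congr rfl fun t _ => by unfold alm; split_ifs <;> norm_num
  set Sg : (Fin s → Option (Fin k)) → ℝ := fun r => ∏ t, sg (r t) with hSg
  have hSgSq : ∀ r, Sg r * Sg r = 1 := fun r => by
    rw [hSg]; simp only; rw [← prod_mul_distrib]
    exact prod_eq_one fun t _ => sg_sq _
  -- Cauchy-Schwarz
  have hden : ∑ r, w r * (Y r * I r) ^ 2 ≤ ∑ r, Y r ^ 2 * ∏ t, (if r t = some m then 0 else mU (p t) (r t)) := by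
    refine sum_le_sum fun r _ => ?_
    have : w r * (Y r * I r) ^ 2 = Y r ^ 2 * (w r * I r) := by rw [mul_pow, sq (I r), hII]; ring
    rw [this]
    refine mul_le_mul_of_nonneg_left ?_ (sq_nonneg _)
    rw [hw, hI]; simp only; rw [← prod_mul_distrib]
    refine prod_le_prod (fun t _ => mul_nonneg (hmL _ _) (by unfold alm; split_ifs <;> norm_num)) fun t _ => ?_
    unfold alm
    split_ifs
    · simp
    · simpa using hLU t _
  have hCS : (∑ r, w r * (Y r * I r) * (Sg r * Ψ r)) ^ 2 ≤ (∑ r, w r * Ψ r ^ 2) * ∑ r, w r * (Y r * I r) ^ 2 := by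
    refine sum_sq_le_sum_mul_sum_of_sq_le_mul _ (fun r _ => mul_nonneg (hw0 r) (sq_nonneg _))
      (fun r _ => mul_nonneg (hw0 r) (sq_nonneg _)) fun r _ => ?_
    have : (Sg r * Ψ r) ^ 2 = Ψ r ^ 2 := by rw [mul_pow, sq (Sg r), hSgSq, one_mul]
    rw [mul_pow, this]; exact le_of_eq (by ring)
  refine le_trans ?_ (hCS.trans (mul_le_mul_of_nonneg_left hden (sum_nonneg fun r _ => mul_nonneg (hw0 r) (sq_nonneg _))))
  -- numerator
  set a : (Fin s → Option (Fin k)) → Fin s → Option (Fin k) → ℝ := fun r t o =>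
    if r t = none then (if o = none then 1 else if o = some m then 1 / p t else 0) else if o = r t then 1 else 0 with ha
  set e : (Fin s → Option (Fin k)) → Fin s → Option (Fin k) → ℝ := fun r t o =>
    if r t = none then (if o = none then 0 else if o = some m then 0 else - (1 / (p t * (p t - 1)))) else 0 with he
  have ha0 : ∀ r t o, 0 ≤ a r t o := fun r t o => by
    have := hp0 t
    simp only [ha]; split_ifs <;> positivity
  have hηs : ∀ t, (k : ℝ) * (1 / (p t * (p t - 1))) ≤ (k : ℝ) ^ 2 / (p t - 1) ^ 2 := fun t => by
    have h1 := hq0 t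
    have h2 := hp0 t
    rw [mul_one_div, div_le_div_iff₀ (by positivity) (by positivity)]
    have : (p t - 1) * 1 ≤ p t * k := mul_le_mul (by linarith) hk1 zero_le_one h2.le
    have h3 : 0 ≤ k * (p t - 1) := by positivity
    nlinarith
  set Φ : (Fin s → Option (Fin k)) → ℝ := fun r => ∑ c, y c * ∏ t, a r t (c t) with hΦ
  have hΨΦ : ∀ r, (1 / 2) * Φ r * I r ≤ I r * (Sg r * Ψ r) := by
    intro r
    by_cases hr : ∃ t, r t = some m
    · obtain ⟨t, ht⟩ := hr
      have : I r = 0 := prod_eq_zero (mem_univ t) (by simp [alm, ht])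
      simp [this]
    push Not at hr
    have e1 : Sg r * Ψ r = ∑ c, y c * ∏ t, (a r t (c t) + e r t (c t)) := by
      rw [hΨ]; simp only; rw [TT_rl, mul_sum]
      refine sum_congr rfl fun c _ => ?_
      rw [hSg]; simp only
      rw [mul_left_comm, ← prod_mul_distrib]
      congr 1
      refine prod_congr rfl fun t _ => ?_
      have hrt := hr t
      have h1 := hq0 t
      have h2 := hp0 t
      rw [rho, Fintype.sum_option]
      simp only [ha, he]
      generalize r t = o at hrt
      generalize c t = o'
      rcases o with _ | i <;> rcases o' with _ | j
      · simp [tau, alm, sg]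
      · by_cases hj : j = m
        · simp [tau, alm, sg, hj]
        · simp [tau, alm, sg, hj]
          field_simp
          ring
      · simp [tau, alm, sg]
      · have : i ≠ m := fun h => hrt (by rw [h])
        by_cases hij : j = i
        · subst hij; simp [tau, alm, sg, this]
        · simp [tau, alm, sg, hij, Ne.symm hij]
    have h2 := perturb (a r) (e r) (fun t => (k : ℝ) ^ 2 / (p t - 1) ^ 2) (ha0 r) hη0 (fun t => by
        simp only [ha, he]
        rw [Fintype.sum_option]
        by_cases hrt : r t = none
        · simp only [hrt, if_true, abs_zero, zero_add, mul_one]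
          refine le_trans ?_ (hηs t)
          calc _ ≤ ∑ i : Fin k, 1 / (p t * (p t - 1)) := sum_le_sum fun i _ => by
                have h1 := hq0 t
                have h2 := hp0 t
                have : 0 ≤ 1 / (p t * (p t - 1)) := by positivity
                have h0 : |-(1 / (p t * (p t - 1)))| = 1 / (p t * (p t - 1)) := by rw [abs_neg, abs_of_nonneg this]
                rw [if_neg (by simp)]
                split_ifs
                · simpa using this
                · exact h0.le
            _ = _ := by simp
        · simp only [hrt, if_false]
          simp [eq_comm, hrt]) y hy
    have hΦ0 : 0 ≤ Φ r := sum_nonneg fun c _ => mul_nonneg (hy.1 c) (prod_nonneg fun t _ => ha0 _ _ _)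
    have h3 := (abs_le.mp h2).1
    rw [← e1] at h3
    have h4 : (1 / 2) * Φ r ≤ Sg r * Ψ r := by
      have : (∏ t, (1 + (k : ℝ) ^ 2 / (p t - 1) ^ 2) - 1) * Φ r ≤ (1 / 2) * Φ r := mul_le_mul_of_nonneg_right (by linarith) hΦ0
      have h5 : Φ r = ∑ c, y c * ∏ t, a r t (c t) := rfl
      rw [← h5] at h3
      linarith
    have := mul_le_mul_of_nonneg_left h4 (hI0 r)
    linarith
  set ν : Fin s → Option (Fin k) → ℝ := fun t o => if o = some m then 1 / p t else mL (p t - 1) o with hν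
  have hswap : ∑ r, w r * Y r * (Φ r * I r) = ∑ c, y c * Y (fun t => er m (c t)) * ∏ t, ν t (c t) := by
    have : ∀ r, w r * Y r * (Φ r * I r) = ∑ c, y c * (Y r * ∏ t, (mL (p t - 1) (r t) * a r t (c t) * alm m t (r t))) := fun r => by
      rw [hΦ]; simp only; rw [sum_mul, mul_sum]
      refine sum_congr rfl fun c _ => ?_
      rw [prod_mul_distrib, prod_mul_distrib, hw, hI]
      ring
    simp only [this]
    rw [sum_comm]
    refine sum_congr rfl fun c _ => ?_
    rw [← mul_sum, mul_assoc]
    congr 1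
    have h5 := sum_delta (fun r => Y r * ∏ t, ν t (c t)) (fun t => er m (c t))
    rw [← h5]
    refine sum_congr rfl fun r _ => ?_
    rw [mul_assoc, ← prod_mul_distrib]
    congr 1
    refine prod_congr rfl fun t _ => ?_
    simp only [ha, hν, er, alm]
    generalize r t = o
    generalize c t = o'
    rcases o with _ | i <;> rcases o' with _ | j
    · simp
    · by_cases hj : j = m
      · simp [hj, mL]
      · simp [hj]
    · simp
    · by_cases hj : j = m
      · by_cases hi : i = m
        · subst hi; simp [hj]
        · have hmi : ¬ m = i := fun h => hi h.symm
          simp [hi, hj, hmi]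
      · by_cases hi : i = m
        · have hmj : ¬ m = j := fun h => hj h.symm
          simp [hi, hj, hmj]
        · by_cases hij : i = j
          · simp [hij, hj]
          · simp [hi, hj, hij, Ne.symm hij, eq_comm]
  have hMon : MonoL (fun c : Fin s → Option (Fin k) => y c * Y (fun t => er m (c t))) := by
    refine ⟨fun c => mul_nonneg (hy.1 _) (hY.1 _), fun c t => mul_le_mul (hy.2 c t) ?_ (hY.1 _) (hy.1 _)⟩
    refine (hY.2 (fun t => er m (c t)) t).trans (le_of_eq ?_)
    congr 1
    funext u
    by_cases hu : u = t
    · subst hu; simp [er]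
    · simp [hu]
  have hfin : (1 / 2) * ∑ c, y c * Y (fun t => er m (c t)) * ∏ t, mU (p t) (c t) ≤
      ∑ c, y c * Y (fun t => er m (c t)) * ∏ t, ν t (c t) := by
    have h2 := perturb (fun t => mU (p t)) (fun t o => ν t o - mU (p t) o) (fun t => (k : ℝ) ^ 2 / (p t - 1) ^ 2) (fun t o => hmU _ _) hη0 (fun t => by
        rw [Fintype.sum_option]
        have h1 := hq0 t
        have h2 := hp0 t
        have e0 : |ν t none - mU (p t) (none : Option (Fin k))| = 0 := by simp [hν, mL, mU]
        have e1 : ∀ i : Fin k, |ν t (some i) - mU (p t) (some i)| ≤ k / (p t - 1) ^ 2 := by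
          intro i
          by_cases hi : i = m
          · simp only [hν, hi, mU]; simp; positivity
          · simp only [hν, Option.some.injEq, hi, if_false, mU, mL]
            have h3 : 1 / (p t - 1) - 1 / p t = 1 / (p t * (p t - 1)) := by field_simp; ring
            have h4 : 0 ≤ 1 / (p t * (p t - 1)) := by positivity
            have h5 := hLU t (some i)
            simp only [mL, mU] at h5
            rw [abs_le]
            constructor <;> linarith
        rw [e0, zero_add]
        calc _ ≤ ∑ i : Fin k, (k : ℝ) / (p t - 1) ^ 2 := sum_le_sum fun i _ => e1 i
          _ = _ := by simp [mU]; ring) _ hMon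
    have hM0 : 0 ≤ ∑ c, y c * Y (fun t => er m (c t)) * ∏ t, mU (p t) (c t) :=
      sum_nonneg fun c _ => mul_nonneg (hMon.1 c) (prod_nonneg fun t _ => hmU _ _)
    have h3 := (abs_le.mp h2).1
    simp only [add_sub_cancel] at h3
    have : (∏ t, (1 + (k : ℝ) ^ 2 / (p t - 1) ^ 2) - 1) * ∑ c, y c * Y (fun t => er m (c t)) * ∏ t, mU (p t) (c t)
       ≤ (1 / 2) * ∑ c, y c * Y (fun t => er m (c t)) * ∏ t, mU (p t) (c t) := mul_le_mul_of_nonneg_right (by linarith) hM0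
    linarith
  have hM0 : 0 ≤ ∑ c, y c * Y (fun t => er m (c t)) * ∏ t, mU (p t) (c t) :=
      sum_nonneg fun c _ => mul_nonneg (hMon.1 c) (prod_nonneg fun t _ => hmU _ _)
  refine pow_le_pow_left₀ (by positivity) ?_ 2
  calc _ ≤ (1 / 2) * ∑ r, w r * Y r * (Φ r * I r) := by rw [hswap]; linarith
    _ = ∑ r, w r * Y r * ((1 / 2) * Φ r * I r) := by rw [mul_sum]; exact sum_congr rfl fun r _ => by ring
    _ ≤ ∑ r, w r * Y r * (I r * (Sg r * Ψ r)) := sum_le_sum fun r _ =>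
        mul_le_mul_of_nonneg_left (hΨΦ r) (mul_nonneg (hw0 r) (hY.1 r))
    _ = _ := sum_congr rfl fun r _ => by ring

end bounds
end TDR

namespace TDR
open Finset

section tup
variable {k s : ℕ}

def lab (c : Fin s → Option (Fin k)) (i : Fin k) : Finset (Fin s) := univ.filter (fun t => c t = some i)

lemma mem_lab {c : Fin s → Option (Fin k)} {i : Fin k} {t : Fin s} : t ∈ lab c i ↔ c t = some i := by
  simp [lab]

lemma lab_inj : Function.Injective (lab : (Fin s → Option (Fin k)) → Fin k → Finset (Fin s)) := by
  intro c c' h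
  funext t
  ext i
  have : t ∈ lab c i ↔ t ∈ lab c' i := by rw [h]
  simpa [mem_lab] using this

lemma exists_lab (T : Fin k → Finset (Fin s)) (h : ∀ i j, i ≠ j → ∀ t, t ∈ T i → t ∉ T j) : ∃ c, lab c = T := by
  classical
  refine ⟨fun t => if h : ∃ i, t ∈ T i then some h.choose else none, ?_⟩
  funext i
  ext t
  rw [mem_lab]
  constructor
  · intro ht
    split_ifs at ht with h1
    have := h1.choose_spec
    rw [Option.some.inj ht] at this
    exact this
  · intro ht
    have h1 : ∃ i, t ∈ T i := ⟨i, ht⟩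
    rw [dif_pos h1]
    congr 1
    by_contra hne
    exact h _ _ hne t h1.choose_spec ht

lemma tup_sum (F : Fin k → Finset (Fin s) → ℝ) : ∑ T : Fin k → Finset (Fin s), ∏ i, F i (T i) = ∏ i, ∑ S, F i S := by
  rw [Finset.prod_univ_sum, Fintype.piFinset_univ]

lemma lab_sum_le (F : Fin k → Finset (Fin s) → ℝ) (hF : ∀ i S, 0 ≤ F i S) :
    ∑ c : Fin s → Option (Fin k), ∏ i, F i (lab c i) ≤ ∏ i, ∑ S, F i S := by
  classical
  rw [← tup_sum]
  rw [← sum_image (f := fun T : Fin k → Finset (Fin s) => ∏ i, F i (T i)) (g := lab) (s := univ) (fun a _ b _ h => lab_inj h)]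
  exact sum_le_sum_of_subset_of_nonneg (subset_univ _) fun T _ _ => prod_nonneg fun i _ => hF _ _

noncomputable def PS (p : Fin s → ℝ) (S : Finset (Fin s)) : ℝ := ∏ t ∈ S, p t

lemma prod_lab (f : Fin s → ℝ) (c : Fin s → Option (Fin k)) :
    ∏ i, ∏ t ∈ lab c i, f t = ∏ t, (if c t = none then 1 else f t) := by
  simp only [lab, prod_filter]
  rw [prod_comm]
  refine prod_congr rfl fun t _ => ?_
  rcases c t with _ | j
  · simp
  · simp

lemma mU_prod (p : Fin s → ℝ) (c : Fin s → Option (Fin k)) :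
    ∏ t, mU (p t) (c t) = ∏ i, (PS p (lab c i))⁻¹ := by
  simp only [PS, ← prod_inv_distrib]
  rw [prod_lab]
  refine prod_congr rfl fun t _ => ?_
  rcases c t with _ | j <;> simp [mU]

theorem lab_lower (p : Fin s → ℝ) (hp : ∀ t, 1 ≤ p t) (R : ℝ) (hR : 1 < R)
    (F : Fin k → Finset (Fin s) → ℝ) (hF : ∀ i S, 0 ≤ F i S)
    (hthin : ∀ i t, ∑ S, (if t ∈ S then F i S else 0) ≤ 1 / p t * ∑ S, F i S)
    (hsq : (k : ℝ) ^ 2 * ∑ t, 1 / p t ^ 2 ≤ 1 / 4)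
    (ε : Fin k → ℝ) (hε : ∑ i, ε i ≤ 1 / 4)
    (hM : ∀ i, ∑ S, F i S * Real.log (PS p S) ≤ ε i * Real.log R * ∑ S, F i S) :
    1 / 2 * ∏ i, ∑ S, F i S ≤
      ∑ c : Fin s → Option (Fin k), (if ∏ i, PS p (lab c i) ≤ R then 1 else 0) * ∏ i, F i (lab c i) := by
  classical
  set Tot := ∏ i, ∑ S, F i S with hTot
  have hA0 : ∀ i, 0 ≤ ∑ S, F i S := fun i => sum_nonneg fun S _ => hF _ _
  have hTot0 : 0 ≤ Tot := prod_nonneg fun i _ => hA0 i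
  have hlR : 0 < Real.log R := Real.log_pos hR
  have hPS1 : ∀ S, 1 ≤ PS p S := fun S => by
    calc (1 : ℝ) = ∏ t ∈ S, (1 : ℝ) := by simp
      _ ≤ ∏ t ∈ S, p t := prod_le_prod (fun _ _ => zero_le_one) fun t _ => hp t
  have hlog : ∀ S, 0 ≤ Real.log (PS p S) := fun S => Real.log_nonneg (hPS1 S)
  set X : (Fin k → Finset (Fin s)) → ℝ := fun T => ∏ i, F i (T i) with hX
  have hX0 : ∀ T, 0 ≤ X T := fun T => prod_nonneg fun i _ => hF _ _
  have h1 : ∀ T : Fin k → Finset (Fin s), X T ≤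
      (if T ∈ univ.image (lab : (Fin s → Option (Fin k)) → _) then (if ∏ i, PS p (T i) ≤ R then 1 else 0) * X T else 0) +
      (∑ i, ∑ j, if i = j then 0 else ∑ t, (if t ∈ T i ∧ t ∈ T j then X T else 0)) +
      ∑ i, Real.log (PS p (T i)) / Real.log R * X T := by
    intro T
    have n2 : ∀ i j, 0 ≤ (if i = j then 0 else ∑ t, (if t ∈ T i ∧ t ∈ T j then X T else 0)) := fun i j => by
      split_ifs
      · exact le_rfl
      · exact sum_nonneg fun t _ => by split_ifs; exacts [hX0 T, le_rfl]
    have n2' : 0 ≤ ∑ i, ∑ j, (if i = j then 0 else ∑ t, (if t ∈ T i ∧ t ∈ T j then X T else 0)) :=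
      sum_nonneg fun i _ => sum_nonneg fun j _ => n2 i j
    have n3 : 0 ≤ ∑ i, Real.log (PS p (T i)) / Real.log R * X T :=
      sum_nonneg fun i _ => mul_nonneg (div_nonneg (hlog _) hlR.le) (hX0 T)
    have n1 : 0 ≤ (if T ∈ univ.image (lab : (Fin s → Option (Fin k)) → _) then (if ∏ i, PS p (T i) ≤ R then 1 else 0) * X T else 0) := by
      split_ifs <;> simp [hX0 T]
    by_cases hd : ∃ i j, i ≠ j ∧ ∃ t, t ∈ T i ∧ t ∈ T j
    · obtain ⟨i, j, hij, t, ht⟩ := hd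
      have : X T ≤ ∑ i, ∑ j, (if i = j then 0 else ∑ t, (if t ∈ T i ∧ t ∈ T j then X T else 0)) := by
        refine le_trans ?_ (single_le_sum (f := fun i => ∑ j, (if i = j then 0 else ∑ t, (if t ∈ T i ∧ t ∈ T j then X T else 0))) (fun i _ => sum_nonneg fun j _ => n2 i j) (mem_univ i))
        refine le_trans ?_ (single_le_sum (f := fun j => (if i = j then 0 else ∑ t, (if t ∈ T i ∧ t ∈ T j then X T else 0))) (fun j _ => n2 i j) (mem_univ j))
        simp only [if_neg hij]
        refine le_trans ?_ (single_le_sum (f := fun t => (if t ∈ T i ∧ t ∈ T j then X T else 0)) (fun t _ => by split_ifs; exacts [hX0 T, le_rfl]) (mem_univ t))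
        simp only [if_pos ht, le_refl]
      linarith
    · push Not at hd
      obtain ⟨c, hc⟩ := exists_lab T hd
      rw [if_pos (mem_image.mpr ⟨c, mem_univ _, hc⟩)]
      by_cases hR' : ∏ i, PS p (T i) ≤ R
      · rw [if_pos hR', one_mul]; linarith
      · have h5 : Real.log R ≤ ∑ i, Real.log (PS p (T i)) := by
          rw [← Real.log_prod (fun i _ => (lt_of_lt_of_le one_pos (hPS1 _)).ne')]
          exact Real.log_le_log (by linarith) (not_le.mp hR').le
        have h6 : X T ≤ ∑ i, Real.log (PS p (T i)) / Real.log R * X T := by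
          rw [← sum_mul, ← sum_div]
          have : 1 ≤ (∑ i, Real.log (PS p (T i))) / Real.log R := by rwa [one_le_div hlR]
          nlinarith [hX0 T]
        rw [if_neg hR', zero_mul]
        linarith
  have h2 := sum_le_sum fun T (_ : T ∈ (univ : Finset (Fin k → Finset (Fin s)))) => h1 T
  rw [sum_add_distrib, sum_add_distrib] at h2
  have e1 : ∑ T, X T = Tot := tup_sum F
  have e2 : ∑ T : Fin k → Finset (Fin s), (if T ∈ univ.image (lab : (Fin s → Option (Fin k)) → _) then (if ∏ i, PS p (T i) ≤ R then 1 else 0) * X T else 0)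
      = ∑ c : Fin s → Option (Fin k), (if ∏ i, PS p (lab c i) ≤ R then 1 else 0) * ∏ i, F i (lab c i) := by
    rw [← sum_filter, filter_mem_eq_inter, univ_inter, sum_image (fun a _ b _ h => lab_inj h)]
  have e3 : ∑ T : Fin k → Finset (Fin s), (∑ i, ∑ j, if i = j then 0 else ∑ t, (if t ∈ T i ∧ t ∈ T j then X T else 0)) ≤ 1 / 4 * Tot := by
    rw [sum_comm]
    have b : ∀ i j : Fin k, ∑ T : Fin k → Finset (Fin s), (if i = j then 0 else ∑ t, (if t ∈ T i ∧ t ∈ T j then X T else 0)) ≤ (∑ t, 1 / p t ^ 2) * Tot := by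
      intro i j
      by_cases hij : i = j
      · simp only [hij, if_true, sum_const_zero]
        exact mul_nonneg (sum_nonneg fun t _ => by positivity) hTot0
      simp only [if_neg hij]
      rw [sum_comm, sum_mul]
      refine sum_le_sum fun t _ => ?_
      have e : ∀ T : Fin k → Finset (Fin s), (if t ∈ T i ∧ t ∈ T j then X T else 0) = ∏ l, (if l = i ∨ l = j then (if t ∈ T l then F l (T l) else 0) else F l (T l)) := by
        intro T
        split_ifs with hh
        · refine prod_congr rfl fun l _ => ?_
          split_ifs with h3 h4
          · rfl
          · rcases h3 with h3 | h3
            · exact absurd hh.1 (h3 ▸ h4)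
            · exact absurd hh.2 (h3 ▸ h4)
          · rfl
        · by_cases hi : t ∈ T i
          · have hj : t ∉ T j := fun h => hh ⟨hi, h⟩
            rw [prod_eq_zero (mem_univ j)]
            simp [hj]
          · rw [prod_eq_zero (mem_univ i)]
            simp [hi]
      simp only [e]
      rw [tup_sum (fun l S => if l = i ∨ l = j then (if t ∈ S then F l S else 0) else F l S)]
      have hpt := hp t
      calc _ ≤ ∏ l, ((if l = i then 1 / p t else 1) * (if l = j then 1 / p t else 1) * ∑ S, F l S) := by
            refine prod_le_prod (fun l _ => sum_nonneg fun S _ => ?_) fun l _ => ?_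
            · have := hF l S
              split_ifs <;> first | exact this | exact le_rfl
            · by_cases hli : l = i
              · have hlj : l ≠ j := fun h => hij (hli ▸ h)
                simp only [hli, true_or, if_true]
                rw [if_neg (hli ▸ hlj)]
                simpa using hthin i t
              · by_cases hlj : l = j
                · simp only [hlj, or_true, if_true]
                  rw [if_neg (hlj ▸ hli)]
                  simpa using hthin j t
                · simp [hli, hlj]
        _ = _ := by
            rw [prod_mul_distrib, prod_mul_distrib]
            simp only [prod_ite_eq', mem_univ, if_true]
            rw [← hTot]; ring
    calc _ = ∑ i, ∑ j, ∑ T : Fin k → Finset (Fin s), (if i = j then 0 else ∑ t, (if t ∈ T i ∧ t ∈ T j then X T else 0)) :=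
          sum_congr rfl fun i _ => sum_comm
      _ ≤ ∑ i : Fin k, ∑ j : Fin k, (∑ t, 1 / p t ^ 2) * Tot := sum_le_sum fun i _ => sum_le_sum fun j _ => b i j
      _ = (k : ℝ) ^ 2 * (∑ t, 1 / p t ^ 2) * Tot := by simp; ring
      _ ≤ _ := mul_le_mul_of_nonneg_right hsq hTot0
  have e4 : ∑ T : Fin k → Finset (Fin s), ∑ i, Real.log (PS p (T i)) / Real.log R * X T ≤ 1 / 4 * Tot := by
    rw [sum_comm]
    have b : ∀ i : Fin k, ∑ T : Fin k → Finset (Fin s), Real.log (PS p (T i)) / Real.log R * X T ≤ ε i * Tot := by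
      intro i
      have e : ∀ T : Fin k → Finset (Fin s), Real.log (PS p (T i)) / Real.log R * X T = (1 / Real.log R) * ∏ l, (if l = i then F l (T l) * Real.log (PS p (T l)) else F l (T l)) := by
        intro T
        have : ∏ l, (if l = i then F l (T l) * Real.log (PS p (T l)) else F l (T l)) = ∏ l, (F l (T l) * (if l = i then Real.log (PS p (T l)) else 1)) :=
          prod_congr rfl fun l _ => by split_ifs <;> simp
        rw [this, prod_mul_distrib]
        simp only [prod_ite_eq', mem_univ, if_true]
        ring
      simp only [e]
      rw [← mul_sum, tup_sum (fun l S => if l = i then F l S * Real.log (PS p S) else F l S)]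
      have h7 : ∏ l, ∑ S, (if l = i then F l S * Real.log (PS p S) else F l S) ≤ ∏ l, ((if l = i then ε i * Real.log R else 1) * ∑ S, F l S) := by
        refine prod_le_prod (fun l _ => sum_nonneg fun S _ => ?_) fun l _ => ?_
        · split_ifs
          · exact mul_nonneg (hF _ _) (hlog _)
          · exact hF _ _
        · split_ifs with hl
          · subst hl; exact hM l
          · simp
      rw [prod_mul_distrib] at h7
      simp only [prod_ite_eq', mem_univ, if_true] at h7
      calc _ ≤ (1 / Real.log R) * (ε i * Real.log R * Tot) := by gcongr
        _ = _ := by field_simp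
    calc _ ≤ ∑ i, ε i * Tot := sum_le_sum fun i _ => b i
      _ = (∑ i, ε i) * Tot := by rw [sum_mul]
      _ ≤ _ := mul_le_mul_of_nonneg_right hε hTot0
  rw [e1, e2] at h2
  linarith

end tup
end TDR

namespace TDR
open Finset

section asm
variable {k s : ℕ}

noncomputable def yv (G : Finset (Fin s) → ℝ) (p : Fin s → ℝ) (R : ℝ) (c : Fin s → Option (Fin k)) : ℝ :=
  (if ∏ i, PS p (lab c i) ≤ R then 1 else 0) * ∏ i, G (lab c i)

noncomputable def AA (G : Finset (Fin s) → ℝ) (p : Fin s → ℝ) (j : ℕ) : ℝ := ∑ S, G S ^ j * (PS p S)⁻¹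
noncomputable def MM (G : Finset (Fin s) → ℝ) (p : Fin s → ℝ) (j : ℕ) : ℝ := ∑ S, G S ^ j * (PS p S)⁻¹ * Real.log (PS p S)

lemma lab_update (c : Fin s → Option (Fin k)) (t : Fin s) (i : Fin k) :
    lab (Function.update c t none) i = (lab c i).erase t := by
  ext u
  rw [mem_erase, mem_lab, mem_lab]
  by_cases h : u = t
  · subst h; simp
  · simp [h]

lemma PS_pos {p : Fin s → ℝ} (hp : ∀ t, 1 ≤ p t) (S : Finset (Fin s)) : 0 < PS p S :=
  prod_pos fun t _ => by linarith [hp t]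

lemma PS_erase_le {p : Fin s → ℝ} (hp : ∀ t, 1 ≤ p t) (S : Finset (Fin s)) (t : Fin s) : PS p (S.erase t) ≤ PS p S := by
  by_cases ht : t ∈ S
  · rw [PS, PS, ← mul_prod_erase S p ht]
    have : 0 < PS p (S.erase t) := PS_pos hp _
    rw [PS] at this
    nlinarith [hp t]
  · rw [erase_eq_of_notMem ht]

lemma mono_prodG {G : Finset (Fin s) → ℝ} (hG0 : ∀ S, 0 ≤ G S) (hG : ∀ S t, G S ≤ G (S.erase t)) (I : Finset (Fin k)) :
    MonoL (fun c : Fin s → Option (Fin k) => ∏ i ∈ I, G (lab c i)) := by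
  refine ⟨fun c => prod_nonneg fun i _ => hG0 _, fun c t => ?_⟩
  simp only [lab_update]
  exact prod_le_prod (fun i _ => hG0 _) fun i _ => hG _ _

lemma mono_yv {G : Finset (Fin s) → ℝ} (hG0 : ∀ S, 0 ≤ G S) (hG : ∀ S t, G S ≤ G (S.erase t))
    {p : Fin s → ℝ} (hp : ∀ t, 1 ≤ p t) (R : ℝ) : MonoL (yv (k := k) G p R) := by
  have h := mono_prodG (k := k) hG0 hG univ
  refine ⟨fun c => mul_nonneg (by split_ifs <;> norm_num) (h.1 c), fun c t => ?_⟩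
  refine mul_le_mul ?_ (h.2 c t) (h.1 c) (by split_ifs <;> norm_num)
  have : ∏ i, PS p (lab (Function.update c t none) i) ≤ ∏ i, PS p (lab c i) := by
    simp only [lab_update]
    exact prod_le_prod (fun i _ => (PS_pos hp _).le) fun i _ => PS_erase_le hp _ _
  split_ifs with h1 h2
  · exact le_rfl
  · exact absurd (this.trans h1) h2
  · norm_num
  · norm_num

lemma yv_le {G : Finset (Fin s) → ℝ} (hG0 : ∀ S, 0 ≤ G S) (p : Fin s → ℝ) (R : ℝ) (c : Fin s → Option (Fin k)) :
    yv G p R c ≤ ∏ i, G (lab c i) := by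
  have : 0 ≤ ∏ i, G (lab c i) := prod_nonneg fun i _ => hG0 _
  unfold yv; split_ifs <;> simp [this]

theorem A_upper (B : Finset (Fin s)) {p : Fin s → ℝ} (hp1 : ∀ t, 1 ≤ p t) (hp : ∀ t, (k : ℝ) ≤ p t)
    {G : Finset (Fin s) → ℝ} (hG0 : ∀ S, 0 ≤ G S) (hG : ∀ S t, G S ≤ G (S.erase t)) (R : ℝ) :
    BB p (rl (alB B) (lam p (yv (k := k) G p R))) (rl (alB B) (lam p (yv G p R))) ≤
      (∏ t, (1 + if t ∈ B then k / p t else 0)) ^ 2 * AA G p 2 ^ k := by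
  refine (BB_upper B p (fun t => by linarith [hp1 t]) hp _ (mono_yv hG0 hG hp1 R)).trans ?_
  refine mul_le_mul_of_nonneg_left ?_ (sq_nonneg _)
  calc _ ≤ ∑ c : Fin s → Option (Fin k), ∏ i, (G (lab c i) ^ 2 * (PS p (lab c i))⁻¹) := by
        refine sum_le_sum fun c _ => ?_
        rw [prod_mul_distrib, mU_prod, prod_pow]
        refine mul_le_mul_of_nonneg_right ?_ (prod_nonneg fun i _ => inv_nonneg.mpr (PS_pos hp1 _).le)
        exact pow_le_pow_left₀ ((mono_yv hG0 hG hp1 R).1 c) (yv_le hG0 p R c) 2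
    _ ≤ _ := lab_sum_le (fun _ S => G S ^ 2 * (PS p S)⁻¹) fun _ S => mul_nonneg (sq_nonneg _) (inv_nonneg.mpr (PS_pos hp1 _).le)
    _ = _ := by simp [AA]

lemma thin {p : Fin s → ℝ} (hp : ∀ t, 1 ≤ p t) {G : Finset (Fin s) → ℝ} (hG0 : ∀ S, 0 ≤ G S) (hG : ∀ S t, G S ≤ G (S.erase t))
    (j : ℕ) (t : Fin s) : ∑ S, (if t ∈ S then G S ^ j * (PS p S)⁻¹ else 0) ≤ 1 / p t * ∑ S, G S ^ j * (PS p S)⁻¹ := by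
  have hpt := hp t
  have hF : ∀ S, 0 ≤ G S ^ j * (PS p S)⁻¹ := fun S => mul_nonneg (pow_nonneg (hG0 S) j) (inv_nonneg.mpr (PS_pos hp _).le)
  rw [← sum_filter, mul_sum]
  calc _ ≤ ∑ S ∈ univ.filter (fun S : Finset (Fin s) => t ∈ S), 1 / p t * (G (S.erase t) ^ j * (PS p (S.erase t))⁻¹) := by
        refine sum_le_sum fun S hS => ?_
        have hS := (mem_filter.mp hS).2
        have e : PS p S = p t * PS p (S.erase t) := (mul_prod_erase S p hS).symm
        rw [e, mul_inv, one_div]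
        have h1 : G S ^ j ≤ G (S.erase t) ^ j := pow_le_pow_left₀ (hG0 S) (hG S t) j
        have h2 : 0 ≤ (p t)⁻¹ * (PS p (S.erase t))⁻¹ := mul_nonneg (by positivity) (inv_nonneg.mpr (PS_pos hp _).le)
        nlinarith
    _ = ∑ S ∈ (univ.filter (fun S : Finset (Fin s) => t ∈ S)).image (fun S => S.erase t), 1 / p t * (G S ^ j * (PS p S)⁻¹) := by
        rw [sum_image]
        intro S hS S' hS' h
        have hS : t ∈ S := by simpa using hS
        have hS' : t ∈ S' := by simpa using hS'
        simp only at h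
        rw [← insert_erase hS, h, insert_erase hS']
    _ ≤ _ := sum_le_sum_of_subset_of_nonneg (subset_univ _) fun S _ _ => mul_nonneg (by positivity) (hF S)

theorem A_lower (m : Fin k) {p : Fin s → ℝ} (hp1 : ∀ t, 1 < p t) (hp : ∀ t, (k : ℝ) + 1 ≤ p t)
    (hprod : ∏ t, (1 + (k : ℝ) ^ 2 / (p t - 1) ^ 2) ≤ 3 / 2)
    (hsq : (k : ℝ) ^ 2 * ∑ t, 1 / p t ^ 2 ≤ 1 / 4)
    {G : Finset (Fin s) → ℝ} (hG0 : ∀ S, 0 ≤ G S) (hG : ∀ S t, G S ≤ G (S.erase t)) (hA2 : 0 < AA G p 2) {R : ℝ} (hR : 1 < R)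
    (hM1 : MM G p 1 ≤ 1 / 8 * Real.log R * AA G p 1) (hM2 : k * MM G p 2 ≤ 1 / 8 * Real.log R * AA G p 2) :
    1 / 64 * AA G p 1 ^ 2 * AA G p 2 ^ (k - 1) ≤
     BB (fun t => p t - 1) (rl (alm m) (lam p (yv (k := k) G p R))) (rl (alm m) (lam p (yv G p R))) := by
  have hk1 : 1 ≤ k := by have := m.2; omega
  have hk0 : (0 : ℝ) < k := by exact_mod_cast hk1
  have hp1' : ∀ t, 1 ≤ p t := fun t => (hp1 t).le
  have hPi : ∀ S, 0 ≤ (PS p S)⁻¹ := fun S => inv_nonneg.mpr (PS_pos hp1' _).le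
  have hb := BB_lower m p hp1 hp hprod (yv G p R) (fun c => ∏ i ∈ univ.erase m, G (lab c i))
    (mono_yv hG0 hG hp1' R) (mono_prodG hG0 hG _)
  have hpr : ∀ a b : ℝ, ∏ i : Fin k, (if i = m then a else b) = a * b ^ (k - 1) := fun a b => by
    rw [← mul_prod_erase univ _ (mem_univ m), if_pos rfl]
    congr 1
    rw [prod_congr rfl (g := fun _ => b) fun i hi => if_neg (ne_of_mem_erase hi)]
    simp [card_erase_of_mem]
  -- denominator
  have hden : ∑ r : Fin s → Option (Fin k), (∏ i ∈ univ.erase m, G (lab r i)) ^ 2 * ∏ t, (if r t = some m then 0 else mU (p t) (r t)) ≤ AA G p 2 ^ (k - 1) := by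
    calc _ ≤ ∑ c : Fin s → Option (Fin k), ∏ i, (if i = m then (if lab c i = ∅ then 1 else 0) else G (lab c i) ^ 2 * (PS p (lab c i))⁻¹) := by
          refine sum_le_sum fun c _ => ?_
          by_cases hc : ∃ t, c t = some m
          · obtain ⟨t, ht⟩ := hc
            rw [prod_eq_zero (mem_univ t) (by simp [ht]), mul_zero]
            refine prod_nonneg fun i _ => ?_
            split_ifs
            · norm_num
            · norm_num
            · exact mul_nonneg (sq_nonneg _) (hPi _)
          · push Not at hc
            have hl : lab c m = ∅ := by
              ext t; simp [mem_lab, hc t]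
            have e1 : ∏ t, (if c t = some m then 0 else mU (p t) (c t)) = ∏ t, mU (p t) (c t) :=
              prod_congr rfl fun t _ => if_neg (hc t)
            rw [e1, mU_prod, ← mul_prod_erase univ _ (mem_univ m), ← mul_prod_erase univ (fun i => ite _ _ _) (mem_univ m), hl]
            simp only [if_true, one_mul]
            rw [prod_congr rfl (s₂ := univ.erase m) (g := fun i => G (lab c i) ^ 2 * (PS p (lab c i))⁻¹) fun i hi => if_neg (ne_of_mem_erase hi)]
            rw [prod_mul_distrib, prod_pow]
            simp [PS]
      _ ≤ _ := lab_sum_le (fun i S => if i = m then (if S = ∅ then 1 else 0) else G S ^ 2 * (PS p S)⁻¹) fun i S => by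
            split_ifs
            · norm_num
            · norm_num
            · exact mul_nonneg (sq_nonneg _) (hPi _)
      _ = ∏ i : Fin k, (if i = m then 1 else AA G p 2) := by
            refine prod_congr rfl fun i _ => ?_
            split_ifs
            · simp
            · rfl
      _ = _ := by rw [hpr, one_mul]
  -- numerator
  have hnum := lab_lower (k := k) p hp1' R hR (fun i S => if i = m then G S ^ 1 * (PS p S)⁻¹ else G S ^ 2 * (PS p S)⁻¹)
    (fun i S => by
      split_ifs
      · exact mul_nonneg (pow_nonneg (hG0 _) _) (hPi _)
      · exact mul_nonneg (pow_nonneg (hG0 _) _) (hPi _))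
    (fun i t => by
      by_cases hi : i = m
      · simp only [if_pos hi]; exact thin hp1' hG0 hG 1 t
      · simp only [if_neg hi]; exact thin hp1' hG0 hG 2 t) hsq (fun i => if i = m then 1 / 8 else 1 / (8 * k))
    (by
      calc _ ≤ ∑ i : Fin k, ((if i = m then (1 / 8 : ℝ) else 0) + 1 / (8 * k)) := sum_le_sum fun i _ => by
            split_ifs
            · have : 0 ≤ 1 / (8 * (k : ℝ)) := by positivity
              linarith
            · simp
        _ = _ := by
            rw [sum_add_distrib]; simp
            field_simp
            norm_num)
    (fun i => by
      by_cases hi : i = m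
      · simp only [if_pos hi]; exact hM1
      · simp only [if_neg hi]
        have e : MM G p 2 ≤ 1 / (8 * k) * Real.log R * AA G p 2 := by
          rw [← mul_le_mul_iff_right₀ hk0]
          refine hM2.trans (le_of_eq ?_)
          field_simp
        exact e)
  have e5 : ∏ i : Fin k, ∑ S, (if i = m then G S ^ 1 * (PS p S)⁻¹ else G S ^ 2 * (PS p S)⁻¹) = AA G p 1 * AA G p 2 ^ (k - 1) := by
    rw [← hpr]
    refine prod_congr rfl fun i _ => ?_
    split_ifs <;> rfl
  rw [e5] at hnum
  have e6 : ∑ c : Fin s → Option (Fin k), yv G p R c * (∏ i ∈ univ.erase m, G (lab (fun t => er m (c t)) i)) * ∏ t, mU (p t) (c t) =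
      ∑ c : Fin s → Option (Fin k), (if ∏ i, PS p (lab c i) ≤ R then 1 else 0) * ∏ i, (if i = m then G (lab c i) ^ 1 * (PS p (lab c i))⁻¹ else G (lab c i) ^ 2 * (PS p (lab c i))⁻¹) := by
    refine sum_congr rfl fun c _ => ?_
    rw [yv, mU_prod, ← mul_prod_erase univ (fun i => G (lab c i)) (mem_univ m), ← mul_prod_erase univ (fun i => (PS p (lab c i))⁻¹) (mem_univ m), ← mul_prod_erase univ (fun i => ite (i = m) _ _) (mem_univ m)]
    rw [prod_congr rfl (s₂ := univ.erase m) (f := fun i => ite (i = m) _ _) (g := fun i => G (lab c i) ^ 2 * (PS p (lab c i))⁻¹) fun i hi => if_neg (ne_of_mem_erase hi)]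
    rw [prod_congr rfl (s₂ := univ.erase m) (f := fun i => G (lab (fun t => er m (c t)) i)) (g := fun i => G (lab c i)) fun i hi => by
      congr 1
      ext t
      rw [mem_lab, mem_lab, er]
      have := ne_of_mem_erase hi
      split_ifs with h
      · rw [h]; simp [Ne.symm this]
      · rfl]
    rw [if_pos rfl, prod_mul_distrib, prod_pow]
    ring
  rw [e6] at hb
  set N := ∑ c : Fin s → Option (Fin k), (if ∏ i, PS p (lab c i) ≤ R then 1 else 0) * ∏ i, (if i = m then G (lab c i) ^ 1 * (PS p (lab c i))⁻¹ else G (lab c i) ^ 2 * (PS p (lab c i))⁻¹) with hN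
  have hN' : 1 / 2 * (AA G p 1 * AA G p 2 ^ (k - 1)) ≤ N := hnum
  set Bv := BB (fun t => p t - 1) (rl (alm m) (lam p (yv (k := k) G p R))) (rl (alm m) (lam p (yv G p R))) with hBv
  have hA1 : 0 ≤ AA G p 1 := sum_nonneg fun S _ => mul_nonneg (pow_nonneg (hG0 _) _) (hPi _)
  have hBv0 : 0 ≤ Bv := by
    refine le_trans (sum_nonneg fun r _ => ?_) (quad (fun t => p t - 1) (fun t => by linarith [hp1 t]) (fun t => by linarith [hp t]) _).1
    exact mul_nonneg (prod_nonneg fun t _ => mL_nonneg (by linarith [hp1 t]) (by linarith [hp t]) _) (sq_nonneg _)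
  have h8 : (1 / 4 * N) ^ 2 ≤ Bv * AA G p 2 ^ (k - 1) := hb.trans (mul_le_mul_of_nonneg_left hden hBv0)
  set a := AA G p 2 ^ (k - 1) with ha
  have ha0 : 0 < a := pow_pos hA2 _
  have h9 : (1 / 4 * (1 / 2 * (AA G p 1 * a))) ^ 2 ≤ (1 / 4 * N) ^ 2 := pow_le_pow_left₀ (by positivity) (by linarith) 2
  have h10 : (1 / 64 * AA G p 1 ^ 2 * a) * a ≤ Bv * a := by
    calc _ = (1 / 4 * (1 / 2 * (AA G p 1 * a))) ^ 2 := by ring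
      _ ≤ _ := h9.trans h8
  exact le_of_mul_le_mul_right h10 ha0

end asm
end TDR

namespace TDR
open Finset

section lamb
variable {k s : ℕ}

lemma mU_nonneg {p : ℝ} (hp : 0 ≤ p) (o : Option (Fin k)) : 0 ≤ mU p o := by
  rcases o with _ | i <;> simp [mU, hp]

lemma mono_push (p : Fin s → ℝ) (hp : ∀ t, 0 < p t) (y : (Fin s → Option (Fin k)) → ℝ) (hy : MonoL y) (c : Fin s → Option (Fin k)) :
    ∑ d, y d * ∏ t, |tau (-p t) (c t) (d t)| ≤ ∑ d, y d * ∏ t, mU (p t) (d t) := by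
  induction s with
  | zero => simp
  | succ s ih =>
    rw [sum_prod_cons (fun t o => |tau (-p t) (c t) o|), sum_prod_cons (fun t o => mU (p t) o)]
    have IH := fun o => ih (fun t => p t.succ) (fun t => hp _) _ (hy.cons o) (fun t => c t.succ)
    set X : Option (Fin k) → ℝ := fun o => ∑ d, y (Fin.cons o d) * ∏ t, |tau (-p (Fin.succ t)) (c (Fin.succ t)) (d t)| with hX
    set M : Option (Fin k) → ℝ := fun o => ∑ d, y (Fin.cons o d) * ∏ t, mU (p (Fin.succ t)) (d t) with hM
    have IH' : ∀ o, X o ≤ M o := IH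
    show ∑ o, |tau (-p 0) (c 0) o| * X o ≤ ∑ o, mU (p 0) o * M o
    have h0 := hp 0
    have hM0 : ∀ o, 0 ≤ M o := fun o => sum_nonneg fun d _ => mul_nonneg (hy.1 _) (prod_nonneg fun t _ => mU_nonneg (hp _).le _)
    rcases c 0 with _ | i
    · refine sum_le_sum fun o _ => ?_
      have : |tau (-p 0) none o| = mU (p 0) o := by rcases o with _ | j <;> simp [tau, mU, abs_of_pos h0]
      rw [this]
      exact mul_le_mul_of_nonneg_left (IH' o) (mU_nonneg h0.le _)
    · have : ∑ o, |tau (-p 0) (some i) o| * X o = X (some i) := by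
        rw [sum_eq_single (some i)]
        · simp [tau]
        · intro o _ ho
          rcases o with _ | j
          · simp [tau]
          · have : ¬ i = j := fun h => ho (by rw [h])
            simp [tau, this]
        · simp
      rw [this]
      refine (IH' _).trans (le_trans (b := M none) ?_ ?_)
      · exact sum_le_sum fun d _ => mul_le_mul_of_nonneg_right (hy.le _ _) (prod_nonneg fun t _ => mU_nonneg (hp _).le _)
      · have := single_le_sum (f := fun o => mU (p 0) o * M o) (fun o _ => mul_nonneg (mU_nonneg h0.le o) (hM0 o)) (mem_univ none)
        simpa [mU] using this

noncomputable def VV (p : Fin s → ℝ) (z : ℝ) : ℝ := ∑ S, (if PS p S ≤ z then (PS p S)⁻¹ else 0)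

lemma VV_nonneg {p : Fin s → ℝ} (hp : ∀ t, 1 ≤ p t) (z : ℝ) : 0 ≤ VV p z :=
  sum_nonneg fun S _ => by split_ifs; exacts [inv_nonneg.mpr (PS_pos hp S).le, le_rfl]

lemma PS_one_le {p : Fin s → ℝ} (hp : ∀ t, 1 ≤ p t) (S : Finset (Fin s)) : 1 ≤ PS p S := by
  calc (1 : ℝ) = ∏ t ∈ S, (1 : ℝ) := by simp
      _ ≤ ∏ t ∈ S, p t := prod_le_prod (fun _ _ => zero_le_one) fun t _ => hp t

lemma lab_le_of_prod {p : Fin s → ℝ} (hp : ∀ t, 1 ≤ p t) {z : ℝ} {c : Fin s → Option (Fin k)} (h : ∏ i, PS p (lab c i) ≤ z) (i : Fin k) :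
    PS p (lab c i) ≤ z := by
  refine le_trans ?_ h
  rw [← mul_prod_erase univ _ (mem_univ i)]
  have : 1 ≤ ∏ x ∈ univ.erase i, PS p (lab c x) := by
    calc (1 : ℝ) = ∏ t ∈ univ.erase i, (1 : ℝ) := by simp
      _ ≤ _ := prod_le_prod (fun _ _ => zero_le_one) fun t _ => PS_one_le hp _
  exact le_mul_of_one_le_right (PS_pos hp _).le this

/-- Sum over labelings of bounded size. -/
lemma sum_lab_VV {p : Fin s → ℝ} (hp : ∀ t, 1 ≤ p t) (z : ℝ) :
    ∑ c : Fin s → Option (Fin k), (if ∏ i, PS p (lab c i) ≤ z then ∏ t, mU (p t) (c t) else 0) ≤ VV p z ^ k := by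
  have h := lab_sum_le (k := k) (fun _ S => if PS p S ≤ z then (PS p S)⁻¹ else 0) (fun _ S => by
    split_ifs; exacts [inv_nonneg.mpr (PS_pos hp S).le, le_rfl])
  have e : ∏ _i : Fin k, ∑ S, (if PS p S ≤ z then (PS p S)⁻¹ else 0) = VV p z ^ k := by simp [VV]
  rw [e] at h
  refine le_trans (sum_le_sum fun c _ => ?_) h
  split_ifs with hc
  · rw [mU_prod]
    refine le_of_eq (prod_congr rfl fun i _ => ?_)
    rw [if_pos (lab_le_of_prod hp hc i)]
  · exact prod_nonneg fun i _ => by split_ifs; exacts [inv_nonneg.mpr (PS_pos hp _).le, le_rfl]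

lemma lam_bound {p : Fin s → ℝ} (hp : ∀ t, 1 ≤ p t) {G : Finset (Fin s) → ℝ} (hG0 : ∀ S, 0 ≤ G S) (hG : ∀ S t, G S ≤ G (S.erase t))
    (hG2 : ∀ S, G S ≤ 2) (R : ℝ) (c : Fin s → Option (Fin k)) :
    |lam p (yv G p R) c| ≤ (2 * VV p R) ^ k := by
  have hy := mono_yv (k := k) hG0 hG hp R
  calc _ ≤ ∑ d, yv G p R d * ∏ t, |tau (-p t) (c t) (d t)| := by
        refine (abs_sum_le_sum_abs _ _).trans (sum_le_sum fun d _ => le_of_eq ?_)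
        rw [abs_mul, abs_mul, abs_of_nonneg (hy.1 d), abs_prod, abs_prod, prod_eq_one fun t _ => abs_sg _, mul_one]
    _ ≤ _ := mono_push p (fun t => by linarith [hp t]) _ hy c
    _ ≤ ∑ d, 2 ^ k * (if ∏ i, PS p (lab d i) ≤ R then ∏ t, mU (p t) (d t) else 0) := by
        refine sum_le_sum fun d _ => ?_
        unfold yv
        have h0 : 0 ≤ ∏ t, mU (p t) (d t) := prod_nonneg fun t _ => mU_nonneg (by linarith [hp t]) _
        split_ifs
        · rw [one_mul]
          refine mul_le_mul_of_nonneg_right ?_ h0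
          calc _ ≤ ∏ _i : Fin k, (2 : ℝ) := prod_le_prod (fun _ _ => hG0 _) fun i _ => hG2 _
            _ = _ := by simp
        · simp
    _ ≤ 2 ^ k * VV p R ^ k := by
        rw [← mul_sum]
        exact mul_le_mul_of_nonneg_left (sum_lab_VV hp R) (by positivity)
    _ = _ := by rw [mul_pow]

lemma lam_supp {p : Fin s → ℝ} (hp : ∀ t, 1 ≤ p t) (G : Finset (Fin s) → ℝ) (R : ℝ) (c : Fin s → Option (Fin k))
    (h : lam p (yv G p R) c ≠ 0) : ∏ i, PS p (lab c i) ≤ R := by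
  obtain ⟨d, _, hd⟩ := exists_ne_zero_of_sum_ne_zero h
  have h1 : yv G p R d ≠ 0 := fun h => hd (by simp [h])
  have h2 : ∏ i, PS p (lab d i) ≤ R := by
    by_contra hc
    exact h1 (by simp [yv, hc])
  have h3 : ∏ t, tau (-p t) (c t) (d t) ≠ 0 := fun h => hd (by rw [h, mul_zero])
  refine le_trans (prod_le_prod (fun i _ => (PS_pos hp _).le) fun i _ => ?_) h2
  refine prod_le_prod_of_subset_of_one_le ?_ ?_ ?_
  · intro t ht
    rw [mem_lab] at ht ⊢
    have := prod_ne_zero_iff.mp h3 t (mem_univ t)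
    rw [ht] at this
    rcases hdt : d t with _ | j
    · rw [hdt] at this; simp [tau] at this
    · rw [hdt] at this
      by_contra hij
      have hij : ¬ i = j := fun h => hij (by rw [h])
      simp [tau, hij] at this
  · intro t _; linarith [hp t]
  · intro t _ _; exact hp t

end lamb
end TDR

namespace TDR
open Finset

section V

noncomputable def cf (W a : ℕ) : ℝ := if W.Coprime a then 1 / (a : ℝ) else 0

lemma cf_nonneg (W a : ℕ) : 0 ≤ cf W a := by unfold cf; split_ifs <;> positivity

lemma block_lower {W : ℕ} (hW : 2 ≤ W) (j : ℕ) :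
    (Nat.totient W : ℝ) / W * (1 / ((j : ℝ) + 1)) ≤ ∑ a ∈ Ico (j * W) (j * W + W), cf W a := by
  have h0 : (0 : ℝ) < W := by exact_mod_cast (by omega : 0 < W)
  unfold cf
  rw [← sum_filter]
  calc _ = ∑ a ∈ (Ico (j * W) (j * W + W)).filter (fun a => W.Coprime a), 1 / (((j : ℝ) + 1) * W) := by
        rw [sum_const, Nat.filter_coprime_Ico_eq_totient, nsmul_eq_mul]
        field_simp
    _ ≤ _ := sum_le_sum fun a ha => by
        rw [mem_filter, mem_Ico] at ha
        have ha0 : 0 < a := by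
          rcases Nat.eq_zero_or_pos a with h | h
          · rw [h, Nat.coprime_zero_right] at ha; omega
          · exact h
        have h1 : (a : ℝ) ≤ (j + 1) * W := by
          have : a ≤ (j + 1) * W := by linarith [ha.1.2, Nat.add_mul j 1 W]
          exact_mod_cast this
        exact one_div_le_one_div_of_le (by exact_mod_cast ha0) h1

lemma block_upper {W : ℕ} (hW : 2 ≤ W) (j : ℕ) (hj : 1 ≤ j) :
    ∑ a ∈ Ico (j * W) (j * W + W), cf W a ≤ (Nat.totient W : ℝ) / W * (1 / (j : ℝ)) := by
  have h0 : (0 : ℝ) < W := by exact_mod_cast (by omega : 0 < W)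
  have hj0 : (0 : ℝ) < j := by exact_mod_cast hj
  unfold cf
  rw [← sum_filter]
  calc _ ≤ ∑ a ∈ (Ico (j * W) (j * W + W)).filter (fun a => W.Coprime a), 1 / ((j : ℝ) * W) := sum_le_sum fun a ha => by
        rw [mem_filter, mem_Ico] at ha
        exact one_div_le_one_div_of_le (by positivity) (by exact_mod_cast ha.1.1)
    _ = _ := by
        rw [sum_const, Nat.filter_coprime_Ico_eq_totient, nsmul_eq_mul]
        field_simp

lemma range_lower {W : ℕ} (hW : 2 ≤ W) (M : ℕ) :
    (Nat.totient W : ℝ) / W * ∑ j ∈ range M, (1 / ((j : ℝ) + 1)) ≤ ∑ a ∈ range (M * W), cf W a := by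
  induction M with
  | zero => simp
  | succ M ih =>
    rw [sum_range_succ, mul_add, Nat.add_mul, one_mul, ← sum_range_add_sum_Ico _ (Nat.le_add_right (M * W) W)]
    exact add_le_add ih (block_lower hW M)

lemma range_upper {W : ℕ} (hW : 2 ≤ W) (M : ℕ) :
    ∑ a ∈ range ((M + 1) * W), cf W a ≤ W + (Nat.totient W : ℝ) / W * ∑ j ∈ range M, (1 / ((j : ℝ) + 1)) := by
  induction M with
  | zero =>
    simp only [zero_add, one_mul, range_zero, sum_empty, mul_zero, add_zero]
    calc _ ≤ ∑ a ∈ range W, (1 : ℝ) := sum_le_sum fun a _ => by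
          unfold cf; split_ifs
          · rcases Nat.eq_zero_or_pos a with h | h
            · simp [h]
            · rw [div_le_one (by exact_mod_cast h)]; exact_mod_cast h
          · norm_num
      _ = _ := by simp
  | succ M ih =>
    rw [sum_range_succ, mul_add, Nat.add_mul (M + 1), one_mul, ← sum_range_add_sum_Ico _ (Nat.le_add_right ((M + 1) * W) W)]
    have := block_upper hW (M + 1) (by omega)
    push_cast at this
    linarith

lemma harm_range (M : ℕ) : ∑ j ∈ range M, (1 / ((j : ℝ) + 1)) = ((harmonic M : ℚ) : ℝ) := by
  rw [harmonic]; push_cast; simp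

lemma cf_lower {W : ℕ} (hW : 2 ≤ W) (z : ℝ) (hz : (W : ℝ) ≤ z) :
    (Nat.totient W : ℝ) / W * Real.log (z / W) ≤ ∑ a ∈ Ioc 0 ⌊z⌋₊, cf W a := by
  have h0 : (0 : ℝ) < W := by exact_mod_cast (by omega : 0 < W)
  have hz0 : 0 < z := h0.trans_le hz
  set M := ⌊z / W⌋₊ with hM
  have h1 := range_lower hW M
  rw [harm_range] at h1
  have h2 := log_add_one_le_harmonic M
  have h3 : Real.log (z / W) ≤ Real.log ((M + 1 : ℕ) : ℝ) := by
    refine Real.log_le_log (by positivity) ?_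
    push_cast; exact (Nat.lt_floor_add_one _).le
  have h4 : M * W ≤ ⌊z⌋₊ := by
    refine Nat.le_floor ?_
    push_cast
    have := Nat.floor_le (show 0 ≤ z / W by positivity)
    rwa [← hM, le_div_iff₀ h0] at this
  have h5 : ∑ a ∈ range (M * W), cf W a ≤ ∑ a ∈ Ioc 0 ⌊z⌋₊, cf W a := by
    calc _ ≤ ∑ a ∈ range (⌊z⌋₊ + 1), cf W a := sum_le_sum_of_subset_of_nonneg (range_subset_range.mpr (by omega)) fun a _ _ => cf_nonneg _ _
      _ = _ := by
        symm
        refine sum_subset (fun a ha => by rw [mem_Ioc] at ha; rw [mem_range]; omega) fun a ha hb => ?_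
        rw [mem_range] at ha; rw [mem_Ioc] at hb
        have : a = 0 := by omega
        subst this; unfold cf; simp
  have h6 : 0 ≤ (Nat.totient W : ℝ) / W := by positivity
  calc _ ≤ (Nat.totient W : ℝ) / W * ((harmonic M : ℚ) : ℝ) := mul_le_mul_of_nonneg_left (h3.trans h2) h6
    _ ≤ _ := by linarith

lemma cf_upper {W : ℕ} (hW : 2 ≤ W) (z : ℝ) (hz : (W : ℝ) ≤ z) :
    ∑ a ∈ Ioc 0 ⌊z⌋₊, cf W a ≤ W + (Nat.totient W : ℝ) / W * (1 + Real.log z) := by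
  have h0 : (0 : ℝ) < W := by exact_mod_cast (by omega : 0 < W)
  have hW1 : (1 : ℝ) ≤ W := by exact_mod_cast (by omega : 1 ≤ W)
  have hz0 : 0 < z := h0.trans_le hz
  set M := ⌊z / W⌋₊ with hM
  have h1 := range_upper hW M
  rw [harm_range] at h1
  have h2 := harmonic_le_one_add_log M
  have hM1 : 1 ≤ M := Nat.le_floor (by rw [Nat.cast_one, le_div_iff₀ h0]; linarith)
  have h3 : Real.log M ≤ Real.log z := by
    refine Real.log_le_log (by exact_mod_cast hM1) ?_
    exact (Nat.floor_le (by positivity)).trans (div_le_self hz0.le hW1)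
  have h4 : ⌊z⌋₊ < (M + 1) * W := by
    rw [Nat.floor_lt hz0.le]
    push_cast
    rw [← div_lt_iff₀ h0]
    exact Nat.lt_floor_add_one _
  have h5 : ∑ a ∈ Ioc 0 ⌊z⌋₊, cf W a ≤ ∑ a ∈ range ((M + 1) * W), cf W a :=
    sum_le_sum_of_subset_of_nonneg (fun a ha => by rw [mem_Ioc] at ha; rw [mem_range]; omega) fun a _ _ => cf_nonneg _ _
  have h6 : 0 ≤ (Nat.totient W : ℝ) / W := by positivity
  have h7 := mul_le_mul_of_nonneg_left (h2.trans (add_le_add_right h3 1)) h6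
  linarith

lemma inv_sq_sum_le (N : ℕ) : ∑ m ∈ Ioc 0 N, 1 / (m : ℝ) ^ 2 ≤ 2 := by
  have := sum_Ioo_inv_sq_le (α := ℝ) 0 (N + 1)
  have e : Ioo 0 (N + 1) = Ioc 0 N := by
    ext x; simp only [mem_Ioo, mem_Ioc]; omega
  rw [e] at this
  simpa using this

lemma cf_sqfree (W N : ℕ) : ∑ a ∈ Ioc 0 N, cf W a ≤ 2 * ∑ b ∈ (Ioc 0 N).filter Squarefree, cf W b := by
  choose b m hbm using fun n : ℕ => Nat.sq_mul_squarefree n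
  have hS : 0 ≤ ∑ b ∈ (Ioc 0 N).filter Squarefree, cf W b := sum_nonneg fun _ _ => cf_nonneg _ _
  calc _ ≤ ∑ a ∈ Ioc 0 N, cf W (b a) * (1 / (m a : ℝ) ^ 2) := sum_le_sum fun a ha => by
        have h := (hbm a).1
        unfold cf
        by_cases hc : W.Coprime a
        · have hb : W.Coprime (b a) := Nat.Coprime.coprime_dvd_right ⟨_, by rw [mul_comm]; exact h.symm⟩ hc
          rw [if_pos hc, if_pos hb, ← h]
          have : ((m a ^ 2 * b a : ℕ) : ℝ) = m a ^ 2 * b a := by push_cast; ring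
          rw [h, ← h, this, h]
          rw [one_div, one_div, one_div, mul_inv, mul_comm]
        · rw [if_neg hc]; split_ifs <;> positivity
    _ = ∑ q ∈ (Ioc 0 N).image (fun a => (b a, m a)), cf W q.1 * (1 / (q.2 : ℝ) ^ 2) := by
        rw [sum_image]
        intro a _ a' _ haa
        simp only [Prod.mk.injEq] at haa
        rw [← (hbm a).1, ← (hbm a').1, haa.1, haa.2]
    _ ≤ ∑ q ∈ ((Ioc 0 N).filter Squarefree) ×ˢ (Ioc 0 N), cf W q.1 * (1 / (q.2 : ℝ) ^ 2) := by
        refine sum_le_sum_of_subset_of_nonneg ?_ fun q _ _ => mul_nonneg (cf_nonneg _ _) (by positivity)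
        intro q hq
        obtain ⟨a, ha, rfl⟩ := mem_image.mp hq
        rw [mem_Ioc] at ha
        have h := (hbm a).1
        have h1 : 0 < m a ^ 2 * b a := by omega
        have hb : 0 < b a := Nat.pos_of_ne_zero fun h => by simp [h] at h1
        have hm : 0 < m a := Nat.pos_of_ne_zero fun h => by simp [h] at h1
        have h2 : b a ≤ m a ^ 2 * b a := Nat.le_mul_of_pos_left _ (by positivity)
        have h3 : m a ≤ m a ^ 2 * b a := by nlinarith [Nat.mul_le_mul_left (m a) hb, Nat.mul_le_mul_left (m a * b a) hm]
        simp only [mem_product, mem_filter, mem_Ioc]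
        exact ⟨⟨⟨hb, by omega⟩, (hbm a).2⟩, hm, by omega⟩
    _ = (∑ b ∈ (Ioc 0 N).filter Squarefree, cf W b) * ∑ m ∈ Ioc 0 N, 1 / (m : ℝ) ^ 2 := by
        rw [sum_product, sum_mul_sum]
    _ ≤ (∑ b ∈ (Ioc 0 N).filter Squarefree, cf W b) * 2 := mul_le_mul_of_nonneg_left (inv_sq_sum_le N) hS
    _ = _ := mul_comm _ _

end V
end TDR

namespace TDR
open Finset

structure PE (D R : ℕ) {s : ℕ} (pr : Fin s → ℕ) : Prop where
  inj : Function.Injective pr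
  prime : ∀ t, (pr t).Prime
  lo : ∀ t, D < pr t
  hi : ∀ t, pr t ≤ R
  surj : ∀ p : ℕ, p.Prime → D < p → p ≤ R → ∃ t, pr t = p

lemma PE_exists (D R : ℕ) : ∃ (s : ℕ) (pr : Fin s → ℕ), PE D R pr := by
  set T := (Ioc D R).filter Nat.Prime with hT
  refine ⟨T.card, fun t => (T.equivFin.symm t : ℕ), ?_, ?_, ?_, ?_, ?_⟩
  · intro a b h
    exact T.equivFin.symm.injective (Subtype.ext h)
  · intro t; exact (mem_filter.mp (T.equivFin.symm t).2).2
  · intro t; exact (mem_Ioc.mp (mem_filter.mp (T.equivFin.symm t).2).1).1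
  · intro t; exact (mem_Ioc.mp (mem_filter.mp (T.equivFin.symm t).2).1).2
  · intro p hp h1 h2
    exact ⟨T.equivFin ⟨p, mem_filter.mpr ⟨mem_Ioc.mpr ⟨h1, h2⟩, hp⟩⟩, by simp⟩

def pn {s : ℕ} (pr : Fin s → ℕ) (S : Finset (Fin s)) : ℕ := ∏ t ∈ S, pr t

lemma primorial_dvd {D p : ℕ} (hp : p.Prime) (h : p ≤ D) : p ∣ primorial D :=
  dvd_prod_of_mem _ (mem_filter.mpr ⟨mem_range.mpr (by omega), hp⟩)

lemma primorial_le_of_dvd {D p : ℕ} (hp : p.Prime) (h : p ∣ primorial D) : p ≤ D := by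
  unfold primorial at h
  obtain ⟨q, hq, hpq⟩ := (Prime.dvd_finset_prod_iff hp.prime _).mp h
  rw [mem_filter, mem_range] at hq
  rw [(Nat.prime_dvd_prime_iff_eq hp hq.2).mp hpq]; omega

lemma primorial_cop {D a : ℕ} : (primorial D).Coprime a ↔ ∀ p : ℕ, p.Prime → p ∣ a → D < p := by
  constructor
  · intro h p hp hpa
    by_contra hh
    exact hp.one_lt.ne' (Nat.dvd_one.mp (h ▸ Nat.dvd_gcd (primorial_dvd hp (by omega)) hpa))
  · intro h
    refine Nat.Coprime.prod_left fun q hq => ?_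
    rw [mem_filter, mem_range] at hq
    rw [Nat.Prime.coprime_iff_not_dvd hq.2]
    intro hd
    have := h q hq.2 hd
    omega

section
variable {D R s : ℕ} {pr : Fin s → ℕ}

lemma PS_pn (S : Finset (Fin s)) : PS (fun t => (pr t : ℝ)) S = (pn pr S : ℝ) := by
  unfold PS pn; push_cast; rfl

lemma pn_dvd (h : PE D R pr) {S : Finset (Fin s)} {p : ℕ} (hp : p.Prime) :
    p ∣ pn pr S ↔ ∃ t ∈ S, pr t = p := by
  unfold pn
  rw [Prime.dvd_finset_prod_iff hp.prime]
  constructor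
  · rintro ⟨t, ht, hd⟩; exact ⟨t, ht, ((Nat.prime_dvd_prime_iff_eq hp (h.prime t)).mp hd).symm⟩
  · rintro ⟨t, ht, rfl⟩; exact ⟨t, ht, dvd_rfl⟩

lemma pn_pos (h : PE D R pr) (S : Finset (Fin s)) : 0 < pn pr S := prod_pos fun t _ => (h.prime t).pos

lemma mem_of_dvd_pn (h : PE D R pr) {S : Finset (Fin s)} {t : Fin s} : pr t ∣ pn pr S ↔ t ∈ S := by
  rw [pn_dvd h (h.prime t)]
  constructor
  · rintro ⟨t', ht, e⟩; rwa [← h.inj e]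
  · intro ht; exact ⟨t, ht, rfl⟩

lemma pn_inj (h : PE D R pr) : Function.Injective (pn pr) := by
  intro S S' e
  ext t
  rw [← mem_of_dvd_pn h, e, mem_of_dvd_pn h]

lemma pn_cop (h : PE D R pr) (S : Finset (Fin s)) : (primorial D).Coprime (pn pr S) := by
  rw [primorial_cop]
  intro p hp hd
  obtain ⟨t, _, rfl⟩ := (pn_dvd h hp).mp hd
  exact h.lo t

lemma VV_le_cf (h : PE D R pr) (z : ℝ) :
    VV (fun t => (pr t : ℝ)) z ≤ ∑ a ∈ Ioc 0 ⌊z⌋₊, cf (primorial D) a := by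
  unfold VV
  rw [← sum_filter]
  calc _ = ∑ S ∈ univ.filter (fun S => PS (fun t => (pr t : ℝ)) S ≤ z), cf (primorial D) (pn pr S) :=
        sum_congr rfl fun S _ => by
          unfold cf; rw [if_pos (pn_cop h S), PS_pn, one_div]
    _ = ∑ a ∈ (univ.filter (fun S => PS (fun t => (pr t : ℝ)) S ≤ z)).image (pn pr), cf (primorial D) a := by
        rw [sum_image (fun a _ b _ e => pn_inj h e)]
    _ ≤ _ := sum_le_sum_of_subset_of_nonneg (fun a ha => by
        obtain ⟨S, hS, rfl⟩ := mem_image.mp ha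
        rw [mem_filter, PS_pn] at hS
        exact mem_Ioc.mpr ⟨pn_pos h S, Nat.le_floor hS.2⟩) fun a _ _ => cf_nonneg _ _

lemma cf_le_VV (h : PE D R pr) (z : ℝ) (hz : 0 ≤ z) (hzR : z ≤ R) :
    ∑ a ∈ (Ioc 0 ⌊z⌋₊).filter Squarefree, cf (primorial D) a ≤ VV (fun t => (pr t : ℝ)) z := by
  unfold VV
  rw [← sum_filter]
  calc _ = ∑ a ∈ ((Ioc 0 ⌊z⌋₊).filter Squarefree).filter (fun a => (primorial D).Coprime a), cf (primorial D) a := by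
        unfold cf; rw [sum_filter (fun a => (primorial D).Coprime a)]
        exact sum_congr rfl fun a _ => by split_ifs <;> rfl
    _ ≤ ∑ a ∈ (univ.filter (fun S => PS (fun t => (pr t : ℝ)) S ≤ z)).image (pn pr), cf (primorial D) a := by
        refine sum_le_sum_of_subset_of_nonneg (fun a ha => ?_) fun a _ _ => cf_nonneg _ _
        rw [mem_filter, mem_filter, mem_Ioc] at ha
        obtain ⟨⟨⟨ha0, haz⟩, hsq⟩, hc⟩ := ha
        have haz' : (a : ℝ) ≤ z := (Nat.le_floor_iff hz).mp haz
        have haR : a ≤ R := by exact_mod_cast haz'.trans hzR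
        have e : pn pr (univ.filter fun t => pr t ∣ a) = a := by
          conv_rhs => rw [← Nat.prod_primeFactors_of_squarefree hsq]
          unfold pn
          rw [← prod_image (s := univ.filter fun t => pr t ∣ a) (g := pr) (f := fun x => x) (fun a _ b _ e => h.inj e)]
          congr 1
          ext q
          simp only [mem_image, mem_filter, mem_univ, true_and, Nat.mem_primeFactors]
          constructor
          · rintro ⟨t, ht, rfl⟩; exact ⟨h.prime t, ht, by omega⟩
          · rintro ⟨hq, hqa, _⟩
            obtain ⟨t, rfl⟩ := h.surj q hq (primorial_cop.mp hc q hq hqa) ((Nat.le_of_dvd ha0 hqa).trans haR)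
            exact ⟨t, hqa, rfl⟩
        refine mem_image.mpr ⟨_, ?_, e⟩
        rw [mem_filter, PS_pn, e]
        exact ⟨mem_univ _, haz'⟩
    _ = ∑ S ∈ univ.filter (fun S => PS (fun t => (pr t : ℝ)) S ≤ z), cf (primorial D) (pn pr S) := by
        rw [sum_image (fun a _ b _ e => pn_inj h e)]
    _ = _ := sum_congr rfl fun S _ => by
          unfold cf; rw [if_pos (pn_cop h S), PS_pn, one_div]

lemma VV_le_log (h : PE D R pr) (z : ℝ) (hz : 1 ≤ z) : VV (fun t => (pr t : ℝ)) z ≤ 1 + Real.log z := by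
  refine (VV_le_cf h z).trans ?_
  calc _ ≤ ∑ a ∈ Ioc 0 ⌊z⌋₊, 1 / (a : ℝ) := sum_le_sum fun a _ => by unfold cf; split_ifs; rfl; positivity
    _ ≤ 1 + Real.log ⌊z⌋₊ := harm_le _
    _ ≤ _ := by
        have h1 : 1 ≤ ⌊z⌋₊ := Nat.le_floor (by simpa using hz)
        have := Real.log_le_log (show (0:ℝ) < ⌊z⌋₊ by exact_mod_cast h1) (Nat.floor_le (by linarith))
        linarith

noncomputable def dl (W : ℕ) : ℝ := (Nat.totient W : ℝ) / W

lemma dl_pos {W : ℕ} (h : 0 < W) : 0 < dl W := by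
  have : 0 < Nat.totient W := Nat.totient_pos.mpr h
  unfold dl; positivity

lemma dl_le_one (W : ℕ) : dl W ≤ 1 := by
  unfold dl
  exact div_le_one_of_le₀ (by exact_mod_cast Nat.totient_le W) (by positivity)

lemma VV_lower (h : PE D R pr) (hW : 2 ≤ primorial D) (z : ℝ) (hz : (primorial D : ℝ) ^ 2 ≤ z) (hzR : z ≤ R) :
    dl (primorial D) * Real.log z / 4 ≤ VV (fun t => (pr t : ℝ)) z := by
  have hW2 : (2 : ℝ) ≤ primorial D := by exact_mod_cast hW
  have hWz : (primorial D : ℝ) ≤ z := by nlinarith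
  have h1 := cf_lower hW z hWz
  have h2 := cf_sqfree (primorial D) ⌊z⌋₊
  have h3 := cf_le_VV h z (by linarith) hzR
  have h4 : Real.log z / 2 ≤ Real.log (z / primorial D) := by
    rw [Real.log_div (by linarith) (by linarith)]
    have := Real.log_le_log (by positivity) hz
    rw [Real.log_pow] at this
    push_cast at this; linarith
  have h5 := mul_le_mul_of_nonneg_left h4 (dl_pos (show 0 < primorial D by omega)).le
  unfold dl at *
  linarith

lemma VV_upper (h : PE D R pr) (hW : 2 ≤ primorial D) (z : ℝ) (hz : (primorial D : ℝ) ^ 2 ≤ z) 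
    (hz2 : (primorial D : ℝ) ≤ dl (primorial D) * Real.log z) (hz1 : 1 ≤ Real.log z) :
    VV (fun t => (pr t : ℝ)) z ≤ 3 * dl (primorial D) * Real.log z := by
  have hW2 : (2 : ℝ) ≤ primorial D := by exact_mod_cast hW
  have hWz : (primorial D : ℝ) ≤ z := by nlinarith
  have h1 := cf_upper hW z hWz
  have h3 := VV_le_cf h z
  have h5 := mul_le_mul_of_nonneg_left hz1 (dl_pos (show 0 < primorial D by omega)).le
  unfold dl at *
  linarith

end
end TDR

namespace TDR
open Finset

lemma geom_le_two (J : ℕ) : ∑ j ∈ range J, (1 / 2 : ℝ) ^ j ≤ 2 := by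
  rw [geom_sum_eq (by norm_num)]
  have : (0 : ℝ) ≤ (1 / 2) ^ J := by positivity
  have e : ((1 / 2 : ℝ) ^ J - 1) / (1 / 2 - 1) = 2 - 2 * (1 / 2) ^ J := by ring
  rw [e]; linarith

lemma geom_sq (J : ℕ) : ∀ u : ℕ → ℝ, (∀ j, u j = 0 ∨ u j = 1) →
    (∑ j ∈ range J, (1 / 2 : ℝ) ^ j * u j) ^ 2 ≤ 4 * ∑ j ∈ range J, (1 / 4 : ℝ) ^ j * u j := by
  induction J with
  | zero => intro u _; simp
  | succ J ih =>
    intro u hu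
    have hu0 : ∀ j, 0 ≤ u j := fun j => by rcases hu j with h | h <;> rw [h]; norm_num
    have hu1 : ∀ j, u j ≤ 1 := fun j => by rcases hu j with h | h <;> rw [h]; norm_num
    rcases hu 0 with h | h
    · rw [sum_range_succ', sum_range_succ', h]
      have := ih (fun j => u (j + 1)) fun j => hu (j + 1)
      have e1 : ∑ j ∈ range J, (1 / 2 : ℝ) ^ (j + 1) * u (j + 1) = 1 / 2 * ∑ j ∈ range J, (1 / 2 : ℝ) ^ j * u (j + 1) := by
        rw [mul_sum]; exact sum_congr rfl fun j _ => by ring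
      have e2 : ∑ j ∈ range J, (1 / 4 : ℝ) ^ (j + 1) * u (j + 1) = 1 / 4 * ∑ j ∈ range J, (1 / 4 : ℝ) ^ j * u (j + 1) := by
        rw [mul_sum]; exact sum_congr rfl fun j _ => by ring
      rw [e1, e2]
      simp only [mul_zero, add_zero]
      nlinarith
    · have h1 : ∑ j ∈ range (J + 1), (1 / 2 : ℝ) ^ j * u j ≤ 2 :=
        (sum_le_sum fun j _ => mul_le_of_le_one_right (by positivity) (hu1 j)).trans (geom_le_two _)
      have h0 : 0 ≤ ∑ j ∈ range (J + 1), (1 / 2 : ℝ) ^ j * u j := sum_nonneg fun j _ => mul_nonneg (by positivity) (hu0 j)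
      have h2 : 1 ≤ ∑ j ∈ range (J + 1), (1 / 4 : ℝ) ^ j * u j := by
        have := single_le_sum (f := fun j => (1 / 4 : ℝ) ^ j * u j) (s := range (J + 1)) (fun j _ => mul_nonneg (by positivity) (hu0 j)) (mem_range.mpr (Nat.succ_pos J))
        simpa [h] using this
      nlinarith

section
variable {s : ℕ}

noncomputable def Gz (J : ℕ) (z : ℕ → ℝ) (p : Fin s → ℝ) (S : Finset (Fin s)) : ℝ :=
  ∑ j ∈ range (J + 1), (1 / 2 : ℝ) ^ j * (if PS p S ≤ z j then 1 else 0)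

variable {J : ℕ} {z : ℕ → ℝ} {p : Fin s → ℝ}

lemma Gz_nonneg (S : Finset (Fin s)) : 0 ≤ Gz J z p S :=
  sum_nonneg fun j _ => mul_nonneg (by positivity) (by split_ifs <;> norm_num)

lemma Gz_le_two (S : Finset (Fin s)) : Gz J z p S ≤ 2 :=
  (sum_le_sum fun j _ => mul_le_of_le_one_right (by positivity) (by split_ifs <;> norm_num)).trans (geom_le_two _)

lemma Gz_anti (hp : ∀ t, 1 ≤ p t) (S : Finset (Fin s)) (t : Fin s) : Gz J z p S ≤ Gz J z p (S.erase t) := by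
  refine sum_le_sum fun j _ => mul_le_mul_of_nonneg_left ?_ (by positivity)
  have h : PS p (S.erase t) ≤ PS p S := by
    unfold PS
    by_cases ht : t ∈ S
    · rw [← mul_prod_erase S p ht]
      exact le_mul_of_one_le_left (prod_nonneg fun i _ => by linarith [hp i]) (hp t)
    · rw [erase_eq_of_notMem ht]
  split_ifs with h1 h2
  · rfl
  · exact absurd (h.trans h1) h2
  · norm_num
  · rfl

lemma AA1_eq : AA (Gz J z p) p 1 = ∑ j ∈ range (J + 1), (1 / 2 : ℝ) ^ j * VV p (z j) := by
  unfold AA VV Gz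
  simp only [pow_one, sum_mul, mul_sum]
  rw [sum_comm]
  exact sum_congr rfl fun j _ => sum_congr rfl fun S _ => by split_ifs <;> ring

lemma Gz_sq (S : Finset (Fin s)) : Gz J z p S ^ 2 ≤ 4 * ∑ j ∈ range (J + 1), (1 / 4 : ℝ) ^ j * (if PS p S ≤ z j then 1 else 0) :=
  geom_sq _ _ fun j => by split_ifs <;> simp

lemma AA2_le (hp : ∀ t, 1 ≤ p t) : AA (Gz J z p) p 2 ≤ 4 * ∑ j ∈ range (J + 1), (1 / 4 : ℝ) ^ j * VV p (z j) := by
  calc _ ≤ ∑ S, (4 * ∑ j ∈ range (J + 1), (1 / 4 : ℝ) ^ j * (if PS p S ≤ z j then 1 else 0)) * (PS p S)⁻¹ :=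
        sum_le_sum fun S _ => mul_le_mul_of_nonneg_right (Gz_sq S) (inv_nonneg.mpr (by linarith [PS_one_le hp S]))
    _ = _ := by
        unfold VV
        simp only [sum_mul, mul_sum]
        rw [sum_comm]
        exact sum_congr rfl fun j _ => sum_congr rfl fun S _ => by split_ifs <;> ring

lemma AA2_ge (hp : ∀ t, 1 ≤ p t) : VV p (z 0) ≤ AA (Gz J z p) p 2 := by
  refine sum_le_sum fun S _ => ?_
  have h0 : 0 ≤ (PS p S)⁻¹ := inv_nonneg.mpr (by linarith [PS_one_le hp S])
  split_ifs with h
  · have h1 : 1 ≤ Gz J z p S := by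
      have := single_le_sum (f := fun j => (1 / 2 : ℝ) ^ j * (if PS p S ≤ z j then (1:ℝ) else 0)) (s := range (J + 1))
        (fun j _ => mul_nonneg (by positivity) (by split_ifs <;> norm_num)) (mem_range.mpr (Nat.succ_pos J))
      unfold Gz
      refine le_trans (le_of_eq ?_) this
      simp [h]
    have h2 : 1 ≤ Gz J z p S ^ 2 := one_le_pow₀ h1
    exact le_mul_of_one_le_left h0 h2
  · exact mul_nonneg (sq_nonneg _) h0

lemma ind_log (hp : ∀ t, 1 ≤ p t) (S : Finset (Fin s)) (z : ℝ) :
    (if PS p S ≤ z then (1:ℝ) else 0) * ((PS p S)⁻¹ * Real.log (PS p S)) ≤ (if PS p S ≤ z then (PS p S)⁻¹ else 0) * Real.log z := by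
  have h1 := PS_one_le hp S
  split_ifs with h
  · rw [one_mul]
    exact mul_le_mul_of_nonneg_left (Real.log_le_log (by linarith) h) (inv_nonneg.mpr (by linarith))
  · simp

lemma MM1_le (hp : ∀ t, 1 ≤ p t) : MM (Gz J z p) p 1 ≤ ∑ j ∈ range (J + 1), (1 / 2 : ℝ) ^ j * (VV p (z j) * Real.log (z j)) := by
  unfold MM VV Gz
  simp only [pow_one, sum_mul, mul_sum]
  rw [sum_comm]
  refine sum_le_sum fun j _ => sum_le_sum fun S _ => ?_
  rw [mul_assoc, mul_assoc]
  exact mul_le_mul_of_nonneg_left (ind_log hp S (z j)) (by positivity)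

lemma MM2_le (hp : ∀ t, 1 ≤ p t) : MM (Gz J z p) p 2 ≤ 4 * ∑ j ∈ range (J + 1), (1 / 4 : ℝ) ^ j * (VV p (z j) * Real.log (z j)) := by
  calc _ ≤ ∑ S, (4 * ∑ j ∈ range (J + 1), (1 / 4 : ℝ) ^ j * (if PS p S ≤ z j then 1 else 0)) * ((PS p S)⁻¹ * Real.log (PS p S)) :=
        sum_le_sum fun S _ => by
          rw [mul_assoc]
          have := PS_one_le hp S
          exact mul_le_mul_of_nonneg_right (Gz_sq S) (mul_nonneg (inv_nonneg.mpr (by linarith)) (Real.log_nonneg this))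
    _ ≤ _ := by
        unfold VV
        simp only [sum_mul, mul_sum]
        rw [sum_comm]
        refine sum_le_sum fun j _ => sum_le_sum fun S _ => ?_
        rw [mul_assoc, mul_assoc]
        exact mul_le_mul_of_nonneg_left (mul_le_mul_of_nonneg_left (ind_log hp S (z j)) (by positivity)) (by norm_num)

/-- numerics of the weight function -/
lemma G_numerics (hp : ∀ t, 1 ≤ p t) {δ l τ : ℝ} (hδ : 0 < δ) (hl : 0 < l) (J : ℕ)
    (hτ : τ = 1 / (384 * 2 ^ J * (J + 1)))
    (hz : ∀ j, z j = Real.exp (2 ^ j * τ * l))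
    (hV : ∀ j ≤ J, δ * (2 ^ j * τ * l) / 4 ≤ VV p (z j) ∧ VV p (z j) ≤ 3 * δ * (2 ^ j * τ * l)) :
    (J + 1) * (δ * τ * l) / 4 ≤ AA (Gz J z p) p 1 ∧ AA (Gz J z p) p 2 ≤ 24 * (δ * τ * l) ∧
    0 < AA (Gz J z p) p 2 ∧ MM (Gz J z p) p 1 ≤ 1/8 * l * AA (Gz J z p) p 1 ∧
    2 ^ J * MM (Gz J z p) p 2 ≤ 1/8 * l * AA (Gz J z p) p 2 := by
  have hτ0 : 0 < τ := by rw [hτ]; positivity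
  have hτ1 : 384 * 2 ^ J * (J + 1) * τ = 1 := by rw [hτ]; field_simp
  have hlz : ∀ j, Real.log (z j) = 2 ^ j * τ * l := fun j => by rw [hz, Real.log_exp]
  have hJ : ∀ j ∈ range (J + 1), j ≤ J := fun j hj => by rw [mem_range] at hj; omega
  have a1 : (J + 1) * (δ * τ * l) / 4 ≤ AA (Gz J z p) p 1 := by
    rw [AA1_eq]
    calc (J + 1) * (δ * τ * l) / 4 = ∑ j ∈ range (J + 1), δ * τ * l / 4 := by simp; ring
      _ ≤ _ := sum_le_sum fun j hj => by
          have := mul_le_mul_of_nonneg_left (hV j (hJ j hj)).1 (show (0:ℝ) ≤ (1/2)^j by positivity)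
          refine le_trans (le_of_eq ?_) this
          have : (1 / 2 : ℝ) ^ j * 2 ^ j = 1 := by rw [← mul_pow]; norm_num
          linear_combination (-(δ * τ * l / 4)) * this
  have a2 : AA (Gz J z p) p 2 ≤ 24 * (δ * τ * l) := by
    refine (AA2_le hp).trans ?_
    calc _ ≤ 4 * ∑ j ∈ range (J + 1), (1 / 2 : ℝ) ^ j * (3 * (δ * τ * l)) := by
          refine mul_le_mul_of_nonneg_left (sum_le_sum fun j hj => ?_) (by norm_num)
          refine (mul_le_mul_of_nonneg_left (hV j (hJ j hj)).2 (by positivity)).trans (le_of_eq ?_)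
          have : (1 / 4 : ℝ) ^ j * 2 ^ j = (1 / 2) ^ j := by rw [← mul_pow]; norm_num
          linear_combination (3 * (δ * τ * l)) * this
      _ ≤ _ := by
          rw [← sum_mul]
          have := mul_le_mul_of_nonneg_right (geom_le_two (J + 1)) (show 0 ≤ 3 * (δ * τ * l) by positivity)
          linarith
  have a3 : δ * τ * l / 4 ≤ AA (Gz J z p) p 2 := by
    refine le_trans ?_ (AA2_ge hp)
    have := (hV 0 (Nat.zero_le _)).1
    rw [pow_zero, one_mul] at this
    linarith
  refine ⟨a1, a2, lt_of_lt_of_le (by positivity) a3, ?_, ?_⟩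
  · have : MM (Gz J z p) p 1 ≤ 6 * 2 ^ J * (δ * τ * l) * (τ * l) := by
      refine (MM1_le hp).trans ?_
      calc _ ≤ ∑ j ∈ range (J + 1), (2 : ℝ) ^ j * (3 * (δ * τ * l) * (τ * l)) := sum_le_sum fun j hj => by
            rw [hlz]
            refine (mul_le_mul_of_nonneg_left (mul_le_mul_of_nonneg_right (hV j (hJ j hj)).2 (by positivity)) (by positivity)).trans (le_of_eq ?_)
            have : (1 / 2 : ℝ) ^ j * 2 ^ j = 1 := by rw [← mul_pow]; norm_num
            linear_combination (3 * 2 ^ j * (δ * τ * l) * (τ * l)) * this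
        _ ≤ _ := by
            rw [← sum_mul, geom_sum_eq (by norm_num), pow_succ]
            have : 0 ≤ 3 * (δ * τ * l) * (τ * l) := by positivity
            have e : ((2:ℝ) ^ J * 2 - 1) / (2 - 1) = 2 ^ J * 2 - 1 := by norm_num
            rw [e]; nlinarith
    refine this.trans ?_
    have h2 := mul_le_mul_of_nonneg_left a1 (show 0 ≤ 1/8 * l by positivity)
    refine le_trans ?_ h2
    have h3 : 192 * 2 ^ J * τ ≤ (J + 1) := by
      have hJ0 : (0:ℝ) ≤ J := by positivity
      have : 0 ≤ 2 ^ J * τ := by positivity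
      nlinarith
    have h4 := mul_le_mul_of_nonneg_right h3 (show 0 ≤ δ * τ * l * l / 32 by positivity)
    linarith
  · have : MM (Gz J z p) p 2 ≤ 12 * (J + 1) * (δ * τ * l) * (τ * l) := by
      refine (MM2_le hp).trans ?_
      calc _ ≤ 4 * ∑ j ∈ range (J + 1), (3 * (δ * τ * l) * (τ * l)) := by
            refine mul_le_mul_of_nonneg_left (sum_le_sum fun j hj => ?_) (by norm_num)
            rw [hlz]
            refine (mul_le_mul_of_nonneg_left (mul_le_mul_of_nonneg_right (hV j (hJ j hj)).2 (by positivity)) (by positivity)).trans (le_of_eq ?_)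
            have : (1 / 4 : ℝ) ^ j * (2 ^ j * 2 ^ j) = 1 := by rw [← mul_pow, ← mul_pow]; norm_num
            linear_combination (3 * (δ * τ * l) * (τ * l)) * this
        _ = _ := by simp; ring
    have h2 := mul_le_mul_of_nonneg_left a3 (show 0 ≤ 1/8 * l by positivity)
    refine le_trans ?_ h2
    refine (mul_le_mul_of_nonneg_left this (by positivity)).trans (le_of_eq ?_)
    linear_combination (δ * τ * l * l / 32) * hτ1

end
end TDR

namespace TDR
open Finset

noncomputable def QQ (E : ℕ) : ℝ := ∏ p ∈ (Ioc 0 E).filter Nat.Prime, (1 - 1 / (p : ℝ))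

lemma fac_pos {p : ℕ} (hp : p.Prime) : (0 : ℝ) < 1 - 1 / (p : ℝ) := by
  have : (1 : ℝ) < p := by exact_mod_cast hp.one_lt
  rw [sub_pos, div_lt_one (by linarith)]; exact this

lemma fac_le {p : ℕ} : (1 : ℝ) - 1 / (p : ℝ) ≤ 1 := by
  have : (0 : ℝ) ≤ 1 / p := by positivity
  linarith

lemma QQ_pos (E : ℕ) : 0 < QQ E := prod_pos fun p hp => fac_pos (mem_filter.mp hp).2

lemma prod_sub_le {S T : Finset ℕ} {f : ℕ → ℝ} (h : S ⊆ T) (h0 : ∀ p ∈ T, 0 ≤ f p) (h1 : ∀ p ∈ T, p ∉ S → f p ≤ 1) :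
    ∏ p ∈ T, f p ≤ ∏ p ∈ S, f p := by
  rw [← prod_sdiff h]
  refine mul_le_of_le_one_left (prod_nonneg fun p hp => h0 p (h hp)) (prod_le_one (fun p hp => h0 p (mem_sdiff.mp hp).1) fun p hp => ?_)
  rw [mem_sdiff] at hp
  exact h1 p hp.1 hp.2

lemma QQ_small (ε : ℝ) (hε : 0 < ε) (E : ℕ) : ∃ E' > E, QQ E' ≤ ε := by
  have h := not_summable_one_div_on_primes
  rw [not_summable_iff_tendsto_nat_atTop_of_nonneg (fun n => Set.indicator_nonneg (fun _ _ => by positivity) n)] at h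
  obtain ⟨N, hN⟩ := ((h.eventually (Filter.eventually_ge_atTop (-Real.log ε))).and (Filter.eventually_gt_atTop (E + 1))).exists
  refine ⟨N - 1, by omega, ?_⟩
  have h1 : QQ (N - 1) ≤ Real.exp (- ∑ p ∈ (Ioc 0 (N-1)).filter Nat.Prime, 1 / (p : ℝ)) := by
    rw [← sum_neg_distrib, Real.exp_sum]
    refine prod_le_prod (fun p hp => (fac_pos (mem_filter.mp hp).2).le) fun p _ => ?_
    have := Real.add_one_le_exp (-(1 / (p : ℝ)))
    linarith
  have h2 : ∑ i ∈ range N, Set.indicator {p : ℕ | p.Prime} (fun n : ℕ => (1 : ℝ) / n) i = ∑ p ∈ (Ioc 0 (N-1)).filter Nat.Prime, 1 / (p : ℝ) := by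
    simp only [Set.indicator_apply, Set.mem_setOf_eq]
    rw [← sum_filter]
    refine sum_congr ?_ fun _ _ => rfl
    ext p
    simp only [mem_filter, mem_range, mem_Ioc]
    refine and_congr_left fun hp => ?_
    have := hp.pos; omega
  rw [← h2] at h1
  refine h1.trans ?_
  rw [← Real.exp_log hε]
  exact Real.exp_le_exp.mpr (by linarith [hN.1])

lemma blocks (E0 : ℕ) : ∃ E : ℕ → ℕ, E 0 = E0 ∧ (∀ i, E i < E (i + 1)) ∧ ∀ i, QQ (E (i + 1)) ≤ QQ (E i) * (QQ (E i) / 4) := by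
  choose f hf1 hf2 using fun E : ℕ => QQ_small (QQ E * (QQ E / 4)) (by have := QQ_pos E; positivity) E
  refine ⟨fun i => f^[i] E0, rfl, fun i => ?_, fun i => ?_⟩
  · simp only [Function.iterate_succ_apply']; exact hf1 _
  · simp only [Function.iterate_succ_apply']; exact hf2 _

lemma crt (D : ℕ) (a : ℕ → ℤ) : ∃ b : ℕ, ∀ p : ℕ, p.Prime → p ≤ D → (p : ℤ) ∣ b - a p := by
  have := Nat.chineseRemainderOfFinset (fun p => (a p % p).toNat) (fun p => p) ((Ioc 0 D).filter Nat.Prime)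
    (fun p hp => (mem_filter.mp hp).2.ne_zero) (fun p hp q hq hpq => by
      simp only [coe_filter, Set.mem_setOf_eq] at hp hq
      exact (Nat.coprime_primes hp.2 hq.2).mpr hpq)
  refine ⟨this.1, fun p hp hpD => ?_⟩
  have h := this.2 p (mem_filter.mpr ⟨mem_Ioc.mpr ⟨hp.pos, hpD⟩, hp⟩)
  have h2 : ((this.1 : ℕ) : ℤ) ≡ ((a p % p).toNat : ℕ) [ZMOD p] := Int.natCast_modEq_iff.mpr h
  rw [Int.toNat_of_nonneg (Int.emod_nonneg _ (by exact_mod_cast hp.ne_zero))] at h2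
  exact (h2.trans (Int.mod_modEq _ _)).symm.dvd

/-- small integers divisible by p vanish -/
lemma small_dvd {p H : ℕ} {x : ℤ} (hp : H < p) (hx : |x| ≤ H) (h : (p : ℤ) ∣ x) : x = 0 :=
  Int.eq_zero_of_abs_lt_dvd h (by linarith [(by exact_mod_cast hp : (H : ℤ) < p)])

lemma avoid {p k : ℕ} (hp : k < p) (f : ℕ → ℤ) : ∃ a : ℤ, ∀ i < k, ¬ (p : ℤ) ∣ a + f i := by
  haveI : NeZero p := ⟨by omega⟩
  have : ∃ x : ZMod p, x ∉ (range k).image (fun i => (-(f i : ZMod p))) := by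
    by_contra hh
    push Not at hh
    have h1 : (univ : Finset (ZMod p)) ⊆ (range k).image (fun i => (-(f i : ZMod p))) := fun x _ => hh x
    have h2 := (card_le_card h1).trans card_image_le
    rw [card_univ, ZMod.card, card_range] at h2
    omega
  obtain ⟨x, hx⟩ := this
  refine ⟨(x.val : ℤ), fun i hi hd => hx (mem_image.mpr ⟨i, mem_range.mpr hi, ?_⟩)⟩
  rw [← ZMod.intCast_zmod_eq_zero_iff_dvd] at hd
  push_cast at hd
  rw [ZMod.natCast_zmod_val] at hd
  exact (eq_neg_of_add_eq_zero_left hd).symm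

lemma residue {k H : ℕ} (hk : 2 ≤ k) (hH : H = k * k.factorial + 1) (E : ℕ → ℕ) (hE : ∀ i, E i < E (i + 1))
    (q : ℕ → ℕ) (hq : Function.Injective q) (hqH : ∀ j, H < q j) (hqE : ∀ j ≤ H, q j ≤ E 0) (hEH : H ≤ E 0) {p : ℕ} (hp : p.Prime) :
    ∃ a : ℤ, (∀ i < k, ¬ (p : ℤ) ∣ a + i * k.factorial) ∧
     (∀ j ≤ H, ¬ k.factorial ∣ j → q j = p → (p : ℤ) ∣ a + j) ∧
     (∀ i < k, E i < p → p ≤ E (i + 1) → ∀ i' < k, ((p : ℤ) ∣ a + i' * k.factorial - 1 ↔ i' = i)) := by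
  have hEm : StrictMono E := strictMono_nat_of_lt_succ hE
  have hf2 : 2 ≤ k.factorial := by
    calc 2 = Nat.factorial 2 := rfl
      _ ≤ _ := Nat.factorial_le hk
  have hf0 : (0:ℤ) < k.factorial := by exact_mod_cast k.factorial_pos
  have hb : ∀ i < k, (i : ℤ) * k.factorial + k.factorial + 1 ≤ H := by
    intro i hi
    have : (i + 1) * k.factorial ≤ k * k.factorial := Nat.mul_le_mul_right _ hi
    rw [hH]; push_cast
    have h2 : ((i : ℤ) + 1) * k.factorial ≤ k * k.factorial := by exact_mod_cast this
    linarith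
  by_cases hpE : p ≤ E 0
  · have hlast : ∀ i < k, E i < p → p ≤ E (i + 1) → ∀ a : ℤ, ∀ i' < k, ((p : ℤ) ∣ a + i' * k.factorial - 1 ↔ i' = i) := by
      intro i _ h
      exact absurd (hpE.trans (hEm.monotone (Nat.zero_le i))) (by omega)
    by_cases hpk : p ≤ k
    · refine ⟨1, fun i _ hd => ?_, fun j _ _ hqj => ?_, fun i hi h1 h2 => hlast i hi h1 h2 1⟩
      · have h1 : (p : ℤ) ∣ i * k.factorial := Dvd.dvd.mul_left (by exact_mod_cast Nat.dvd_factorial hp.pos hpk) _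
        have h2 : (p : ℤ) ∣ 1 := (dvd_add_left h1).mp hd
        have h3 : p ∣ 1 := by exact_mod_cast h2
        exact hp.one_lt.ne' (Nat.dvd_one.mp h3)
      · have := hqH j
        have h3 : k ≤ H := by rw [hH]; nlinarith
        omega
    · by_cases hpH : p ≤ H
      · obtain ⟨a, ha⟩ := avoid (p := p) (k := k) (by omega) (fun i => (i : ℤ) * k.factorial)
        refine ⟨a, ha, fun j _ _ hqj => ?_, fun i hi h1 h2 => hlast i hi h1 h2 a⟩
        have := hqH j; omega
      · by_cases hex : ∃ j ≤ H, ¬ k.factorial ∣ j ∧ q j = p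
        · obtain ⟨j, hj, hjk, hjp⟩ := hex
          refine ⟨-j, fun i hi hd => hjk ?_, fun j' _ _ hj' => ?_, fun i hi h1 h2 => hlast i hi h1 h2 _⟩
          · have hji : (j : ℤ) ≤ H := by exact_mod_cast hj
            have h0 := hb i hi
            have hi0 : (0 : ℤ) ≤ i * k.factorial := by positivity
            have hj0 : (0 : ℤ) ≤ j := by positivity
            have := small_dvd (p := p) (H := H) (by omega) (by rw [abs_le]; constructor <;> linarith) hd
            have h5 : (j : ℤ) = ((i * k.factorial : ℕ) : ℤ) := by push_cast; linarith
            have h6 : j = i * k.factorial := by exact_mod_cast h5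
            rw [h6]; exact dvd_mul_left _ _
          · have : j' = j := hq (hj'.trans hjp.symm)
            subst this; simp
        · push Not at hex
          refine ⟨1, fun i hi hd => ?_, fun j h1 h2 h3 => absurd h3 (hex j h1 h2), fun i hi h1 h2 => hlast i hi h1 h2 1⟩
          have h0 := hb i hi
          have hi0 : (0 : ℤ) ≤ i * k.factorial := by positivity
          have := small_dvd (p := p) (H := H) (by omega) (by rw [abs_le]; constructor <;> linarith) hd
          linarith
  · have hqno : ∀ j ≤ H, q j ≠ p := fun j hj h => hpE (h ▸ hqE j hj)
    by_cases hex : ∃ i < k, E i < p ∧ p ≤ E (i + 1)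
    · obtain ⟨i, hi, h1, h2⟩ := hex
      have hi0 : (0 : ℤ) ≤ i * k.factorial := by positivity
      have h0 := hb i hi
      refine ⟨1 - i * k.factorial, fun i' hi' hd => ?_, fun j hj _ h => absurd h (hqno j hj), fun i2 hi2 h3 h4 i' hi' => ?_⟩
      · have h0' := hb i' hi'
        have hi0' : (0 : ℤ) ≤ i' * k.factorial := by positivity
        have := small_dvd (p := p) (H := H) (by omega) (by rw [abs_le]; constructor <;> linarith) hd
        have h5 : (k.factorial : ℤ) ∣ 1 := ⟨i - i', by linarith⟩
        have h6 : k.factorial ∣ 1 := by exact_mod_cast h5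
        have := Nat.le_of_dvd one_pos h6
        omega
      · have hii : i2 = i := by
          rcases lt_trichotomy i2 i with h | h | h
          · have := hEm.monotone (show i2 + 1 ≤ i by omega); omega
          · exact h
          · have := hEm.monotone (show i + 1 ≤ i2 by omega); omega
        subst hii
        constructor
        · intro hd
          have h0' := hb i' hi'
          have hi0' : (0 : ℤ) ≤ i' * k.factorial := by positivity
          have := small_dvd (p := p) (H := H) (by omega) (by rw [abs_le]; constructor <;> linarith) hd
          have h5 : ((i' : ℤ) - i2) * k.factorial = 0 := by linarith
          rcases mul_eq_zero.mp h5 with h | h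
          · omega
          · omega
        · rintro rfl; simp
    · push Not at hex
      refine ⟨1, fun i hi hd => ?_, fun j hj _ h => absurd h (hqno j hj), fun i hi h1 h2 => absurd h2 (by have := hex i hi h1; omega)⟩
      have h0 := hb i hi
      have hi0 : (0 : ℤ) ≤ i * k.factorial := by positivity
      have := small_dvd (p := p) (H := H) (by omega) (by rw [abs_le]; constructor <;> linarith) hd
      linarith

noncomputable def FF (D b h : ℕ) : ℝ := ∏ p ∈ ((Ioc 0 D).filter Nat.Prime).filter (fun p : ℕ => (p : ℤ) ∣ (b : ℤ) + h - 1), (1 - 1 / (p : ℝ))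

theorem modC (k : ℕ) (hk : 2 ≤ k) (D0 : ℕ) : ∃ D b : ℕ, D0 ≤ D ∧ 2 ≤ D ∧ k * k.factorial ≤ D ∧
    (∀ i < k, ∀ p : ℕ, p.Prime → p ≤ D → ¬ p ∣ b + i * k.factorial) ∧
    (∀ j ≤ k * k.factorial, ¬ k.factorial ∣ j → ∃ p : ℕ, p.Prime ∧ p ≤ D ∧ p ∣ b + j) ∧
    (∀ i i' : ℕ, i < i' → i' < k → FF D b (i' * k.factorial) ≤ FF D b (i * k.factorial) / 4) := by
  obtain ⟨H, hH⟩ : ∃ H, H = k * k.factorial + 1 := ⟨_, rfl⟩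
  set q : ℕ → ℕ := fun j => Nat.nth Nat.Prime (j + H) with hqdef
  have hqm : StrictMono q := fun a b hab => Nat.nth_strictMono Nat.infinite_setOf_prime (by omega)
  have hqp : ∀ j, (q j).Prime := fun j => Nat.prime_nth_prime _
  have hqH : ∀ j, H < q j := fun j => by
    have := Nat.add_two_le_nth_prime (j + H); simp only [hqdef]; omega
  obtain ⟨E, hE0, hE, hEQ⟩ := blocks (max D0 (q H) + 2)
  have hEm : StrictMono E := strictMono_nat_of_lt_succ hE
  have hqE : ∀ j ≤ H, q j ≤ E 0 := fun j hj => by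
    have := hqm.monotone hj; omega
  have hEH : H ≤ E 0 := by have := hqE 0 (Nat.zero_le _); have := hqH 0; omega
  have hres := fun p : ℕ => fun hp : p.Prime => residue hk hH E hE q hqm.injective hqH hqE hEH hp
  choose! a ha1 ha2 ha3 using hres
  set D := E k with hD
  obtain ⟨b, hb⟩ := crt D a
  have hED : E 0 ≤ D := hEm.monotone (Nat.zero_le k)
  have key : ∀ p : ℕ, p.Prime → p ≤ D → ∀ x : ℤ, (p : ℤ) ∣ b + x ↔ (p : ℤ) ∣ a p + x := by
    intro p hp hpD x
    have h := hb p hp hpD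
    have e : (b : ℤ) + x = (b - a p) + (a p + x) := by ring
    rw [e]; exact dvd_add_right h
  have hblock : ∀ i < k, ∀ p : ℕ, p.Prime → p ≤ D → E i < p → ((p : ℤ) ∣ (b : ℤ) + (i * k.factorial : ℕ) - 1 → p ≤ E (i + 1)) := by
    intro i hi p hp hpD hip hd
    by_contra hcon
    -- find block
    have : ∃ m, p ≤ E m := ⟨k, hpD⟩
    classical
    set m := Nat.find this with hm
    have hm1 : p ≤ E m := Nat.find_spec this
    have hm2 : ∀ m' < m, E m' < p := fun m' h => by have := Nat.find_min this h; omega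
    have hmk : m ≤ k := Nat.find_min' this hpD
    have him : i + 1 < m := by
      by_contra hh
      exact hcon (hm1.trans (hEm.monotone (by omega)))
    have h3 := ha3 p hp (m - 1) (by omega) (hm2 (m - 1) (by omega)) (by rwa [Nat.sub_add_cancel (by omega)]) i hi
    have h4 := (key p hp hpD ((i * k.factorial : ℕ) - 1)).mp (by rwa [← add_sub_assoc])
    rw [← add_sub_assoc] at h4
    push_cast at h4
    have := h3.mp h4
    omega
  refine ⟨D, b, by omega, by omega, by omega, ?_, ?_, ?_⟩
  · intro i hi p hp hpD hd
    refine ha1 p hp i hi ?_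
    rw [← key p hp hpD]
    exact_mod_cast hd
  · intro j hj hjk
    have hjH : j ≤ H := by omega
    refine ⟨q j, hqp j, (hqE j hjH).trans hED, ?_⟩
    have := ha2 (q j) (hqp j) j hjH hjk rfl
    rw [← key (q j) (hqp j) ((hqE j hjH).trans hED)] at this
    exact_mod_cast this
  · intro i i' hii hi'
    have hEi' : E (i' + 1) ≤ D := hEm.monotone (by omega)
    -- upper bound
    have hup : FF D b (i' * k.factorial) * QQ (E i') ≤ QQ (E (i' + 1)) := by
      have hsplit : QQ (E (i' + 1)) = QQ (E i') * ∏ p ∈ (Ioc (E i') (E (i' + 1))).filter Nat.Prime, (1 - 1 / (p : ℝ)) := by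
        unfold QQ
        rw [← prod_union]
        · congr 1
          rw [← filter_union, Ioc_union_Ioc_eq_Ioc (Nat.zero_le _) (hE i').le]
        · refine disjoint_filter_filter ?_
          rw [disjoint_left]; intro x hx hy
          rw [mem_Ioc] at hx hy; omega
      rw [hsplit, mul_comm]
      refine mul_le_mul_of_nonneg_left ?_ (QQ_pos _).le
      unfold FF
      refine prod_sub_le ?_ ?_ ?_
      · intro p hp
        rw [mem_filter, mem_Ioc] at hp
        rw [mem_filter, mem_filter, mem_Ioc]
        refine ⟨⟨⟨by omega, by omega⟩, hp.2⟩, ?_⟩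
        have h3 := (ha3 p hp.2 i' hi' hp.1.1 hp.1.2 i' hi').mpr rfl
        rw [add_sub_assoc, ← key p hp.2 (by omega), ← add_sub_assoc] at h3
        push_cast; exact h3
      · intro p hp; exact (fac_pos (mem_filter.mp (mem_filter.mp hp).1).2).le
      · intro p hp _; exact fac_le
    have hlow : QQ (E i') ≤ FF D b (i * k.factorial) := by
      unfold FF QQ
      refine prod_sub_le ?_ ?_ ?_
      · intro p hp
        rw [mem_filter, mem_filter, mem_Ioc] at hp
        rw [mem_filter, mem_Ioc]
        refine ⟨⟨hp.1.1.1, ?_⟩, hp.1.2⟩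
        have hm : E (i + 1) ≤ E i' := hEm.monotone (by omega)
        by_cases h : E i < p
        · exact (hblock i (by omega) p hp.1.2 hp.1.1.2 h hp.2).trans hm
        · have := hE i; omega
      · intro p hp; exact (fac_pos (mem_filter.mp hp).2).le
      · intro p hp _; exact fac_le
    have h5 := hup.trans (hEQ i')
    rw [mul_comm] at h5
    have h6 := le_of_mul_le_mul_left h5 (QQ_pos _)
    linarith

end TDR

namespace TDR
open Finset

section
variable {s k : ℕ}

def dv (pr : Fin s → ℕ) (h : Fin k → ℕ) (n : ℕ) (c : Fin s → Option (Fin k)) : Prop :=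
  ∀ t i, c t = some i → pr t ∣ n + h i

open Classical in
noncomputable def dvi (pr : Fin s → ℕ) (h : Fin k → ℕ) (n : ℕ) (c : Fin s → Option (Fin k)) : ℝ :=
  if dv pr h n c then 1 else 0

noncomputable def HH (pr : Fin s → ℕ) (h : Fin k → ℕ) (l : (Fin s → Option (Fin k)) → ℝ) (n : ℕ) : ℝ :=
  ∑ c, l c * dvi pr h n c

def jo : Option (Fin k) → Option (Fin k) → Option (Fin k)
  | some i, _ => some i
  | none, o => o

def jn (c c' : Fin s → Option (Fin k)) : Fin s → Option (Fin k) := fun t => jo (c t) (c' t)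

def Cmp (c c' : Fin s → Option (Fin k)) : Prop := ∀ t i j, c t = some i → c' t = some j → i = j

lemma kap_prod {q : Fin s → ℝ} {c c' : Fin s → Option (Fin k)} (h : Cmp c c') :
    ∏ t, kap (q t) (c t) (c' t) = ∏ t, mU (q t) (jn c c' t) := by
  refine prod_congr rfl fun t _ => ?_
  have := h t
  unfold jn
  rcases hc : c t with _ | i <;> rcases hc' : c' t with _ | j
  · simp [kap, jo, mU]
  · simp [kap, jo, mU]
  · simp [kap, jo, mU]
  · simp [kap, jo, mU, this i j hc hc']

lemma kap_prod0 {q : Fin s → ℝ} {c c' : Fin s → Option (Fin k)} (h : ¬ Cmp c c') :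
    ∏ t, kap (q t) (c t) (c' t) = 0 := by
  unfold Cmp at h
  push Not at h
  obtain ⟨t, i, j, h1, h2, h3⟩ := h
  refine prod_eq_zero (mem_univ t) ?_
  rw [h1, h2]; simp [kap, h3]

lemma dvi_mul {pr : Fin s → ℕ} {h : Fin k → ℕ} {n : ℕ} {c c' : Fin s → Option (Fin k)} (hc : Cmp c c') :
    dvi pr h n c * dvi pr h n c' = dvi pr h n (jn c c') := by
  have : dv pr h n (jn c c') ↔ dv pr h n c ∧ dv pr h n c' := by
    constructor
    · intro H
      refine ⟨fun t i hi => H t i ?_, fun t j hj => H t j ?_⟩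
      · unfold jn; rw [hi]; rfl
      · unfold jn
        rcases h2 : c t with _ | i
        · exact hj
        · rw [hc t i j h2 hj]; rfl
    · rintro ⟨h1, h2⟩ t i hi
      unfold jn at hi
      rcases h3 : c t with _ | j
      · rw [h3] at hi; exact h2 t i hi
      · rw [h3] at hi; exact h1 t i (h3.trans hi)
  unfold dvi
  by_cases h1 : dv pr h n c <;> by_cases h2 : dv pr h n c' <;> simp [h1, h2, this]

lemma dvi_mul0 {pr : Fin s → ℕ} {h : Fin k → ℕ} (hcp : ∀ t i j n, pr t ∣ n + h i → pr t ∣ n + h j → i = j) {n : ℕ}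
    {c c' : Fin s → Option (Fin k)} (hc : ¬ Cmp c c') : dvi pr h n c * dvi pr h n c' = 0 := by
  unfold Cmp at hc
  push Not at hc
  obtain ⟨t, i, j, h1, h2, h3⟩ := hc
  unfold dvi
  by_cases h4 : dv pr h n c
  · by_cases h5 : dv pr h n c'
    · exact absurd (hcp t i j n (h4 t i h1) (h5 t j h2)) h3
    · simp [h5]
  · simp [h4]

open Classical in
theorem G_expand {pr : Fin s → ℕ} {h : Fin k → ℕ} (hcp : ∀ t i j n, pr t ∣ n + h i → pr t ∣ n + h j → i = j)
    (l : (Fin s → Option (Fin k)) → ℝ) (I : Finset ℕ) (w : ℕ → ℝ) (q : Fin s → ℝ) (X : ℝ)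
    (err : (Fin s → Option (Fin k)) → (Fin s → Option (Fin k)) → ℝ)
    (he : ∀ c c', 0 ≤ err c c')
    (hu : ∀ c c', l c ≠ 0 → l c' ≠ 0 → Cmp c c' →
      |∑ n ∈ I, w n * dvi pr h n (jn c c') - X * ∏ t, mU (q t) (jn c c' t)| ≤ err c c') :
    |∑ n ∈ I, w n * HH pr h l n ^ 2 - X * BB q l l| ≤ ∑ c, ∑ c', |l c| * |l c'| * err c c' := by
  have e : ∑ n ∈ I, w n * HH pr h l n ^ 2 - X * BB q l l =
      ∑ c, ∑ c', l c * l c' * (∑ n ∈ I, w n * (dvi pr h n c * dvi pr h n c') - X * ∏ t, kap (q t) (c t) (c' t)) := by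
    simp only [mul_sub, sum_sub_distrib]
    congr 1
    · have : ∀ n, w n * HH pr h l n ^ 2 = ∑ c, ∑ c', l c * l c' * (w n * (dvi pr h n c * dvi pr h n c')) := by
        intro n
        rw [HH, sq, sum_mul_sum, mul_sum]
        refine sum_congr rfl fun c _ => ?_
        rw [mul_sum]
        exact sum_congr rfl fun c' _ => by ring
      simp only [this, mul_sum]
      rw [sum_comm]
      refine sum_congr rfl fun c _ => ?_
      rw [sum_comm]
    · unfold BB
      rw [mul_sum]
      refine sum_congr rfl fun c _ => ?_
      rw [mul_sum]
      exact sum_congr rfl fun c' _ => by ring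
  rw [e]
  refine (abs_sum_le_sum_abs _ _).trans (sum_le_sum fun c _ => (abs_sum_le_sum_abs _ _).trans (sum_le_sum fun c' _ => ?_))
  rw [abs_mul, abs_mul]
  by_cases h1 : l c = 0
  · simp [h1]
  by_cases h2 : l c' = 0
  · simp [h2]
  refine mul_le_mul_of_nonneg_left ?_ (by positivity)
  by_cases h3 : Cmp c c'
  · simp only [dvi_mul h3, kap_prod h3]
    exact hu c c' h1 h2 h3
  · simp only [dvi_mul0 hcp h3, kap_prod0 h3]
    simpa using he c c'

/-- support of a labeling -/
def sup (c : Fin s → Option (Fin k)) : Finset (Fin s) := univ.filter (fun t => c t ≠ none)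

lemma mem_sup {c : Fin s → Option (Fin k)} {t : Fin s} : t ∈ sup c ↔ c t ≠ none := by simp [sup]

lemma mU_sup (q : Fin s → ℝ) (c : Fin s → Option (Fin k)) : ∏ t, mU (q t) (c t) = ∏ t ∈ sup c, (1 / q t) := by
  unfold sup
  rw [prod_filter]
  refine prod_congr rfl fun t _ => ?_
  rcases c t with _ | i <;> simp [mU]

lemma crt_class {D R : ℕ} {pr : Fin s → ℕ} (hP : PE D R pr) (W b : ℕ) (f : Fin s → ℕ) (S : Finset (Fin s)) (hS : ∀ t ∈ S, W.Coprime (pr t)) :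
    ∃ v, ∀ n, (n ≡ b [MOD W] ∧ ∀ t ∈ S, pr t ∣ n + f t) ↔ n ≡ v [MOD W * pn pr S] := by
  induction S using Finset.induction_on with
  | empty => exact ⟨b, fun n => by simp [pn]⟩
  | insert t S ht ih =>
    obtain ⟨v, hv⟩ := ih fun t' h => hS t' (mem_insert_of_mem h)
    have hco : (W * pn pr S).Coprime (pr t) := by
      refine Nat.Coprime.mul_left (hS t (mem_insert_self _ _)) ?_
      rw [Nat.coprime_comm, Nat.Prime.coprime_iff_not_dvd (hP.prime t), mem_of_dvd_pn hP]
      exact ht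
    have hr : ∀ n, pr t ∣ n + f t ↔ n ≡ (pr t - 1) * f t [MOD pr t] := by
      intro n
      have h1 := (hP.prime t).one_lt
      have e : (pr t - 1) * f t + f t = pr t * f t := by
        obtain ⟨m, hm⟩ : ∃ m, pr t = m + 1 := ⟨pr t - 1, by omega⟩
        rw [hm, Nat.add_sub_cancel]; ring
      have h2 : pr t ∣ (pr t - 1) * f t + f t := by rw [e]; exact dvd_mul_right _ _
      constructor
      · intro h
        exact Nat.ModEq.add_right_cancel' (f t) (((Nat.modEq_zero_iff_dvd).mpr h).trans ((Nat.modEq_zero_iff_dvd).mpr h2).symm)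
      · intro h
        exact Nat.modEq_zero_iff_dvd.mp ((h.add_right (f t)).trans ((Nat.modEq_zero_iff_dvd).mpr h2))
    obtain ⟨x, hx1, hx2⟩ := Nat.chineseRemainder hco v ((pr t - 1) * f t)
    refine ⟨x, fun n => ?_⟩
    have e : W * pn pr (insert t S) = W * pn pr S * pr t := by
      unfold pn; rw [prod_insert ht]; ring
    rw [e, ← Nat.modEq_and_modEq_iff_modEq_mul hco]
    rw [forall_mem_insert, ← and_assoc, and_right_comm, hv n, hr n]
    constructor
    · rintro ⟨h1, h2⟩; exact ⟨h1.trans hx1.symm, h2.trans hx2.symm⟩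
    · rintro ⟨h1, h2⟩; exact ⟨h1.trans hx1, h2.trans hx2⟩

/-- class of n determined by a labeling -/
lemma dv_class {D R : ℕ} {pr : Fin s → ℕ} (hP : PE D R pr) (W b : ℕ) (h : Fin k → ℕ) (c : Fin s → Option (Fin k))
    (hS : ∀ t ∈ sup c, W.Coprime (pr t)) :
    ∃ v, ∀ n, (n ≡ b [MOD W] ∧ dv pr h n c) ↔ n ≡ v [MOD W * pn pr (sup c)] := by
  obtain ⟨v, hv⟩ := crt_class hP W b (fun t => match c t with | none => 0 | some i => h i) (sup c) hS
  refine ⟨v, fun n => ?_⟩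
  rw [← hv n]
  refine and_congr_right fun _ => ?_
  constructor
  · intro H t ht
    rcases hc : c t with _ | i
    · exact absurd hc (mem_sup.mp ht)
    · exact H t i hc
  · intro H t i hc
    have := H t (mem_sup.mpr (by rw [hc]; simp))
    rw [hc] at this
    exact this

lemma count_class (N M v : ℕ) (hM : 0 < M) : |(((Ioc 0 N).filter (fun n => n ≡ v [MOD M])).card : ℝ) - N / M| ≤ 1 := by
  have h0 := Nat.Ioc_filter_modEq_card 0 N hM v
  have hM' : (0 : ℚ) < M := by exact_mod_cast hM
  have f1 := Int.floor_le (((N : ℚ) - v) / M)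
  have f2 := Int.lt_floor_add_one (((N : ℚ) - v) / M)
  have f3 := Int.floor_le ((((0:ℕ) : ℚ) - v) / M)
  have f4 := Int.lt_floor_add_one ((((0:ℕ) : ℚ) - v) / M)
  have e : ((N : ℚ) - v) / M - (((0:ℕ) : ℚ) - v) / M = N / M := by push_cast; ring
  have hpos : (0:ℚ) ≤ N / M := by positivity
  have key : |((((Ioc 0 N).filter (fun n => n ≡ v [MOD M])).card : ℤ) : ℚ) - N / M| ≤ 1 := by
    rw [h0]
    rw [abs_le]
    push_cast at *
    rcases le_total (0:ℚ) ((⌊((N : ℚ) - v) / M⌋ : ℚ) - ⌊((0 : ℚ) - v) / M⌋) with h | h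
    · rw [max_eq_left h]; constructor <;> linarith
    · rw [max_eq_right h]; constructor <;> linarith
  have : ((|((((Ioc 0 N).filter (fun n => n ≡ v [MOD M])).card : ℤ) : ℚ) - N / M| : ℚ) : ℝ) ≤ ((1 : ℚ) : ℝ) := by exact_mod_cast key
  push_cast at this
  exact this

end
end TDR

namespace TDR
open Finset

section
variable {s k D R : ℕ} {pr : Fin s → ℕ}

lemma lab_pn (c : Fin s → Option (Fin k)) : ∏ i, PS (fun t => (pr t : ℝ)) (lab c i) = (pn pr (sup c) : ℝ) := by
  unfold PS
  rw [prod_lab (fun t => (pr t : ℝ)) c]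
  unfold pn sup
  push_cast
  rw [prod_filter]
  refine prod_congr rfl fun t _ => ?_
  rcases c t with _ | i <;> simp

lemma PE.one_le (hP : PE D R pr) (t : Fin s) : (1 : ℝ) ≤ (fun t => (pr t : ℝ)) t := by
  show (1 : ℝ) ≤ (pr t : ℝ)
  exact_mod_cast (hP.prime t).one_lt.le

lemma mU_pn (c : Fin s → Option (Fin k)) : ∏ t, mU ((fun t => (pr t : ℝ)) t) (c t) = 1 / (pn pr (sup c) : ℝ) := by
  rw [mU_sup]
  unfold pn; push_cast
  rw [prod_div_distrib]; simp

lemma count_lab (hP : PE D R pr) (z : ℕ) :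
    ((univ.filter (fun c : Fin s → Option (Fin k) => pn pr (sup c) ≤ z)).card : ℝ) ≤ z * VV (fun t => (pr t : ℝ)) z ^ k := by
  have h := sum_lab_VV (k := k) (p := fun t => (pr t : ℝ)) hP.one_le (z : ℝ)
  refine le_trans ?_ (mul_le_mul_of_nonneg_left h (Nat.cast_nonneg z))
  rw [← sum_filter, mul_sum]
  simp only [lab_pn, Nat.cast_le]
  rw [card_eq_sum_ones]; push_cast
  refine sum_le_sum fun c hc => ?_
  rw [mU_pn]
  have h1 : pn pr (sup c) ≤ z := (mem_filter.mp hc).2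
  have h0 : (0 : ℝ) < pn pr (sup c) := by exact_mod_cast pn_pos hP (sup c)
  rw [mul_one_div, le_div_iff₀ h0, one_mul]
  exact_mod_cast h1

lemma sup_jn {c c' : Fin s → Option (Fin k)} : sup (jn c c') = sup c ∪ sup c' := by
  ext t
  simp only [mem_union, mem_sup]
  unfold jn
  rcases c t with _ | i <;> simp [jo]

open Classical in
theorem S1_gen (hP : PE D R pr) {h : Fin k → ℕ} (hcp : ∀ t i j n, pr t ∣ n + h i → pr t ∣ n + h j → i = j)
    (W b N : ℕ) (hW : 0 < W) (l : (Fin s → Option (Fin k)) → ℝ) (Λ : ℝ) (hΛ : ∀ c, |l c| ≤ Λ)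
    (hs : ∀ c, l c ≠ 0 → pn pr (sup c) ≤ R) (hco : ∀ c, l c ≠ 0 → ∀ t ∈ sup c, W.Coprime (pr t)) :
    |∑ n ∈ Ioc 0 N, (if n ≡ b [MOD W] then 1 else 0) * HH pr h l n ^ 2 - N / W * BB (fun t => (pr t : ℝ)) l l| ≤
      (Λ * (R * VV (fun t => (pr t : ℝ)) R ^ k)) ^ 2 := by
  refine (G_expand hcp l (Ioc 0 N) _ (fun t => (pr t : ℝ)) ((N : ℝ) / W) (fun c c' => 1) (fun _ _ => zero_le_one) ?_).trans ?_
  · intro c c' h1 h2 _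
    obtain ⟨v, hv⟩ := dv_class hP W b h (jn c c') (fun t ht => by
      rw [sup_jn, mem_union] at ht
      exact ht.elim (hco c h1 t) (hco c' h2 t))
    have e : ∑ n ∈ Ioc 0 N, (if n ≡ b [MOD W] then (1:ℝ) else 0) * dvi pr h n (jn c c') =
        (((Ioc 0 N).filter (fun n => n ≡ v [MOD W * pn pr (sup (jn c c'))])).card : ℝ) := by
      rw [card_filter]; push_cast
      refine sum_congr rfl fun n _ => ?_
      have := hv n
      unfold dvi
      by_cases h3 : n ≡ b [MOD W] <;> by_cases h4 : dv pr h n (jn c c') <;> simp [h3, h4] at this ⊢ <;> simp [this]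
    rw [e, mU_pn]
    have := count_class N (W * pn pr (sup (jn c c'))) v (Nat.mul_pos hW (pn_pos hP _))
    push_cast at this
    rw [div_mul_div_comm, mul_one]
    exact this
  · simp only [mul_one]
    have e : ∑ c, ∑ c', |l c| * |l c'| = (∑ c, |l c|) ^ 2 := by rw [sq, sum_mul_sum]
    rw [e]
    refine pow_le_pow_left₀ (sum_nonneg fun _ _ => abs_nonneg _) ?_ 2
    have hΛ0 : 0 ≤ Λ := (abs_nonneg _).trans (hΛ fun _ => none)
    calc ∑ c, |l c| ≤ ∑ c ∈ univ.filter (fun c : Fin s → Option (Fin k) => pn pr (sup c) ≤ R), Λ := by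
          rw [sum_filter]
          refine sum_le_sum fun c _ => ?_
          split_ifs with hh
          · exact hΛ c
          · have : l c = 0 := by by_contra h0; exact hh (hs c h0)
            simp [this]
      _ = Λ * ((univ.filter (fun c : Fin s → Option (Fin k) => pn pr (sup c) ≤ R)).card : ℝ) := by rw [sum_const, nsmul_eq_mul, mul_comm]
      _ ≤ _ := mul_le_mul_of_nonneg_left (count_lab hP R) hΛ0

end
end TDR

namespace TDR
open Finset

noncomputable def EE (ω : ℕ → ℝ) (N r : ℕ) : ℝ := ∑ χ ∈ primSet r, ‖tw (fun n => χ (n : ZMod r)) ω N‖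

lemma EE_nonneg (ω : ℕ → ℝ) (N r : ℕ) : 0 ≤ EE ω N r := sum_nonneg fun _ _ => norm_nonneg _

lemma sum_nonprincipal (M P N : ℕ) (hM : 0 < M) (hMP : M ≤ P) (ω : ℕ → ℝ) (hω : ∀ n, ω n ≠ 0 → n.Coprime M) [NeZero M] :
    ∑ χ ∈ (univ : Finset (DirichletCharacter ℂ M)).erase 1, ‖tw (fun n => χ (n : ZMod M)) ω N‖ ≤
      ∑ r ∈ (Ioc 1 P).filter (fun r => r ∣ M), EE ω N r := by
  classical
  set mp : DirichletCharacter ℂ M → (Σ r, DirichletCharacter ℂ r) := fun χ => ⟨χ.conductor, χ.primitiveCharacter⟩ with hmp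
  set f : (Σ r, DirichletCharacter ℂ r) → ℝ := fun σ => ‖tw (fun n => σ.2 (n : ZMod σ.1)) ω N‖ with hf
  have hinj : Function.Injective mp := by
    have hl : Function.LeftInverse (fun σ : (Σ r, DirichletCharacter ℂ r) => if h : σ.1 ∣ M then DirichletCharacter.changeLevel h σ.2 else 1) mp := by
      intro χ
      simp only [hmp]
      rw [dif_pos χ.conductor_dvd_level, χ.changeLevel_primitiveCharacter]
    exact hl.injective
  have h1 : ∀ χ : DirichletCharacter ℂ M, ‖tw (fun n => χ (n : ZMod M)) ω N‖ = f (mp χ) := by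
    intro χ
    simp only [hf, hmp, tw]
    congr 1
    refine sum_congr rfl fun n _ => ?_
    by_cases h0 : ω n = 0
    · simp [h0]
    · congr 1
      have := χ.primitiveCharacter_apply_of_isCoprime (a := n) (by exact_mod_cast (Nat.isCoprime_iff_coprime.2 (hω n h0)))
      simpa using this.symm
  simp only [h1]
  rw [← sum_image (f := f) (fun a _ b _ e => hinj e)]
  unfold EE
  rw [sum_sigma' ((Ioc 1 P).filter (fun r => r ∣ M)) primSet (fun r χ => ‖tw (fun n => χ (n : ZMod r)) ω N‖)]
  refine sum_le_sum_of_subset_of_nonneg ?_ fun _ _ _ => norm_nonneg _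
  intro σ hσ
  obtain ⟨χ, hχ, rfl⟩ := mem_image.mp hσ
  have hχ1 : χ ≠ 1 := (mem_erase.mp hχ).1
  have hd : χ.conductor ∣ M := χ.conductor_dvd_level
  have h0 : χ.conductor ≠ 0 := χ.conductor_ne_zero
  have hc1 : χ.conductor ≠ 1 := fun h => hχ1 (χ.eq_one_iff_conductor_eq_one.mpr h)
  haveI : NeZero χ.conductor := ⟨h0⟩
  simp only [hmp, mem_sigma, mem_filter, mem_Ioc]
  exact ⟨⟨⟨by omega, (Nat.le_of_dvd hM hd).trans hMP⟩, hd⟩, (mem_primSet _).mpr χ.primitiveCharacter_isPrimitive⟩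

open Classical in
theorem char_err (M P N a : ℕ) (hM : 0 < M) (hMP : M ≤ P) (ha : a.Coprime M) (ω : ℕ → ℝ) (hω : ∀ n, ω n ≠ 0 → n.Coprime M) :
    |∑ n ∈ Ioc 0 N, ω n * (if n ≡ a [MOD M] then 1 else 0) - (∑ n ∈ Ioc 0 N, ω n) * (1 / (Nat.totient M : ℝ))| ≤
      1 / (Nat.totient M : ℝ) * ∑ r ∈ (Ioc 1 P).filter (fun r => r ∣ M), EE ω N r := by
  haveI : NeZero M := ⟨by omega⟩
  have hφ : (0 : ℝ) < Nat.totient M := by exact_mod_cast Nat.totient_pos.mpr hM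
  have hφc : (Nat.totient M : ℂ) ≠ 0 := by exact_mod_cast hφ.ne'
  have hau : IsUnit ((a : ℕ) : ZMod M) := (ZMod.isUnit_iff_coprime a M).mpr ha
  have h1 : ((∑ n ∈ Ioc 0 N, ω n * (if n ≡ a [MOD M] then 1 else 0) : ℝ) : ℂ) =
      1 / (Nat.totient M : ℂ) * ∑ χ : DirichletCharacter ℂ M, χ ((a : ZMod M)⁻¹) * tw (fun n => χ (n : ZMod M)) ω N := by
    have : ∀ n : ℕ, ((if n ≡ a [MOD M] then 1 else 0 : ℝ) : ℂ) = 1 / (Nat.totient M : ℂ) * ∑ χ : DirichletCharacter ℂ M, χ ((a : ZMod M)⁻¹) * χ (n : ZMod M) := by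
      intro n
      rw [DirichletCharacter.sum_char_inv_mul_char_eq ℂ hau]
      have e : ((a : ZMod M) = (n : ZMod M)) ↔ n ≡ a [MOD M] := by
        rw [ZMod.natCast_eq_natCast_iff]; exact ⟨fun h => h.symm, fun h => h.symm⟩
      by_cases h : n ≡ a [MOD M]
      · rw [if_pos h, if_pos (e.mpr h)]; field_simp; simp
      · rw [if_neg h, if_neg (fun hh => h (e.mp hh))]; simp
    push_cast
    push_cast at this
    simp only [this, tw, mul_sum]
    rw [sum_comm]
    exact sum_congr rfl fun χ _ => sum_congr rfl fun n _ => by ring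
  have h2 : (1 : DirichletCharacter ℂ M) ((a : ZMod M)⁻¹) * tw (fun n => (1 : DirichletCharacter ℂ M) (n : ZMod M)) ω N = ((∑ n ∈ Ioc 0 N, ω n : ℝ) : ℂ) := by
    have hi : IsUnit ((a : ZMod M)⁻¹) := by
      obtain ⟨u, hu⟩ := hau
      rw [← hu, ZMod.inv_coe_unit]; exact Units.isUnit _
    rw [MulChar.one_apply hi, one_mul, tw]
    push_cast
    refine sum_congr rfl fun n _ => ?_
    by_cases h0 : ω n = 0
    · simp [h0]
    · rw [MulChar.one_apply ((ZMod.isUnit_iff_coprime n M).mpr (hω n h0)), mul_one]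
  rw [← add_sum_erase _ _ (mem_univ (1 : DirichletCharacter ℂ M)), h2] at h1
  have h3 : ((∑ n ∈ Ioc 0 N, ω n * (if n ≡ a [MOD M] then 1 else 0) - (∑ n ∈ Ioc 0 N, ω n) * (1 / (Nat.totient M : ℝ)) : ℝ) : ℂ) =
      1 / (Nat.totient M : ℂ) * ∑ χ ∈ (univ : Finset (DirichletCharacter ℂ M)).erase 1, χ ((a : ZMod M)⁻¹) * tw (fun n => χ (n : ZMod M)) ω N := by
    rw [Complex.ofReal_sub, h1]; push_cast; ring
  rw [← Real.norm_eq_abs, ← Complex.norm_real, h3, norm_mul]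
  have e : ‖1 / (Nat.totient M : ℂ)‖ = 1 / (Nat.totient M : ℝ) := by simp
  rw [e]
  refine mul_le_mul_of_nonneg_left ?_ (by positivity)
  refine le_trans ((norm_sum_le _ _).trans (sum_le_sum fun χ _ => ?_)) (sum_nonprincipal M P N hM hMP ω hω)
  rw [norm_mul]
  exact mul_le_of_le_one_left (norm_nonneg _) (χ.norm_le_one _)

end TDR

namespace TDR
open Finset

section
variable {s k D R : ℕ} {pr : Fin s → ℕ}

lemma pairs_le (F : Finset (Fin s) → ℝ) (hF : ∀ U, 0 ≤ F U) :
    ∑ c : Fin s → Option (Fin k), ∑ c' : Fin s → Option (Fin k), F (sup c ∪ sup c') ≤ ∑ U, ((k + 1) ^ 2 : ℝ) ^ U.card * F U := by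
  classical
  rw [← sum_product' univ univ (fun c c' : Fin s → Option (Fin k) => F (sup c ∪ sup c'))]
  rw [← sum_fiberwise _ (fun x : (Fin s → Option (Fin k)) × (Fin s → Option (Fin k)) => sup x.1 ∪ sup x.2)]
  refine sum_le_sum fun U _ => ?_
  rw [sum_congr rfl (g := fun _ => F U) (fun x hx => by rw [(mem_filter.mp hx).2]), sum_const, nsmul_eq_mul]
  refine mul_le_mul_of_nonneg_right ?_ (hF U)
  set T : Fin s → Finset (Option (Fin k) × Option (Fin k)) := fun t => if t ∈ U then univ else {(none, none)} with hT
  have h1 : (Fintype.piFinset T).card = ((k + 1) ^ 2) ^ U.card := by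
    rw [Fintype.card_piFinset]
    have : ∀ t, (T t).card = if t ∈ U then (k + 1) ^ 2 else 1 := by
      intro t; simp only [hT]; split_ifs
      · rw [card_univ]; simp [sq]
      · simp
    simp only [this]
    rw [prod_ite]; simp
  have h2 : ((univ ×ˢ univ).filter (fun x : (Fin s → Option (Fin k)) × (Fin s → Option (Fin k)) => sup x.1 ∪ sup x.2 = U)).card ≤ (Fintype.piFinset T).card := by
    refine card_le_card_of_injOn (fun x t => (x.1 t, x.2 t)) ?_ ?_
    · intro x hx
      have hx := (mem_filter.mp hx).2
      refine Fintype.mem_piFinset.mpr fun t => ?_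
      simp only [hT]
      split_ifs with h
      · exact mem_univ _
      · rw [← hx, mem_union, mem_sup, mem_sup] at h
        push Not at h
        simp [h.1, h.2]
    · intro x _ y _ hxy
      refine Prod.ext (funext fun t => ?_) (funext fun t => ?_)
      · exact congrArg Prod.fst (congrFun hxy t)
      · exact congrArg Prod.snd (congrFun hxy t)
  rw [h1] at h2
  exact_mod_cast h2

lemma sum_pow_VV (hP : PE D R pr) (m z : ℕ) :
    ∑ U ∈ univ.filter (fun U => pn pr U ≤ z), (∏ t ∈ U, ((m : ℝ) / pr t)) ≤ VV (fun t => (pr t : ℝ)) z ^ m := by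
  classical
  have h := sum_lab_VV (k := m) (p := fun t => (pr t : ℝ)) hP.one_le (z : ℝ)
  refine le_trans (le_of_eq ?_) h
  rw [← sum_fiberwise univ (fun c : Fin s → Option (Fin m) => sup c), sum_filter]
  refine sum_congr rfl fun U _ => ?_
  simp only [lab_pn, Nat.cast_le, mU_pn]
  rw [sum_congr rfl (g := fun _ => if pn pr U ≤ z then 1 / (pn pr U : ℝ) else 0) (fun x hx => by rw [(mem_filter.mp hx).2]), sum_const, nsmul_eq_mul]
  have hc : (univ.filter (fun c : Fin s → Option (Fin m) => sup c = U)).card = m ^ U.card := by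
    set T : Fin s → Finset (Option (Fin m)) := fun t => if t ∈ U then univ.erase none else {none} with hT
    have h1 : (Fintype.piFinset T).card = m ^ U.card := by
      rw [Fintype.card_piFinset]
      have : ∀ t, (T t).card = if t ∈ U then m else 1 := by
        intro t; simp only [hT]; split_ifs
        · rw [card_erase_of_mem (mem_univ _), card_univ]; simp
        · simp
      simp only [this]
      rw [prod_ite]; simp
    rw [← h1]
    congr 1
    ext c
    rw [mem_filter, Fintype.mem_piFinset]
    simp only [mem_univ, true_and, hT]
    constructor
    · rintro rfl t
      split_ifs with h
      · exact mem_erase.mpr ⟨mem_sup.mp h, mem_univ _⟩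
      · rw [mem_sup] at h; push Not at h; simp [h]
    · intro H
      ext t
      have := H t
      rw [mem_sup]
      split_ifs at this with h
      · exact ⟨fun _ => h, fun _ => (mem_erase.mp this).1⟩
      · simp only [mem_singleton] at this; simp [this, h]
  rw [hc]
  split_ifs
  · rw [prod_div_distrib, prod_const]
    unfold pn; push_cast; ring
  · simp

lemma totient_pn (hP : PE D R pr) (W : ℕ) (hW : ∀ t, W.Coprime (pr t)) (U : Finset (Fin s)) :
    (1 : ℝ) / (Nat.totient (W * pn pr U) : ℝ) = 1 / (Nat.totient W : ℝ) * ∏ t ∈ U, (1 / ((pr t : ℝ) - 1)) := by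
  classical
  induction U using Finset.induction_on with
  | empty => simp [pn]
  | insert t U ht ih =>
    have hco : (W * pn pr U).Coprime (pr t) := by
      refine Nat.Coprime.mul_left (hW t) ?_
      rw [Nat.coprime_comm, Nat.Prime.coprime_iff_not_dvd (hP.prime t), mem_of_dvd_pn hP]
      exact ht
    have e : W * pn pr (insert t U) = W * pn pr U * pr t := by
      unfold pn; rw [prod_insert ht]; ring
    rw [e, Nat.totient_mul hco, Nat.totient_prime (hP.prime t), prod_insert ht]
    push_cast
    rw [Nat.cast_sub (hP.prime t).one_lt.le, one_div, mul_inv, ← one_div, ih]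
    push_cast; ring

/-- inner sum -/
lemma inner_r (hP : PE D R pr) (W : ℕ) (hW0 : 0 < W) (hW : ∀ t, W.Coprime (pr t)) (m z r : ℕ) (hr : 0 < r)
    (hm : ∀ t, (m : ℝ) * (1 / ((pr t : ℝ) - 1)) ≤ (pr t : ℝ) ^ (-(3/4) : ℝ)) :
    ∑ U ∈ univ.filter (fun U => pn pr U ≤ z ∧ r ∣ W * pn pr U), ∏ t ∈ U, ((m : ℝ) * (1 / ((pr t : ℝ) - 1))) ≤
      W * (r : ℝ) ^ (-(3/4) : ℝ) * VV (fun t => (pr t : ℝ)) z ^ (2 * m) := by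
  classical
  set g : Fin s → ℝ := fun t => (m : ℝ) * (1 / ((pr t : ℝ) - 1)) with hg
  have hp2 : ∀ t, (2 : ℝ) ≤ pr t := fun t => by exact_mod_cast (hP.prime t).two_le
  have hg0 : ∀ t, 0 ≤ g t := fun t => mul_nonneg (Nat.cast_nonneg _) (one_div_nonneg.mpr (by linarith [hp2 t]))
  set Ur : Finset (Fin s) := univ.filter (fun t => pr t ∣ r) with hUr
  have key : ∀ U, r ∣ W * pn pr U → ∏ t ∈ U, g t ≤ (W * (r : ℝ) ^ (-(3/4) : ℝ)) * ∏ t ∈ U \ Ur, ((2 * m : ℕ) : ℝ) / pr t := by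
    intro U hd
    have hsplit : ∏ t ∈ U, g t = (∏ t ∈ U ∩ Ur, g t) * ∏ t ∈ U \ Ur, g t := (prod_inter_mul_prod_diff U Ur g).symm
    have hr1 : r ∣ W * pn pr (U ∩ Ur) := by
      have e : pn pr U = pn pr (U ∩ Ur) * pn pr (U \ Ur) := (prod_inter_mul_prod_diff U Ur pr).symm
      rw [e, ← mul_assoc] at hd
      refine Nat.Coprime.dvd_of_dvd_mul_right ?_ hd
      unfold pn
      refine Nat.Coprime.prod_right fun t ht => ?_
      rw [Nat.coprime_comm, Nat.Prime.coprime_iff_not_dvd (hP.prime t)]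
      intro h
      rw [mem_sdiff, hUr, mem_filter] at ht
      exact ht.2 ⟨mem_univ _, h⟩
    have hrle : (r : ℝ) ≤ W * pn pr (U ∩ Ur) := by
      exact_mod_cast Nat.le_of_dvd (Nat.mul_pos hW0 (pn_pos hP _)) hr1
    have hr0 : (0 : ℝ) < r := by exact_mod_cast hr
    have hW1 : (1 : ℝ) ≤ W := by exact_mod_cast hW0
    have hpn : (0 : ℝ) < pn pr (U ∩ Ur) := by exact_mod_cast pn_pos hP _
    have h1 : ∏ t ∈ U ∩ Ur, g t ≤ W * (r : ℝ) ^ (-(3/4) : ℝ) := by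
      calc ∏ t ∈ U ∩ Ur, g t ≤ ∏ t ∈ U ∩ Ur, (pr t : ℝ) ^ (-(3/4) : ℝ) := prod_le_prod (fun t _ => hg0 t) fun t _ => hm t
        _ = (pn pr (U ∩ Ur) : ℝ) ^ (-(3/4) : ℝ) := by
            rw [Real.finsetProd_rpow _ _ (fun t _ => by positivity)]
            unfold pn; push_cast; rfl
        _ ≤ W * (r : ℝ) ^ (-(3/4) : ℝ) := by
            have h2 : (W * pn pr (U ∩ Ur) : ℝ) ^ (-(3/4) : ℝ) ≤ (r : ℝ) ^ (-(3/4) : ℝ) :=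
              Real.rpow_le_rpow_of_nonpos hr0 hrle (by norm_num)
            rw [Real.mul_rpow (by positivity) (by positivity)] at h2
            have h3 : (1 : ℝ) ≤ W * (W : ℝ) ^ (-(3/4) : ℝ) := by
              have : (W : ℝ) * (W : ℝ) ^ (-(3/4) : ℝ) = (W : ℝ) ^ ((1/4) : ℝ) := by
                nth_rewrite 1 [← Real.rpow_one (W : ℝ)]
                rw [← Real.rpow_add (by positivity)]; norm_num
              rw [this]; exact Real.one_le_rpow hW1 (by norm_num)
            have h4 : (0 : ℝ) ≤ (pn pr (U ∩ Ur) : ℝ) ^ (-(3/4) : ℝ) := by positivity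
            calc _ ≤ (W * (W : ℝ) ^ (-(3/4) : ℝ)) * (pn pr (U ∩ Ur) : ℝ) ^ (-(3/4) : ℝ) := le_mul_of_one_le_left h4 h3
              _ = W * ((W : ℝ) ^ (-(3/4) : ℝ) * (pn pr (U ∩ Ur) : ℝ) ^ (-(3/4) : ℝ)) := by ring
              _ ≤ _ := mul_le_mul_of_nonneg_left h2 (by positivity)
    rw [hsplit]
    refine mul_le_mul h1 (prod_le_prod (fun t _ => hg0 t) fun t _ => ?_) (prod_nonneg fun t _ => hg0 t) (by positivity)
    simp only [hg]
    have := hp2 t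
    rw [mul_one_div, div_le_div_iff₀ (by linarith) (by linarith)]
    push_cast
    have hm0 : (0:ℝ) ≤ m := Nat.cast_nonneg m
    nlinarith
  calc _ ≤ ∑ U ∈ univ.filter (fun U => pn pr U ≤ z ∧ r ∣ W * pn pr U), (W * (r : ℝ) ^ (-(3/4) : ℝ)) * ∏ t ∈ U \ Ur, ((2 * m : ℕ) : ℝ) / pr t :=
        sum_le_sum fun U hU => key U (mem_filter.mp hU).2.2
    _ = (W * (r : ℝ) ^ (-(3/4) : ℝ)) * ∑ U ∈ univ.filter (fun U => pn pr U ≤ z ∧ r ∣ W * pn pr U), ∏ t ∈ U \ Ur, ((2 * m : ℕ) : ℝ) / pr t := by rw [mul_sum]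
    _ ≤ _ := by
        refine mul_le_mul_of_nonneg_left ?_ (by positivity)
        refine le_trans ?_ (sum_pow_VV hP (2 * m) z)
        have hinj : Set.InjOn (fun U => U \ Ur) (univ.filter (fun U => pn pr U ≤ z ∧ r ∣ W * pn pr U ) : Finset (Finset (Fin s))) := by
          have hsub : ∀ U : Finset (Fin s), r ∣ W * pn pr U → U = (U \ Ur) ∪ Ur := by
            intro U hU
            refine (sdiff_union_of_subset ?_).symm
            intro t ht
            have h1 : pr t ∣ W * pn pr U := ((mem_filter.mp ht).2).trans hU
            exact (mem_of_dvd_pn hP).mp (Nat.Coprime.dvd_of_dvd_mul_left (hW t).symm h1)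
          intro U hU V hV e
          rw [hsub U (mem_filter.mp hU).2.2, hsub V (mem_filter.mp hV).2.2]
          simp only at e
          rw [e]
        rw [← sum_image (f := fun V => ∏ t ∈ V, ((2 * m : ℕ) : ℝ) / pr t) hinj]
        refine sum_le_sum_of_subset_of_nonneg ?_ fun _ _ _ => prod_nonneg fun _ _ => by positivity
        intro V hV
        obtain ⟨U, hU, rfl⟩ := mem_image.mp hV
        refine mem_filter.mpr ⟨mem_univ _, le_trans ?_ (mem_filter.mp hU).2.1⟩
        exact Nat.le_of_dvd (pn_pos hP _) (prod_dvd_prod_of_subset _ _ _ sdiff_subset)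

end
end TDR

namespace TDR
open Finset

lemma shift_sum (g : ℕ → ℝ) (h N : ℕ) (hg : ∀ n, g n ≠ 0 → h < n ∧ n ≤ N) :
    ∑ n ∈ Ioc 0 N, g (n + h) = ∑ n ∈ Ioc 0 N, g n := by
  have h1 : ∑ n ∈ Ioc 0 N, g (n + h) = ∑ n ∈ Ioc h (N + h), g n := by
    have := Finset.sum_map (Ioc 0 N) (addRightEmbedding h) g
    rw [Finset.map_add_right_Ioc, zero_add] at this
    exact this.symm
  rw [h1]
  have e1 : ∑ n ∈ Ioc h (N + h), g n = ∑ n ∈ Ioc 0 (N + h), g n := by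
    refine sum_subset (Ioc_subset_Ioc_left (Nat.zero_le _)) fun n hn hn' => ?_
    by_contra h0
    have := hg n h0
    rw [mem_Ioc] at hn hn'
    omega
  have e2 : ∑ n ∈ Ioc 0 N, g n = ∑ n ∈ Ioc 0 (N + h), g n := by
    refine sum_subset (Ioc_subset_Ioc_right (by omega)) fun n hn hn' => ?_
    by_contra h0
    have := hg n h0
    rw [mem_Ioc] at hn hn'
    omega
  rw [e1, e2]

section
variable {s k D R : ℕ} {pr : Fin s → ℕ}

lemma pn_union_le (hP : PE D R pr) (U V : Finset (Fin s)) : pn pr (U ∪ V) ≤ pn pr U * pn pr V := by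
  have e : pn pr U * pn pr V = pn pr (U ∪ V) * pn pr (U ∩ V) := (prod_union_inter).symm
  rw [e]
  exact Nat.le_mul_of_pos_right _ (pn_pos hP _)

open Classical in
theorem S2_gen (hP : PE D R pr) {h : Fin k → ℕ} (hcp : ∀ t i j n, pr t ∣ n + h i → pr t ∣ n + h j → i = j)
    (m : Fin k) (W b N P : ℕ) (hW0 : 0 < W) (hW : ∀ t, W.Coprime (pr t)) (hbm : (b + h m).Coprime W)
    (ω : ℕ → ℝ) (hω : ∀ n, ω n ≠ 0 → n.Prime ∧ P < n ∧ h m < n ∧ n ≤ N) (hPW : W * R ^ 2 ≤ P)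
    (hM : ∀ t, (((k + 1) ^ 2 : ℕ) : ℝ) * (1 / ((pr t : ℝ) - 1)) ≤ (pr t : ℝ) ^ (-(3/4) : ℝ))
    (l : (Fin s → Option (Fin k)) → ℝ) (Λ : ℝ) (hΛ : ∀ c, |l c| ≤ Λ)
    (hs : ∀ c, l c ≠ 0 → pn pr (sup c) ≤ R) (hm : ∀ c, l c ≠ 0 → ∀ t, c t ≠ some m) :
    |∑ n ∈ Ioc 0 N, (ω (n + h m) * (if n ≡ b [MOD W] then 1 else 0)) * HH pr h l n ^ 2 -
        ((∑ n ∈ Ioc 0 N, ω n) * (1 / (Nat.totient W : ℝ))) * BB (fun t => (pr t : ℝ) - 1) l l| ≤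
      Λ ^ 2 * (1 / (Nat.totient W : ℝ) * (W * VV (fun t => (pr t : ℝ)) ((R ^ 2 : ℕ) : ℝ) ^ (2 * (k + 1) ^ 2) *
        ∑ r ∈ Ioc 1 P, (r : ℝ) ^ (-(3/4) : ℝ) * EE ω N r)) := by
  have hφ : (0 : ℝ) < Nat.totient W := by exact_mod_cast Nat.totient_pos.mpr hW0
  set F : Finset (Fin s) → ℝ := fun U => if pn pr U ≤ R ^ 2 then
    1 / (Nat.totient (W * pn pr U) : ℝ) * ∑ r ∈ (Ioc 1 P).filter (fun r => r ∣ W * pn pr U), EE ω N r else 0 with hF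
  have hF0 : ∀ U, 0 ≤ F U := by
    intro U; simp only [hF]; split_ifs
    · exact mul_nonneg (by positivity) (sum_nonneg fun _ _ => EE_nonneg _ _ _)
    · exact le_rfl
  have hΛ0 : 0 ≤ Λ := (abs_nonneg _).trans (hΛ fun _ => none)
  refine (G_expand hcp l (Ioc 0 N) _ (fun t => (pr t : ℝ) - 1) ((∑ n ∈ Ioc 0 N, ω n) * (1 / (Nat.totient W : ℝ)))
    (fun c c' => F (sup c ∪ sup c')) (fun _ _ => hF0 _) ?_).trans ?_
  · intro c c' h1 h2 _
    have hsz : pn pr (sup c ∪ sup c') ≤ R ^ 2 := by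
      refine (pn_union_le hP _ _).trans ?_
      rw [sq]; exact Nat.mul_le_mul (hs c h1) (hs c' h2)
    obtain ⟨v, hv⟩ := dv_class hP W b h (jn c c') (fun t _ => hW t)
    have hvv := (hv v).mpr (Nat.ModEq.refl _)
    rw [mU_sup, mul_assoc, ← totient_pn hP W hW]
    rw [sup_jn] at hv ⊢
    simp only [hF]
    rw [if_pos hsz]
    set M := W * pn pr (sup c ∪ sup c') with hMd
    have hM0 : 0 < M := Nat.mul_pos hW0 (pn_pos hP _)
    have hMP : M ≤ P := (Nat.mul_le_mul_left W hsz).trans hPW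
    have ha : (v + h m).Coprime M := by
      refine Nat.Coprime.mul_right ?_ ?_
      · have : v + h m ≡ b + h m [MOD W] := hvv.1.add_right _
        exact (Nat.ModEq.gcd_eq this).trans hbm
      · unfold pn
        refine Nat.Coprime.prod_right fun t ht => ?_
        rw [Nat.coprime_comm, Nat.Prime.coprime_iff_not_dvd (hP.prime t)]
        intro hd
        rw [← sup_jn, mem_sup] at ht
        obtain ⟨i, hi⟩ := Option.ne_none_iff_exists'.mp ht
        have h3 := hcp t i m v (hvv.2 t i hi) hd
        rw [h3] at hi
        have : c t = some m ∨ c' t = some m := by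
          unfold jn at hi
          rcases hc : c t with _ | j
          · rw [hc] at hi; right; simpa [jo] using hi
          · rw [hc] at hi; left; simpa [jo] using hi
        exact this.elim (hm c h1 t) (hm c' h2 t)
    have key := char_err M P N (v + h m) hM0 hMP ha ω (fun n hn => by
      obtain ⟨a1, a2, _, _⟩ := hω n hn
      rw [Nat.Prime.coprime_iff_not_dvd a1]
      intro hd
      have := Nat.le_of_dvd hM0 hd
      omega)
    convert key using 3
    rw [← shift_sum (fun n => ω n * (if n ≡ v + h m [MOD M] then 1 else 0)) (h m) N (fun n hn => by
      obtain ⟨_, _, a3, a4⟩ := hω n (left_ne_zero_of_mul hn)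
      exact ⟨a3, a4⟩)]
    refine sum_congr rfl fun n _ => ?_
    have e1 := hv n
    have e2 : n + h m ≡ v + h m [MOD M] ↔ n ≡ v [MOD M] := ⟨Nat.ModEq.add_right_cancel' _, fun hh => hh.add_right _⟩
    unfold dvi
    by_cases h3 : n ≡ b [MOD W] <;> by_cases h4 : dv pr h n (jn c c') <;> simp [h3, h4] at e1 ⊢ <;> simp [e1, e2]
  · calc ∑ c, ∑ c', |l c| * |l c'| * F (sup c ∪ sup c') ≤ ∑ c : Fin s → Option (Fin k), ∑ c' : Fin s → Option (Fin k), Λ ^ 2 * F (sup c ∪ sup c') := by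
          refine sum_le_sum fun c _ => sum_le_sum fun c' _ => mul_le_mul_of_nonneg_right ?_ (hF0 _)
          rw [sq]; exact mul_le_mul (hΛ c) (hΛ c') (abs_nonneg _) hΛ0
      _ = Λ ^ 2 * ∑ c : Fin s → Option (Fin k), ∑ c' : Fin s → Option (Fin k), F (sup c ∪ sup c') := by simp only [mul_sum]
      _ ≤ _ := by
          refine mul_le_mul_of_nonneg_left ((pairs_le F hF0).trans ?_) (by positivity)
          set q : ℕ := (k + 1) ^ 2 with hq
          have e : ∀ U, ((k + 1) ^ 2 : ℝ) ^ U.card * F U = ∑ r ∈ Ioc 1 P,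
              1 / (Nat.totient W : ℝ) * EE ω N r * (if pn pr U ≤ R ^ 2 ∧ r ∣ W * pn pr U then ∏ t ∈ U, ((q : ℝ) * (1 / ((pr t : ℝ) - 1))) else 0) := by
            intro U
            simp only [hF]
            split_ifs with hU
            · rw [totient_pn hP W hW, sum_filter, mul_sum, mul_sum]
              refine sum_congr rfl fun r _ => ?_
              by_cases hr : r ∣ W * pn pr U
              · simp only [hr, hU, and_self, if_true]
                rw [prod_mul_distrib, prod_const, hq]; push_cast; ring
              · simp [hr]
            · simp [hU]
          simp only [e]
          rw [sum_comm, mul_sum, mul_sum]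
          refine sum_le_sum fun r hr => ?_
          rw [← mul_sum, ← sum_filter]
          have h1 := inner_r hP W hW0 hW q (R ^ 2) r (by rw [mem_Ioc] at hr; omega) hM
          have h2 : 0 ≤ 1 / (Nat.totient W : ℝ) * EE ω N r := mul_nonneg (by positivity) (EE_nonneg _ _ _)
          refine (mul_le_mul_of_nonneg_left h1 h2).trans (le_of_eq ?_)
          ring

end
end TDR

namespace TDR
open Finset

section
variable {s k D R : ℕ} {pr : Fin s → ℕ}

lemma HH_rl {h : Fin k → ℕ} (al : Fin s → Option (Fin k) → ℝ) (l : (Fin s → Option (Fin k)) → ℝ) (n : ℕ)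
    (ha : ∀ c, l c ≠ 0 → dv pr h n c → ∀ t, al t (c t) = 1) : HH pr h l n = HH pr h (rl al l) n := by
  unfold HH
  refine sum_congr rfl fun c _ => ?_
  by_cases h1 : l c = 0
  · simp [rl, h1]
  · by_cases h2 : dv pr h n c
    · rw [rl, prod_eq_one fun t _ => ha c h1 h2 t, one_mul]
    · simp [dvi, h2]

lemma rl_abs_le (al : Fin s → Option (Fin k) → ℝ) (hal : ∀ t o, al t o = 0 ∨ al t o = 1)
    (l : (Fin s → Option (Fin k)) → ℝ) (c : Fin s → Option (Fin k)) : |rl al l c| ≤ |l c| := by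
  unfold rl
  rw [abs_mul]
  refine mul_le_of_le_one_left (abs_nonneg _) ?_
  rw [abs_prod]
  refine prod_le_one (fun _ _ => abs_nonneg _) fun t _ => ?_
  rcases hal t (c t) with h | h <;> simp [h]

lemma rl_ne {al : Fin s → Option (Fin k) → ℝ} {l : (Fin s → Option (Fin k)) → ℝ} {c : Fin s → Option (Fin k)}
    (hc : rl al l c ≠ 0) : l c ≠ 0 ∧ ∀ t, al t (c t) ≠ 0 := by
  unfold rl at hc
  exact ⟨right_ne_zero_of_mul hc, fun t h => left_ne_zero_of_mul hc (prod_eq_zero (mem_univ t) h)⟩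

lemma alB_01 (B : Finset (Fin s)) (t : Fin s) (o : Option (Fin k)) : alB B t o = 0 ∨ alB B t o = 1 := by
  unfold alB; split_ifs <;> simp

lemma alm_01 (m : Fin k) (t : Fin s) (o : Option (Fin k)) : alm m t o = 0 ∨ alm m t o = 1 := by
  unfold alm; split_ifs <;> simp

lemma rl_alB_empty (l : (Fin s → Option (Fin k)) → ℝ) : rl (alB ∅) l = l := by
  funext c; simp [rl, alB]

/-- telescoping sum of inverse squares over the primes of the sieve -/
lemma sum_inv_sq (hP : PE D R pr) (hD : 1 ≤ D) : ∑ t, 1 / (pr t : ℝ) ^ 2 ≤ 1 / (D : ℝ) := by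
  have h1 : ∑ t, 1 / (pr t : ℝ) ^ 2 = ∑ a ∈ univ.image pr, 1 / (a : ℝ) ^ 2 := by
    rw [sum_image fun a _ b _ e => hP.inj e]
  rw [h1]
  have h2 : univ.image pr ⊆ Ioc D (D + R) := by
    intro a ha
    obtain ⟨t, _, rfl⟩ := mem_image.mp ha
    rw [mem_Ioc]; exact ⟨hP.lo t, by have := hP.hi t; omega⟩
  refine (sum_le_sum_of_subset_of_nonneg h2 fun _ _ _ => by positivity).trans ?_
  have h3 : ∀ m : ℕ, ∑ a ∈ Ioc D (D + m), 1 / (a : ℝ) ^ 2 ≤ 1 / (D : ℝ) - 1 / ((D + m : ℕ) : ℝ) := by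
    intro m
    induction m with
    | zero => simp
    | succ m ih =>
      rw [← add_assoc, Finset.sum_Ioc_succ_top (by omega)]
      have hp : (0 : ℝ) < ((D + m : ℕ) : ℝ) := by exact_mod_cast (by omega : 0 < D + m)
      have : 1 / ((D + m + 1 : ℕ) : ℝ) ^ 2 ≤ 1 / ((D + m : ℕ) : ℝ) - 1 / ((D + m + 1 : ℕ) : ℝ) := by
        push_cast at hp ⊢
        rw [div_sub_div _ _ hp.ne' (by linarith), div_le_div_iff₀ (by positivity) (by positivity)]
        nlinarith
      linarith
  refine (h3 R).trans ?_
  have : (0 : ℝ) ≤ 1 / ((D + R : ℕ) : ℝ) := by positivity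
  linarith

open Classical in
/-- the sieve weights with an extra divisibility `pr t₀ ∣ n + g` -/
theorem S1q (hP : PE D R pr) {h : Fin k → ℕ} (hcp : ∀ t i j n, pr t ∣ n + h i → pr t ∣ n + h j → i = j)
    (W b N : ℕ) (hW : 0 < W) (hWp : ∀ t, W.Coprime (pr t)) (l : (Fin s → Option (Fin k)) → ℝ) (Λ : ℝ) (hΛ : ∀ c, |l c| ≤ Λ)
    (hs : ∀ c, l c ≠ 0 → pn pr (sup c) ≤ R) (t0 : Fin s) (i : Fin k)
    (hq : ∀ n j, 0 < n → pr t0 ∣ n + h i - 1 → ¬ pr t0 ∣ n + h j) :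
    |∑ n ∈ Ioc 0 N, (if n ≡ b [MOD W] then 1 else 0) * (if pr t0 ∣ n + h i - 1 then 1 else 0) * HH pr h l n ^ 2 -
      N / (W * pr t0) * BB (fun t => (pr t : ℝ)) (rl (alB {t0}) l) (rl (alB {t0}) l)| ≤
      (Λ * (R * VV (fun t => (pr t : ℝ)) R ^ k)) ^ 2 := by
  obtain ⟨v, hv⟩ : ∃ v, ∀ n, 0 < n → ((n ≡ b [MOD W] ∧ pr t0 ∣ n + h i - 1) ↔ n ≡ v [MOD W * pr t0]) := by
    have hpos := (hP.prime t0).pos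
    obtain ⟨u, hu⟩ : ∃ u, u + h i ≡ 1 [MOD pr t0] := by
      refine ⟨pr t0 * h i + 1 - h i, ?_⟩
      have : h i ≤ pr t0 * h i := Nat.le_mul_of_pos_left _ hpos
      have e : pr t0 * h i + 1 - h i + h i = 1 + pr t0 * h i := by omega
      rw [e]
      exact Nat.ModEq.symm ((Nat.modEq_iff_dvd' (by omega)).mpr ⟨h i, by omega⟩)
    obtain ⟨v, hv1, hv2⟩ := Nat.chineseRemainder (hWp t0) b u
    refine ⟨v, fun n hn => ?_⟩
    rw [← Nat.modEq_and_modEq_iff_modEq_mul (hWp t0)]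
    refine and_congr ⟨fun h => h.trans hv1.symm, fun h => h.trans hv1⟩ ?_
    rw [← Nat.modEq_iff_dvd' (by omega)]
    constructor
    · intro h1
      exact Nat.ModEq.add_right_cancel' (h i) (h1.symm.trans (hu.symm.trans (hv2.symm.add_right _)))
    · intro h1
      exact ((h1.add_right (h i)).trans ((hv2.add_right _).trans hu)).symm
  have key := S1_gen hP hcp (W * pr t0) v N (Nat.mul_pos hW (hP.prime t0).pos) (rl (alB {t0}) l) Λ
    (fun c => (rl_abs_le _ (alB_01 _) l c).trans (hΛ c)) (fun c hc => hs c (rl_ne hc).1) (fun c hc t ht => by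
      refine Nat.Coprime.mul_left (hWp t) ?_
      rw [Nat.coprime_primes (hP.prime _) (hP.prime _)]
      intro e
      have := hP.inj e
      have h2 := (rl_ne hc).2 t
      rw [mem_sup] at ht
      apply h2
      unfold alB
      rw [if_pos ⟨by rw [this]; simp, ht⟩])
  push_cast at key
  convert key using 3
  refine sum_congr rfl fun n hn => ?_
  have hn0 : 0 < n := (mem_Ioc.mp hn).1
  have e := hv n hn0
  by_cases h1 : n ≡ b [MOD W] <;> by_cases h2 : pr t0 ∣ n + h i - 1 <;> simp only [h1, h2, true_and, and_true, and_self, false_and, true_iff, false_iff, if_true, if_false, mul_zero, zero_mul, mul_one, one_mul] at e ⊢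
  · rw [if_pos e, one_mul]
    congr 1
    refine HH_rl _ l n fun c _ hd t => ?_
    unfold alB
    rw [if_neg]
    rintro ⟨h3, h4⟩
    rw [mem_singleton] at h3
    obtain ⟨j, hj⟩ := Option.ne_none_iff_exists'.mp h4
    have := hd t j hj
    rw [h3] at this
    exact hq n j hn0 h2 this
  all_goals rw [if_neg e, zero_mul]

end
end TDR

namespace TDR
open Finset

section
variable {s k D R : ℕ} {pr : Fin s → ℕ}

open Classical in
/-- truncated sum of `1/p` over the sieve primes in `T` dividing `n + h i - 1` -/
noncomputable def ff (pr : Fin s → ℕ) (h : Fin k → ℕ) (T : Finset (Fin s)) (n : ℕ) : ℝ :=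
  ∑ i, ∑ t ∈ T, (if pr t ∣ n + h i - 1 then 1 / (pr t : ℝ) else 0)

open Classical in
theorem sieve_up (hP : PE D R pr) (hD : 1 ≤ D) {h : Fin k → ℕ} (hcp : ∀ t i j n, pr t ∣ n + h i → pr t ∣ n + h j → i = j)
    (hq : ∀ t i n j, 0 < n → pr t ∣ n + h i - 1 → ¬ pr t ∣ n + h j)
    (W b N : ℕ) (hW : 0 < W) (hWp : ∀ t, W.Coprime (pr t)) (l : (Fin s → Option (Fin k)) → ℝ) (Λ : ℝ) (hΛ : ∀ c, |l c| ≤ Λ)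
    (hs : ∀ c, l c ≠ 0 → pn pr (sup c) ≤ R) (T : Finset (Fin s)) (A E : ℝ)
    (hA : 0 ≤ A) (hB0 : BB (fun t => (pr t : ℝ)) l l ≤ A)
    (hB1 : ∀ t, BB (fun t => (pr t : ℝ)) (rl (alB {t}) l) (rl (alB {t}) l) ≤ 4 * A)
    (hE : (Λ * (R * VV (fun t => (pr t : ℝ)) R ^ k)) ^ 2 ≤ E) (κ C : ℝ) (hκ : 0 ≤ κ) (hC : 0 ≤ C) :
    ∑ n ∈ Ioc 0 N, (if n ≡ b [MOD W] then 1 else 0) * HH pr h l n ^ 2 * (κ + C * ff pr h T n) ≤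
      κ * (N / W * A + E) + C * (k * (4 * (N / W * A) * (1 / D) + T.card * E)) := by
  have hW0 : (0 : ℝ) < W := by exact_mod_cast hW
  have h1 : ∑ n ∈ Ioc 0 N, (if n ≡ b [MOD W] then 1 else 0) * HH pr h l n ^ 2 ≤ N / W * A + E := by
    have := (abs_le.mp (S1_gen hP hcp W b N hW l Λ hΛ hs (fun c _ t _ => hWp t))).2
    have h2 : (N : ℝ) / W * BB (fun t => (pr t : ℝ)) l l ≤ N / W * A := mul_le_mul_of_nonneg_left hB0 (by positivity)
    linarith
  have hE0 : 0 ≤ E := (sq_nonneg _).trans hE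
  have h2 : ∀ i t, ∑ n ∈ Ioc 0 N, (if n ≡ b [MOD W] then 1 else 0) * HH pr h l n ^ 2 * (if pr t ∣ n + h i - 1 then 1 / (pr t : ℝ) else 0) ≤
      4 * (N / W * A) * (1 / (pr t : ℝ) ^ 2) + E := by
    intro i t
    have hp : (1 : ℝ) ≤ pr t := hP.one_le t
    have := (abs_le.mp (S1q hP hcp W b N hW hWp l Λ hΛ hs t i (fun n j => hq t i n j))).2
    have h3 : (N : ℝ) / (W * pr t) * BB (fun t => (pr t : ℝ)) (rl (alB {t}) l) (rl (alB {t}) l) ≤ N / (W * pr t) * (4 * A) :=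
      mul_le_mul_of_nonneg_left (hB1 t) (by positivity)
    have h4 : ∑ n ∈ Ioc 0 N, (if n ≡ b [MOD W] then 1 else 0) * HH pr h l n ^ 2 * (if pr t ∣ n + h i - 1 then 1 / (pr t : ℝ) else 0) =
        1 / (pr t : ℝ) * ∑ n ∈ Ioc 0 N, (if n ≡ b [MOD W] then 1 else 0) * (if pr t ∣ n + h i - 1 then 1 else 0) * HH pr h l n ^ 2 := by
      rw [mul_sum]
      refine sum_congr rfl fun n _ => ?_
      split_ifs <;> ring
    rw [h4]
    calc _ ≤ 1 / (pr t : ℝ) * (N / (W * pr t) * (4 * A) + E) := mul_le_mul_of_nonneg_left (by linarith) (by positivity)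
      _ = 4 * (N / W * A) * (1 / (pr t : ℝ) ^ 2) + 1 / (pr t : ℝ) * E := by field_simp
      _ ≤ _ := by
          have : 1 / (pr t : ℝ) ≤ 1 := by rw [div_le_one (by linarith)]; exact hp
          have := mul_le_of_le_one_left hE0 this
          linarith
  have h3 : ∑ n ∈ Ioc 0 N, (if n ≡ b [MOD W] then 1 else 0) * HH pr h l n ^ 2 * ff pr h T n ≤
      k * (4 * (N / W * A) * (1 / D) + T.card * E) := by
    have e : ∑ n ∈ Ioc 0 N, (if n ≡ b [MOD W] then 1 else 0) * HH pr h l n ^ 2 * ff pr h T n =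
        ∑ i, ∑ t ∈ T, ∑ n ∈ Ioc 0 N, (if n ≡ b [MOD W] then 1 else 0) * HH pr h l n ^ 2 * (if pr t ∣ n + h i - 1 then 1 / (pr t : ℝ) else 0) := by
      unfold ff
      simp only [mul_sum]
      rw [sum_comm]
      exact sum_congr rfl fun i _ => by rw [sum_comm]
    rw [e]
    calc _ ≤ ∑ _i : Fin k, ∑ t ∈ T, (4 * (N / W * A) * (1 / (pr t : ℝ) ^ 2) + E) := sum_le_sum fun i _ => sum_le_sum fun t _ => h2 i t
      _ = k * (4 * (N / W * A) * (∑ t ∈ T, 1 / (pr t : ℝ) ^ 2) + T.card * E) := by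
          rw [sum_const, sum_add_distrib, sum_const, ← mul_sum, nsmul_eq_mul, nsmul_eq_mul]; simp
      _ ≤ _ := by
          have h5 : ∑ t ∈ T, 1 / (pr t : ℝ) ^ 2 ≤ 1 / (D : ℝ) :=
            (sum_le_sum_of_subset_of_nonneg (subset_univ T) fun _ _ _ => by positivity).trans (sum_inv_sq hP hD)
          gcongr
  calc _ = κ * ∑ n ∈ Ioc 0 N, (if n ≡ b [MOD W] then 1 else 0) * HH pr h l n ^ 2 + C * ∑ n ∈ Ioc 0 N, (if n ≡ b [MOD W] then 1 else 0) * HH pr h l n ^ 2 * ff pr h T n := by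
        rw [mul_sum, mul_sum, ← sum_add_distrib]
        exact sum_congr rfl fun n _ => by ring
    _ ≤ _ := add_le_add (mul_le_mul_of_nonneg_left h1 hκ) (mul_le_mul_of_nonneg_left h3 hC)

open Classical in
theorem sieve_low (hP : PE D R pr) {h : Fin k → ℕ} (hcp : ∀ t i j n, pr t ∣ n + h i → pr t ∣ n + h j → i = j)
    (m : Fin k) (W b N P : ℕ) (hW0 : 0 < W) (hW : ∀ t, W.Coprime (pr t)) (hbm : (b + h m).Coprime W)
    (ω : ℕ → ℝ) (hω : ∀ n, ω n ≠ 0 → n.Prime ∧ P < n ∧ h m < n ∧ n ≤ N) (hPW : W * R ^ 2 ≤ P)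
    (hM : ∀ t, (((k + 1) ^ 2 : ℕ) : ℝ) * (1 / ((pr t : ℝ) - 1)) ≤ (pr t : ℝ) ^ (-(3/4) : ℝ))
    (l : (Fin s → Option (Fin k)) → ℝ) (Λ : ℝ) (hΛ : ∀ c, |l c| ≤ Λ)
    (hs : ∀ c, l c ≠ 0 → pn pr (sup c) ≤ R) (c1 B E : ℝ) (hc1 : 0 ≤ c1) (hB : 0 ≤ B) (hX : c1 ≤ ∑ n ∈ Ioc 0 N, ω n)
    (hBB : B ≤ BB (fun t => (pr t : ℝ) - 1) (rl (alm m) l) (rl (alm m) l))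
    (hE : Λ ^ 2 * (W * VV (fun t => (pr t : ℝ)) ((R ^ 2 : ℕ) : ℝ) ^ (2 * (k + 1) ^ 2) *
        ∑ r ∈ Ioc 1 P, (r : ℝ) ^ (-(3/4) : ℝ) * EE ω N r) ≤ E) :
    1 / (Nat.totient W : ℝ) * (c1 * B - E) ≤
      ∑ n ∈ Ioc 0 N, (ω (n + h m) * (if n ≡ b [MOD W] then 1 else 0)) * HH pr h l n ^ 2 := by
  have key := (abs_le.mp (S2_gen hP hcp m W b N P hW0 hW hbm ω hω hPW hM (rl (alm m) l) Λ
    (fun c => (rl_abs_le _ (alm_01 _) l c).trans (hΛ c)) (fun c hc => hs c (rl_ne hc).1) (fun c hc t h1 => by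
      have := (rl_ne hc).2 t
      exact this (by rw [alm, if_pos h1])))).1
  have hφ : (0 : ℝ) < Nat.totient W := by exact_mod_cast Nat.totient_pos.mpr hW0
  have e : ∑ n ∈ Ioc 0 N, (ω (n + h m) * (if n ≡ b [MOD W] then 1 else 0)) * HH pr h l n ^ 2 =
      ∑ n ∈ Ioc 0 N, (ω (n + h m) * (if n ≡ b [MOD W] then 1 else 0)) * HH pr h (rl (alm m) l) n ^ 2 := by
    refine sum_congr rfl fun n _ => ?_
    by_cases h0 : ω (n + h m) = 0
    · rw [h0]; ring
    congr 2
    obtain ⟨a1, a2, _, _⟩ := hω _ h0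
    refine HH_rl _ l n fun c _ hd t => ?_
    rw [alm, if_neg]
    intro h1
    have h2 := hd t m h1
    rw [Nat.prime_dvd_prime_iff_eq (hP.prime t) a1] at h2
    have h3 := hP.hi t
    have : R ≤ W * R ^ 2 := by nlinarith [Nat.zero_le R]
    omega
  rw [e]
  have h1 : c1 * B ≤ (∑ n ∈ Ioc 0 N, ω n) * BB (fun t => (pr t : ℝ) - 1) (rl (alm m) l) (rl (alm m) l) :=
    mul_le_mul hX hBB hB (hc1.trans hX)
  have h2 : 1 / (Nat.totient W : ℝ) * (c1 * B - E) ≤ 1 / (Nat.totient W : ℝ) * ((∑ n ∈ Ioc 0 N, ω n) * BB (fun t => (pr t : ℝ) - 1) (rl (alm m) l) (rl (alm m) l)) -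
      1 / (Nat.totient W : ℝ) * (Λ ^ 2 * (W * VV (fun t => (pr t : ℝ)) ((R ^ 2 : ℕ) : ℝ) ^ (2 * (k + 1) ^ 2) *
        ∑ r ∈ Ioc 1 P, (r : ℝ) ^ (-(3/4) : ℝ) * EE ω N r)) := by
    rw [← mul_sub]
    exact mul_le_mul_of_nonneg_left (by linarith) (by positivity)
  refine h2.trans ?_
  linarith [key]

open Classical in
/-- comparison: if the number of prime hits is always small, the lower sums are bounded by the upper sum -/
theorem sieve_cmp {h : Fin k → ℕ} (W b N : ℕ) (l : (Fin s → Option (Fin k)) → ℝ) (T : Finset (Fin s))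
    (ω : ℕ → ℝ) (Ω κ C : ℝ) (hΩ : ∀ n, ω n ≤ Ω) (hΩ0 : 0 ≤ Ω)
    (hn : ∀ n ∈ Ioc 0 N, n ≡ b [MOD W] → ((univ.filter (fun m : Fin k => ω (n + h m) ≠ 0)).card : ℝ) ≤ κ + C * ff pr h T n) :
    ∑ m : Fin k, ∑ n ∈ Ioc 0 N, (ω (n + h m) * (if n ≡ b [MOD W] then 1 else 0)) * HH pr h l n ^ 2 ≤
      Ω * ∑ n ∈ Ioc 0 N, (if n ≡ b [MOD W] then 1 else 0) * HH pr h l n ^ 2 * (κ + C * ff pr h T n) := by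
  rw [sum_comm, mul_sum]
  refine sum_le_sum fun n hnN => ?_
  by_cases hb : n ≡ b [MOD W]
  · simp only [hb, if_true, mul_one, one_mul]
    rw [← sum_mul]
    have h1 : ∑ m : Fin k, ω (n + h m) ≤ Ω * (κ + C * ff pr h T n) := by
      calc ∑ m : Fin k, ω (n + h m) = ∑ m ∈ univ.filter (fun m : Fin k => ω (n + h m) ≠ 0), ω (n + h m) := (sum_filter_ne_zero _).symm
        _ ≤ ∑ m ∈ univ.filter (fun m : Fin k => ω (n + h m) ≠ 0), Ω := sum_le_sum fun m _ => hΩ _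
        _ = Ω * ((univ.filter (fun m : Fin k => ω (n + h m) ≠ 0)).card : ℝ) := by rw [sum_const, nsmul_eq_mul, mul_comm]
        _ ≤ _ := mul_le_mul_of_nonneg_left (hn n hnN hb) hΩ0
    calc _ ≤ (Ω * (κ + C * ff pr h T n)) * HH pr h l n ^ 2 := mul_le_mul_of_nonneg_right h1 (sq_nonneg _)
      _ = _ := by ring
  · simp [hb]

end
end TDR

namespace TDR
open Finset

lemma final_num (k : ℕ) (hk : 1 ≤ k) (c1 C1 φ W A1 A2 L l τ K J N : ℝ) (hc1 : 0 < c1) (hC1 : 0 < C1) (hφ : 0 < φ) (hW : 0 < W)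
    (hτ : τ * (384 * k * (J + 1)) = 1) (hJ : 0 ≤ J) (hK : 0 ≤ K) (hL : 0 < L) (hl : L / 400 ≤ l)
    (hA1 : (J + 1) * (φ / W * τ * l) / 4 ≤ A1) (hA2 : A2 ≤ 24 * (φ / W * τ * l)) (hA20 : 0 < A2)
    (hN : N ≤ 500 * Real.exp L)
    (hbig : 400 * 384 * 2048 * 12000 * C1 * (K + 2) < c1 * (J + 1))
    (h : k * (1 / φ * (c1 * (1 / 64 * A1 ^ 2 * A2 ^ (k - 1)) - c1 / 128 * (A1 ^ 2 * A2 ^ (k - 1)))) ≤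
      C1 * L * Real.exp (-L) * ((K + 2) * (N / W * A2 ^ k))) : False := by
  have hk0 : (0 : ℝ) < k := by exact_mod_cast hk
  have hτ0 : 0 < τ := by
    by_contra hh
    push Not at hh
    have : τ * (384 * k * (J + 1)) ≤ 0 := mul_nonpos_of_nonpos_of_nonneg hh (by positivity)
    linarith
  have hl0 : 0 < l := by linarith
  set x := φ / W * τ * l with hx
  have hx0 : 0 < x := by positivity
  have e1 : A2 ^ k = A2 * A2 ^ (k - 1) := by rw [← pow_succ']; congr 1; omega
  set Y := A2 ^ (k - 1) with hY
  have hY0 : 0 < Y := by positivity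
  have h1 : (k * (c1 / (128 * φ)) * A1 ^ 2) * Y ≤ (C1 * L * (K + 2) * 500 / W * A2) * Y := by
    calc _ = k * (1 / φ * (c1 * (1 / 64 * A1 ^ 2 * Y) - c1 / 128 * (A1 ^ 2 * Y))) := by field_simp; ring
      _ ≤ _ := h
      _ = (C1 * L * (K + 2) / W * A2 * Y) * (Real.exp (-L) * N) := by rw [e1]; ring
      _ ≤ (C1 * L * (K + 2) / W * A2 * Y) * 500 := by
          refine mul_le_mul_of_nonneg_left ?_ (by positivity)
          calc Real.exp (-L) * N ≤ Real.exp (-L) * (500 * Real.exp L) := mul_le_mul_of_nonneg_left hN (Real.exp_pos _).le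
            _ = 500 * (Real.exp (-L) * Real.exp L) := by ring
            _ = 500 := by rw [← Real.exp_add]; simp
      _ = _ := by ring
  have h2 := le_of_mul_le_mul_right h1 hY0
  have h3 : k * (c1 / (128 * φ)) * ((J + 1) * x / 4) ^ 2 ≤ C1 * L * (K + 2) * 500 / W * (24 * x) :=
    calc _ ≤ k * (c1 / (128 * φ)) * A1 ^ 2 := by gcongr
      _ ≤ _ := h2
      _ ≤ _ := by gcongr
  have h4 : (k * c1 * (J + 1) ^ 2 * (τ * l) / 2048) * (x / W) ≤ (12000 * C1 * L * (K + 2)) * (x / W) := by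
    calc _ = k * (c1 / (128 * φ)) * ((J + 1) * x / 4) ^ 2 := by rw [hx]; field_simp; ring
      _ ≤ _ := h3
      _ = _ := by ring
  have h5 := le_of_mul_le_mul_right h4 (by positivity)
  have h6 : k * c1 * (J + 1) ^ 2 * (τ * l) / 2048 = (τ * (384 * k * (J + 1))) * (c1 * (J + 1) * l / (384 * 2048)) := by ring
  rw [h6, hτ, one_mul] at h5
  have h7 : c1 * (J + 1) * (L / 400) ≤ c1 * (J + 1) * l := mul_le_mul_of_nonneg_left hl (by positivity)
  have h8 := mul_lt_mul_of_pos_right hbig hL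
  nlinarith

lemma ev_poly (C a : ℝ) (n : ℕ) (ha : 0 < a) : ∀ᶠ L : ℝ in Filter.atTop, C * L ^ n ≤ Real.exp (a * L) := by
  have h1 : Filter.Tendsto (fun L : ℝ => (a * L) ^ n * Real.exp (-(a * L))) Filter.atTop (nhds 0) :=
    (Real.tendsto_pow_mul_exp_neg_atTop_nhds_zero n).comp (Filter.tendsto_id.const_mul_atTop ha)
  have h2 := h1.const_mul (C / a ^ n)
  rw [mul_zero] at h2
  filter_upwards [h2.eventually (gt_mem_nhds one_pos)] with L hL
  have e : C / a ^ n * ((a * L) ^ n * Real.exp (-(a * L))) = C * L ^ n * Real.exp (-(a * L)) := by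
    rw [mul_pow]; field_simp
  rw [e, Real.exp_neg] at hL
  have := Real.exp_pos (a * L)
  rw [mul_inv_lt_iff₀ this, one_mul] at hL
  exact hL.le

/-- all the largeness conditions on `L` used in the main argument -/
lemma ev_all (k M K W : ℕ) (c1 τ Z : ℝ) (hc1 : 0 < c1) (hτ : 0 < τ) : ∃ L0 : ℝ, ∀ L, L0 ≤ L →
    1 ≤ L ∧ 1600 ≤ L ∧ Z ≤ τ * (L / 400) ∧ (W : ℝ) ≤ Real.exp (L / 400) ∧ (k * k.factorial : ℝ) < Real.exp L ∧
    4 ^ (2 * k) * 2 ^ (2 * M) * W * 128 / c1 ≤ L ∧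
    ((8 * L ^ 2) ^ (2 * k) * (K + 4 * k ^ 2 * L)) * W ≤ Real.exp (L / 2) ∧ L + 1 ≤ Real.exp (L / 200) := by
  have h1 := Filter.eventually_ge_atTop (1600 : ℝ)
  have h2 := Filter.eventually_ge_atTop (Z / τ * 400)
  have h3 := ev_poly W (1 / 400) 0 (by norm_num)
  have h4 := ev_poly (k * k.factorial + 1) 1 0 (by norm_num)
  have h5 := Filter.eventually_ge_atTop ((4 ^ (2 * k) * 2 ^ (2 * M) * W * 128 / c1 : ℝ))
  have h6 := ev_poly (8 ^ (2 * k) * (K + 4 * k ^ 2) * W) (1 / 2) (4 * k + 1) (by norm_num)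
  have h7 := ev_poly 2 (1 / 200) 1 (by norm_num)
  obtain ⟨L0, hL0⟩ := Filter.eventually_atTop.mp (h1.and (h2.and (h3.and (h4.and (h5.and (h6.and h7))))))
  refine ⟨L0, fun L hL => ?_⟩
  obtain ⟨g1, g2, g3, g4, g5, g6, g7⟩ := hL0 L hL
  have hL1 : (1 : ℝ) ≤ L := by linarith
  refine ⟨hL1, g1, ?_, ?_, ?_, g5, ?_, ?_⟩
  · rw [div_mul_eq_mul_div, div_le_iff₀ hτ] at g2
    linarith
  · have e : (1 / 400 : ℝ) * L = L / 400 := by ring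
    rw [e] at g3; simpa using g3
  · rw [one_mul] at g4; simp only [pow_zero, mul_one] at g4; linarith
  · have e : (1 / 2 : ℝ) * L = L / 2 := by ring
    rw [e] at g6
    refine le_trans ?_ g6
    have e2 : (8 * L ^ 2) ^ (2 * k) = 8 ^ (2 * k) * L ^ (4 * k) := by rw [mul_pow, ← pow_mul]; congr 2; ring
    have e3 : (K : ℝ) + 4 * k ^ 2 * L ≤ (K + 4 * k ^ 2) * L := by
      have : (K : ℝ) ≤ K * L := le_mul_of_one_le_right (Nat.cast_nonneg _) hL1
      linarith
    calc _ ≤ (8 ^ (2 * k) * L ^ (4 * k) * ((K + 4 * k ^ 2) * L)) * W := by rw [e2]; gcongr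
      _ = _ := by ring
  · have e : (1 / 200 : ℝ) * L = L / 200 := by ring
    rw [e, pow_one] at g7; linarith

section
variable {s k D R : ℕ} {pr : Fin s → ℕ}

lemma tuple_hcp (hP : PE D R pr) (hkD : k * k.factorial ≤ D) (t : Fin s) (i j : Fin k) (n : ℕ)
    (h1 : pr t ∣ n + (i : ℕ) * k.factorial) (h2 : pr t ∣ n + (j : ℕ) * k.factorial) : i = j := by
  have hlo := hP.lo t
  have key : ∀ a b : Fin k, a < b → pr t ∣ n + (a : ℕ) * k.factorial → pr t ∣ n + (b : ℕ) * k.factorial → False := by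
    intro a b hab ha hb
    have hd := (Nat.dvd_sub hb ha)
    have e : n + (b : ℕ) * k.factorial - (n + (a : ℕ) * k.factorial) = ((b : ℕ) - a) * k.factorial := by
      rw [Nat.sub_mul]; omega
    rw [e] at hd
    have hab' : (a : ℕ) < b := hab
    have hb' := b.isLt
    have h3 := Nat.le_of_dvd (Nat.mul_pos (by omega) (Nat.factorial_pos k)) hd
    have h4 : ((b : ℕ) - a) * k.factorial ≤ k * k.factorial := Nat.mul_le_mul_right _ (by omega)
    omega
  rcases lt_trichotomy i j with h | h | h
  · exact (key i j h h1 h2).elim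
  · exact h
  · exact (key j i h h2 h1).elim

lemma tuple_hq (hP : PE D R pr) (hk : 2 ≤ k) (hkD : k * k.factorial ≤ D) (t : Fin s) (i : Fin k) (n : ℕ) (j : Fin k) (hn : 0 < n)
    (h1 : pr t ∣ n + (i : ℕ) * k.factorial - 1) : ¬ pr t ∣ n + (j : ℕ) * k.factorial := by
  intro h2
  have hlo := hP.lo t
  have hf : 2 ≤ k.factorial := by
    calc 2 = Nat.factorial 2 := rfl
      _ ≤ _ := Nat.factorial_le hk
  have hi : (i : ℕ) * k.factorial + k.factorial ≤ k * k.factorial := by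
    have := Nat.mul_le_mul_right k.factorial (show (i : ℕ) + 1 ≤ k from i.isLt); rwa [Nat.add_mul, one_mul] at this
  have hj : (j : ℕ) * k.factorial + k.factorial ≤ k * k.factorial := by
    have := Nat.mul_le_mul_right k.factorial (show (j : ℕ) + 1 ≤ k from j.isLt); rwa [Nat.add_mul, one_mul] at this
  rcases lt_or_ge (j : ℕ) (i : ℕ) with hij | hij
  · have hd := Nat.dvd_sub h1 h2
    have hij' : (j : ℕ) * k.factorial + k.factorial ≤ i * k.factorial := by
      have := Nat.mul_le_mul_right k.factorial (show (j : ℕ) + 1 ≤ i from hij); rwa [Nat.add_mul, one_mul] at this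
    have := Nat.le_of_dvd (by omega) hd
    omega
  · have hd := Nat.dvd_sub h2 h1
    have hij' : (i : ℕ) * k.factorial ≤ j * k.factorial := Nat.mul_le_mul_right _ hij
    have := Nat.le_of_dvd (by omega) hd
    omega

lemma side_M (hP : PE D R pr) (q : ℕ) (hD : (2 * q) ^ 4 ≤ D) (t : Fin s) :
    (q : ℝ) * (1 / ((pr t : ℝ) - 1)) ≤ (pr t : ℝ) ^ (-(3/4) : ℝ) := by
  have h2 : (2 : ℝ) ≤ pr t := by exact_mod_cast (hP.prime t).two_le
  have hp : (0 : ℝ) < pr t := by linarith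
  have h3 : (2 * q : ℝ) ≤ (pr t : ℝ) ^ ((1/4) : ℝ) := by
    have h4 : ((2 * q : ℝ)) ^ (4 : ℕ) ≤ pr t := by
      have := hP.lo t
      exact_mod_cast (by omega : (2 * q) ^ 4 ≤ pr t)
    have h5 := Real.rpow_le_rpow (by positivity) h4 (show (0:ℝ) ≤ 1/4 by norm_num)
    rw [← Real.rpow_natCast, ← Real.rpow_mul (by positivity)] at h5
    norm_num at h5
    convert h5 using 2
  have e : (pr t : ℝ) ^ (-(3/4) : ℝ) = (pr t : ℝ) ^ ((1/4) : ℝ) / pr t := by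
    rw [eq_div_iff hp.ne']
    nth_rewrite 2 [← Real.rpow_one (pr t : ℝ)]
    rw [← Real.rpow_add hp]; norm_num
  rw [e, mul_one_div, div_le_div_iff₀ (by linarith) hp]
  have hq0 : (0 : ℝ) ≤ q := Nat.cast_nonneg q
  nlinarith

lemma side_prod (hP : PE D R pr) (hD1 : 1 ≤ D) (hD : 16 * k ^ 2 ≤ D) :
    ∏ t, (1 + (k : ℝ) ^ 2 / ((pr t : ℝ) - 1) ^ 2) ≤ 3 / 2 ∧ (k : ℝ) ^ 2 * ∑ t, 1 / (pr t : ℝ) ^ 2 ≤ 1 / 4 := by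
  have h1 := sum_inv_sq hP hD1
  have hD0 : (0 : ℝ) < D := by exact_mod_cast hD1
  have h2 : (k : ℝ) ^ 2 * ∑ t, 1 / (pr t : ℝ) ^ 2 ≤ 1 / 16 := by
    refine (mul_le_mul_of_nonneg_left h1 (by positivity)).trans ?_
    rw [mul_one_div, div_le_div_iff₀ hD0 (by norm_num)]
    have : (16 * k ^ 2 : ℝ) ≤ D := by exact_mod_cast hD
    linarith
  refine ⟨?_, h2.trans (by norm_num)⟩
  calc ∏ t, (1 + (k : ℝ) ^ 2 / ((pr t : ℝ) - 1) ^ 2) ≤ ∏ t, Real.exp (4 * ((k : ℝ) ^ 2 * (1 / (pr t : ℝ) ^ 2))) := by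
        refine prod_le_prod (fun t _ => by positivity) fun t _ => ?_
        have hp : (2 : ℝ) ≤ pr t := by exact_mod_cast (hP.prime t).two_le
        have : (k : ℝ) ^ 2 / ((pr t : ℝ) - 1) ^ 2 ≤ 4 * ((k : ℝ) ^ 2 * (1 / (pr t : ℝ) ^ 2)) := by
          have e : 4 * ((k : ℝ) ^ 2 * (1 / (pr t : ℝ) ^ 2)) = (k : ℝ) ^ 2 / ((pr t : ℝ) / 2) ^ 2 := by field_simp; ring
          rw [e]
          have : (0 : ℝ) < (pr t : ℝ) / 2 := by linarith
          gcongr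
          linarith
        have := Real.add_one_le_exp (4 * ((k : ℝ) ^ 2 * (1 / (pr t : ℝ) ^ 2)))
        linarith
    _ = Real.exp (4 * ((k : ℝ) ^ 2 * ∑ t, (1 / (pr t : ℝ) ^ 2))) := by rw [← Real.exp_sum, ← mul_sum, ← mul_sum]
    _ ≤ Real.exp (1 / 4) := Real.exp_le_exp.mpr (by linarith)
    _ ≤ 3 / 2 := by
        have h := Real.abs_exp_sub_one_le (x := 1/4) (by norm_num [abs_of_pos])
        rw [abs_of_nonneg (by linarith [Real.add_one_le_exp (1/4 : ℝ)]), abs_of_pos (by norm_num)] at h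
        linarith

end
end TDR

namespace TDR
open Finset

section
variable {s k D R : ℕ} {pr : Fin s → ℕ}

lemma AA_one_le {p : Fin s → ℝ} (hp : ∀ t, 1 ≤ p t) (J : ℕ) (z : ℕ → ℝ) (hz : 1 ≤ z 0) (j : ℕ) : 1 ≤ AA (Gz J z p) p j := by
  unfold AA
  have h0 : ∀ S ∈ (univ : Finset (Finset (Fin s))), 0 ≤ Gz J z p S ^ j * (PS p S)⁻¹ := fun S _ =>
    mul_nonneg (pow_nonneg (Gz_nonneg S) _) (inv_nonneg.mpr (PS_pos hp S).le)
  refine le_trans ?_ (single_le_sum h0 (mem_univ ∅))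
  have h1 : PS p ∅ = 1 := by simp [PS]
  have h2 : 1 ≤ Gz J z p ∅ := by
    unfold Gz
    have := single_le_sum (f := fun j => (1 / 2 : ℝ) ^ j * (if PS p ∅ ≤ z j then 1 else 0)) (s := range (J + 1))
      (fun j _ => mul_nonneg (by positivity) (by split_ifs <;> norm_num)) (mem_range.mpr (Nat.succ_pos J))
    simpa [h1, hz] using this
  rw [h1]; simp only [inv_one, mul_one]
  exact one_le_pow₀ h2

theorem weights (hP : PE D R pr) (J : ℕ) (hk : k = 2 ^ J) (hW : 2 ≤ primorial D) (hk1 : k + 1 ≤ D) (hkD : 16 * k ^ 2 ≤ D)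
    (hR : 1 < R) (τ : ℝ) (hτ : τ = 1 / (384 * 2 ^ J * (J + 1)))
    (z1 : 2 * Real.log (primorial D) ≤ τ * Real.log R) (z2 : (primorial D : ℝ) ≤ dl (primorial D) * (τ * Real.log R))
    (z3 : 1 ≤ τ * Real.log R) :
    ∃ (l : (Fin s → Option (Fin k)) → ℝ) (A1 A2 : ℝ), (∀ c, |l c| ≤ (2 * VV (fun t => (pr t : ℝ)) R) ^ k) ∧
      (∀ c, l c ≠ 0 → pn pr (sup c) ≤ R) ∧ BB (fun t => (pr t : ℝ)) l l ≤ A2 ^ k ∧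
      (∀ t, BB (fun t => (pr t : ℝ)) (rl (alB {t}) l) (rl (alB {t}) l) ≤ 4 * A2 ^ k) ∧
      (∀ m, 1 / 64 * A1 ^ 2 * A2 ^ (k - 1) ≤ BB (fun t => (pr t : ℝ) - 1) (rl (alm m) l) (rl (alm m) l)) ∧
      1 ≤ A1 ∧ 1 ≤ A2 ∧ (J + 1) * (dl (primorial D) * τ * Real.log R) / 4 ≤ A1 ∧ A2 ≤ 24 * (dl (primorial D) * τ * Real.log R) := by
  set p : Fin s → ℝ := fun t => (pr t : ℝ) with hp
  have hp1 : ∀ t, 1 ≤ p t := hP.one_le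
  have hpk : ∀ t, (k : ℝ) + 1 ≤ p t := fun t => by
    have := hP.lo t
    simp only [hp]; exact_mod_cast (by omega : k + 1 ≤ pr t)
  have hpk0 : ∀ t, (k : ℝ) ≤ p t := fun t => by linarith [hpk t]
  have hp2 : ∀ t, 1 < p t := fun t => by simp only [hp]; exact_mod_cast (hP.prime t).one_lt
  have hW0 : (0 : ℝ) < primorial D := by exact_mod_cast (by omega : 0 < primorial D)
  have hRr : (1 : ℝ) < R := by exact_mod_cast hR
  set x := Real.log R with hx
  have hx0 : 0 < x := Real.log_pos hRr
  have hτ0 : 0 < τ := by rw [hτ]; positivity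
  have hδ := dl_pos (by omega : 0 < primorial D)
  set z : ℕ → ℝ := fun j => Real.exp (2 ^ j * τ * x) with hz
  have hlz : ∀ j, Real.log (z j) = 2 ^ j * τ * x := fun j => Real.log_exp _
  have hge : ∀ j : ℕ, τ * x ≤ 2 ^ j * τ * x := fun j => by
    rw [mul_assoc]
    exact le_mul_of_one_le_left (by positivity) (one_le_pow₀ (by norm_num))
  have hV : ∀ j ≤ J, dl (primorial D) * (2 ^ j * τ * x) / 4 ≤ VV p (z j) ∧ VV p (z j) ≤ 3 * dl (primorial D) * (2 ^ j * τ * x) := by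
    intro j hj
    have hz1 : (primorial D : ℝ) ^ 2 ≤ z j := by
      have e : (primorial D : ℝ) ^ 2 = Real.exp (2 * Real.log (primorial D)) := by
        rw [mul_comm, Real.exp_mul, Real.exp_log hW0]; norm_num
      rw [e]; exact Real.exp_le_exp.mpr (z1.trans (hge j))
    have hzR : z j ≤ R := by
      rw [← Real.exp_log (by linarith : (0:ℝ) < R)]
      refine Real.exp_le_exp.mpr ?_
      rw [← hx]
      refine mul_le_of_le_one_left hx0.le ?_
      have h2 : (2 : ℝ) ^ j ≤ 2 ^ J := pow_le_pow_right₀ (by norm_num) hj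
      rw [hτ, mul_one_div, div_le_one (by positivity)]
      have h3 : (0 : ℝ) < 2 ^ J := by positivity
      have h4 : (0 : ℝ) ≤ J := Nat.cast_nonneg J
      nlinarith
    have a := VV_lower hP hW (z j) hz1 hzR
    have b := VV_upper hP hW (z j) hz1 (by
      rw [hlz]; exact z2.trans (mul_le_mul_of_nonneg_left (hge j) hδ.le)) (by rw [hlz]; exact z3.trans (hge j))
    rw [hlz] at a b
    exact ⟨a, b⟩
  obtain ⟨n1, n2, n3, n4, n5⟩ := G_numerics hp1 hδ hx0 J hτ (fun j => rfl) hV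
  have hz0 : 1 ≤ z 0 := Real.one_le_exp (by positivity)
  obtain ⟨sp, ssq⟩ := side_prod hP (by omega) hkD
  set G := Gz J z p with hG
  have hG0 : ∀ S, 0 ≤ G S := Gz_nonneg
  have hGa : ∀ S t, G S ≤ G (S.erase t) := Gz_anti hp1
  refine ⟨lam p (yv G p R), AA G p 1, AA G p 2, ?_, ?_, ?_, ?_, ?_, AA_one_le hp1 J z hz0 1, AA_one_le hp1 J z hz0 2, n1, n2⟩
  · exact lam_bound hp1 hG0 hGa Gz_le_two R
  · intro c hc
    have := lam_supp hp1 G R c hc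
    rw [lab_pn] at this
    exact_mod_cast this
  · have := A_upper (k := k) ∅ hp1 hpk0 hG0 hGa R
    rw [rl_alB_empty] at this
    simpa using this
  · intro t
    refine (A_upper (k := k) {t} hp1 hpk0 hG0 hGa R).trans ?_
    refine mul_le_mul_of_nonneg_right ?_ (pow_nonneg n3.le _)
    have e : ∏ t', (1 + if t' ∈ ({t} : Finset (Fin s)) then (k : ℝ) / p t' else 0) = 1 + k / p t := by
      rw [← mul_prod_erase univ _ (mem_univ t), prod_eq_one]
      · simp
      · intro t' ht'
        have : t' ≠ t := (mem_erase.mp ht').1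
        simp [this]
    rw [e]
    have h1 : (k : ℝ) / p t ≤ 1 := div_le_one_of_le₀ (hpk0 t) (by linarith [hp1 t])
    have h2 : 0 ≤ (k : ℝ) / p t := div_nonneg (Nat.cast_nonneg _) (by linarith [hp1 t])
    nlinarith
  · intro m
    refine A_lower m hp2 hpk sp ssq hG0 hGa n3 hRr n4 ?_
    rw [hk]; push_cast; exact n5

end
end TDR

namespace TDR
open Finset

section
variable {s k D R : ℕ} {pr : Fin s → ℕ}

lemma err_num (k M K W : ℕ) (L c1 N Rr V1 V2 Sr : ℝ) (hc1 : 0 < c1) (hW : 0 < W) (hL : 1 ≤ L)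
    (hR0 : 0 ≤ Rr) (hR : Rr ≤ Real.exp (L / 200)) (hV10 : 0 ≤ V1) (hV1 : V1 ≤ 2 * L) (hV20 : 0 ≤ V2) (hV2 : V2 ≤ 2 * L) (hS0 : 0 ≤ Sr)
    (hS : Sr ≤ (L ^ (2 * k + 2 * M + 1))⁻¹) (hN : Real.exp L ≤ N)
    (h1 : 4 ^ (2 * k) * 2 ^ (2 * M) * W * 128 / c1 ≤ L)
    (h2 : ((8 * L ^ 2) ^ (2 * k) * (K + 4 * k ^ 2 * L)) * W ≤ Real.exp (L / 2)) :
    ((4 * L) ^ k * (Rr * V1 ^ k)) ^ 2 ≤ (8 * L ^ 2) ^ (2 * k) * Real.exp (L / 100) ∧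
    ((8 * L ^ 2) ^ (2 * k) * Real.exp (L / 100)) * (K + 4 * k ^ 2 * L) ≤ N / W ∧
    ((4 * L) ^ k) ^ 2 * (W * V2 ^ (2 * M) * Sr) ≤ c1 / 128 := by
  have hW0 : (0 : ℝ) < W := by exact_mod_cast hW
  have hL0 : 0 < L := by linarith
  refine ⟨?_, ?_, ?_⟩
  · calc ((4 * L) ^ k * (Rr * V1 ^ k)) ^ 2 ≤ ((4 * L) ^ k * (Real.exp (L / 200) * (2 * L) ^ k)) ^ 2 := by gcongr
      _ = ((4 * L) * (2 * L)) ^ (2 * k) * Real.exp (L / 200) ^ 2 := by rw [mul_pow (4 * L)]; ring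
      _ = _ := by
          rw [← Real.exp_nat_mul]; congr 2
          · ring
          · push_cast; ring
  · rw [le_div_iff₀ hW0]
    calc _ = ((8 * L ^ 2) ^ (2 * k) * (K + 4 * k ^ 2 * L)) * W * Real.exp (L / 100) := by ring
      _ ≤ Real.exp (L / 2) * Real.exp (L / 100) := by gcongr
      _ = Real.exp (L / 2 + L / 100) := (Real.exp_add _ _).symm
      _ ≤ Real.exp L := Real.exp_le_exp.mpr (by linarith)
      _ ≤ N := hN
  · calc ((4 * L) ^ k) ^ 2 * (W * V2 ^ (2 * M) * Sr) ≤ ((4 * L) ^ k) ^ 2 * (W * (2 * L) ^ (2 * M) * (L ^ (2 * k + 2 * M + 1))⁻¹) := by gcongr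
      _ = 4 ^ (2 * k) * 2 ^ (2 * M) * W / L := by
          rw [← pow_mul, mul_comm k 2, mul_pow, mul_pow, pow_add, pow_add, pow_one]
          field_simp
      _ ≤ c1 / 128 := by
          rw [div_le_iff₀ hL0]
          rw [div_le_iff₀ hc1] at h1
          linarith

open Classical in
lemma ff_sum (hP : PE D R pr) (L : ℕ) (hL : L ≤ R) (a : ℕ) :
    ∑ p ∈ (Ioc D L).filter (fun p => p.Prime ∧ p ∣ a), 1 / (p : ℝ) =
      ∑ t ∈ univ.filter (fun t => pr t ≤ L), (if pr t ∣ a then 1 / (pr t : ℝ) else 0) := by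
  rw [← sum_filter]
  have e : (Ioc D L).filter (fun p => p.Prime ∧ p ∣ a) = ((univ.filter (fun t => pr t ≤ L)).filter (fun t => pr t ∣ a)).image pr := by
    ext p
    simp only [mem_filter, mem_Ioc, mem_image, mem_univ, true_and]
    constructor
    · rintro ⟨⟨h1, h2⟩, h3, h4⟩
      obtain ⟨t, rfl⟩ := hP.surj p h3 h1 (h2.trans hL)
      exact ⟨t, ⟨h2, h4⟩, rfl⟩
    · rintro ⟨t, ⟨h1, h2⟩, rfl⟩
      exact ⟨⟨hP.lo t, h1⟩, hP.prime t, h2⟩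
  rw [e, sum_image fun a _ b _ hab => hP.inj hab]

open Classical in
theorem sieve_main (K : ℕ) : ∃ k D0 : ℕ, 2 ≤ k ∧ ∀ D b : ℕ, D0 ≤ D → k * k.factorial ≤ D →
    (∀ i < k, ∀ p : ℕ, p.Prime → p ≤ D → ¬ p ∣ b + i * k.factorial) → ∀ L0 : ℝ, ∃ (L : ℝ) (n : ℕ), L0 ≤ L ∧ 1 ≤ L ∧
      n ≡ b [MOD primorial D] ∧ 0 < n ∧ n ≤ NN L ∧
      (∃ S : Finset (Fin k), K ≤ S.card ∧ ∀ m ∈ S, (n + (m : ℕ) * k.factorial).Prime ∧ Real.exp L ≤ (n + (m : ℕ) * k.factorial : ℕ)) ∧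
      ∀ i : Fin k, ∑ p ∈ (Ioc D ⌊L⌋₊).filter (fun p => p.Prime ∧ p ∣ n + (i : ℕ) * k.factorial - 1), 1 / (p : ℝ) ≤ 1 / 4 := by
  obtain ⟨c1, C1, hc1, hC1, hthm⟩ := thmP
  obtain ⟨J, hJ⟩ := exists_nat_gt (400 * 384 * 2048 * 12000 * C1 * (K + 2) / c1)
  rw [div_lt_iff₀ hc1] at hJ
  have hJ1 : 1 ≤ J := by
    by_contra h
    have : J = 0 := by omega
    rw [this] at hJ
    have : (0 : ℝ) ≤ 400 * 384 * 2048 * 12000 * C1 * (K + 2) := by positivity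
    simp at hJ; linarith
  obtain ⟨k, hk⟩ : ∃ k, k = 2 ^ J := ⟨_, rfl⟩
  have hk2 : 2 ≤ k := by
    rw [hk]; calc 2 = 2 ^ 1 := rfl
      _ ≤ _ := Nat.pow_le_pow_right (by norm_num) hJ1
  have hk0 : (0 : ℝ) < k := by exact_mod_cast (by omega : 0 < k)
  obtain ⟨M, hMd⟩ : ∃ M, M = (k + 1) ^ 2 := ⟨_, rfl⟩
  refine ⟨k, 2 + (k + 1) + 16 * k ^ 2 + (2 * M) ^ 4, hk2, fun D b hD0 hkD hb L0 => ?_⟩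
  obtain ⟨W, hWd⟩ : ∃ W, W = primorial D := ⟨_, rfl⟩
  have hW2 : 2 ≤ W := by rw [hWd]; exact Nat.le_of_dvd (primorial_pos D) (primorial_dvd Nat.prime_two (by omega))
  have hW0 : (0 : ℝ) < W := by exact_mod_cast (by omega : 0 < W)
  have hD16 : 16 * k ^ 2 ≤ D := by omega
  obtain ⟨τ, hτ⟩ : ∃ τ : ℝ, τ = 1 / (384 * 2 ^ J * (J + 1)) := ⟨_, rfl⟩
  have hτ0 : 0 < τ := by rw [hτ]; positivity
  have hδ := dl_pos (by omega : 0 < W)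
  obtain ⟨Z, hZ⟩ : ∃ Z : ℝ, Z = max (max (2 * Real.log W) (W / dl W)) 1 := ⟨_, rfl⟩
  obtain ⟨L1, hL1⟩ := ev_all k M K W c1 τ Z hc1 hτ0
  obtain ⟨L, hLL, hL, ω, hω0, hω, hωC, hωs, hωE⟩ := hthm (2 * k + 2 * M + 1) (max L0 L1)
  obtain ⟨-, g1, g2, g3, g4, g5, g6, g7⟩ := hL1 L ((le_max_right _ _).trans hLL)
  have hLp : 0 < L := by linarith
  set N := NN L with hN
  have hN1 : (N : ℝ) ≤ 500 * Real.exp L := Nat.floor_le (by positivity)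
  have hN2 : Real.exp L ≤ N := by
    have h1 := Nat.lt_floor_add_one (500 * Real.exp L)
    have h2 := Real.add_one_le_exp L
    have h3 : (N : ℝ) = (⌊500 * Real.exp L⌋₊ : ℝ) := rfl
    linarith
  obtain ⟨R, hRd⟩ : ∃ R, R = ⌊Real.exp (L / 200)⌋₊ := ⟨_, rfl⟩
  have hR1 : (R : ℝ) ≤ Real.exp (L / 200) := by rw [hRd]; exact Nat.floor_le (Real.exp_pos _).le
  have hR2 : L < R := by
    have := Nat.lt_floor_add_one (Real.exp (L / 200))
    rw [hRd]; linarith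
  have hRn : 1 < R := by
    have : (1 : ℝ) < R := by linarith
    exact_mod_cast this
  have hR0 : (0 : ℝ) < R := by linarith
  have hlR1 : Real.log R ≤ L / 200 := by rw [Real.log_le_iff_le_exp hR0]; exact hR1
  have hlR2 : L / 400 ≤ Real.log R := by
    rw [Real.le_log_iff_exp_le hR0]
    have h1 : Real.exp (L / 200) < R + 1 := by rw [hRd]; exact Nat.lt_floor_add_one _
    have h2 : Real.exp (L / 200) = Real.exp (L / 400) * Real.exp (L / 400) := by rw [← Real.exp_add]; congr 1; ring
    have h3 := Real.add_one_le_exp (L / 400)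
    have h4 : (4 : ℝ) ≤ L / 400 := by linarith
    nlinarith
  obtain ⟨s, pr, hP⟩ := PE_exists D R
  have hZle : Z ≤ τ * Real.log R := g2.trans (mul_le_mul_of_nonneg_left hlR2 hτ0.le)
  have z1 : 2 * Real.log (primorial D) ≤ τ * Real.log R := by
    refine le_trans ?_ hZle; rw [hZ, ← hWd]; exact (le_max_left _ _).trans (le_max_left _ _)
  have z2 : (primorial D : ℝ) ≤ dl (primorial D) * (τ * Real.log R) := by
    rw [← hWd, mul_comm, ← div_le_iff₀ hδ]
    refine le_trans ?_ hZle; rw [hZ]; exact (le_max_right _ _).trans (le_max_left _ _)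
  have z3 : 1 ≤ τ * Real.log R := by refine le_trans ?_ hZle; rw [hZ]; exact le_max_right _ _
  obtain ⟨l, A1, A2, w1, w2, w3, w4, w5, w6, w7, w8, w9⟩ :=
    weights hP J hk (by rw [← hWd]; exact hW2) (by omega) hD16 hRn τ hτ z1 z2 z3
  rw [← hWd] at w8 w9
  set h : Fin k → ℕ := fun i => (i : ℕ) * k.factorial with hh
  have hcp : ∀ t i j n, pr t ∣ n + h i → pr t ∣ n + h j → i = j := fun t i j n => tuple_hcp hP hkD t i j n
  have hq : ∀ t i n j, 0 < n → pr t ∣ n + h i - 1 → ¬ pr t ∣ n + h j := fun t i n j => tuple_hq hP hk2 hkD t i n j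
  have hWp : ∀ t, W.Coprime (pr t) := fun t => by
    rw [hWd, primorial_cop]
    intro p hp hd
    rw [(Nat.prime_dvd_prime_iff_eq hp (hP.prime t)).mp hd]
    exact hP.lo t
  have hV1 : VV (fun t => (pr t : ℝ)) R ≤ 2 * L := by
    have := VV_le_log hP R (by linarith)
    linarith
  have hV10 := VV_nonneg hP.one_le (R : ℝ)
  have hV2 : VV (fun t => (pr t : ℝ)) ((R ^ 2 : ℕ) : ℝ) ≤ 2 * L := by
    have := VV_le_log hP ((R ^ 2 : ℕ) : ℝ) (by exact_mod_cast Nat.one_le_pow _ _ (by omega))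
    push_cast at this ⊢
    rw [Real.log_pow] at this
    push_cast at this
    linarith
  have hV20 := VV_nonneg hP.one_le ((R ^ 2 : ℕ) : ℝ)
  obtain ⟨P, hPd⟩ : ∃ P, P = W * R ^ 2 := ⟨_, rfl⟩
  have hPe : (P : ℝ) ≤ Real.exp (L / 80) := by
    rw [hPd]; push_cast
    calc (W : ℝ) * R ^ 2 ≤ Real.exp (L / 400) * Real.exp (L / 200) ^ 2 := by gcongr
      _ = Real.exp (L / 80) := by rw [← Real.exp_nat_mul, ← Real.exp_add]; congr 1; push_cast; ring
  have hSr := hωE P hPe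
  have hSr0 : 0 ≤ ∑ r ∈ Ioc 1 P, (r : ℝ) ^ (-(3/4) : ℝ) * EE ω N r :=
    sum_nonneg fun r _ => mul_nonneg (by positivity) (EE_nonneg _ _ _)
  obtain ⟨e1, e2, e3⟩ := err_num k M K W L c1 N R _ _ _ hc1 (by omega) hL hR0.le hR1 hV10 hV1 hV20 hV2 hSr0 hSr hN2 g5 g6
  set T : Finset (Fin s) := univ.filter (fun t => pr t ≤ ⌊L⌋₊) with hT
  have hTc : (T.card : ℝ) ≤ L := by
    have h1 : T.card ≤ (Ioc 0 ⌊L⌋₊).card := card_le_card_of_injOn pr (fun t ht => by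
      have := (mem_filter.mp ht).2
      simp only [coe_Ioc, Set.mem_Ioc]; exact ⟨(hP.prime t).pos, this⟩) hP.inj.injOn
    rw [Nat.card_Ioc] at h1
    exact le_trans (by exact_mod_cast h1) (Nat.floor_le hLp.le)
  have hΛ : ∀ c, |l c| ≤ (4 * L) ^ k := fun c => (w1 c).trans (pow_le_pow_left₀ (by positivity) (by linarith) k)
  have hLR : ⌊L⌋₊ ≤ R := by
    have h1 : (⌊L⌋₊ : ℝ) ≤ R := (Nat.floor_le hLp.le).trans hR2.le
    exact_mod_cast h1
  -- existence of a good n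
  obtain ⟨n, hn, hnb, hcard⟩ : ∃ n ∈ Ioc 0 N, n ≡ b [MOD W] ∧
      (K : ℝ) + 4 * k * ff pr h T n < ((univ.filter (fun m : Fin k => ω (n + h m) ≠ 0)).card : ℝ) := by
    by_contra hcon
    push Not at hcon
    have hA2k : 1 ≤ A2 ^ k := one_le_pow₀ w7
    have up := sieve_up hP (by omega) hcp hq W b N (by omega) hWp l _ hΛ w2 T (A2 ^ k) _ (by linarith) w3 w4 e1 K (4 * k)
      (Nat.cast_nonneg _) (by positivity)
    have hΩ0 : 0 ≤ C1 * L * Real.exp (-L) := by positivity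
    have cmp := sieve_cmp (h := h) W b N l T ω (C1 * L * Real.exp (-L)) K (4 * k) hωC hΩ0 hcon
    have low : ∀ m : Fin k, 1 / (Nat.totient W : ℝ) * (c1 * (1 / 64 * A1 ^ 2 * A2 ^ (k - 1)) - c1 / 128 * (A1 ^ 2 * A2 ^ (k - 1))) ≤
        ∑ n ∈ Ioc 0 N, (ω (n + h m) * (if n ≡ b [MOD W] then 1 else 0)) * HH pr h l n ^ 2 := by
      intro m
      refine sieve_low hP hcp m W b N P (by omega) hWp ?_ ω ?_ (by rw [hPd]) ?_ l _ hΛ w2 c1 _ _ hc1.le (by positivity) hωs (w5 m) ?_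
      · rw [Nat.coprime_comm, hWd, primorial_cop]
        intro p hp hd
        by_contra hpD
        exact hb m m.isLt p hp (by omega) hd
      · intro n hn0
        obtain ⟨a1, a2, a3⟩ := hω n hn0
        refine ⟨a1, ?_, ?_, a3⟩
        · have : (P : ℝ) < n := lt_of_lt_of_le (hPe.trans_lt (Real.exp_lt_exp.mpr (by linarith))) a2
          exact_mod_cast this
        · have h1 : h m ≤ k * k.factorial := Nat.mul_le_mul_right _ m.isLt.le
          have : ((k * k.factorial : ℕ) : ℝ) < n := by push_cast; linarith
          have : k * k.factorial < n := by exact_mod_cast this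
          omega
      · exact side_M hP _ (by rw [← hMd]; omega)
      · rw [← hMd]
        refine e3.trans ?_
        have : 1 ≤ A1 ^ 2 * A2 ^ (k - 1) := one_le_mul_of_one_le_of_one_le (one_le_pow₀ w6) (one_le_pow₀ w7)
        have := mul_le_mul_of_nonneg_left this (by positivity : (0:ℝ) ≤ c1 / 128)
        linarith
    have tot := sum_le_sum fun (m : Fin k) (_ : m ∈ univ) => low m
    rw [sum_const, nsmul_eq_mul, card_univ, Fintype.card_fin] at tot
    have hφ : (0 : ℝ) < Nat.totient W := by exact_mod_cast Nat.totient_pos.mpr (by omega)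
    have hup2 : (K : ℝ) * (N / W * A2 ^ k + (8 * L ^ 2) ^ (2 * k) * Real.exp (L / 100)) +
        4 * k * (k * (4 * (N / W * A2 ^ k) * (1 / D) + T.card * ((8 * L ^ 2) ^ (2 * k) * Real.exp (L / 100)))) ≤ (K + 2) * (N / W * A2 ^ k) := by
      set E := (8 * L ^ 2) ^ (2 * k) * Real.exp (L / 100) with hE
      have hE0 : 0 ≤ E := by positivity
      set X := (N : ℝ) / W * A2 ^ k with hX
      have hNW : (0 : ℝ) ≤ N / W := by positivity
      have hX1 : (N : ℝ) / W ≤ X := le_mul_of_one_le_right hNW hA2k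
      have hDr : (16 * k ^ 2 : ℝ) ≤ D := by exact_mod_cast hD16
      have h16 : (0 : ℝ) < 16 * k ^ 2 := by positivity
      have h1 : 16 * (k : ℝ) ^ 2 * (1 / D) ≤ 1 := by rw [mul_one_div]; exact div_le_one_of_le₀ hDr (by positivity)
      have h2 := mul_le_mul_of_nonneg_left h1 (hNW.trans hX1)
      have h3 : 4 * (k : ℝ) ^ 2 * E * T.card ≤ 4 * (k : ℝ) ^ 2 * E * L := mul_le_mul_of_nonneg_left hTc (by positivity)
      linarith
    refine final_num k (by omega) c1 C1 (Nat.totient W) W A1 A2 L (Real.log R) τ K J N hc1 hC1 hφ hW0 ?_ (Nat.cast_nonneg _) (Nat.cast_nonneg _) hLp hlR2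
      w8 w9 (by linarith) hN1 (by linarith) ?_
    · rw [hτ, hk]; push_cast; field_simp
    · exact tot.trans (cmp.trans (mul_le_mul_of_nonneg_left (up.trans hup2) hΩ0))
  have hin0 : ∀ i : Fin k, 0 ≤ ∑ t ∈ T, (if pr t ∣ n + h i - 1 then 1 / (pr t : ℝ) else 0) := fun i =>
    sum_nonneg fun t _ => by split_ifs <;> positivity
  have hff0 : 0 ≤ ff pr h T n := sum_nonneg fun i _ => hin0 i
  refine ⟨L, n, (le_max_left _ _).trans hLL, hL, by rw [← hWd]; exact hnb, (mem_Ioc.mp hn).1, (mem_Ioc.mp hn).2,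
    ⟨univ.filter (fun m : Fin k => ω (n + h m) ≠ 0), ?_, fun m hm => ?_⟩, fun i => ?_⟩
  · have h1 : (0 : ℝ) ≤ 4 * k * ff pr h T n := by positivity
    have h2 : (K : ℝ) ≤ ((univ.filter (fun m : Fin k => ω (n + h m) ≠ 0)).card : ℝ) := by linarith
    exact_mod_cast h2
  · obtain ⟨a1, a2, _⟩ := hω _ (mem_filter.mp hm).2
    exact ⟨a1, a2⟩
  · rw [ff_sum hP _ hLR]
    have h1 : ∑ t ∈ T, (if pr t ∣ n + h i - 1 then 1 / (pr t : ℝ) else 0) ≤ ff pr h T n :=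
      single_le_sum (f := fun i => ∑ t ∈ T, (if pr t ∣ n + h i - 1 then 1 / (pr t : ℝ) else 0)) (fun i _ => hin0 i) (mem_univ i)
    refine h1.trans ?_
    have h2 : ((univ.filter (fun m : Fin k => ω (n + h m) ≠ 0)).card : ℝ) ≤ k := by
      have := card_le_univ (univ.filter (fun m : Fin k => ω (n + h m) ≠ 0))
      rw [Fintype.card_fin] at this
      exact_mod_cast this
    have h3 : (0 : ℝ) ≤ K := Nat.cast_nonneg _
    have h4 : (k : ℝ) * (4 * ff pr h T n) ≤ k * 1 := by linarith
    have h5 := le_of_mul_le_mul_left h4 hk0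
    linarith

end
end TDR

namespace TDR
open Finset

lemma tot_real (m : ℕ) : (Nat.totient m : ℝ) = m * ∏ p ∈ m.primeFactors, (1 - 1 / (p : ℝ)) := by
  have h := congrArg (Rat.cast : ℚ → ℝ) (Nat.totient_eq_mul_prod_factors m)
  push_cast at h
  simpa [one_div] using h

lemma weier (S : Finset ℕ) (hS : ∀ p ∈ S, p.Prime) : 1 - ∑ p ∈ S, 1 / (p : ℝ) ≤ ∏ p ∈ S, (1 - 1 / (p : ℝ)) := by
  induction S using Finset.induction_on with
  | empty => simp
  | insert a s ha ih =>
    rw [sum_insert ha, prod_insert ha]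
    have h1 := ih fun p hp => hS p (mem_insert_of_mem hp)
    have h2 := fac_pos (hS a (mem_insert_self _ _))
    have h3 : 0 ≤ ∑ p ∈ s, 1 / (p : ℝ) := sum_nonneg fun p _ => by positivity
    have h4 : (0 : ℝ) ≤ 1 / a := by positivity
    nlinarith [mul_le_mul_of_nonneg_left h1 h2.le, mul_nonneg h4 h3]

lemma tail_sum (m : ℕ) (hm : m ≠ 0) (L : ℝ) (h16 : 16 ≤ L) (h8 : 8 ≤ Real.log L) (hL : Real.log m ≤ L + 16) :
    ∑ p ∈ m.primeFactors.filter (fun p => ⌊L⌋₊ < p), 1 / (p : ℝ) ≤ 1 / 4 := by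
  set S := m.primeFactors.filter (fun p => ⌊L⌋₊ < p)
  have hLp : ∀ p ∈ S, L ≤ p := fun p hp => (Nat.lt_of_floor_lt (mem_filter.mp hp).2).le
  have hc : (S.card : ℝ) * Real.log L ≤ L + 16 := by
    have h1 : (S.card : ℝ) * Real.log L ≤ ∑ p ∈ S, Real.log p := by
      rw [← nsmul_eq_mul, ← sum_const]
      exact sum_le_sum fun p hp => Real.log_le_log (by linarith) (hLp p hp)
    have h2 : ∑ p ∈ S, Real.log (p : ℝ) = Real.log ((∏ p ∈ S, p : ℕ) : ℝ) := by
      push_cast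
      rw [Real.log_prod]
      intro p hp
      have := hLp p hp
      linarith
    have h3 : ∏ p ∈ S, p ≤ m := Nat.le_of_dvd (by omega)
      ((prod_dvd_prod_of_subset _ _ _ (filter_subset _ _)).trans (Nat.prod_primeFactors_dvd m))
    have h4 : 0 < ∏ p ∈ S, p := prod_pos fun p hp => (Nat.prime_of_mem_primeFactors (mem_filter.mp hp).1).pos
    have h5 : Real.log ((∏ p ∈ S, p : ℕ) : ℝ) ≤ Real.log m := Real.log_le_log (by exact_mod_cast h4) (by exact_mod_cast h3)
    linarith
  have hs : ∑ p ∈ S, 1 / (p : ℝ) ≤ S.card * (1 / L) := by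
    rw [← nsmul_eq_mul, ← sum_const]
    exact sum_le_sum fun p hp => one_div_le_one_div_of_le (by linarith) (hLp p hp)
  refine hs.trans ?_
  rw [mul_one_div, div_le_iff₀ (by linarith)]
  have : (S.card : ℝ) * 8 ≤ S.card * Real.log L := mul_le_mul_of_nonneg_left h8 (Nat.cast_nonneg _)
  linarith

lemma FF_eq (n D b h : ℕ) (hn : n ≡ b [MOD primorial D]) (h1 : 1 < n) :
    FF D b h = ∏ p ∈ (n + h - 1).primeFactors.filter (fun p => p ≤ D), (1 - 1 / (p : ℝ)) := by
  unfold FF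
  refine prod_congr ?_ fun _ _ => rfl
  ext p
  simp only [mem_filter, mem_Ioc, Nat.mem_primeFactors]
  have key : p.Prime → p ≤ D → ((p : ℤ) ∣ (b : ℤ) + h - 1 ↔ p ∣ n + h - 1) := by
    intro hp hpD
    have h2 : n ≡ b [MOD p] := hn.of_dvd (primorial_dvd hp hpD)
    have h3 : (p : ℤ) ∣ (b : ℤ) - n := (Nat.modEq_iff_dvd.mp h2)
    have h4 : ((n + h - 1 : ℕ) : ℤ) = (n : ℤ) + h - 1 := by push_cast [show 1 ≤ n + h by omega]; ring
    rw [← Int.natCast_dvd_natCast, h4, show (b : ℤ) + h - 1 = (b - n) + ((n : ℤ) + h - 1) by ring]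
    exact (Int.dvd_add_right h3)
  constructor
  · rintro ⟨⟨⟨_, hD⟩, hp⟩, hd⟩
    exact ⟨⟨hp, (key hp hD).mp hd, by omega⟩, hD⟩
  · rintro ⟨⟨hp, hd, _⟩, hD⟩
    exact ⟨⟨⟨hp.pos, hD⟩, hp⟩, (key hp hD).mpr hd⟩

lemma tot_up (m D : ℕ) : (Nat.totient m : ℝ) ≤ m * ∏ p ∈ m.primeFactors.filter (fun p => p ≤ D), (1 - 1 / (p : ℝ)) := by
  rw [tot_real]
  refine mul_le_mul_of_nonneg_left (prod_sub_le (filter_subset _ _) (fun p hp => (fac_pos (Nat.prime_of_mem_primeFactors hp)).le)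
    fun p _ _ => fac_le) (Nat.cast_nonneg _)

lemma tot_low (m D : ℕ) (hs : ∑ p ∈ m.primeFactors.filter (fun p => ¬ p ≤ D), 1 / (p : ℝ) ≤ 1 / 2) :
    m * (∏ p ∈ m.primeFactors.filter (fun p => p ≤ D), (1 - 1 / (p : ℝ))) / 2 ≤ Nat.totient m := by
  rw [tot_real, ← prod_filter_mul_prod_filter_not m.primeFactors (fun p => p ≤ D)]
  have h1 := weier (m.primeFactors.filter (fun p => ¬ p ≤ D)) fun p hp => Nat.prime_of_mem_primeFactors (mem_filter.mp hp).1
  have h2 : 0 ≤ ∏ p ∈ m.primeFactors.filter (fun p => p ≤ D), (1 - 1 / (p : ℝ)) :=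
    prod_nonneg fun p hp => (fac_pos (Nat.prime_of_mem_primeFactors (mem_filter.mp hp).1)).le
  have h3 : (0 : ℝ) ≤ m * ∏ p ∈ m.primeFactors.filter (fun p => p ≤ D), (1 - 1 / (p : ℝ)) := by positivity
  rw [← mul_assoc, div_eq_mul_inv]
  exact mul_le_mul_of_nonneg_left (by linarith) h3

lemma tot_lt (n D b h h' : ℕ) (L : ℝ) (hn : n ≡ b [MOD primorial D]) (h1 : 1 < n) (hh : h' + 1 < n)
    (h16 : 16 ≤ L) (h8 : 8 ≤ Real.log L) (hL : Real.log ((n + h - 1 : ℕ) : ℝ) ≤ L + 16)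
    (hF : FF D b h' ≤ FF D b h / 4)
    (hs : ∑ p ∈ (n + h - 1).primeFactors.filter (fun p => D < p ∧ p ≤ ⌊L⌋₊), 1 / (p : ℝ) ≤ 1 / 4) :
    Nat.totient (n + h' - 1) < Nat.totient (n + h - 1) := by
  have hm : n + h - 1 ≠ 0 := by omega
  have low := tot_low (n + h - 1) D (by
    have t := tail_sum _ hm L h16 h8 hL
    have : (n + h - 1).primeFactors.filter (fun p => ¬ p ≤ D) ⊆
        (n + h - 1).primeFactors.filter (fun p => D < p ∧ p ≤ ⌊L⌋₊) ∪ (n + h - 1).primeFactors.filter (fun p => ⌊L⌋₊ < p) := by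
      intro p hp
      simp only [mem_union, mem_filter] at hp ⊢
      rcases le_or_gt p ⌊L⌋₊ with h | h
      · exact Or.inl ⟨hp.1, by omega, h⟩
      · exact Or.inr ⟨hp.1, h⟩
    have s1 := sum_le_sum_of_subset_of_nonneg (f := fun p : ℕ => 1 / (p : ℝ)) this (fun p _ _ => by positivity)
    have s2 := sum_union_inter (f := fun p : ℕ => 1 / (p : ℝ)) (s₁ := (n + h - 1).primeFactors.filter (fun p => D < p ∧ p ≤ ⌊L⌋₊))
      (s₂ := (n + h - 1).primeFactors.filter (fun p => ⌊L⌋₊ < p))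
    have s3 : 0 ≤ ∑ p ∈ (n + h - 1).primeFactors.filter (fun p => D < p ∧ p ≤ ⌊L⌋₊) ∩ (n + h - 1).primeFactors.filter (fun p => ⌊L⌋₊ < p), 1 / (p : ℝ) :=
      sum_nonneg fun p _ => by positivity
    linarith)
  have up := tot_up (n + h' - 1) D
  rw [← FF_eq n D b h' hn h1] at up
  rw [← FF_eq n D b h hn h1] at low
  have hF0 : 0 < FF D b h := prod_pos fun p hp => fac_pos (mem_filter.mp (mem_filter.mp hp).1).2
  have hlt : n + h' - 1 < 2 * (n + h - 1) := by omega
  have hltr : ((n + h' - 1 : ℕ) : ℝ) < 2 * ((n + h - 1 : ℕ) : ℝ) := by exact_mod_cast hlt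
  have a1 : ((n + h' - 1 : ℕ) : ℝ) * FF D b h' ≤ ((n + h' - 1 : ℕ) : ℝ) * (FF D b h / 4) :=
    mul_le_mul_of_nonneg_left hF (Nat.cast_nonneg _)
  have a2 : ((n + h' - 1 : ℕ) : ℝ) * (FF D b h / 4) < (2 * ((n + h - 1 : ℕ) : ℝ)) * (FF D b h / 4) :=
    mul_lt_mul_of_pos_right hltr (by positivity)
  have : (Nat.totient (n + h' - 1) : ℝ) < Nat.totient (n + h - 1) := by linarith
  exact_mod_cast this

lemma run_eq (K k n D b : ℕ) (S : Finset (Fin k)) (hK : 1 ≤ K) (hS : K ≤ S.card) (hD : D < n) (hn : n ≡ b [MOD primorial D])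
    (hp : ∀ m ∈ S, (n + (m : ℕ) * k.factorial).Prime)
    (hb : ∀ j ≤ k * k.factorial, ¬ k.factorial ∣ j → ∃ p, p.Prime ∧ p ≤ D ∧ p ∣ b + j) (i : ℕ) (hi : i < K) :
    ∃ m < k, Nat.nth Nat.Prime (Nat.count Nat.Prime n + i) = n + m * k.factorial := by
  have hinf : (Set.ofPred Nat.Prime).Infinite := Nat.infinite_setOfPred_prime
  set q := Nat.nth Nat.Prime (Nat.count Nat.Prime n + i) with hq
  have hqp : q.Prime := Nat.prime_nth_prime _
  have h1 : n ≤ q := (Nat.count_le_iff_le_nth hinf).mp (Nat.le_add_right _ _)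
  have hf := Nat.factorial_pos k
  have h2 : q < n + ((k - 1) * k.factorial + 1) := by
    refine Nat.nth_lt_of_lt_count ?_
    rw [Nat.count_add]
    refine Nat.add_lt_add_left (hi.trans_le (hS.trans ?_)) _
    rw [Nat.count_eq_card_filter_range]
    refine card_le_card_of_injOn (fun m => (m : ℕ) * k.factorial) ?_ ?_
    · intro m hm
      simp only [coe_filter, mem_range, Set.mem_setOf_eq]
      exact ⟨Nat.lt_succ_of_le (Nat.mul_le_mul_right _ (by have := m.isLt; omega)), hp m hm⟩
    · intro m _ m' _ h
      exact Fin.ext (Nat.eq_of_mul_eq_mul_right hf h)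
  have hk : 1 ≤ k := by
    have := card_le_univ S
    rw [Fintype.card_fin] at this; omega
  have hkk : (k - 1) * k.factorial + k.factorial = k * k.factorial := by
    rw [← Nat.succ_mul, Nat.succ_eq_add_one, Nat.sub_add_cancel hk]
  by_cases hd : k.factorial ∣ q - n
  · obtain ⟨m, hm⟩ := hd
    refine ⟨m, ?_, ?_⟩
    · by_contra hcon
      have : k * k.factorial ≤ k.factorial * m := by rw [mul_comm k.factorial]; exact Nat.mul_le_mul_right _ (by omega)
      omega
    · rw [mul_comm]; omega
  · exfalso
    obtain ⟨p, hpp, hpD, hpd⟩ := hb (q - n) (by omega) hd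
    have h3 : n + (q - n) ≡ b + (q - n) [MOD p] := (hn.of_dvd (primorial_dvd hpp hpD)).add_right _
    have h4 : p ∣ n + (q - n) := (h3.dvd_iff dvd_rfl).mpr hpd
    rw [Nat.add_sub_cancel' h1] at h4
    have := (Nat.prime_dvd_prime_iff_eq hpp hqp).mp h4
    omega

theorem final (K : ℕ) (hK : 1 ≤ K) :
    {n : ℕ | ∀ i : ℕ, i + 1 < K →
      Nat.totient (Nat.nth Nat.Prime (n + i + 1) - 1) <
        Nat.totient (Nat.nth Nat.Prime (n + i) - 1)}.Infinite := by
  have hinf : (Set.ofPred Nat.Prime).Infinite := Nat.infinite_setOfPred_prime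
  obtain ⟨k, D0, hk, main⟩ := sieve_main K
  obtain ⟨D, b, hD0, hD2, hkD, c1, c2, c3⟩ := modC k hk D0
  refine Set.infinite_of_forall_exists_gt fun a => ?_
  set q := Nat.nth Nat.Prime a with hq
  obtain ⟨L, n, hL0, hL1, hn, hn0, hnN, ⟨S, hSc, hS⟩, hsum⟩ := main D b hD0 hkD c1 (Real.exp 8 + 16 + 2 * (k * k.factorial : ℕ) + D + q)
  have he8 : 0 < Real.exp 8 := Real.exp_pos 8
  have hkf : (0 : ℝ) ≤ ((k * k.factorial : ℕ) : ℝ) := Nat.cast_nonneg _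
  have hDr : (0 : ℝ) ≤ (D : ℝ) := Nat.cast_nonneg _
  have hqr : (0 : ℝ) ≤ (q : ℝ) := Nat.cast_nonneg _
  have h16 : 16 ≤ L := by linarith
  have h8 : 8 ≤ Real.log L := by rw [Real.le_log_iff_exp_le (by linarith)]; linarith
  have hnbig : k * k.factorial + D + q + 2 < n := by
    obtain ⟨m, hm⟩ := card_pos.mp (by omega : 0 < S.card)
    have h1 := (hS m hm).2
    have h2 : (m : ℕ) * k.factorial ≤ k * k.factorial := Nat.mul_le_mul_right _ m.isLt.le
    have h3 : ((n + (m : ℕ) * k.factorial : ℕ) : ℝ) ≤ n + (k * k.factorial : ℕ) := by exact_mod_cast Nat.add_le_add_left h2 n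
    have h4 := Real.add_one_le_exp L
    have : ((k * k.factorial + D + q + 2 : ℕ) : ℝ) < n := by
      rw [Nat.cast_add, Nat.cast_add, Nat.cast_add]
      push_cast at *
      linarith
    exact_mod_cast this
  refine ⟨Nat.count Nat.Prime n, ?_, (Nat.lt_nth_iff_count_lt hinf).mpr (by omega)⟩
  intro i hi
  obtain ⟨m, hm, e⟩ := run_eq K k n D b S hK hSc (by omega) hn (fun m hm => (hS m hm).1) c2 i (by omega)
  obtain ⟨m', hm', e'⟩ := run_eq K k n D b S hK hSc (by omega) hn (fun m hm => (hS m hm).1) c2 (i + 1) hi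
  have hlt : Nat.nth Nat.Prime (Nat.count Nat.Prime n + i) < Nat.nth Nat.Prime (Nat.count Nat.Prime n + (i + 1)) :=
    Nat.nth_strictMono hinf (by omega)
  rw [add_assoc, e', e]
  rw [e, e'] at hlt
  have hmm : m < m' := Nat.lt_of_mul_lt_mul_right (Nat.lt_of_add_lt_add_left hlt)
  have b1 : m * k.factorial ≤ k * k.factorial := Nat.mul_le_mul_right _ hm.le
  have b2 : m' * k.factorial ≤ k * k.factorial := Nat.mul_le_mul_right _ hm'.le
  refine tot_lt n D b (m * k.factorial) (m' * k.factorial) L hn (by omega) (by omega) h16 h8 ?_ (c3 m m' hmm hm') ?_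
  · have h1 : ((n + m * k.factorial - 1 : ℕ) : ℝ) ≤ 2 * NN L := by
      exact_mod_cast (by omega : n + m * k.factorial - 1 ≤ 2 * NN L)
    have h2 : (NN L : ℝ) ≤ 500 * Real.exp L := Nat.floor_le (by positivity)
    have h3 : (1000 : ℝ) ≤ Real.exp 16 := by
      have := Real.exp_one_gt_d9
      have h5 : Real.exp 16 = Real.exp 1 ^ 16 := by rw [← Real.exp_nat_mul]; norm_num
      have h6 : (2 : ℝ) ^ 16 ≤ Real.exp 1 ^ 16 := pow_le_pow_left₀ (by norm_num) (by linarith) 16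
      rw [h5]; linarith
    rw [Real.log_le_iff_le_exp (by exact_mod_cast (by omega : 0 < n + m * k.factorial - 1)), Real.exp_add]
    have := mul_le_mul_of_nonneg_left h3 (Real.exp_pos L).le
    linarith
  · refine le_trans (le_of_eq ?_) (hsum ⟨m, hm⟩)
    refine sum_congr ?_ fun _ _ => rfl
    ext p
    simp only [mem_filter, mem_Ioc, Nat.mem_primeFactors]
    constructor
    · rintro ⟨⟨x1, x2, x3⟩, x4, x5⟩
      exact ⟨⟨x4, x5⟩, x1, x2⟩
    · rintro ⟨⟨x4, x5⟩, x1, x2⟩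
      exact ⟨⟨x1, x2, by omega⟩, x4, x5⟩

end TDR

/-- Pollack–Thompson: for every `K ≥ 1`, there are infinitely many `n` such that
Euler's totient evaluated at `p - 1` is strictly decreasing along the run of `K`
consecutive primes `p_n, p_{n+1}, …, p_{n+K-1}`. -/
theorem totient_decreasing_runs (K : ℕ) (hK : 1 ≤ K) :
    {n : ℕ | ∀ i : ℕ, i + 1 < K →
      Nat.totient (Nat.nth Nat.Prime (n + i + 1) - 1) <
        Nat.totient (Nat.nth Nat.Prime (n + i) - 1)}.Infinite := by
  exact TDR.final K hK
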